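/- For every p < 1/2, the critical colouring densities of the DaC model on the square lattice satisfy r_c(p) + r_c*(p) ≤ 1. -/

import Mathlib

/-!
Common definitions for the Divide-and-Colour (DaC) model of
Bálint, Camia and Meester, "Sharp phase transition and critical
behaviour in 2D divide and colour models".

The model is built concretely: a single uniform random variable on `(0,1]`
is decomposed into countably many i.i.d. uniform random variables (via its
binary digits); one family of uniforms drives the Bernoulli(p) bond
percolation (the edge configuration), and an independent family of uniforms
attaches an independent Bernoulli(r) colour to each bond cluster (the colour
of a cluster is determined by the uniform label of its canonical
representative, the vertex of minimal encoding).  The DaC measure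
`ℙ_{p,r}` is the pushforward of Lebesgue measure on `(0,1]` under the map
producing the pair (edge configuration, colour configuration).
-/

open MeasureTheory ENNReal

namespace DaC

/-- Vertices of the lattice. -/
abbrev V : Type := ℤ × ℤ

/-- Square lattice adjacency: Euclidean distance `1`. -/
def SqAdj (u v : V) : Prop := (u.1 - v.1) ^ 2 + (u.2 - v.2) ^ 2 = 1

/-- `*`-adjacency (matching graph of the square lattice):
Euclidean distance `1` or `√2`. -/
def StarAdj (u v : V) : Prop :=
  (u.1 - v.1) ^ 2 + (u.2 - v.2) ^ 2 = 1 ∨ (u.1 - v.1) ^ 2 + (u.2 - v.2) ^ 2 = 2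

/-- Triangular lattice adjacency. -/
def TriAdj (u v : V) : Prop :=
  (u.1 - v.1, u.2 - v.2) ∈
    ({(1, 0), (-1, 0), (0, 1), (0, -1), (1, 1), (-1, -1)} : Set (ℤ × ℤ))

/-- Classical indicator of a proposition, as a boolean. -/
noncomputable def boolOf (P : Prop) : Bool := @decide P (Classical.propDecidable P)

/-- The `n`-th binary digit of a real number `x ∈ (0,1]`. -/
noncomputable def bit (n : ℕ) (x : ℝ) : Bool := boolOf (⌊x * 2 ^ (n + 1)⌋ % 2 = 1)

/-- A countable family of i.i.d. uniform random variables on `[0,1]`, extracted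
from a single uniform sample `x` by splitting its binary digits. -/
noncomputable def unif (i : ℕ) (x : ℝ) : ℝ :=
  ∑' k : ℕ, if bit (Nat.pair i k) x then ((2 : ℝ)⁻¹) ^ (k + 1) else 0

/-- A symmetric encoding of (unordered) pairs of vertices. -/
noncomputable def eIdx (u v : V) : ℕ :=
  min (Encodable.encode (u, v)) (Encodable.encode (v, u))

/-- The uniform label attached to the edge `{u,v}`. -/
noncomputable def edgeU (u v : V) (x : ℝ) : ℝ := unif (2 * eIdx u v) x

/-- The uniform label attached to the vertex `v` (independent of the edge labels). -/
noncomputable def vtxU (v : V) (x : ℝ) : ℝ := unif (2 * Encodable.encode v + 1) x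

/-- Edge configurations: a boolean (open/closed) for each (ordered) pair of
vertices; configurations arising from the model are symmetric and are
supported on pairs of adjacent vertices. -/
abbrev EdgeCfg : Type := V → V → Bool

/-- Colour configurations: a colour (black = `true`, white = `false`) for each vertex. -/
abbrev ColourCfg : Type := V → Bool

/-- Full configurations of the DaC model: an edge configuration together with
a colour configuration. -/
abbrev Config : Type := EdgeCfg × ColourCfg

/-- The Bernoulli(p) edge configuration determined by the uniform sample `x`,
on the lattice with adjacency `adj`: an edge `{u,v}` of the lattice is open
iff its uniform label is `< p`. -/
noncomputable def edgeCfg (adj : V → V → Prop) (p : ℝ) (x : ℝ) : EdgeCfg :=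
  fun u v => boolOf (adj u v) && boolOf (edgeU u v x < p)

/-- Connectivity through open edges of the edge configuration `η`. -/
def Conn (η : EdgeCfg) (u v : V) : Prop :=
  Relation.ReflTransGen (fun a b => η a b = true) u v

/-- The `p`-cluster of the vertex `v`: its connected component in the graph
retaining only open edges. -/
def pCluster (η : EdgeCfg) (v : V) : Set V := {w | Conn η v w}

/-- Canonical representative of the `p`-cluster of `v`: the vertex of the
cluster with minimal encoding. -/
noncomputable def clusterRep (η : EdgeCfg) (v : V) : V :=
  (Encodable.decode (α := V) (sInf (Encodable.encode '' pCluster η v))).getD v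

/-- The colour configuration with parameters `p, r` determined by the uniform
sample `x`: every `p`-cluster is coloured black (with probability `r`)
or white, independently of all other `p`-clusters, according to the uniform
label of its canonical representative. -/
noncomputable def colourCfg (adj : V → V → Prop) (p r : ℝ) (x : ℝ) : ColourCfg :=
  fun v => boolOf (vtxU (clusterRep (edgeCfg adj p x) v) x < r)

/-- The uniform sample: Lebesgue measure on `(0,1]`. -/
noncomputable def base : Measure ℝ := volume.restrict (Set.Ioc 0 1)

/-- `ν_p`: the product Bernoulli(p) measure on edge configurations of the
lattice with adjacency `adj`. -/
noncomputable def edgeMeasure (adj : V → V → Prop) (p : ℝ) : Measure EdgeCfg :=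
  base.map (edgeCfg adj p)

/-- `ℙ_{p,r}`: the DaC measure on pairs (edge configuration, colour
configuration) for the lattice with adjacency `adj`. -/
noncomputable def DaCMeasure (adj : V → V → Prop) (p r : ℝ) : Measure Config :=
  base.map (fun x => (edgeCfg adj p x, colourCfg adj p r x))

/-- Monochromatic connectivity: `u` and `v` are joined by a path (for the
adjacency `adj`) all of whose vertices have colour `c`. -/
def MonoConn (adj : V → V → Prop) (ξ : ColourCfg) (c : Bool) (u v : V) : Prop :=
  Relation.ReflTransGen (fun a b => adj a b ∧ ξ a = c ∧ ξ b = c) u v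

/-- The colour-`c` cluster of `v` (for the adjacency `adj`): empty if `v` does
not have colour `c`, and otherwise the maximal `adj`-connected set of
`c`-coloured vertices containing `v`. -/
def monoCluster (adj : V → V → Prop) (ξ : ColourCfg) (c : Bool) (v : V) : Set V :=
  {w | ξ v = c ∧ MonoConn adj ξ c v w}

/-- The origin. -/
def origin : V := (0, 0)

/-- The size (cardinality) of a set of vertices, with values in `ℝ≥0∞`. -/
noncomputable def sizeE (S : Set V) : ℝ≥0∞ := S.encard

/-- The probability, under the DaC measure with edge adjacency `eadj` and
parameters `p, r`, that the origin lies in an infinite colour-`c` cluster for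
the adjacency `cadj`. -/
noncomputable def percProb (eadj cadj : V → V → Prop) (c : Bool) (p r : ℝ) : ℝ≥0∞ :=
  DaCMeasure eadj p r {ω | (monoCluster cadj ω.2 c origin).Infinite}

/-- `Θ(p,r)` for the square lattice: probability that the origin lies in an
infinite black `r`-cluster. -/
noncomputable def thetaSq (p r : ℝ) : ℝ≥0∞ := percProb SqAdj SqAdj true p r

/-- `Θ*(p,s)` for the square lattice: the `ℙ_{p,1-s}`-probability that the
origin lies in an infinite white `*`-cluster. -/
noncomputable def thetaStarSq (p s : ℝ) : ℝ≥0∞ := percProb SqAdj StarAdj false p (1 - s)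

/-- `Θ(p,r)` for the triangular lattice. -/
noncomputable def thetaTri (p r : ℝ) : ℝ≥0∞ := percProb TriAdj TriAdj true p r

/-- The critical colouring density `r_c(p)` of the square lattice DaC model. -/
noncomputable def rcSq (p : ℝ) : ℝ :=
  sSup {r : ℝ | r ∈ Set.Icc (0 : ℝ) 1 ∧ thetaSq p r = 0}

/-- The critical colouring density `r_c*(p)` for white `*`-percolation. -/
noncomputable def rcStarSq (p : ℝ) : ℝ :=
  sSup {s : ℝ | s ∈ Set.Icc (0 : ℝ) 1 ∧ thetaStarSq p s = 0}

/-- The critical colouring density `r_c(p)` of the triangular lattice DaC model. -/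
noncomputable def rcTri (p : ℝ) : ℝ :=
  sSup {r : ℝ | r ∈ Set.Icc (0 : ℝ) 1 ∧ thetaTri p r = 0}

/-! ### Rectangles and crossings -/

/-- The rectangle `S_{n,m} = ([0,n] × [0,m]) ∩ ℤ²`. -/
def Rect (n m : ℕ) : Set V :=
  {v | 0 ≤ v.1 ∧ v.1 ≤ (n : ℤ) ∧ 0 ≤ v.2 ∧ v.2 ≤ (m : ℤ)}

/-- The top side of `S_{n,m}`. -/
def TopSide (n m : ℕ) : Set V := {v | v ∈ Rect n m ∧ v.2 = (m : ℤ)}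

/-- The bottom side of `S_{n,m}`. -/
def BotSide (n m : ℕ) : Set V := {v | v ∈ Rect n m ∧ v.2 = 0}

/-- The left side of `S_{n,m}`. -/
def LeftSide (n m : ℕ) : Set V := {v | v ∈ Rect n m ∧ v.1 = 0}

/-- The right side of `S_{n,m}`. -/
def RightSide (n m : ℕ) : Set V := {v | v ∈ Rect n m ∧ v.1 = (n : ℤ)}

/-- There is a path (for the adjacency `adj`), all of whose vertices lie in the
region `R` and satisfy the predicate `good`, from the set `A` to the set `B`. -/
def HasCrossing (adj : V → V → Prop) (good : V → Prop) (R A B : Set V) : Prop :=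
  ∃ (k : ℕ) (f : Fin (k + 1) → V),
    (∀ i, f i ∈ R ∧ good (f i)) ∧
    (∀ i : Fin k, adj (f i.castSucc) (f i.succ)) ∧
    f 0 ∈ A ∧ f (Fin.last k) ∈ B

/-- `V^b_{n,m}` as a set of colour configurations: there is a black vertical
crossing of `S_{n,m}` (for the adjacency `adj`). -/
def VertBC (adj : V → V → Prop) (n m : ℕ) : Set ColourCfg :=
  {ξ | HasCrossing adj (fun v => ξ v = true) (Rect n m) (TopSide n m) (BotSide n m)}

/-- `V^{w*}_{n,m}` as a set of colour configurations: there is a white vertical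
`*`-crossing of `S_{n,m}`. -/
def VertWStarC (n m : ℕ) : Set ColourCfg :=
  {ξ | HasCrossing StarAdj (fun v => ξ v = false) (Rect n m) (TopSide n m) (BotSide n m)}

/-- `H^{w*}_{n,m}` as a set of colour configurations: there is a white
horizontal `*`-crossing of `S_{n,m}`. -/
def HorizWStarC (n m : ℕ) : Set ColourCfg :=
  {ξ | HasCrossing StarAdj (fun v => ξ v = false) (Rect n m) (LeftSide n m) (RightSide n m)}

/-- The event (set of full configurations) determined by a set of colour
configurations. -/
def colourEvent (C : Set ColourCfg) : Set Config := {ω | ω.2 ∈ C}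

/-! ### Events depending on colours, increasing events, pivotal clusters -/

/-- The event `A` is defined in terms of the colours of the vertices in `W`. -/
def DependsOnColoursIn (A : Set Config) (W : Set V) : Prop :=
  ∀ ω ω' : Config, (∀ v ∈ W, ω.2 v = ω'.2 v) → (ω ∈ A ↔ ω' ∈ A)

/-- The event `A` is increasing (for the partial order comparing colour
configurations pointwise, black = `true` above white = `false`). -/
def IncreasingColourEvent (A : Set Config) : Prop :=
  ∀ ω ω' : Config, (∀ v : V, ω.2 v = true → ω'.2 v = true) → ω ∈ A → ω' ∈ A

/-- Flip the colours of the vertices of `C`. -/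
noncomputable def flipOn (C : Set V) (ξ : ColourCfg) : ColourCfg :=
  fun v => @ite _ (v ∈ C) (Classical.propDecidable _) (!ξ v) (ξ v)

/-- The set `C` is a pivotal `p`-cluster for the event `A` in the
configuration `ω`: `C` is a `p`-cluster of the edge configuration of `ω`, and
flipping the colour of (all the vertices of) `C` changes whether the
configuration belongs to `A`. -/
def IsPivotal (A : Set Config) (ω : Config) (C : Set V) : Prop :=
  (∃ v : V, C = pCluster ω.1 v) ∧ ¬ (ω ∈ A ↔ (ω.1, flipOn C ω.2) ∈ A)

/-- `n(A)`: the number of pivotal `p`-clusters for the event `A`, with values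
in `ℝ≥0∞`. -/
noncomputable def numPivotal (A : Set Config) (ω : Config) : ℝ≥0∞ :=
  {C : Set V | IsPivotal A ω C}.encard

/-! ### Barriers -/

/-- Connectivity in the square lattice avoiding the edges of `E`. -/
def AvoidConn (E : Set (V × V)) (u v : V) : Prop :=
  Relation.ReflTransGen (fun a b => SqAdj a b ∧ (a, b) ∉ E ∧ (b, a) ∉ E) u v

/-- `E` is a barrier: a set of edges of the square lattice whose removal
(keeping the end-vertices) separates `ℤ²` into two or more connected
components, exactly one of which is infinite. -/
def IsBarrier (E : Set (V × V)) : Prop :=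
  (∀ e ∈ E, SqAdj e.1 e.2) ∧
  (∃ v, {w | AvoidConn E v w}.Infinite) ∧
  (∀ v w, {x | AvoidConn E v x}.Infinite → {x | AvoidConn E w x}.Infinite → AvoidConn E v w) ∧
  (∃ v, {w | AvoidConn E v w}.Finite)

/-- The exterior of a barrier: its unique infinite complementary component. -/
def barrierExt (E : Set (V × V)) : Set V := {v | {w | AvoidConn E v w}.Infinite}

/-- The interior of a barrier: the union of the finite complementary components. -/
def barrierInt (E : Set (V × V)) : Set V := {v | {w | AvoidConn E v w}.Finite}

/-- The event `A ⊆ EdgeCfg` is increasing (opening edges preserves it). -/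
def IncreasingEdgeEvent (A : Set EdgeCfg) : Prop :=
  ∀ η η' : EdgeCfg, (∀ a b : V, η a b = true → η' a b = true) → η ∈ A → η' ∈ A

/-- The event `A ⊆ EdgeCfg` depends only on the states of the edges both of
whose endpoints lie in `W`. -/
def DependsOnEdgesIn (A : Set EdgeCfg) (W : Set V) : Prop :=
  ∀ η η' : EdgeCfg, (∀ a b : V, a ∈ W → b ∈ W → η a b = η' a b) → (η ∈ A ↔ η' ∈ A)

/-! ### Translations -/

/-- Translation of configurations by the vector `u`. -/
def shift (u : V) (ω : Config) : Config :=
  (fun a b => ω.1 (a + u) (b + u), fun a => ω.2 (a + u))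

end DaC

namespace DaC

/-! ### Planar combinatorics -/

/-- Connectivity inside a set `S`. -/
def CI (adj : V → V → Prop) (S : Set V) (a b : V) : Prop :=
  a ∈ S ∧ Relation.ReflTransGen (fun u v => adj u v ∧ v ∈ S) a b

lemma sqAdj_iff (u v : V) : SqAdj u v ↔
    (u.1 = v.1 ∧ (u.2 = v.2 + 1 ∨ v.2 = u.2 + 1)) ∨
    (u.2 = v.2 ∧ (u.1 = v.1 + 1 ∨ v.1 = u.1 + 1)) := by
  unfold SqAdj
  constructor
  · intro h
    have h1 : -1 ≤ u.1 - v.1 := by nlinarith [sq_nonneg (u.2 - v.2)]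
    have h2 : u.1 - v.1 ≤ 1 := by nlinarith [sq_nonneg (u.2 - v.2)]
    have h3 : -1 ≤ u.2 - v.2 := by nlinarith [sq_nonneg (u.1 - v.1)]
    have h4 : u.2 - v.2 ≤ 1 := by nlinarith [sq_nonneg (u.1 - v.1)]
    generalize hx : u.1 - v.1 = x at *
    generalize hy : u.2 - v.2 = y at *
    interval_cases x <;> interval_cases y <;> omega
  · rintro (⟨h, h' | h'⟩ | ⟨h, h' | h'⟩) <;> simp [h, h']

lemma starAdj_iff (u v : V) : StarAdj u v ↔
    (u.1 ≠ v.1 ∨ u.2 ≠ v.2) ∧ u.1 ≤ v.1 + 1 ∧ v.1 ≤ u.1 + 1 ∧ u.2 ≤ v.2 + 1 ∧ v.2 ≤ u.2 + 1 := by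
  unfold StarAdj
  constructor
  · intro h
    have h1 : -1 ≤ u.1 - v.1 := by rcases h with h | h <;> nlinarith [sq_nonneg (u.2 - v.2)]
    have h2 : u.1 - v.1 ≤ 1 := by rcases h with h | h <;> nlinarith [sq_nonneg (u.2 - v.2)]
    have h3 : -1 ≤ u.2 - v.2 := by rcases h with h | h <;> nlinarith [sq_nonneg (u.1 - v.1)]
    have h4 : u.2 - v.2 ≤ 1 := by rcases h with h | h <;> nlinarith [sq_nonneg (u.1 - v.1)]
    refine ⟨?_, by omega, by omega, by omega, by omega⟩
    by_contra hc
    push Not at hc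
    simp [hc.1, hc.2] at h
  · rintro ⟨h0, h1, h2, h3, h4⟩
    have e1 : u.1 - v.1 = -1 ∨ u.1 - v.1 = 0 ∨ u.1 - v.1 = 1 := by omega
    have e2 : u.2 - v.2 = -1 ∨ u.2 - v.2 = 0 ∨ u.2 - v.2 = 1 := by omega
    rcases e1 with e1 | e1 | e1 <;> rcases e2 with e2 | e2 | e2 <;> simp [e1, e2]
    omega

lemma SqAdj.symm {u v : V} (h : SqAdj u v) : SqAdj v u := by
  rw [sqAdj_iff] at *; omega
lemma StarAdj.symm {u v : V} (h : StarAdj u v) : StarAdj v u := by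
  rw [starAdj_iff] at *; omega
lemma SqAdj.star {u v : V} (h : SqAdj u v) : StarAdj u v := Or.inl h

/-- The two adjacencies we use. -/
def Okay (adj : V → V → Prop) : Prop := adj = SqAdj ∨ adj = StarAdj

lemma Okay.symm {adj : V → V → Prop} (h : Okay adj) {u v : V} (huv : adj u v) : adj v u := by
  rcases h with rfl | rfl
  · exact SqAdj.symm huv
  · exact StarAdj.symm huv
lemma Okay.star {adj : V → V → Prop} (h : Okay adj) {u v : V} (huv : adj u v) : StarAdj u v := by
  rcases h with rfl | rfl
  · exact SqAdj.star huv
  · exact huv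
lemma Okay.ofSq {adj : V → V → Prop} (h : Okay adj) {u v : V} (huv : SqAdj u v) : adj u v := by
  rcases h with rfl | rfl
  · exact huv
  · exact huv.star

lemma CI.refl {adj : V → V → Prop} {S : Set V} {a : V} (h : a ∈ S) : CI adj S a a :=
  ⟨h, Relation.ReflTransGen.refl⟩

lemma CI.left {adj : V → V → Prop} {S : Set V} {a b : V} (h : CI adj S a b) : a ∈ S := h.1

lemma CI.right {adj : V → V → Prop} {S : Set V} {a b : V} (h : CI adj S a b) : b ∈ S := by
  obtain ⟨h1, h2⟩ := h
  induction h2 with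
  | refl => exact h1
  | tail _ h _ => exact h.2

lemma CI.tail {adj : V → V → Prop} {S : Set V} {a b c : V} (h : CI adj S a b) (hb : adj b c)
    (hc : c ∈ S) : CI adj S a c := ⟨h.1, h.2.tail ⟨hb, hc⟩⟩

lemma CI.trans {adj : V → V → Prop} {S : Set V} {a b c : V} (h : CI adj S a b)
    (h' : CI adj S b c) : CI adj S a c := ⟨h.1, h.2.trans h'.2⟩

@[elab_as_elim]
lemma CI.induct {adj : V → V → Prop} {S : Set V} {a : V} {P : (b : V) → CI adj S a b → Prop} {b : V}
    (h : CI adj S a b) (h0 : ∀ h : a ∈ S, P a (CI.refl h))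
    (hs : ∀ b c, ∀ h : CI adj S a b, P b h → ∀ (h1 : adj b c), b ∈ S → ∀ h3 : c ∈ S,
      P c (h.tail h1 h3)) : P b h := by
  obtain ⟨h1, h2⟩ := h
  induction h2 with
  | refl => exact h0 h1
  | tail h3 h ih => exact hs _ _ ⟨h1, h3⟩ ih h.1 (CI.right ⟨h1, h3⟩) h.2

lemma CI.mono {adj adj' : V → V → Prop} {S T : Set V} {a b : V} (h : CI adj S a b)
    (hadj : ∀ u v, adj u v → adj' u v) (hST : S ⊆ T) : CI adj' T a b := by
  induction h using CI.induct with
  | h0 h => exact CI.refl (hST h)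
  | hs b c _ ih h1 _ h3 => exact ih.tail (hadj _ _ h1) (hST h3)

lemma CI.monoS {adj : V → V → Prop} {S T : Set V} {a b : V} (h : CI adj S a b)
    (hST : S ⊆ T) : CI adj T a b := h.mono (fun _ _ h => h) hST

lemma CI.symm {adj : V → V → Prop} (ok : Okay adj) {S : Set V} {a b : V} (h : CI adj S a b) :
    CI adj S b a := by
  induction h using CI.induct with
  | h0 h => exact CI.refl h
  | hs b c _ ih h1 h2 h3 =>
    exact CI.trans ((CI.refl h3).tail (ok.symm h1) h2) ih

lemma CI.comp {adj : V → V → Prop} {S : Set V} {a b : V} (h : CI adj S a b) :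
    CI adj {v | CI adj S a v} a b := by
  induction h using CI.induct with
  | h0 h => exact CI.refl (CI.refl h)
  | hs b c h0 ih h1 _ h3 => exact ih.tail h1 (h0.tail h1 h3)

/-- The mod 2 winding function of a nearest-neighbour path. -/
lemma winding {S : Set V} {a b : V} (h : CI SqAdj S a b) :
    ∃ H : V → ℤ,
      (∀ v w : V, v ∉ S → w ∉ S → w.1 = v.1 + 1 → w.2 ≤ v.2 + 1 → v.2 ≤ w.2 + 1 →
        (H v + H w + (if a.1 = w.1 ∧ a.2 < w.2 then 1 else 0)
          + (if b.1 = w.1 ∧ b.2 < w.2 then 1 else 0)) % 2 = 0) ∧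
      (∀ v w : V, v ∉ S → w ∉ S → w.1 = v.1 → w.2 = v.2 + 1 → H v = H w) ∧
      (∀ v : V, (∀ u ∈ S, v.2 ≤ u.2) → H v = 0) ∧
      (∀ v : V, v ∉ S → (∀ u ∈ S, u.2 ≤ v.2) →
        (H v + (if a.1 ≤ v.1 then 1 else 0) + (if b.1 ≤ v.1 then 1 else 0)) % 2 = 0) := by
  induction h using CI.induct with
  | h0 h =>
    refine ⟨fun _ => 0, ?_, ?_, ?_, ?_⟩
    · intros; split_ifs <;> norm_num
    · intros; rfl
    · intros; rfl
    · intros; split_ifs <;> norm_num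
  | hs b c hab ih hbc hb hc =>
    obtain ⟨H, h1, h2, h3, h4⟩ := ih
    rw [sqAdj_iff] at hbc
    refine ⟨fun v => H v + if (b.2 < v.2 ∧ c.2 = b.2 ∧
      ((b.1 = v.1 ∧ c.1 = v.1 + 1) ∨ (c.1 = v.1 ∧ b.1 = v.1 + 1))) then 1 else 0, ?_, ?_, ?_, ?_⟩
    · intro v w hv hw e1 e2 e3
      have := h1 v w hv hw e1 e2 e3
      have n1 : ¬ (b.1 = v.1 ∧ b.2 = v.2) := fun ⟨x, y⟩ => hv (by rwa [← Prod.ext x y])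
      have n2 : ¬ (c.1 = v.1 ∧ c.2 = v.2) := fun ⟨x, y⟩ => hv (by rwa [← Prod.ext x y])
      have n3 : ¬ (b.1 = w.1 ∧ b.2 = w.2) := fun ⟨x, y⟩ => hw (by rwa [← Prod.ext x y])
      have n4 : ¬ (c.1 = w.1 ∧ c.2 = w.2) := fun ⟨x, y⟩ => hw (by rwa [← Prod.ext x y])
      have key : ((if (b.2 < v.2 ∧ c.2 = b.2 ∧
          ((b.1 = v.1 ∧ c.1 = v.1 + 1) ∨ (c.1 = v.1 ∧ b.1 = v.1 + 1))) then (1:ℤ) else 0)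
        + (if (b.2 < w.2 ∧ c.2 = b.2 ∧
          ((b.1 = w.1 ∧ c.1 = w.1 + 1) ∨ (c.1 = w.1 ∧ b.1 = w.1 + 1))) then 1 else 0)
        + (if b.1 = w.1 ∧ b.2 < w.2 then 1 else 0)
        + (if c.1 = w.1 ∧ c.2 < w.2 then 1 else 0)) % 2 = 0 := by
        clear this h1 h2 h3 h4
        split_ifs <;> first | rfl | (exfalso; omega)
      dsimp only
      omega
    · intro v w hv hw e1 e2
      have := h2 v w hv hw e1 e2
      have n1 : ¬ (b.1 = v.1 ∧ b.2 = v.2) := fun ⟨x, y⟩ => hv (by rwa [← Prod.ext x y])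
      have n2 : ¬ (c.1 = v.1 ∧ c.2 = v.2) := fun ⟨x, y⟩ => hv (by rwa [← Prod.ext x y])
      dsimp only
      rw [this]
      congr 1
      split_ifs <;> first | rfl | (exfalso; omega)
    · intro v hv
      have := hv b hb
      simp only [h3 v hv, zero_add]
      rw [if_neg]
      omega
    · intro v hv hu
      have := h4 v hv hu
      have q := hu b hb
      have n1 : ¬ (b.1 = v.1 ∧ b.2 = v.2) := fun ⟨x, y⟩ => hv (by rwa [← Prod.ext x y])
      have n2 : ¬ (c.1 = v.1 ∧ c.2 = v.2) := fun ⟨x, y⟩ => hv (by rwa [← Prod.ext x y])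
      have key : ((if (b.2 < v.2 ∧ c.2 = b.2 ∧
          ((b.1 = v.1 ∧ c.1 = v.1 + 1) ∨ (c.1 = v.1 ∧ b.1 = v.1 + 1))) then (1:ℤ) else 0)
        + (if b.1 ≤ v.1 then 1 else 0)
        + (if c.1 ≤ v.1 then 1 else 0)) % 2 = 0 := by
        clear this h1 h2 h3 h4
        split_ifs <;> first | rfl | (exfalso; omega)
      dsimp only
      omega

/-- A left-right nearest neighbour path and a bottom-top `*`-path intersect. -/
theorem cross {S T : Set V} {a b c d : V} (hS : CI SqAdj S a b) (hT : CI StarAdj T c d)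
    (hTx : ∀ v ∈ T, a.1 ≤ v.1 ∧ v.1 ≤ b.1) (hSy : ∀ v ∈ S, c.2 ≤ v.2 ∧ v.2 ≤ d.2) :
    (S ∩ T).Nonempty := by
  by_contra hne
  rw [Set.not_nonempty_iff_eq_empty] at hne
  have hdis : ∀ v ∈ T, v ∉ S := fun v hv hv' => by
    have : v ∈ S ∩ T := ⟨hv', hv⟩
    rw [hne] at this; exact this
  set b' : V := (b.1 + 1, b.2) with hb'
  have hS' : CI SqAdj (insert b' S) a b' :=
    (hS.monoS (Set.subset_insert _ _)).tail (by rw [sqAdj_iff]; simp [hb']) (Set.mem_insert _ _)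
  obtain ⟨H, h1, h2, h3, h4⟩ := winding hS'
  have hdis' : ∀ v ∈ T, v ∉ insert b' S := by
    intro v hv hv'
    rcases hv' with rfl | hv'
    · have := (hTx _ hv).2; simp [hb'] at this
    · exact hdis v hv hv'
  have hSy' : ∀ v ∈ insert b' S, c.2 ≤ v.2 ∧ v.2 ≤ d.2 := by
    intro v hv
    rcases hv with rfl | hv
    · exact hSy b hS.right
    · exact hSy v hv
  have hstep : ∀ v w, v ∈ T → w ∈ T → w.1 = v.1 + 1 → w.2 ≤ v.2 + 1 → v.2 ≤ w.2 + 1 →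
      H v % 2 = H w % 2 := by
    intro v w hv hw e1 e2 e3
    have := h1 v w (hdis' v hv) (hdis' w hw) e1 e2 e3
    have q1 := hTx v hv
    have q2 := hTx w hw
    rw [if_neg (by omega), if_neg (by simp [hb']; omega)] at this
    omega
  have hconst : ∀ x, CI StarAdj T c x → H x % 2 = H c % 2 := by
    intro x hx
    induction hx using CI.induct with
    | h0 h => rfl
    | hs u v _ ih huv hu hv =>
      rw [← ih]
      rw [starAdj_iff] at huv
      have t : v.1 = u.1 + 1 ∨ u.1 = v.1 + 1 ∨ v.1 = u.1 := by omega
      rcases t with t | t | t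
      · exact (hstep u v hu hv t (by omega) (by omega)).symm
      · exact (hstep v u hv hu t (by omega) (by omega))
      · have t' : v.2 = u.2 + 1 ∨ u.2 = v.2 + 1 := by omega
        rcases t' with t' | t'
        · rw [h2 u v (hdis' u hu) (hdis' v hv) t t']
        · rw [h2 v u (hdis' v hv) (hdis' u hu) t.symm t']
  have e1 := hconst d hT
  have e2 := h3 c (fun u hu => (hSy' u hu).1)
  have e3 := h4 d (hdis' d hT.right) (fun u hu => (hSy' u hu).2)
  have q := hTx d hT.right
  rw [if_pos q.1, if_neg (by simp [hb']; omega)] at e3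
  omega

/-- Replace a `*`-path by a nearest neighbour path close to it. -/
def thick (S : Set V) : Set V :=
  {u | ∃ s ∈ S, ∃ t ∈ S, (u = s ∨ StarAdj u s) ∧ s.1 = u.1 ∧ t.2 = u.2}

lemma subset_thick (S : Set V) : S ⊆ thick S := fun u hu => ⟨u, hu, u, hu, Or.inl rfl, rfl, rfl⟩

lemma CI.thick {S : Set V} {a b : V} (h : CI StarAdj S a b) : CI SqAdj (thick S) a b := by
  induction h using CI.induct with
  | h0 h => exact CI.refl (subset_thick S h)
  | hs u v _ ih huv hu hv =>
    by_cases hq : SqAdj u v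
    · exact ih.tail hq (subset_thick S hv)
    · have hw : ((u.1, v.2) : V) ∈ DaC.thick S := by
        refine ⟨u, hu, v, hv, Or.inr ?_, rfl, rfl⟩
        rw [starAdj_iff] at *; rw [sqAdj_iff] at hq; dsimp only; omega
      have h1 : SqAdj u (u.1, v.2) := by
        rw [starAdj_iff] at huv; rw [sqAdj_iff] at *; dsimp only; omega
      have h2 : SqAdj (u.1, v.2) v := by
        rw [starAdj_iff] at huv; rw [sqAdj_iff] at *; dsimp only; omega
      exact (ih.tail h1 hw).tail h2 (subset_thick S hv)

/-- Two touching sets. -/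
def Touch (adj : V → V → Prop) (S T : Set V) : Prop :=
  ∃ u ∈ S, ∃ v ∈ T, u = v ∨ adj u v

lemma Okay.thickSq {adj : V → V → Prop} (ok : Okay adj) {S : Set V} {a b : V} (h : CI adj S a b) :
    ∃ S', CI SqAdj S' a b ∧ (∀ u ∈ S', (∃ s ∈ S, u = s ∨ adj u s)) ∧
      (∀ u ∈ S', (∃ s ∈ S, s.1 = u.1) ∧ (∃ s ∈ S, s.2 = u.2)) := by
  rcases ok with rfl | rfl
  · exact ⟨S, h, fun u hu => ⟨u, hu, Or.inl rfl⟩, fun u hu => ⟨⟨u, hu, rfl⟩, ⟨u, hu, rfl⟩⟩⟩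
  · exact ⟨thick S, h.thick, fun u ⟨s, hs, t, ht, h1, h2, h3⟩ => ⟨s, hs, h1⟩,
      fun u ⟨s, hs, t, ht, h1, h2, h3⟩ => ⟨⟨s, hs, h2⟩, ⟨t, ht, h3⟩⟩⟩

/-- Same-colour crossing lemma. -/
theorem crossTouch {adj : V → V → Prop} (ok : Okay adj) {S T : Set V} {a b c d : V}
    (hS : CI adj S a b) (hT : CI adj T c d)
    (hTx : ∀ v ∈ T, a.1 ≤ v.1 ∧ v.1 ≤ b.1) (hSy : ∀ v ∈ S, c.2 ≤ v.2 ∧ v.2 ≤ d.2) :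
    Touch adj S T := by
  obtain ⟨S', h1, h2, h3⟩ := ok.thickSq hS
  obtain ⟨v, hv, hv'⟩ := cross h1 (hT.mono (fun _ _ => ok.star) (le_refl T)) hTx (by
    intro v hv
    obtain ⟨_, s, hs, e⟩ := h3 v hv
    rw [← e]; exact hSy s hs)
  obtain ⟨s, hs, e⟩ := h2 v hv
  exact ⟨s, hs, v, hv', e.imp (fun h => h.symm) ok.symm⟩

/-- A horizontal segment, vertical segment connection. -/
lemma CI.vert {adj : V → V → Prop} (ok : Okay adj) {S : Set V} (x y : ℤ) (k : ℕ)
    (h : ∀ j : ℤ, y ≤ j → j ≤ y + k → (x, j) ∈ S) : CI adj S (x, y) (x, y + k) := by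
  induction k with
  | zero => simpa using CI.refl (h y le_rfl (by simp))
  | succ k ih =>
    refine (ih (fun j h1 h2 => h j h1 (by push_cast; omega))).tail (ok.ofSq ?_) (h _ (by omega) le_rfl)
    rw [sqAdj_iff]; push_cast; omega

/-- Half-plane lemma: an arc with both ends on the line `x = n` separates. -/
theorem arcCross {S T : Set V} {n s y1 y2 B : ℤ} {z : V} (hS : CI SqAdj S z (n, s))
    (hT : CI StarAdj T (n, y2) (n, y1)) (h2 : y2 < s) (h1 : s < y1)
    (hSx : ∀ v ∈ S, v.1 ≤ n) (hSy : ∀ v ∈ S, -B ≤ v.2 ∧ v.2 ≤ B)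
    (hTx : ∀ v ∈ T, z.1 ≤ v.1 ∧ v.1 ≤ n) : (S ∩ T).Nonempty := by
  obtain ⟨k1, hk1⟩ : ∃ k : ℕ, B ≤ y1 + k := ⟨(B - y1).toNat, by omega⟩
  obtain ⟨k2, hk2⟩ : ∃ k : ℕ, y2 - k ≤ -B := ⟨(y2 + B).toNat, by omega⟩
  set S' := insert ((n + 1, s) : V) S
  set U : Set V := {v | v.1 = n + 1 ∧ (y1 ≤ v.2 ∨ v.2 ≤ y2)}
  have hS' : CI SqAdj S' z (n + 1, s) :=
    (hS.monoS (Set.subset_insert _ _)).tail (by rw [sqAdj_iff]; simp) (Set.mem_insert _ _)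
  have ok : Okay StarAdj := Or.inr rfl
  have c1 : CI StarAdj (T ∪ U) (n + 1, y1) (n + 1, y1 + k1) :=
    CI.vert ok _ _ _ (fun j h1 h2 => Or.inr ⟨rfl, Or.inl h1⟩)
  have c2 : CI StarAdj (T ∪ U) (n + 1, y2 - k2) (n + 1, y2 - k2 + k2) :=
    CI.vert ok _ _ _ (fun j h1 h2 => Or.inr ⟨rfl, Or.inr (by simp at h2; exact h2)⟩)
  rw [sub_add_cancel] at c2
  have c3 : CI StarAdj (T ∪ U) (n, y2) (n, y1) := hT.monoS Set.subset_union_left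
  have c4 := (((c2.tail (c := (n, y2)) (by rw [starAdj_iff]; dsimp only; omega) c3.left).trans c3).tail
    (c := (n + 1, y1)) (by rw [starAdj_iff]; dsimp only; omega) c1.left).trans c1
  have hz := hSx z hS.left
  have hsy := hSy _ hS.right
  obtain ⟨v, hv, hv'⟩ := cross hS' c4 (by
    rintro v (hv | hv)
    · have := hTx v hv; exact ⟨by omega, by dsimp only; omega⟩
    · have := hv.1; exact ⟨by omega, by dsimp only; omega⟩) (by
    rintro v (rfl | hv)
    · dsimp only at *; constructor <;> omega
    · have := hSy v hv; constructor <;> dsimp only <;> omega)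
  rcases hv with rfl | hv
  · rcases hv' with hv' | hv'
    · have := (hTx _ hv').2; simp at this
    · obtain ⟨_, h | h⟩ := hv' <;> simp at h <;> omega
  · rcases hv' with hv' | hv'
    · exact ⟨v, hv, hv'⟩
    · have := hSx v hv; have := hv'.1; omega

theorem arcTouch {adj : V → V → Prop} (ok : Okay adj) {S T : Set V} {n s y1 y2 B : ℤ} {z : V}
    (hS : CI adj S z (n, s))
    (hT : CI adj T (n, y2) (n, y1)) (h2 : y2 < s) (h1 : s < y1)
    (hSx : ∀ v ∈ S, v.1 ≤ n) (hSy : ∀ v ∈ S, -B ≤ v.2 ∧ v.2 ≤ B)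
    (hTx : ∀ v ∈ T, z.1 ≤ v.1 ∧ v.1 ≤ n) : Touch adj S T := by
  obtain ⟨S', g1, g2, g3⟩ := ok.thickSq hS
  obtain ⟨v, hv, hv'⟩ := arcCross g1 (hT.mono (fun _ _ => ok.star) (le_refl T)) h2 h1
    (fun v hv => by obtain ⟨⟨t, ht, e⟩, _⟩ := g3 v hv; rw [← e]; exact hSx t ht)
    (fun v hv => by obtain ⟨_, ⟨t, ht, e⟩⟩ := g3 v hv; rw [← e]; exact hSy t ht) hTx
  obtain ⟨t, ht, e⟩ := g2 v hv
  exact ⟨t, ht, v, hv', e.imp (fun h => h.symm) ok.symm⟩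

/-- If connected pieces of `G` touch, they are connected in `G`. -/
lemma Touch.join {adj : V → V → Prop} {G : Set V} {a c : V}
    (h : Touch adj {v | CI adj G a v} {v | CI adj G c v}) (ok : Okay adj) : CI adj G a c := by
  obtain ⟨u, hu, v, hv, rfl | e⟩ := h
  · exact CI.trans hu (CI.symm ok hv)
  · exact (CI.tail hu e (CI.right hv)).trans (CI.symm ok hv)

end DaC

namespace DaC

lemma CI.map {adj : V → V → Prop} {S T : Set V} {a b : V} (h : CI adj S a b) (g : V → V)
    (hg : ∀ u v, adj u v → adj (g u) (g v)) (hST : ∀ v ∈ S, g v ∈ T) : CI adj T (g a) (g b) := by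
  induction h using CI.induct with
  | h0 h => exact CI.refl (hST _ h)
  | hs b c _ ih h1 _ h3 => exact ih.tail (hg _ _ h1) (hST _ h3)

/-- The part of a path after the last visit to a level. -/
lemma CI.lastPart {adj : V → V → Prop} {S : Set V} {a b : V} (h : CI adj S a b) (φ : V → ℤ)
    (hφ : ∀ u v, adj u v → φ v ≤ φ u + 1) {m : ℤ} (ha : φ a ≤ m) (hb : m ≤ φ b) :
    ∃ a', φ a' = m ∧ CI adj S a a' ∧ CI adj (S ∩ {v | m ≤ φ v}) a' b := by
  induction h using CI.induct with
  | h0 h => exact ⟨a, le_antisymm ha hb, CI.refl h, CI.refl ⟨h, hb⟩⟩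
  | hs b c hab ih h1 h2 h3 =>
    by_cases hm : m ≤ φ b
    · obtain ⟨a', e, e1, e2⟩ := ih hm
      exact ⟨a', e, e1, e2.tail h1 ⟨h3, hb⟩⟩
    · have := hφ _ _ h1
      exact ⟨c, by omega, hab.tail h1 h3, CI.refl ⟨h3, hb⟩⟩

/-- The part of a path up to the first visit to a level. -/
lemma CI.firstPart {adj : V → V → Prop} {S : Set V} {a b : V} (h : CI adj S a b) (φ : V → ℤ)
    (hφ : ∀ u v, adj u v → φ v ≤ φ u + 1) {m : ℤ} (ha : φ a ≤ m) (hb : m ≤ φ b) :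
    ∃ b', φ b' = m ∧ CI adj (S ∩ {v | φ v ≤ m}) a b' := by
  by_contra hcon
  push Not at hcon
  have key : φ b < m ∧ CI adj (S ∩ {v | φ v ≤ m}) a b := by
    clear hb
    induction h using CI.induct with
    | h0 h =>
      have := CI.refl (adj := adj) (S := S ∩ {v | φ v ≤ m}) ⟨h, ha⟩
      exact ⟨lt_of_le_of_ne ha (fun e => hcon a e this), this⟩
    | hs b c hab ih h1 h2 h3 =>
      have q := hφ _ _ h1
      have q2 : φ c ≤ m := by omega
      have := ih.2.tail h1 ⟨h3, q2⟩
      exact ⟨lt_of_le_of_ne q2 (fun e => hcon c e this), this⟩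
  omega

lemma telescope2 (f : ℕ → ZMod 2) (m : ℕ) :
    ∑ j ∈ Finset.range m, (f j + f (j + 1)) = f 0 + f m := by
  induction m with
  | zero => simp [CharTwo.add_self_eq_zero]
  | succ m ih =>
    rw [Finset.sum_range_succ, ih]
    have := CharTwo.add_self_eq_zero (f m)
    linear_combination this

lemma stokes2 (H W : ℕ → ℕ → ZMod 2) (m n : ℕ)
    (h : ∀ i < m, ∀ j < n, H i j + H i (j + 1) + W i j + W (i + 1) j = 0) :
    ∑ i ∈ Finset.range m, (H i 0 + H i n) + ∑ j ∈ Finset.range n, (W 0 j + W m j) = 0 := by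
  have e1 : ∑ i ∈ Finset.range m, (H i 0 + H i n) =
      ∑ i ∈ Finset.range m, ∑ j ∈ Finset.range n, (H i j + H i (j + 1)) :=
    Finset.sum_congr rfl (fun i _ => (telescope2 (H i) n).symm)
  have e2 : ∑ j ∈ Finset.range n, (W 0 j + W m j) =
      ∑ i ∈ Finset.range m, ∑ j ∈ Finset.range n, (W i j + W (i + 1) j) := by
    rw [Finset.sum_comm]
    exact Finset.sum_congr rfl (fun j _ => (telescope2 (fun i => W i j) m).symm)
  rw [e1, e2, ← Finset.sum_add_distrib]
  refine Finset.sum_eq_zero (fun i hi => ?_)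
  rw [← Finset.sum_add_distrib]
  refine Finset.sum_eq_zero (fun j hj => ?_)
  rw [← h i (Finset.mem_range.1 hi) j (Finset.mem_range.1 hj)]; ring

/-- the boxes -/
def Box (x0 x1 y0 y1 : ℤ) : Set V := {v | x0 ≤ v.1 ∧ v.1 ≤ x1 ∧ y0 ≤ v.2 ∧ v.2 ≤ y1}

def chi4 (a b : Fin 4) : ZMod 2 := if (a = 0 ∧ b = 2) ∨ (a = 2 ∧ b = 0) then 1 else 0

set_option synthInstance.maxSize 2000 in
set_option synthInstance.maxHeartbeats 400000 in
set_option maxRecDepth 20000 in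
lemma square4 : ∀ a b c d : Fin 4,
    -- a = (i,j), b = (i+1,j), c = (i+1,j+1), d = (i,j+1)
    (¬ (a = 0 ∧ b = 1) ∧ ¬ (b = 0 ∧ a = 1)) → (¬ (b = 0 ∧ c = 1) ∧ ¬ (c = 0 ∧ b = 1)) →
    (¬ (c = 0 ∧ d = 1) ∧ ¬ (d = 0 ∧ c = 1)) → (¬ (a = 0 ∧ d = 1) ∧ ¬ (d = 0 ∧ a = 1)) →
    (¬ (a = 2 ∧ b = 3) ∧ ¬ (b = 2 ∧ a = 3)) → (¬ (b = 2 ∧ c = 3) ∧ ¬ (c = 2 ∧ b = 3)) →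
    (¬ (c = 2 ∧ d = 3) ∧ ¬ (d = 2 ∧ c = 3)) → (¬ (a = 2 ∧ d = 3) ∧ ¬ (d = 2 ∧ a = 3)) →
    (¬ (a = 2 ∧ c = 3) ∧ ¬ (c = 2 ∧ a = 3)) → (¬ (b = 2 ∧ d = 3) ∧ ¬ (d = 2 ∧ b = 3)) →
    chi4 a b + chi4 d c + chi4 a d + chi4 b c = 0 := by
  unfold chi4; decide

open Classical in
/-- Duality in a rectangle: either a left-right nearest neighbour crossing in `G` or
a bottom-top `*`-crossing outside `G`. -/
theorem dual_exists (x0 x1 y0 y1 : ℤ) (hx : x0 ≤ x1) (hy : y0 ≤ y1) (G : Set V) :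
    (∃ a b, a.1 = x0 ∧ b.1 = x1 ∧ CI SqAdj (Box x0 x1 y0 y1 ∩ G) a b) ∨
    (∃ c d, c.2 = y0 ∧ d.2 = y1 ∧ CI StarAdj (Box x0 x1 y0 y1 ∩ Gᶜ) c d) := by
  by_contra hcon
  push Not at hcon
  obtain ⟨hL, hB⟩ := hcon
  set R := Box x0 x1 y0 y1 with hR
  set CL : V → Prop := fun u => ∃ a, a.1 = x0 ∧ CI SqAdj (R ∩ G) a u with hCL
  set CB : V → Prop := fun u => ∃ a, a.2 = y0 ∧ CI StarAdj (R ∩ Gᶜ) a u with hCB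
  set lab : V → Fin 4 := fun u => if u.2 < y0 then 2 else if y1 < u.2 then 3 else
    if u.1 < x0 then 0 else if x1 < u.1 then 1 else
    if u ∈ G then (if CL u then 0 else 1) else (if CB u then 2 else 3) with hlab
  have CLG : ∀ u, CL u → u ∈ R ∩ G := fun u ⟨a, _, h⟩ => h.right
  have CBG : ∀ u, CB u → u ∈ R ∩ Gᶜ := fun u ⟨a, _, h⟩ => h.right
  have l0 : ∀ u, lab u = 0 → y0 ≤ u.2 ∧ u.2 ≤ y1 ∧ (u.1 < x0 ∨ (CL u)) := by
    intro u; simp only [hlab]; split_ifs <;> intro h <;> first | (exfalso; revert h; decide) | skip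
    · exact ⟨by omega, by omega, Or.inl (by assumption)⟩
    · exact ⟨by omega, by omega, Or.inr (by assumption)⟩
  have l1 : ∀ u, lab u = 1 → y0 ≤ u.2 ∧ u.2 ≤ y1 ∧ (x1 < u.1 ∨ (u ∈ R ∩ G ∧ ¬ CL u)) := by
    intro u; simp only [hlab]; split_ifs <;> intro h <;> first | (exfalso; revert h; decide) | skip
    · exact ⟨by omega, by omega, Or.inl (by assumption)⟩
    · exact ⟨by omega, by omega, Or.inr ⟨⟨⟨by omega, by omega, by omega, by omega⟩, by assumption⟩, by assumption⟩⟩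
  have l2 : ∀ u, lab u = 2 → (u.2 < y0 ∨ (CB u)) := by
    intro u; simp only [hlab]; split_ifs <;> intro h <;> first | (exfalso; revert h; decide) | skip
    · exact Or.inl (by assumption)
    · exact Or.inr (by assumption)
  have l3 : ∀ u, lab u = 3 → (y1 < u.2 ∨ (u ∈ R ∩ Gᶜ ∧ ¬ CB u)) := by
    intro u; simp only [hlab]; split_ifs <;> intro h <;> first | (exfalso; revert h; decide) | skip
    · exact Or.inl (by assumption)
    · exact Or.inr ⟨⟨⟨by omega, by omega, by omega, by omega⟩, by assumption⟩, by assumption⟩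
  have n1 : ∀ u v, SqAdj u v → ¬ (lab u = 0 ∧ lab v = 1) := by
    rintro u v huv ⟨h0, h1⟩
    obtain ⟨a1, a2, a3⟩ := l0 u h0
    obtain ⟨b1, b2, b3⟩ := l1 v h1
    have huv' := huv
    rw [sqAdj_iff] at huv'
    rcases a3 with a3 | ⟨a, ea, a3⟩ <;> rcases b3 with b3 | ⟨b3, b4⟩
    · omega
    · have := b3.1
      have t : x0 ≤ v.1 := this.1
      exact b4 ⟨v, by omega, CI.refl b3⟩
    · have := a3.right.1
      have t : u.1 ≤ x1 := this.2.1
      exact hL a u ea (by omega) a3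
    · exact b4 ⟨a, ea, a3.tail huv b3⟩
  have n2 : ∀ u v, StarAdj u v → ¬ (lab u = 2 ∧ lab v = 3) := by
    rintro u v huv ⟨h0, h1⟩
    have huv' := huv
    rw [starAdj_iff] at huv'
    rcases l2 u h0 with a3 | ⟨a, ea, a3⟩ <;> rcases l3 v h1 with b3 | ⟨b3, b4⟩
    · omega
    · have := b3.1
      have t : y0 ≤ v.2 := this.2.2.1
      exact b4 ⟨v, by omega, CI.refl b3⟩
    · have := a3.right.1
      have t : u.2 ≤ y1 := this.2.2.2
      exact hB a u ea (by omega) a3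
    · exact b4 ⟨a, ea, a3.tail huv b3⟩
  have N1 : ∀ u v, SqAdj u v → ¬ (lab u = 0 ∧ lab v = 1) ∧ ¬ (lab v = 0 ∧ lab u = 1) :=
    fun u v h => ⟨n1 u v h, n1 v u h.symm⟩
  have N2 : ∀ u v, StarAdj u v → ¬ (lab u = 2 ∧ lab v = 3) ∧ ¬ (lab v = 2 ∧ lab u = 3) :=
    fun u v h => ⟨n2 u v h, n2 v u h.symm⟩
  obtain ⟨m, hm⟩ : ∃ m : ℕ, x1 = x0 + m := ⟨(x1 - x0).toNat, by omega⟩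
  obtain ⟨n, hn⟩ : ∃ n : ℕ, y1 = y0 + n := ⟨(y1 - y0).toNat, by omega⟩
  set P : ℕ → ℕ → V := fun i j => (x0 - 1 + i, y0 - 1 + j) with hP
  have key := stokes2 (fun i j => chi4 (lab (P i j)) (lab (P (i + 1) j)))
    (fun i j => chi4 (lab (P i j)) (lab (P i (j + 1)))) (m + 2) (n + 2) (by
      intro i hi j hj
      have A1 : ∀ i j, SqAdj (P i j) (P (i + 1) j) := fun i j => by
        rw [sqAdj_iff]; exact Or.inr ⟨rfl, Or.inr (by simp only [hP]; push_cast; ring)⟩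
      have A2 : ∀ i j, SqAdj (P i j) (P i (j + 1)) := fun i j => by
        rw [sqAdj_iff]; exact Or.inl ⟨rfl, Or.inr (by simp only [hP]; push_cast; ring)⟩
      have A3 : StarAdj (P i j) (P (i + 1) (j + 1)) := by
        rw [starAdj_iff]; simp only [hP]; push_cast; omega
      have A4 : StarAdj (P (i + 1) j) (P i (j + 1)) := by
        rw [starAdj_iff]; simp only [hP]; push_cast; omega
      exact square4 _ _ _ _ (N1 _ _ (A1 i j)) (N1 _ _ (A2 (i + 1) j))
        (N1 _ _ (A1 i (j + 1)).symm) (N1 _ _ (A2 i j)) (N2 _ _ (A1 i j).star)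
        (N2 _ _ (A2 (i + 1) j).star) (N2 _ _ (A1 i (j + 1)).star.symm) (N2 _ _ (A2 i j).star)
        (N2 _ _ A3) (N2 _ _ A4))
  have B0 : ∀ i, lab (P i 0) = 2 := by
    intro i; simp only [hlab, hP]; rw [if_pos]; simp
  have T0 : ∀ i, lab (P i (n + 2)) = 3 := by
    intro i; simp only [hlab, hP]; push_cast; rw [if_neg (by omega), if_pos (by omega)]
  have L0 : ∀ j, j < n + 1 → lab (P 0 (j + 1)) = 0 := by
    intro i hi; simp only [hlab, hP]; push_cast
    rw [if_neg (by omega), if_neg (by omega), if_pos (by omega)]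
  have R0 : ∀ j, j < n + 1 → lab (P (m + 2) (j + 1)) = 1 := by
    intro i hi; simp only [hlab, hP]; push_cast
    rw [if_neg (by omega), if_neg (by omega), if_neg (by omega), if_pos (by omega)]
  have s1 : ∑ i ∈ Finset.range (m + 2), (chi4 (lab (P i 0)) (lab (P (i + 1) 0))
      + chi4 (lab (P i (n + 2))) (lab (P (i + 1) (n + 2)))) = 0 := by
    refine Finset.sum_eq_zero (fun i _ => ?_)
    rw [B0, B0, T0, T0]; decide
  have s2 : ∑ j ∈ Finset.range (n + 2), (chi4 (lab (P 0 j)) (lab (P 0 (j + 1)))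
      + chi4 (lab (P (m + 2) j)) (lab (P (m + 2) (j + 1)))) = 1 := by
    rw [Finset.sum_range_succ', Finset.sum_range_succ]
    rw [Finset.sum_eq_zero]
    · rw [L0 n (by omega), R0 n (by omega), show n + 1 + 1 = n + 2 from rfl, T0, T0, B0, B0,
        L0 0 (by omega), R0 0 (by omega)]
      decide
    · intro j hj
      have := Finset.mem_range.1 hj
      rw [L0 j (by omega), L0 (j + 1) (by omega), R0 j (by omega), R0 (j + 1) (by omega)]; decide
  rw [s1, s2] at key
  exact absurd key (by decide)

end DaC

namespace DaC

/-! ### Product Bernoulli measures -/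

section Prob
variable {ι : Type*}

/-- clamp to `[0,1]` -/
noncomputable def clamp (q : ℝ) : ℝ := max 0 (min q 1)

lemma clamp_nonneg (q : ℝ) : 0 ≤ clamp q := le_max_left _ _
lemma clamp_le_one (q : ℝ) : clamp q ≤ 1 := max_le zero_le_one (min_le_right _ _)
lemma clamp_eq {q : ℝ} (h0 : 0 ≤ q) (h1 : q ≤ 1) : clamp q = q := by
  unfold clamp; rw [min_eq_left h1, max_eq_right h0]
lemma clamp_mono {q q' : ℝ} (h : q ≤ q') : clamp q ≤ clamp q' :=
  max_le_max le_rfl (min_le_min h le_rfl)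

/-- Bernoulli measure with parameter `clamp q`. -/
noncomputable def ber (q : ℝ) : Measure Bool :=
  ENNReal.ofReal (clamp q) • Measure.dirac true + ENNReal.ofReal (1 - clamp q) • Measure.dirac false

instance (q : ℝ) : IsProbabilityMeasure (ber q) := ⟨by
  simp only [ber, Measure.coe_add, Measure.coe_smul, Pi.add_apply, Pi.smul_apply, measure_univ,
    smul_eq_mul, mul_one]
  rw [← ENNReal.ofReal_add (clamp_nonneg q) (by linarith [clamp_le_one q])]
  simp⟩

/-- weight of a boolean -/
noncomputable def wt (q : ℝ) (b : Bool) : ℝ := if b then clamp q else 1 - clamp q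

lemma wt_nonneg (q : ℝ) (b : Bool) : 0 ≤ wt q b := by
  unfold wt; split_ifs
  · exact clamp_nonneg q
  · linarith [clamp_le_one q]

/-- The product measure. -/
noncomputable def PP (w : ι → ℝ) : Measure (ι → Bool) := Measure.infinitePi (fun i => ber (w i))

instance (w : ι → ℝ) : IsProbabilityMeasure (PP w) := by unfold PP; infer_instance

lemma integral_ber (q : ℝ) (f : Bool → ℝ) :
    ∫ b, f b ∂(ber q) = clamp q * f true + (1 - clamp q) * f false := by
  unfold ber
  rw [integral_add_measure, integral_smul_measure, integral_smul_measure, integral_dirac,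
    integral_dirac, ENNReal.toReal_ofReal (clamp_nonneg q),
    ENNReal.toReal_ofReal (by linarith [clamp_le_one q])]
  · simp
  · exact (integrable_dirac (by simp)).smul_measure (by simp)
  · exact (integrable_dirac (by simp)).smul_measure (by simp)

/-- Local functions. -/
def Loc {β : Type*} (F : (ι → Bool) → β) : Prop := ∃ S : Finset ι, DependsOn F (S : Set ι)

lemma Loc.measurable {β : Type*} [MeasurableSpace β] {F : (ι → Bool) → β} (h : Loc F) :
    Measurable F := by
  obtain ⟨S, hS⟩ := h
  haveI : Nonempty β := ⟨F fun _ => false⟩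
  obtain ⟨g, rfl⟩ := (dependsOn_iff_exists_comp).1 hS
  exact (Measurable.of_discrete).comp (by fun_prop)

lemma Loc.finite_range {β : Type*} {F : (ι → Bool) → β} (h : Loc F) : (Set.range F).Finite := by
  obtain ⟨S, hS⟩ := h
  haveI : Nonempty β := ⟨F fun _ => false⟩
  obtain ⟨g, rfl⟩ := (dependsOn_iff_exists_comp).1 hS
  exact (Set.finite_range g).subset (Set.range_comp_subset_range _ _)

lemma Loc.bdd {F : (ι → Bool) → ℝ} (h : Loc F) : ∃ C, ∀ x, ‖F x‖ ≤ C := by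
  obtain ⟨C, hC⟩ := h.finite_range.isBounded.exists_norm_le
  exact ⟨C, fun x => hC _ ⟨x, rfl⟩⟩

lemma Loc.integrable {F : (ι → Bool) → ℝ} (h : Loc F) (μ : Measure (ι → Bool))
    [IsFiniteMeasure μ] : Integrable F μ := by
  obtain ⟨C, hC⟩ := h.bdd
  exact Integrable.of_bound h.measurable.aestronglyMeasurable C (Filter.Eventually.of_forall hC)

lemma Loc.const {β : Type*} (c : β) : Loc (fun _ : ι → Bool => c) :=
  ⟨∅, fun _ _ _ => rfl⟩

open Classical in
lemma Loc.map₂ {β γ δ : Type*} {F : (ι → Bool) → β} {G : (ι → Bool) → γ} (hF : Loc F) (hG : Loc G)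
    (f : β → γ → δ) : Loc (fun x => f (F x) (G x)) := by
  obtain ⟨S, hS⟩ := hF
  obtain ⟨T, hT⟩ := hG
  refine ⟨S ∪ T, fun x y h => ?_⟩
  dsimp only
  rw [hS (fun i hi => h i (by simp at *; exact Or.inl hi)),
    hT (fun i hi => h i (by simp at *; exact Or.inr hi))]

lemma Loc.map {β γ : Type*} {F : (ι → Bool) → β} (hF : Loc F) (f : β → γ) :
    Loc (fun x => f (F x)) := hF.map₂ hF (fun a _ => f a)

variable [DecidableEq ι]

lemma Loc.upd {β : Type*} {F : (ι → Bool) → β} (hF : Loc F) (i : ι) (b : Bool) :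
    Loc (fun x => F (Function.update x i b)) := by
  obtain ⟨S, hS⟩ := hF
  refine ⟨S, fun x y h => hS (fun j hj => ?_)⟩
  by_cases hji : j = i
  · subst hji; simp
  · simp [hji, h j hj]

/-- Resampling one coordinate preserves the measure. -/
lemma map_update (w : ι → ℝ) (i : ι) :
    ((PP w).prod (ber (w i))).map (fun z => Function.update z.1 i z.2) = PP w := by
  have hm : Measurable (fun z : (ι → Bool) × Bool => Function.update z.1 i z.2) := by
    rw [measurable_pi_iff]
    intro j
    by_cases h : j = i
    · subst h; simpa using measurable_snd
    · simp only [Function.update_of_ne h]; exact (measurable_pi_apply j).comp measurable_fst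
  refine Measure.eq_infinitePi _ (fun s t ht => ?_)
  rw [Measure.map_apply hm (MeasurableSet.pi s.countable_toSet (fun i _ => ht i))]
  by_cases hi : i ∈ s
  · have : (fun z : (ι → Bool) × Bool => Function.update z.1 i z.2) ⁻¹' (Set.pi s t) =
        (Set.pi (s.erase i : Finset ι) t) ×ˢ (t i) := by
      ext z
      simp only [Set.mem_preimage, Set.mem_pi, Finset.mem_coe, Set.mem_prod, Finset.mem_erase]
      constructor
      · intro h
        refine ⟨fun j hj => by simpa [hj.1] using h j hj.2, by simpa using h i hi⟩
      · rintro ⟨h1, h2⟩ j hj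
        by_cases hji : j = i
        · subst hji; simpa using h2
        · simpa [hji] using h1 j ⟨hji, hj⟩
    rw [this, Measure.prod_prod, PP, Measure.infinitePi_pi _ (fun i _ => ht i),
      Finset.prod_erase_mul _ _ hi]
  · have : (fun z : (ι → Bool) × Bool => Function.update z.1 i z.2) ⁻¹' (Set.pi s t) =
        (Set.pi s t) ×ˢ Set.univ := by
      ext z
      simp only [Set.mem_preimage, Set.mem_pi, Finset.mem_coe, Set.mem_prod, Set.mem_univ, and_true]
      refine forall₂_congr (fun j hj => ?_)
      have : j ≠ i := fun e => hi (e ▸ hj)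
      simp [this]
    rw [this, Measure.prod_prod, PP, Measure.infinitePi_pi _ (fun i _ => ht i)]
    rw [measure_univ, mul_one]

/-- Expectation. -/
noncomputable def EE (w : ι → ℝ) (F : (ι → Bool) → ℝ) : ℝ := ∫ x, F x ∂(PP w)

lemma EE_resample_gen (w : ι → ℝ) (i : ι) (F : (ι → Bool) → ℝ) (hF : Measurable F)
    (C : ℝ) (hC : ∀ x, ‖F x‖ ≤ C) :
    EE w F = clamp (w i) * EE w (fun x => F (Function.update x i true))
      + (1 - clamp (w i)) * EE w (fun x => F (Function.update x i false)) := by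
  have hm : Measurable (fun z : (ι → Bool) × Bool => Function.update z.1 i z.2) := by
    rw [measurable_pi_iff]
    intro j
    by_cases h : j = i
    · subst h; simpa using measurable_snd
    · simp only [Function.update_of_ne h]; exact (measurable_pi_apply j).comp measurable_fst
  have hup : ∀ b, Measurable (fun x : ι → Bool => Function.update x i b) := fun b =>
    hm.comp (measurable_id.prodMk measurable_const)
  unfold EE
  conv_lhs => rw [← map_update w i]
  rw [integral_map hm.aemeasurable hF.aestronglyMeasurable, integral_prod]
  · simp_rw [integral_ber]
    rw [integral_add, integral_const_mul, integral_const_mul]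
    · exact (Integrable.of_bound (hF.comp (hup true)).aestronglyMeasurable C
        (Filter.Eventually.of_forall (fun x => hC _))).const_mul _
    · exact (Integrable.of_bound (hF.comp (hup false)).aestronglyMeasurable C
        (Filter.Eventually.of_forall (fun x => hC _))).const_mul _
  · exact Integrable.of_bound (hF.comp hm).aestronglyMeasurable C
      (Filter.Eventually.of_forall (fun x => hC _))

lemma EE_resample (w : ι → ℝ) (i : ι) {F : (ι → Bool) → ℝ} (hF : Loc F) :
    EE w F = clamp (w i) * EE w (fun x => F (Function.update x i true))
      + (1 - clamp (w i)) * EE w (fun x => F (Function.update x i false)) := by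
  obtain ⟨C, hC⟩ := hF.bdd
  exact EE_resample_gen w i F hF.measurable C hC

lemma EE_const (w : ι → ℝ) (c : ℝ) : EE w (fun _ => c) = c := by simp [EE]
lemma EE_add (w : ι → ℝ) {F G : (ι → Bool) → ℝ} (hF : Loc F) (hG : Loc G) :
    EE w (fun x => F x + G x) = EE w F + EE w G := integral_add (hF.integrable _) (hG.integrable _)
lemma EE_sub (w : ι → ℝ) {F G : (ι → Bool) → ℝ} (hF : Loc F) (hG : Loc G) :
    EE w (fun x => F x - G x) = EE w F - EE w G := integral_sub (hF.integrable _) (hG.integrable _)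
lemma EE_mul_const (w : ι → ℝ) (F : (ι → Bool) → ℝ) (c : ℝ) :
    EE w (fun x => F x * c) = EE w F * c := integral_mul_const c F
lemma EE_mono (w : ι → ℝ) {F G : (ι → Bool) → ℝ} (hF : Loc F) (hG : Loc G) (h : ∀ x, F x ≤ G x) :
    EE w F ≤ EE w G := integral_mono (hF.integrable _) (hG.integrable _) h
lemma EE_nonneg (w : ι → ℝ) {F : (ι → Bool) → ℝ} (h : ∀ x, 0 ≤ F x) : 0 ≤ EE w F :=
  integral_nonneg h
lemma EE_abs (w : ι → ℝ) (F : (ι → Bool) → ℝ) : |EE w F| ≤ EE w (fun x => |F x|) :=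
  abs_integral_le_integral_abs

/-- discrete derivative -/
def DD (i : ι) (F : (ι → Bool) → ℝ) : (ι → Bool) → ℝ := fun x =>
  F (Function.update x i true) - F (Function.update x i false)

lemma Loc.DD {F : (ι → Bool) → ℝ} (hF : Loc F) (i : ι) : Loc (DD i F) :=
  (hF.upd i true).map₂ (hF.upd i false) (· - ·)


lemma Loc.dep {β : Type*} {F : (ι → Bool) → β} (S : Finset ι)
    (h : ∀ x y, (∀ i ∈ S, x i = y i) → F x = F y) : Loc F := ⟨S, fun x y hxy => h x y hxy⟩

/-- indicator -/
noncomputable def ind {α : Type*} (A : Set α) : α → ℝ := A.indicator (fun _ => 1)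

open Classical in
lemma ind_apply {α : Type*} (A : Set α) (x : α) : ind A x = if x ∈ A then 1 else 0 := by
  simp [ind, Set.indicator_apply]
lemma ind_nonneg {α : Type*} (A : Set α) (x : α) : 0 ≤ ind A x := by
  rw [ind_apply]; split_ifs <;> norm_num
lemma ind_le_one {α : Type*} (A : Set α) (x : α) : ind A x ≤ 1 := by
  rw [ind_apply]; split_ifs <;> norm_num
lemma ind_mem {α : Type*} {A : Set α} {x : α} (h : x ∈ A) : ind A x = 1 := by
  rw [ind_apply, if_pos h]
lemma ind_not {α : Type*} {A : Set α} {x : α} (h : x ∉ A) : ind A x = 0 := by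
  rw [ind_apply, if_neg h]

open Classical in
lemma Loc.ind {A : Set (ι → Bool)} (h : Loc (fun x => x ∈ A)) : Loc (ind A) := by
  have : DaC.ind A = fun x => (fun q : Prop => if q then (1:ℝ) else 0) (x ∈ A) := by
    ext x; simp [ind_apply]
  rw [this]
  exact Loc.map (F := fun x => x ∈ A) h (fun q : Prop => if q then (1:ℝ) else 0)

lemma EE_ind (w : ι → ℝ) {A : Set (ι → Bool)} (hA : MeasurableSet A) :
    EE w (ind A) = (PP w).real A := by
  unfold EE ind
  rw [integral_indicator hA]; simp

end Prob
end DaC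

namespace DaC

section Prob2
variable {ι : Type*} [DecidableEq ι]

/-! ### The OSSS inequality -/

/-- decision trees -/
inductive DTree (ι : Type*) where
  | leaf (c : ℝ) : DTree ι
  | node (i : ι) (f t : DTree ι) : DTree ι

namespace DTree
/-- value -/
def eval : DTree ι → (ι → Bool) → ℝ
  | leaf c, _ => c
  | node i f t, x => if x i then t.eval x else f.eval x
/-- set of queried variables on the branch of `x` -/
def rev : DTree ι → (ι → Bool) → Finset ι
  | leaf _, _ => ∅
  | node i f t, x => insert i (if x i then t.rev x else f.rev x)
/-- all variables -/
def vars : DTree ι → Finset ι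
  | leaf _ => ∅
  | node i f t => insert i (f.vars ∪ t.vars)
/-- no repeated query -/
def NoRep : DTree ι → Prop
  | leaf _ => True
  | node i f t => i ∉ f.vars ∧ i ∉ t.vars ∧ f.NoRep ∧ t.NoRep
/-- bounded by one -/
def Bd : DTree ι → Prop
  | leaf c => |c| ≤ 1
  | node _ f t => f.Bd ∧ t.Bd

lemma eval_congr (T : DTree ι) {x y : ι → Bool} (h : ∀ i ∈ T.vars, x i = y i) :
    T.eval x = T.eval y := by
  induction T with
  | leaf c => rfl
  | node i f t ihf iht =>
    simp only [vars, Finset.mem_insert, Finset.mem_union] at h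
    simp only [eval, h i (Or.inl rfl)]
    rw [ihf (fun j hj => h j (Or.inr (Or.inl hj))), iht (fun j hj => h j (Or.inr (Or.inr hj)))]

lemma rev_congr (T : DTree ι) {x y : ι → Bool} (h : ∀ i ∈ T.vars, x i = y i) :
    T.rev x = T.rev y := by
  induction T with
  | leaf c => rfl
  | node i f t ihf iht =>
    simp only [vars, Finset.mem_insert, Finset.mem_union] at h
    simp only [rev, h i (Or.inl rfl)]
    rw [ihf (fun j hj => h j (Or.inr (Or.inl hj))), iht (fun j hj => h j (Or.inr (Or.inr hj)))]

lemma loc_eval (T : DTree ι) : Loc T.eval := ⟨T.vars, fun _ _ h => T.eval_congr h⟩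
lemma loc_rev (T : DTree ι) : Loc T.rev := ⟨T.vars, fun _ _ h => T.rev_congr h⟩

lemma eval_upd (T : DTree ι) {i : ι} (hi : i ∉ T.vars) (x : ι → Bool) (b : Bool) :
    T.eval (Function.update x i b) = T.eval x :=
  T.eval_congr (fun j hj => by
    have : j ≠ i := fun e => hi (e ▸ hj)
    simp [this])
lemma rev_upd (T : DTree ι) {i : ι} (hi : i ∉ T.vars) (x : ι → Bool) (b : Bool) :
    T.rev (Function.update x i b) = T.rev x :=
  T.rev_congr (fun j hj => by
    have : j ≠ i := fun e => hi (e ▸ hj)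
    simp [this])

lemma rev_sub (T : DTree ι) (x : ι → Bool) : T.rev x ⊆ T.vars := by
  induction T with
  | leaf c => simp [rev]
  | node i f t ihf iht =>
    simp only [rev, vars]
    refine Finset.insert_subset_insert _ ?_
    split_ifs
    · exact iht.trans Finset.subset_union_right
    · exact ihf.trans Finset.subset_union_left

lemma bd_eval (T : DTree ι) (h : T.Bd) (x : ι → Bool) : |T.eval x| ≤ 1 := by
  induction T with
  | leaf c => exact h
  | node i f t ihf iht =>
    simp only [eval]; split_ifs
    · exact iht h.2
    · exact ihf h.1

/-- expected number of times `j` is revealed -/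
noncomputable def del (w : ι → ℝ) (T : DTree ι) (j : ι) : ℝ :=
  EE w (fun x => if j ∈ T.rev x then 1 else 0)

lemma del_nonneg (w : ι → ℝ) (T : DTree ι) (j : ι) : 0 ≤ T.del w j :=
  EE_nonneg w (fun x => by positivity)

lemma del_node (w : ι → ℝ) (i : ι) (f t : DTree ι) (h : (node i f t).NoRep) (j : ι) :
    (node i f t).del w j = (if j = i then 1 else 0) + clamp (w i) * t.del w j
      + (1 - clamp (w i)) * f.del w j := by
  obtain ⟨h1, h2, -, -⟩ := h
  unfold del
  rw [EE_resample w i ((loc_rev (node i f t)).map (fun s => if j ∈ s then (1:ℝ) else 0))]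
  simp only [rev, Function.update_self, if_true, Bool.false_eq_true, if_false, Finset.mem_insert,
    rev_upd _ h1, rev_upd _ h2]
  by_cases hj : j = i
  · subst hj
    have e1 : ∀ x, j ∉ t.rev x := fun x hx => h2 (t.rev_sub x hx)
    have e2 : ∀ x, j ∉ f.rev x := fun x hx => h1 (f.rev_sub x hx)
    simp only [true_or, if_true, e1, e2, if_false, EE_const]; ring
  · simp [hj]

/-- OSSS for decision trees. -/
theorem osss (w : ι → ℝ) {g : (ι → Bool) → ℝ} (hg : Loc g) (T : DTree ι) (hN : T.NoRep)
    (hB : T.Bd) (S : Finset ι) (hS : T.vars ⊆ S) :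
    |EE w (fun x => T.eval x * g x) - EE w T.eval * EE w g| ≤
      ∑ j ∈ S, T.del w j * (2 * (clamp (w j) * (1 - clamp (w j))) * EE w (fun x => |DD j g x|)) := by
  induction T with
  | leaf c =>
    have : EE w (fun x => (leaf c : DTree ι).eval x * g x) - EE w (leaf c : DTree ι).eval * EE w g = 0 := by
      have h1 : EE w (fun x => (leaf c : DTree ι).eval x * g x) = c * EE w g := by
        simp only [eval]; unfold EE; rw [integral_const_mul]
      have h2 : EE w (leaf c : DTree ι).eval = c := EE_const w c
      rw [h1, h2]; ring
    rw [this, abs_zero]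
    refine Finset.sum_nonneg (fun j _ => ?_)
    have := del_nonneg w (leaf c : DTree ι) j
    have := clamp_nonneg (w j); have := clamp_le_one (w j)
    have := EE_nonneg w (F := fun x => |DD j g x|) (fun x => abs_nonneg _)
    have : 0 ≤ 1 - clamp (w j) := by linarith
    positivity
  | node i f t ihf iht =>
    have hN' := hN
    obtain ⟨h1, h2, hf, ht⟩ := hN
    simp only [vars] at hS
    have hiS : i ∈ S := hS (Finset.mem_insert_self _ _)
    have ihf := ihf hf hB.1 (fun j hj => hS (by simp [hj]))
    have iht := iht ht hB.2 (fun j hj => hS (by simp [hj]))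
    set c := clamp (w i) with hc
    have c0 : 0 ≤ c := clamp_nonneg _
    have c1 : 0 ≤ 1 - c := by linarith [clamp_le_one (w i)]
    set D := EE w (fun x => |DD i g x|) with hD
    have hD0 : 0 ≤ D := EE_nonneg w (fun x => abs_nonneg _)
    have e1 : EE w (node i f t).eval = c * EE w t.eval + (1 - c) * EE w f.eval := by
      rw [EE_resample w i (loc_eval _)]
      simp only [eval, Function.update_self, if_true, Bool.false_eq_true, if_false, eval_upd _ h1,
        eval_upd _ h2]
      rfl
    have e2 : EE w (fun x => (node i f t).eval x * g x) =
        c * EE w (fun x => t.eval x * g (Function.update x i true)) +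
        (1 - c) * EE w (fun x => f.eval x * g (Function.update x i false)) := by
      rw [EE_resample w i ((loc_eval _).map₂ hg (· * ·))]
      simp only [eval, Function.update_self, if_true, Bool.false_eq_true, if_false, eval_upd _ h1,
        eval_upd _ h2]
      rfl
    have key : ∀ (U : DTree ι) (b : Bool), U.Bd → i ∉ U.vars →
        |EE w (fun x => U.eval x * g (Function.update x i b)) - EE w (fun x => U.eval x * g x)| ≤
        (if b then (1 - c) else c) * D := by
      intro U b hU hi
      rw [← EE_sub w ((loc_eval U).map₂ (hg.upd i b) (· * ·)) ((loc_eval U).map₂ hg (· * ·))]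
      refine (EE_abs w _).trans ?_
      refine (EE_mono w (G := fun x => |g (Function.update x i b) - g x|) ?_ ?_ ?_).trans ?_
      · exact (((loc_eval U).map₂ (hg.upd i b) (· * ·)).map₂ ((loc_eval U).map₂ hg (· * ·))
          (fun a b => |a - b|))
      · exact (hg.upd i b).map₂ hg (fun a b => |a - b|)
      · intro x
        rw [← mul_sub, abs_mul]
        exact mul_le_of_le_one_left (abs_nonneg _) (bd_eval U hU x)
      · rw [EE_resample w i ((hg.upd i b).map₂ hg (fun a b => |a - b|))]
        cases b
        · simp only [Function.update_idem, sub_self, abs_zero, EE_const, mul_zero, add_zero]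
          refine le_of_eq ?_
          simp only [Bool.false_eq_true, if_false, hD, DD]
          congr 2; ext x; rw [abs_sub_comm]
        · simp only [Function.update_idem, sub_self, abs_zero, EE_const, mul_zero, zero_add]
          exact le_rfl
    have kt := key t true hB.2 h2
    have kf := key f false hB.1 h1
    simp only [if_true, Bool.false_eq_true, if_false] at kt kf
    have expand : EE w (fun x => (node i f t).eval x * g x) - EE w (node i f t).eval * EE w g =
      c * (EE w (fun x => t.eval x * g (Function.update x i true)) - EE w (fun x => t.eval x * g x))
      + (1 - c) * (EE w (fun x => f.eval x * g (Function.update x i false)) - EE w (fun x => f.eval x * g x))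
      + c * (EE w (fun x => t.eval x * g x) - EE w t.eval * EE w g)
      + (1 - c) * (EE w (fun x => f.eval x * g x) - EE w f.eval * EE w g) := by
      rw [e1, e2]; ring
    have sumeq : ∑ j ∈ S, (node i f t).del w j * (2 * (clamp (w j) * (1 - clamp (w j))) * EE w (fun x => |DD j g x|))
      = 2 * (c * (1 - c)) * D
        + c * ∑ j ∈ S, t.del w j * (2 * (clamp (w j) * (1 - clamp (w j))) * EE w (fun x => |DD j g x|))
        + (1 - c) * ∑ j ∈ S, f.del w j * (2 * (clamp (w j) * (1 - clamp (w j))) * EE w (fun x => |DD j g x|)) := by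
      simp_rw [del_node w i f t hN', add_mul, Finset.sum_add_distrib, Finset.mul_sum]
      congr 1
      · congr 1
        · rw [Finset.sum_eq_single i]
          · simp [hc, hD]
          · intro j _ hj; simp [hj]
          · intro h; exact absurd hiS h
        · exact Finset.sum_congr rfl (fun j _ => by ring)
      · exact Finset.sum_congr rfl (fun j _ => by ring)
    rw [expand, sumeq]
    have a1 := abs_le.1 kt; have a2 := abs_le.1 kf; have a3 := abs_le.1 iht; have a4 := abs_le.1 ihf
    rw [abs_le]
    constructor
    · nlinarith [mul_le_mul_of_nonneg_left a1.1 c0, mul_le_mul_of_nonneg_left a2.1 c1,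
        mul_le_mul_of_nonneg_left a3.1 c0, mul_le_mul_of_nonneg_left a4.1 c1]
    · nlinarith [mul_le_mul_of_nonneg_left a1.2 c0, mul_le_mul_of_nonneg_left a2.2 c1,
        mul_le_mul_of_nonneg_left a3.2 c0, mul_le_mul_of_nonneg_left a4.2 c1]

/-- the tree built from an exploration rule -/
noncomputable def mk (F : (ι → Bool) → ℝ) (next : Finset ι → (ι → Bool) → Option ι) :
    ℕ → Finset ι → (ι → Bool) → DTree ι
  | 0, _, z => leaf (F z)
  | n + 1, K, z => match next K z with
    | none => leaf (F z)
    | some i => node i (mk F next n (insert i K) (Function.update z i false))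
        (mk F next n (insert i K) (Function.update z i true))

end DTree

/-- OSSS with an exploration rule. -/
theorem osss_explore (w : ι → ℝ) {F g : (ι → Bool) → ℝ} (hg : Loc g) (hF1 : ∀ x, |F x| ≤ 1)
    (S : Finset ι) (next : Finset ι → (ι → Bool) → Option ι)
    (h2 : ∀ K z i, next K z = some i → i ∈ S ∧ i ∉ K)
    (h3 : ∀ K z, (∀ i ∉ K, z i = false) → next K z = none →
      ∀ x, (∀ i ∈ K, x i = z i) → F x = F z)
    (Full : (ι → Bool) → Set ι) (hL : ∀ j, Loc (fun x => j ∈ Full x))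
    (h4 : ∀ K z x i, (∀ i ∉ K, z i = false) → (∀ i ∈ K, x i = z i) → next K z = some i →
      i ∈ Full x) :
    |EE w (fun x => F x * g x) - EE w F * EE w g| ≤
      ∑ j ∈ S, EE w (ind {x | j ∈ Full x}) *
        (2 * (clamp (w j) * (1 - clamp (w j))) * EE w (fun x => |DD j g x|)) := by
  classical
  have A1 : ∀ n K z, (DTree.mk F next n K z).vars ⊆ S \ K := by
    intro n
    induction n with
    | zero => intro K z; simp [DTree.mk, DTree.vars]
    | succ n ih =>
      intro K z
      simp only [DTree.mk]
      cases h : next K z with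
      | none => simp [DTree.vars]
      | some i =>
        simp only [DTree.vars]
        have := h2 K z i h
        intro j hj
        simp only [Finset.mem_insert, Finset.mem_union] at hj
        rcases hj with rfl | hj | hj
        · simp [this]
        · have := ih _ _ hj; simp at this ⊢; tauto
        · have := ih _ _ hj; simp at this ⊢; tauto
  have A2 : ∀ n K z, (DTree.mk F next n K z).NoRep := by
    intro n
    induction n with
    | zero => intro K z; simp [DTree.mk, DTree.NoRep]
    | succ n ih =>
      intro K z
      simp only [DTree.mk]
      cases h : next K z with
      | none => simp [DTree.NoRep]
      | some i =>
        refine ⟨fun hi => ?_, fun hi => ?_, ih _ _, ih _ _⟩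
        · have := A1 _ _ _ hi; simp at this
        · have := A1 _ _ _ hi; simp at this
  have A3 : ∀ n K z, (DTree.mk F next n K z).Bd := by
    intro n
    induction n with
    | zero => intro K z; exact hF1 z
    | succ n ih =>
      intro K z
      simp only [DTree.mk]
      cases h : next K z with
      | none => exact hF1 z
      | some i => exact ⟨ih _ _, ih _ _⟩
  have A4 : ∀ n K z x, (∀ i ∉ K, z i = false) → (∀ i ∈ K, x i = z i) → (S \ K).card < n →
      (DTree.mk F next n K z).eval x = F x := by
    intro n
    induction n with
    | zero => intro K z x _ _ h; omega
    | succ n ih =>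
      intro K z x hz hx hc
      simp only [DTree.mk]
      cases h : next K z with
      | none => exact (h3 K z hz h x hx).symm
      | some i =>
        have hi := h2 K z i h
        have hcard : (S \ insert i K).card < n := by
          have : S \ insert i K ⊂ S \ K := by
            refine Finset.ssubset_iff_subset_ne.2 ⟨fun j => by simp; tauto, fun e => ?_⟩
            have : i ∈ S \ insert i K := by rw [e]; simp [hi]
            simp at this
          have := Finset.card_lt_card this
          omega
        have gen : ∀ b, x i = b → (DTree.mk F next n (insert i K) (Function.update z i b)).eval x
            = F x := by
          intro b hb
          refine ih _ _ x ?_ ?_ hcard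
          · intro j hj; simp at hj; simp [hj.1, hz j hj.2]
          · intro j hj
            by_cases hji : j = i
            · subst hji; simp [hb]
            · simp [hji] at hj ⊢; exact hx j hj
        simp only [DTree.eval]
        split_ifs with hb
        · exact gen true hb
        · exact gen false (by simpa using hb)
  have A5 : ∀ n K z x, (∀ i ∉ K, z i = false) → (∀ i ∈ K, x i = z i) →
      ∀ j ∈ (DTree.mk F next n K z).rev x, j ∈ Full x := by
    intro n
    induction n with
    | zero => intro K z x _ _ j hj; simp [DTree.mk, DTree.rev] at hj
    | succ n ih =>
      intro K z x hz hx j hj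
      simp only [DTree.mk] at hj
      cases h : next K z with
      | none => rw [h] at hj; simp [DTree.rev] at hj
      | some i =>
        rw [h] at hj
        simp only [DTree.rev, Finset.mem_insert] at hj
        rcases hj with rfl | hj
        · exact h4 K z x j hz hx h
        · have gen : ∀ b, x i = b →
            j ∈ (DTree.mk F next n (insert i K) (Function.update z i b)).rev x → j ∈ Full x := by
            intro b hb
            refine ih _ _ x ?_ ?_ j
            · intro j hj; simp at hj; simp [hj.1, hz j hj.2]
            · intro j hj
              by_cases hji : j = i
              · subst hji; simp [hb]
              · simp [hji] at hj ⊢; exact hx j hj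
          split_ifs at hj with hb
          · exact gen true hb hj
          · exact gen false (by simpa using hb) hj
  set T := DTree.mk F next (S.card + 1) ∅ (fun _ => false) with hT
  have hTe : T.eval = F := by
    ext x
    exact A4 _ _ _ x (by simp) (by simp) (by simp)
  have := DTree.osss w hg T (A2 _ _ _) (A3 _ _ _) S (fun j hj => by
    have := A1 _ _ _ hj; simpa using this)
  rw [hTe] at this
  refine this.trans (Finset.sum_le_sum (fun j _ => ?_))
  have := clamp_nonneg (w j); have := clamp_le_one (w j)
  have := EE_nonneg w (F := fun x => |DD j g x|) (fun x => abs_nonneg _)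
  have : 0 ≤ 1 - clamp (w j) := by linarith
  refine mul_le_mul_of_nonneg_right ?_ (by positivity)
  refine EE_mono w ((DTree.loc_rev T).map (fun s => if j ∈ s then (1:ℝ) else 0)) ?_ ?_
  · exact Loc.ind (hL j)
  · intro x
    split_ifs with h
    · rw [ind_mem]; exact A5 _ _ _ x (by simp) (by simp) j h
    · exact ind_nonneg _ _

end Prob2
end DaC

namespace DaC

section Prob3
variable {ι : Type*} [DecidableEq ι]

lemma dep_upd {β : Type*} {F : (ι → Bool) → β} {S : Finset ι} {i : ι}
    (h : DependsOn F (insert i S : Finset ι)) (b : Bool) :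
    DependsOn (fun x => F (Function.update x i b)) (S : Set ι) := by
  intro x y hxy
  refine h (fun j hj => ?_)
  by_cases hji : j = i
  · subst hji; simp
  · simp only [Finset.coe_insert, Set.mem_insert_iff, hji, false_or] at hj
    simp [hji, hxy j hj]

lemma dep_empty {β : Type*} {F : (ι → Bool) → β} (h : DependsOn F ((∅ : Finset ι) : Set ι)) (x) :
    F x = F (fun _ => false) := h (by simp)

lemma upd_mono {x y : ι → Bool} (h : x ≤ y) (i : ι) {b c : Bool} (hb : b ≤ c) :
    Function.update x i b ≤ Function.update y i c := by
  intro j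
  by_cases hji : j = i
  · subst hji; simpa using hb
  · simpa [hji] using h j

lemma mono_upd {F : (ι → Bool) → ℝ} (h : Monotone F) (i : ι) (b : Bool) :
    Monotone (fun x => F (Function.update x i b)) := fun _ _ hxy => h (upd_mono hxy i le_rfl)

theorem harris (w : ι → ℝ) {F G : (ι → Bool) → ℝ} (hF : Loc F) (hG : Loc G)
    (mF : Monotone F) (mG : Monotone G) : EE w F * EE w G ≤ EE w (fun x => F x * G x) := by
  obtain ⟨S, hS⟩ := hF
  obtain ⟨T, hT⟩ := hG
  replace hS : DependsOn F ((S ∪ T : Finset ι) : Set ι) := fun x y h => hS (fun i hi => h i (by simp at *; tauto))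
  replace hT : DependsOn G ((S ∪ T : Finset ι) : Set ι) := fun x y h => hT (fun i hi => h i (by simp at *; tauto))
  generalize S ∪ T = U at hS hT
  induction U using Finset.induction_on generalizing F G with
  | empty =>
    have e1 : F = fun _ => F (fun _ => false) := funext (dep_empty hS)
    have e2 : G = fun _ => G (fun _ => false) := funext (dep_empty hT)
    rw [e1, e2]; simp only [EE_const]; exact le_rfl
  | insert i U hi ih =>
    have lF : Loc F := ⟨_, hS⟩
    have lG : Loc G := ⟨_, hT⟩
    rw [EE_resample w i lF, EE_resample w i lG, EE_resample w i (lF.map₂ lG (· * ·))]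
    have i1 := ih (mono_upd mF i true) (mono_upd mG i true) (dep_upd hS true) (dep_upd hT true)
    have i0 := ih (mono_upd mF i false) (mono_upd mG i false) (dep_upd hS false) (dep_upd hT false)
    have m1 : EE w (fun x => F (Function.update x i false)) ≤ EE w (fun x => F (Function.update x i true)) :=
      EE_mono w (lF.upd i _) (lF.upd i _) (fun x => mF (upd_mono le_rfl i (by simp)))
    have m2 : EE w (fun x => G (Function.update x i false)) ≤ EE w (fun x => G (Function.update x i true)) :=
      EE_mono w (lG.upd i _) (lG.upd i _) (fun x => mG (upd_mono le_rfl i (by simp)))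
    have c0 := clamp_nonneg (w i)
    have c1 : 0 ≤ 1 - clamp (w i) := by linarith [clamp_le_one (w i)]
    nlinarith [mul_le_mul_of_nonneg_left i1 c0, mul_le_mul_of_nonneg_left i0 c1,
      mul_nonneg (mul_nonneg c0 c1) (mul_nonneg (sub_nonneg.2 m1) (sub_nonneg.2 m2))]

theorem EE_mono_w {w w' : ι → ℝ} (hw : ∀ i, w i ≤ w' i) {F : (ι → Bool) → ℝ} (hF : Loc F)
    (mF : Monotone F) : EE w F ≤ EE w' F := by
  obtain ⟨S, hS⟩ := hF
  induction S using Finset.induction_on generalizing F with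
  | empty =>
    have e1 : F = fun _ => F (fun _ => false) := funext (dep_empty hS)
    rw [e1]; simp only [EE_const]; exact le_rfl
  | insert i U hi ih =>
    have lF : Loc F := ⟨_, hS⟩
    rw [EE_resample w i lF, EE_resample w' i lF]
    have i1 := ih (mono_upd mF i true) (dep_upd hS true)
    have i0 := ih (mono_upd mF i false) (dep_upd hS false)
    have m1 : EE w' (fun x => F (Function.update x i false)) ≤ EE w' (fun x => F (Function.update x i true)) :=
      EE_mono w' (lF.upd i _) (lF.upd i _) (fun x => mF (upd_mono le_rfl i (by simp)))
    have c0 := clamp_nonneg (w i)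
    have c1 : 0 ≤ 1 - clamp (w i) := by linarith [clamp_le_one (w i)]
    have := clamp_mono (hw i)
    nlinarith [mul_le_mul_of_nonneg_left i1 c0, mul_le_mul_of_nonneg_left i0 c1,
      mul_nonneg (sub_nonneg.2 this) (sub_nonneg.2 m1)]

theorem EE_indep (w : ι → ℝ) {F G : (ι → Bool) → ℝ} {S : Finset ι} (hF : DependsOn F (S : Set ι))
    (hG : Loc G) (hd : ∀ i ∈ S, ∀ x b, G (Function.update x i b) = G x) :
    EE w (fun x => F x * G x) = EE w F * EE w G := by
  induction S using Finset.induction_on generalizing F with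
  | empty =>
    have e1 : F = fun _ => F (fun _ => false) := funext (dep_empty hF)
    rw [e1]; simp only [EE_const]; unfold EE; rw [integral_const_mul]
  | insert i U hi ih =>
    have lF : Loc F := ⟨_, hF⟩
    rw [EE_resample w i lF, EE_resample w i (lF.map₂ hG (· * ·))]
    have hd' : ∀ i ∈ U, ∀ x b, G (Function.update x i b) = G x := fun j hj => hd j (by simp [hj])
    have i1 := ih (dep_upd hF true) hd'
    have i0 := ih (dep_upd hF false) hd'
    simp only [hd i (by simp)]
    rw [i1, i0]; ring

theorem EE_indep' (w : ι → ℝ) {F G : (ι → Bool) → ℝ} {S T : Finset ι} (hF : DependsOn F (S : Set ι))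
    (hG : DependsOn G (T : Set ι)) (hd : Disjoint S T) :
    EE w (fun x => F x * G x) = EE w F * EE w G := by
  refine EE_indep w hF ⟨T, hG⟩ (fun i hi x b => hG (fun j hj => ?_))
  have : j ≠ i := fun e => Finset.disjoint_left.1 hd hi (e ▸ hj)
  simp [this]

theorem russo {w : ℝ → ι → ℝ} {w' : ι → ℝ} {s : ℝ}
    (hw : ∀ i, HasDerivAt (fun t => clamp (w t i)) (w' i) s)
    {F : (ι → Bool) → ℝ} {S : Finset ι} (hS : DependsOn F (S : Set ι)) :
    HasDerivAt (fun t => EE (w t) F) (∑ i ∈ S, w' i * EE (w s) (DD i F)) s := by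
  induction S using Finset.induction_on generalizing F with
  | empty =>
    have e1 : F = fun _ => F (fun _ => false) := funext (dep_empty hS)
    rw [e1]; simp only [EE_const, Finset.sum_empty]
    exact hasDerivAt_const _ _
  | insert i U hi ih =>
    have lF : Loc F := ⟨_, hS⟩
    have i1 := ih (dep_upd hS true)
    have i0 := ih (dep_upd hS false)
    have e : (fun t => EE (w t) F) = fun t => clamp (w t i) * EE (w t) (fun x => F (Function.update x i true))
      + (1 - clamp (w t i)) * EE (w t) (fun x => F (Function.update x i false)) := by
      ext t; exact EE_resample (w t) i lF
    rw [e]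
    have := ((hw i).mul i1).add (((hw i).const_sub 1).mul i0)
    refine this.congr_deriv ?_
    rw [Finset.sum_insert hi]
    have e1 : EE (w s) (DD i F) = EE (w s) (fun x => F (Function.update x i true)) -
      EE (w s) (fun x => F (Function.update x i false)) := EE_sub _ (lF.upd i _) (lF.upd i _)
    have e2 : ∀ j ∈ U, EE (w s) (DD j F) =
      clamp (w s i) * EE (w s) (DD j (fun x => F (Function.update x i true))) +
      (1 - clamp (w s i)) * EE (w s) (DD j (fun x => F (Function.update x i false))) := by
      intro j hj
      have hji : j ≠ i := fun e => hi (e ▸ hj)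
      rw [EE_resample (w s) i (lF.DD j)]
      have c1 : ∀ b, (fun x => DD j F (Function.update x i b)) = DD j (fun x => F (Function.update x i b)) := by
        intro b; ext x
        show _ - _ = _ - _
        rw [Function.update_comm hji.symm, Function.update_comm hji.symm]
      rw [c1, c1]
    have e3 : ∑ j ∈ U, w' j * EE (w s) (DD j F) =
      clamp (w s i) * ∑ j ∈ U, w' j * EE (w s) (DD j (fun x => F (Function.update x i true))) +
      (1 - clamp (w s i)) * ∑ j ∈ U, w' j * EE (w s) (DD j (fun x => F (Function.update x i false))) := by
      rw [Finset.mul_sum, Finset.mul_sum, ← Finset.sum_add_distrib]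
      exact Finset.sum_congr rfl (fun j hj => by rw [e2 j hj]; ring)
    rw [e1, e3]; ring

end Prob3
end DaC

namespace DaC

/-! ### Gluing paths -/

lemma glue {adj : V → V → Prop} (ok : Okay adj) {S T U : Set V} {a b c d : V}
    (hS : CI adj S a b) (hT : CI adj T c d) (hSU : S ⊆ U) (hTU : T ⊆ U)
    (hTx : ∀ v ∈ T, a.1 ≤ v.1 ∧ v.1 ≤ b.1) (hSy : ∀ v ∈ S, c.2 ≤ v.2 ∧ v.2 ≤ d.2) :
    CI adj U a c := by
  obtain ⟨u, hu, v, hv, h⟩ := crossTouch ok hS.comp hT.comp (fun v hv => hTx v (CI.right hv))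
    (fun v hv => hSy v (CI.right hv))
  have hu' : CI adj U a u := CI.monoS hu hSU
  have hv' : CI adj U c v := CI.monoS hv hTU
  rcases h with rfl | h
  · exact hu'.trans (hv'.symm ok)
  · exact (hu'.tail h hv'.right).trans (hv'.symm ok)

lemma glueArc {adj : V → V → Prop} (ok : Okay adj) {S T U : Set V} {n s y1 y2 B : ℤ} {z : V}
    (hS : CI adj S z (n, s))
    (hT : CI adj T (n, y2) (n, y1)) (h2 : y2 < s) (h1 : s < y1) (hSU : S ⊆ U) (hTU : T ⊆ U)
    (hSx : ∀ v ∈ S, v.1 ≤ n) (hSy : ∀ v ∈ S, -B ≤ v.2 ∧ v.2 ≤ B)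
    (hTx : ∀ v ∈ T, z.1 ≤ v.1 ∧ v.1 ≤ n) : CI adj U z (n, y2) := by
  obtain ⟨u, hu, v, hv, h⟩ := arcTouch ok hS.comp hT.comp h2 h1 (fun v hv => hSx v (CI.right hv))
    (fun v hv => hSy v (CI.right hv)) (fun v hv => hTx v (CI.right hv))
  have hu' : CI adj U z u := CI.monoS hu hSU
  have hv' : CI adj U (n, y2) v := CI.monoS hv hTU
  rcases h with rfl | h
  · exact hu'.trans (hv'.symm ok)
  · exact (hu'.tail h hv'.right).trans (hv'.symm ok)

lemma jhalf {adj : V → V → Prop} (ok : Okay adj) {G S U : Set V} {n N y g B s : ℤ}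
    {z a1 b1 a2 b2 c d : V} (hS : CI adj S z (n, s)) (hSx : ∀ v ∈ S, v.1 ≤ n)
    (hSy : ∀ v ∈ S, -B ≤ v.2 ∧ v.2 ≤ B) (hz : z.1 ≤ n - 2 * N) (hSU : S ⊆ U)
    (hU : Box (n - 2 * N) n (y - N) (y + N) ∩ G ⊆ U)
    (h1 : CI adj (Box (n - 2 * N) n (y - N) (y + N) ∩ G) a1 b1) (ha1 : a1.1 = n - 2 * N)
    (hb1 : b1.1 = n) (hb1' : y + g ≤ b1.2)
    (h2 : CI adj (Box (n - 2 * N) n (y - N) (y + N) ∩ G) a2 b2) (ha2 : a2.1 = n - 2 * N)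
    (hb2 : b2.1 = n) (hb2' : b2.2 ≤ y - g)
    (hT : CI adj (Box (n - 2 * N) n (y - N) (y + N) ∩ G) c d) (hc : c.2 = y - N)
    (hd : d.2 = y + N) (hs1 : y - g < s) (hs2 : s < y + g) : CI adj U z c := by
  have e1 := glue ok h1 hT subset_rfl subset_rfl
    (fun v hv => by have := hv.1; simp only [Box, Set.mem_setOf_eq] at this; omega)
    (fun v hv => by have := hv.1; simp only [Box, Set.mem_setOf_eq] at this; omega)
  have e2 := glue ok h2 hT subset_rfl subset_rfl
    (fun v hv => by have := hv.1; simp only [Box, Set.mem_setOf_eq] at this; omega)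
    (fun v hv => by have := hv.1; simp only [Box, Set.mem_setOf_eq] at this; omega)
  have e3 : CI adj (Box (n - 2 * N) n (y - N) (y + N) ∩ G) b2 c := (h2.symm ok).trans e2
  have e4 : CI adj (Box (n - 2 * N) n (y - N) (y + N) ∩ G) b1 c := (h1.symm ok).trans e1
  have e5 : CI adj (Box (n - 2 * N) n (y - N) (y + N) ∩ G) (n, b2.2) (n, b1.2) := by
    have q1 : (n, b2.2) = b2 := by rw [← hb2]
    have q2 : (n, b1.2) = b1 := by rw [← hb1]
    rw [q1, q2]; exact e3.trans (e4.symm ok)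
  have e6 := glueArc ok hS e5 (by omega) (by omega) hSU hU hSx hSy
    (fun v hv => by have := hv.1; simp only [Box, Set.mem_setOf_eq] at this; omega)
  have q1 : (n, b2.2) = b2 := by rw [← hb2]
  rw [q1] at e6
  exact e6.trans (e3.monoS hU)

/-! ### Symmetries and increasing events -/

/-- the symmetries we use -/
inductive Sy : (V → V) → Prop
  | sh (a b : ℤ) : Sy (fun v => (v.1 + 2 * a, v.2 + 2 * b))
  | rx : Sy (fun v => (-v.1, v.2))
  | sw : Sy (fun v => (v.2, v.1))
  | comp {f g} : Sy f → Sy g → Sy (f ∘ g)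

lemma Sy.adj {g : V → V} (hg : Sy g) {adj : V → V → Prop} (ok : Okay adj) :
    ∀ u v, adj u v → adj (g u) (g v) := by
  induction hg with
  | sh a b =>
    rcases ok with rfl | rfl <;> intro u v <;> simp only [sqAdj_iff, starAdj_iff] <;> omega
  | rx => rcases ok with rfl | rfl <;> intro u v <;> simp only [sqAdj_iff, starAdj_iff] <;> omega
  | sw => rcases ok with rfl | rfl <;> intro u v <;> simp only [sqAdj_iff, starAdj_iff] <;> omega
  | comp _ _ h1 h2 => exact fun u v h => h1 _ _ (h2 _ _ h)

lemma Sy.congr {f g : V → V} (hf : Sy f) (h : ∀ v, g v = f v) : Sy g := by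
  rwa [funext h]

lemma Sy.ry : Sy (fun v => (v.1, -v.2)) := (Sy.sw.comp (Sy.rx.comp Sy.sw)).congr (fun _ => rfl)
/-- reflection and shift in `x` -/
lemma Sy.rxs (a b : ℤ) : Sy (fun v => (2 * a - v.1, v.2 + 2 * b)) :=
  ((Sy.sh a b).comp Sy.rx).congr (fun v => by ext <;> simp; ring)
lemma Sy.sws (a b : ℤ) : Sy (fun v => (v.2 + 2 * a, v.1 + 2 * b)) :=
  ((Sy.sh a b).comp Sy.sw).congr (fun v => rfl)
lemma Sy.rys (a b : ℤ) : Sy (fun v => (v.1 + 2 * a, 2 * b - v.2)) :=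
  ((Sy.sh a b).comp Sy.ry).congr (fun v => by ext <;> simp; ring)
lemma Sy.rxys (a b : ℤ) : Sy (fun v => (2 * a - v.1, 2 * b - v.2)) :=
  ((Sy.sh a b).comp (Sy.rx.comp Sy.ry)).congr (fun v => by ext <;> simp <;> ring)

/-- increasing local events -/
structure Inc (A : Set (V → Bool)) : Prop where
  loc : Loc (fun ξ => ξ ∈ A)
  up : ∀ ξ ζ : V → Bool, ξ ≤ ζ → ξ ∈ A → ζ ∈ A

lemma Inc.inter {A B : Set (V → Bool)} (hA : Inc A) (hB : Inc B) : Inc (A ∩ B) :=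
  ⟨hA.loc.map₂ hB.loc And, fun _ _ h hx => ⟨hA.up _ _ h hx.1, hB.up _ _ h hx.2⟩⟩

lemma loc_meas {ι : Type*} {A : Set (ι → Bool)} (h : Loc (fun ξ => ξ ∈ A)) : MeasurableSet A := by
  have h2 : Measurable (fun ξ => ξ ∈ A) := h.measurable
  exact measurableSet_setOf.2 h2

lemma Inc.meas {A : Set (V → Bool)} (hA : Inc A) : MeasurableSet A := loc_meas hA.loc

/-- measures to which the RSW theory applies -/
structure Rsw (μ : Measure (V → Bool)) : Prop where
  prob : IsProbabilityMeasure μ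
  inv : ∀ g, Sy g → ∀ A, Inc A → μ.real {ξ | ξ ∘ g ∈ A} = μ.real A
  fkg : ∀ A B, Inc A → Inc B → μ.real A * μ.real B ≤ μ.real (A ∩ B)

lemma Rsw.and {μ : Measure (V → Bool)} (h : Rsw μ) {A B : Set (V → Bool)} (hA : Inc A) (hB : Inc B)
    {a b : ℝ} (ha : a ≤ μ.real A) (hb : b ≤ μ.real B) (ha0 : 0 ≤ a) (hb0 : 0 ≤ b) :
    a * b ≤ μ.real (A ∩ B) :=
  (mul_le_mul ha hb hb0 (ha0.trans ha)).trans (h.fkg A B hA hB)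

/-- black vertices -/
def Gt (ξ : V → Bool) : Set V := {v | ξ v = true}

/-- connection event -/
def Con (adj : V → V → Prop) (D A B : Set V) : Set (V → Bool) :=
  {ξ | ∃ a ∈ A, ∃ b ∈ B, CI adj (D ∩ Gt ξ) a b}

lemma box_finite (x0 x1 y0 y1 : ℤ) : (Box x0 x1 y0 y1).Finite := by
  refine ((Set.finite_Icc x0 x1).prod (Set.finite_Icc y0 y1)).subset ?_
  rintro ⟨x, y⟩ h
  simp only [Box, Set.mem_setOf_eq] at h
  simp only [Set.mem_prod, Set.mem_Icc]; tauto

lemma loc_of_finite {D : Set V} (hD : D.Finite) (P : Set V → Prop) :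
    Loc (fun ξ : V → Bool => P (D ∩ Gt ξ)) := by
  refine ⟨hD.toFinset, fun x y h => ?_⟩
  have : D ∩ Gt x = D ∩ Gt y := by
    ext v
    simp only [Set.mem_inter_iff, Gt, Set.mem_setOf_eq]
    refine and_congr_right (fun hv => ?_)
    rw [h v (by simpa using hv)]
  simp only [this]

lemma Gt_mono {ξ ζ : V → Bool} (h : ξ ≤ ζ) : Gt ξ ⊆ Gt ζ := by
  intro v hv
  have h1 : ξ v = true := hv
  have h2 := h v
  rw [h1] at h2
  exact top_le_iff.1 h2

lemma Con.inc {adj : V → V → Prop} {D A B : Set V} (hD : D.Finite) : Inc (Con adj D A B) := by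
  refine ⟨loc_of_finite hD (fun S => ∃ a ∈ A, ∃ b ∈ B, CI adj S a b), fun ξ ζ h => ?_⟩
  rintro ⟨a, ha, b, hb, hc⟩
  exact ⟨a, ha, b, hb, hc.monoS (Set.inter_subset_inter_right _ (Gt_mono h))⟩

lemma Rsw.map {μ : Measure (V → Bool)} (h : Rsw μ) {adj : V → V → Prop} (ok : Okay adj)
    {D A B D' A' B' : Set V} (hD : D.Finite) {g : V → V} (hg : Sy g) (h1 : ∀ v ∈ D, g v ∈ D')
    (h2 : ∀ v ∈ D, v ∈ A → g v ∈ A') (h3 : ∀ v ∈ D, v ∈ B → g v ∈ B') :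
    μ.real (Con adj D A B) ≤ μ.real (Con adj D' A' B') := by
  have := h.prob
  rw [← h.inv g hg _ (Con.inc hD)]
  refine measureReal_mono ?_
  rintro ξ ⟨a, ha, b, hb, hc⟩
  refine ⟨g a, h2 a hc.left.1 ha, g b, h3 b hc.right.1 hb, hc.map g (hg.adj ok) ?_⟩
  rintro v ⟨hv, hv'⟩
  exact ⟨h1 v hv, hv'⟩

end DaC

namespace DaC

/-- left-right crossing -/
def LR (adj : V → V → Prop) (x0 x1 y0 y1 : ℤ) : Set (V → Bool) :=
  Con adj (Box x0 x1 y0 y1) {v | v.1 = x0} {v | v.1 = x1}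
/-- bottom-top crossing -/
def TB (adj : V → V → Prop) (x0 x1 y0 y1 : ℤ) : Set (V → Bool) :=
  Con adj (Box x0 x1 y0 y1) {v | v.2 = y0} {v | v.2 = y1}
/-- crossing of a square with restricted endpoint -/
def HH (adj : V → V → Prop) (n a b : ℤ) : Set (V → Bool) :=
  Con adj (Box (-n) n (-n) n) {v | v.1 = -n} {v | v.1 = n ∧ a ≤ v.2 ∧ v.2 ≤ b}

lemma LR.inc {adj x0 x1 y0 y1} : Inc (LR adj x0 x1 y0 y1) := Con.inc (box_finite _ _ _ _)
lemma TB.inc {adj x0 x1 y0 y1} : Inc (TB adj x0 x1 y0 y1) := Con.inc (box_finite _ _ _ _)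
lemma HH.inc {adj n a b} : Inc (HH adj n a b) := Con.inc (box_finite _ _ _ _)

lemma Okay.lip1 {adj : V → V → Prop} (ok : Okay adj) (u v : V) (h : adj u v) : v.1 ≤ u.1 + 1 := by
  have := ok.star h; rw [starAdj_iff] at this; omega
lemma Okay.lip2 {adj : V → V → Prop} (ok : Okay adj) (u v : V) (h : adj u v) : v.2 ≤ u.2 + 1 := by
  have := ok.star h; rw [starAdj_iff] at this; omega

lemma lr_trim {adj : V → V → Prop} (ok : Okay adj) {G : Set V} {x0 x1 y0 y1 x1' y0' y1' : ℤ} {a b : V}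
    (h : CI adj (Box x0 x1 y0 y1 ∩ G) a b) (ha : a.1 = x0) (hb : b.1 = x1) (h1 : x0 ≤ x1')
    (h2 : x1' ≤ x1) (h3 : y0' ≤ y0) (h4 : y1 ≤ y1') :
    ∃ b', b'.1 = x1' ∧ CI adj (Box x0 x1' y0' y1' ∩ G) a b' := by
  obtain ⟨b', e1, e2⟩ := h.firstPart (fun v => v.1) ok.lip1 (m := x1') (by omega) (by omega)
  refine ⟨b', e1, e2.monoS ?_⟩
  rintro v ⟨⟨hv, hG⟩, hv'⟩
  refine ⟨?_, hG⟩
  simp only [Box, Set.mem_setOf_eq] at *; omega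

lemma tb_trim {adj : V → V → Prop} (ok : Okay adj) {G : Set V} {x0 x1 y0 y1 y0' y1' : ℤ} {a b : V}
    (h : CI adj (Box x0 x1 y0 y1 ∩ G) a b) (ha : a.2 = y0) (hb : b.2 = y1) (h1 : y0 ≤ y0')
    (h2 : y0' ≤ y1') (h3 : y1' ≤ y1) :
    ∃ a' b', a'.2 = y0' ∧ b'.2 = y1' ∧ CI adj (Box x0 x1 y0' y1' ∩ G) a' b' := by
  obtain ⟨a', e1, -, e2⟩ := h.lastPart (fun v => v.2) ok.lip2 (m := y0') (by omega) (by omega)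
  obtain ⟨b', e3, e4⟩ := e2.firstPart (fun v => v.2) ok.lip2 (m := y1') (by omega)
    (by omega)
  refine ⟨a', b', e1, e3, e4.monoS ?_⟩
  rintro v ⟨⟨⟨hv, hG⟩, hv''⟩, hv'⟩
  refine ⟨?_, hG⟩
  simp only [Box, Set.mem_setOf_eq] at *; omega


lemma hh_half {μ : Measure (V → Bool)} (hμ : Rsw μ) {adj : V → V → Prop} (ok : Okay adj)
    {n : ℤ} (h : 1/2 ≤ μ.real (LR adj (-n) n (-n) n)) : 1/4 ≤ μ.real (HH adj n 0 n) := by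
  have := hμ.prob
  have h1 : LR adj (-n) n (-n) n ⊆ HH adj n 0 n ∪ HH adj n (-n) 0 := by
    rintro ξ ⟨a, ha, b, hb, hc⟩
    have hb2 := hc.right.1
    simp only [Box, Set.mem_setOf_eq] at hb2 hb
    rcases le_total 0 b.2 with h | h
    · exact Or.inl ⟨a, ha, b, ⟨hb, h, hb2.2.2.2⟩, hc⟩
    · exact Or.inr ⟨a, ha, b, ⟨hb, hb2.2.2.1, h⟩, hc⟩
  have h2 : μ.real (HH adj n (-n) 0) ≤ μ.real (HH adj n 0 n) :=
    hμ.map ok (box_finite _ _ _ _) Sy.ry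
      (fun v hv => by simp only [Box, Set.mem_setOf_eq] at *; omega)
      (fun v hv h => by simp only [Set.mem_setOf_eq] at *; omega)
      (fun v hv h => by simp only [Set.mem_setOf_eq] at *; omega)
  have h3 := measureReal_mono (μ := μ) h1
  have h4 := measureReal_union_le (μ := μ) (HH adj n 0 n) (HH adj n (-n) 0)
  linarith

lemma exists_alpha {μ : Measure (V → Bool)} (hμ : Rsw μ) {adj : V → V → Prop} (ok : Okay adj)
    {k : ℤ} (hk : 0 ≤ k) (h : 1/2 ≤ μ.real (LR adj (-(2*k)) (2*k) (-(2*k)) (2*k))) :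
    ∃ a : ℕ, (a : ℤ) ≤ k ∧ 1/8 ≤ μ.real (HH adj (2*k) 0 (2*a)) ∧
      (1 ≤ a → 1/8 ≤ μ.real (HH adj (2*k) (2*a-2) (2*k))) := by
  classical
  have := hμ.prob
  have h0 := hh_half hμ ok h
  have ex : ∃ a : ℕ, 1/8 ≤ μ.real (HH adj (2*k) 0 (2*a)) := ⟨k.toNat, by
    rw [Int.toNat_of_nonneg hk]; linarith⟩
  refine ⟨Nat.find ex, ?_, Nat.find_spec ex, fun h1 => ?_⟩
  · have : Nat.find ex ≤ k.toNat := Nat.find_min' ex (by rw [Int.toNat_of_nonneg hk]; linarith)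
    omega
  · have hlt := Nat.find_min ex (m := Nat.find ex - 1) (by omega)
    push Not at hlt
    have e : ((Nat.find ex - 1 : ℕ) : ℤ) = Nat.find ex - 1 := by omega
    rw [e] at hlt
    have hs : HH adj (2*k) 0 (2*k) ⊆ HH adj (2*k) 0 (2 * ((Nat.find ex : ℤ) - 1)) ∪
        HH adj (2*k) (2 * (Nat.find ex : ℤ) - 2) (2*k) := by
      rintro ξ ⟨a, ha, b, hb, hc⟩
      simp only [Set.mem_setOf_eq] at hb
      rcases le_total b.2 (2 * ((Nat.find ex : ℤ) - 1)) with h | h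
      · exact Or.inl ⟨a, ha, b, ⟨hb.1, hb.2.1, h⟩, hc⟩
      · exact Or.inr ⟨a, ha, b, ⟨hb.1, by omega, hb.2.2⟩, hc⟩
    have h3 := measureReal_mono (μ := μ) hs
    have h4 := measureReal_union_le (μ := μ) (HH adj (2*k) 0 (2 * ((Nat.find ex : ℤ) - 1)))
      (HH adj (2*k) (2 * (Nat.find ex : ℤ) - 2) (2*k))
    linarith

lemma jcase1 {μ : Measure (V → Bool)} (hμ : Rsw μ) {adj : V → V → Prop} (ok : Okay adj)
    {k : ℤ} (hk : 0 ≤ k) (h : 1/8 ≤ μ.real (HH adj (16*k) 0 2)) :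
    (1/24)^2 ≤ μ.real (LR adj (-(16*k)) (44*k) (-(18*k)) (18*k)) := by
  have := hμ.prob
  obtain ⟨y, hy⟩ : ∃ y, 1/24 ≤ μ.real (HH adj (16*k) y y) := by
    by_contra hcon
    push Not at hcon
    have hs : HH adj (16*k) 0 2 ⊆ (HH adj (16*k) 0 0 ∪ HH adj (16*k) 1 1) ∪ HH adj (16*k) 2 2 := by
      rintro ξ ⟨a, ha, b, hb, hc⟩
      simp only [Set.mem_setOf_eq] at hb
      have : b.2 = 0 ∨ b.2 = 1 ∨ b.2 = 2 := by omega
      rcases this with h | h | h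
      · exact Or.inl (Or.inl ⟨a, ha, b, ⟨hb.1, by omega, by omega⟩, hc⟩)
      · exact Or.inl (Or.inr ⟨a, ha, b, ⟨hb.1, by omega, by omega⟩, hc⟩)
      · exact Or.inr ⟨a, ha, b, ⟨hb.1, by omega, by omega⟩, hc⟩
    have h3 := measureReal_mono (μ := μ) hs
    have h4 := measureReal_union_le (μ := μ) (HH adj (16*k) 0 0 ∪ HH adj (16*k) 1 1) (HH adj (16*k) 2 2)
    have h5 := measureReal_union_le (μ := μ) (HH adj (16*k) 0 0) (HH adj (16*k) 1 1)
    linarith [hcon 0, hcon 1, hcon 2]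
  have hm : μ.real (HH adj (16*k) y y) ≤ μ.real (Con adj (Box (16*k) (48*k) (-(16*k)) (16*k))
      {v | v.1 = 48*k} {v | v.1 = 16*k ∧ v.2 = y}) :=
    hμ.map ok (box_finite _ _ _ _) (Sy.rxs (16*k) 0)
      (fun v hv => by simp only [Box, Set.mem_setOf_eq] at *; omega)
      (fun v hv h => by simp only [Set.mem_setOf_eq] at *; omega)
      (fun v hv h => by simp only [Set.mem_setOf_eq] at *; omega)
  have h5 := hμ.and HH.inc (Con.inc (box_finite _ _ _ _)) hy (hy.trans hm) (by norm_num) (by norm_num)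
  rw [sq]
  refine h5.trans (measureReal_mono ?_)
  rintro ξ ⟨⟨a, ha, b, hb, hc⟩, ⟨a', ha', b', hb', hc'⟩⟩
  simp only [Set.mem_setOf_eq] at *
  have e : b = b' := Prod.ext (by omega) (by omega)
  subst e
  have hj : CI adj (Box (-(16*k)) (48*k) (-(16*k)) (16*k) ∩ Gt ξ) a a' := by
    refine (hc.monoS ?_).trans (CI.symm ok (hc'.monoS ?_))
    · rintro v ⟨hv, hG⟩
      exact ⟨by simp only [Box, Set.mem_setOf_eq] at *; omega, hG⟩
    · rintro v ⟨hv, hG⟩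
      exact ⟨by simp only [Box, Set.mem_setOf_eq] at *; omega, hG⟩
  obtain ⟨b', e1, e2⟩ := lr_trim ok hj ha ha' (x1' := 44*k) (y0' := -(18*k)) (y1' := 18*k)
    (by omega) (by omega) (by omega) (by omega)
  exact ⟨a, ha, b', e1, e2⟩

lemma jcase2 {μ : Measure (V → Bool)} (hμ : Rsw μ) {adj : V → V → Prop} (ok : Okay adj)
    {k K : ℤ} (hK : 0 ≤ K) (hk : 8 * K ≤ k) {y g : ℤ} (hy0 : 0 ≤ y) (hyk : 2*y ≤ 16*k) (hg : 0 < g)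
    {c : ℝ} (hc : 0 ≤ c) (h1 : c ≤ μ.real (HH adj (16*k) (2*y) (2*y+g-1)))
    (h2 : 1/8 ≤ μ.real (HH adj (16*K) g (16*K)))
    (h3 : 1/2 ≤ μ.real (LR adj (-(16*K)) (16*K) (-(16*K)) (16*K))) :
    c * (c * (1/8 * (1/8 * (1/8 * (1/8 * (1/2)))))) ≤ μ.real (LR adj (-(16*k)) (44*k) (-(18*k)) (18*k)) := by
  have := hμ.prob
  set W := Box (16*k - 2*(16*K)) (16*k) (2*y - 16*K) (2*y + 16*K) with hW
  have hWf : W.Finite := box_finite _ _ _ _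
  have m1 : μ.real (HH adj (16*k) (2*y) (2*y+g-1)) ≤ μ.real (Con adj
      (Box (16*k-32*K) (48*k-32*K) (-(16*k)) (16*k)) {v | v.1 = 48*k-32*K}
      {v | v.1 = 16*k-32*K ∧ 2*y ≤ v.2 ∧ v.2 ≤ 2*y+g-1}) :=
    hμ.map ok (box_finite _ _ _ _) (Sy.rxs (16*k-16*K) 0)
      (fun v hv => by simp only [Box, Set.mem_setOf_eq] at *; omega)
      (fun v hv h => by simp only [Set.mem_setOf_eq] at *; omega)
      (fun v hv h => by simp only [Set.mem_setOf_eq] at *; omega)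
  have u1 : μ.real (HH adj (16*K) g (16*K)) ≤ μ.real (Con adj W {v | v.1 = 16*k-32*K}
      {v | v.1 = 16*k ∧ 2*y+g ≤ v.2}) :=
    hμ.map ok (box_finite _ _ _ _) (Sy.sh (8*k-8*K) y)
      (fun v hv => by simp only [hW, Box, Set.mem_setOf_eq] at *; omega)
      (fun v hv h => by simp only [Set.mem_setOf_eq] at *; omega)
      (fun v hv h => by simp only [Set.mem_setOf_eq] at *; omega)
  have u2 : μ.real (HH adj (16*K) g (16*K)) ≤ μ.real (Con adj W {v | v.1 = 16*k-32*K}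
      {v | v.1 = 16*k ∧ v.2 ≤ 2*y-g}) :=
    hμ.map ok (box_finite _ _ _ _) (Sy.rys (8*k-8*K) y)
      (fun v hv => by simp only [hW, Box, Set.mem_setOf_eq] at *; omega)
      (fun v hv h => by simp only [Set.mem_setOf_eq] at *; omega)
      (fun v hv h => by simp only [Set.mem_setOf_eq] at *; omega)
  have u3 : μ.real (HH adj (16*K) g (16*K)) ≤ μ.real (Con adj W {v | v.1 = 16*k}
      {v | v.1 = 16*k-32*K ∧ 2*y+g ≤ v.2}) :=
    hμ.map ok (box_finite _ _ _ _) (Sy.rxs (8*k-8*K) y)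
      (fun v hv => by simp only [hW, Box, Set.mem_setOf_eq] at *; omega)
      (fun v hv h => by simp only [Set.mem_setOf_eq] at *; omega)
      (fun v hv h => by simp only [Set.mem_setOf_eq] at *; omega)
  have u4 : μ.real (HH adj (16*K) g (16*K)) ≤ μ.real (Con adj W {v | v.1 = 16*k}
      {v | v.1 = 16*k-32*K ∧ v.2 ≤ 2*y-g}) :=
    hμ.map ok (box_finite _ _ _ _) (Sy.rxys (8*k-8*K) y)
      (fun v hv => by simp only [hW, Box, Set.mem_setOf_eq] at *; omega)
      (fun v hv h => by simp only [Set.mem_setOf_eq] at *; omega)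
      (fun v hv h => by simp only [Set.mem_setOf_eq] at *; omega)
  have t1 : μ.real (LR adj (-(16*K)) (16*K) (-(16*K)) (16*K)) ≤ μ.real (Con adj W {v | v.2 = 2*y-16*K}
      {v | v.2 = 2*y+16*K}) :=
    hμ.map ok (box_finite _ _ _ _) (Sy.sws (8*k-8*K) y)
      (fun v hv => by simp only [hW, Box, Set.mem_setOf_eq] at *; omega)
      (fun v hv h => by simp only [Set.mem_setOf_eq] at *; omega)
      (fun v hv h => by simp only [Set.mem_setOf_eq] at *; omega)
  have i1 := hμ.and (Con.inc hWf) (Con.inc hWf) (h2.trans u4) (h3.trans t1) (by norm_num) (by norm_num)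
  have i2 := hμ.and (Con.inc hWf) ((Con.inc hWf).inter (Con.inc hWf)) (h2.trans u3) i1 (by norm_num) (by norm_num)
  have i3 := hμ.and (Con.inc hWf) ((Con.inc hWf).inter ((Con.inc hWf).inter (Con.inc hWf))) (h2.trans u2) i2 (by norm_num) (by norm_num)
  have i4 := hμ.and (Con.inc hWf) ((Con.inc hWf).inter ((Con.inc hWf).inter ((Con.inc hWf).inter (Con.inc hWf)))) (h2.trans u1) i3 (by norm_num) (by norm_num)
  have i5 := hμ.and (Con.inc (box_finite _ _ _ _)) ((Con.inc hWf).inter ((Con.inc hWf).inter ((Con.inc hWf).inter ((Con.inc hWf).inter (Con.inc hWf))))) (h1.trans m1) i4 hc (by norm_num)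
  have i6 := hμ.and HH.inc ((Con.inc (box_finite _ _ _ _)).inter ((Con.inc hWf).inter ((Con.inc hWf).inter ((Con.inc hWf).inter ((Con.inc hWf).inter (Con.inc hWf)))))) h1 i5 hc (by positivity)
  refine i6.trans (measureReal_mono ?_)
  rintro ξ ⟨⟨z, hz, b, hb, hP⟩, ⟨z', hz', b', hb', hP'⟩, ⟨a1, ha1, b1, hb1, hU1⟩, ⟨a2, ha2, b2, hb2, hU2⟩,
    ⟨a3, ha3, b3, hb3, hU3⟩, ⟨a4, ha4, b4, hb4, hU4⟩, ⟨c, hc, d, hd, hT⟩⟩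
  simp only [Set.mem_setOf_eq] at hz hb hz' hb' ha1 hb1 ha2 hb2 ha3 hb3 ha4 hb4 hc hd
  set U := Box (-(16*k)) (48*k-32*K) (-(18*k)) (18*k) ∩ Gt ξ with hU
  have hWU : W ∩ Gt ξ ⊆ U := by
    rintro v ⟨hv, hG⟩
    exact ⟨by simp only [hW, Box, Set.mem_setOf_eq] at *; omega, hG⟩
  have c1 : CI adj U z c := by
    refine jhalf (n := 16*k) (N := 16*K) (y := 2*y) (g := g) (B := 16*k) (s := b.2) (G := Gt ξ) ok
      (S := Box (-(16*k)) (16*k) (-(16*k)) (16*k) ∩ Gt ξ) ?_ ?_ ?_ ?_ ?_ hWU hU1 ?_ hb1.1 hb1.2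
      hU2 ?_ hb2.1 hb2.2 hT hc hd ?_ ?_
    · have : ((16*k, b.2) : V) = b := by rw [← hb.1]
      rw [this]; exact hP
    · intro v hv; have := hv.1; simp only [Box, Set.mem_setOf_eq] at this; omega
    · intro v hv; have := hv.1; simp only [Box, Set.mem_setOf_eq] at this; omega
    · omega
    · rintro v ⟨hv, hG⟩
      exact ⟨by simp only [Box, Set.mem_setOf_eq] at *; omega, hG⟩
    · omega
    · omega
    · omega
    · omega
  have c2 : CI adj U z' c := by
    let ρ : V → V := fun v => (-v.1, v.2)
    have hρ : ∀ u v, adj u v → adj (ρ u) (ρ v) := Sy.rx.adj ok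
    have hρρ : ∀ v, ρ (ρ v) = v := fun v => by ext <;> simp [ρ]
    have tr : ∀ {a b : V}, CI adj (W ∩ Gt ξ) a b → CI adj (Box (32*K-16*k - 2*(16*K)) (32*K-16*k)
        (2*y - 16*K) (2*y + 16*K) ∩ {v | ρ v ∈ Gt ξ}) (ρ a) (ρ b) := by
      intro a b h
      refine h.map ρ hρ ?_
      rintro v ⟨hv, hG⟩
      refine ⟨?_, by simpa [hρρ] using hG⟩
      simp only [hW, Box, Set.mem_setOf_eq, ρ] at *; omega
    have key : CI adj {v | ρ v ∈ U} (ρ z') (ρ c) := by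
      refine jhalf (n := 32*K-16*k) (N := 16*K) (y := 2*y) (g := g) (B := 16*k) (s := b'.2)
        (G := {v | ρ v ∈ Gt ξ}) ok
        (S := {v | ρ v ∈ Box (16*k-32*K) (48*k-32*K) (-(16*k)) (16*k) ∩ Gt ξ})
        ?_ ?_ ?_ ?_ ?_ ?_ (tr (hU3)) ?_ ?_ hb3.2 (tr hU4) ?_ ?_ hb4.2 (tr hT) hc hd ?_ ?_
      · have : ((32*K-16*k, b'.2) : V) = ρ b' := by ext <;> simp [ρ]; omega
        rw [this]
        exact hP'.map ρ hρ (fun v hv => by simpa [hρρ] using hv)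
      · intro v hv; have := hv.1; simp only [Box, Set.mem_setOf_eq, ρ] at this; omega
      · intro v hv; have := hv.1; simp only [Box, Set.mem_setOf_eq, ρ] at this; omega
      · simp only [ρ]; omega
      · rintro v ⟨hv, hG⟩
        exact ⟨by simp only [Box, Set.mem_setOf_eq] at *; omega, hG⟩
      · rintro v ⟨hv, hG⟩
        exact ⟨by simp only [Box, Set.mem_setOf_eq, ρ] at *; omega, hG⟩
      all_goals (try simp only [ρ])
      all_goals omega
    have := key.map ρ hρ (T := U) (fun v hv => hv)
    simpa [hρρ] using this
  have hj := c1.trans (c2.symm ok)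
  obtain ⟨b', e1, e2⟩ := lr_trim ok hj hz hz' (x1' := 44*k) (y0' := -(18*k)) (y1' := 18*k)
    (by omega) (by omega) (by omega) (by omega)
  exact ⟨z, hz, b', e1, e2⟩

end DaC

namespace DaC


lemma jlong {μ : Measure (V → Bool)} (hμ : Rsw μ) {adj : V → V → Prop} (ok : Okay adj)
    {k : ℤ} (hk : 0 ≤ k) {c : ℝ} (hc : 0 ≤ c)
    (h : c ≤ μ.real (LR adj (-(16*k)) (44*k) (-(18*k)) (18*k))) :
    c * (c * (c * (c * c))) ≤ μ.real (LR adj (-(54*k)) (54*k) (-(18*k)) (18*k)) := by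
  have := hμ.prob
  have m1 : c ≤ μ.real (LR adj (-(54*k)) (6*k) (-(18*k)) (18*k)) :=
    h.trans (hμ.map ok (box_finite _ _ _ _) (Sy.sh (-(19*k)) 0)
      (fun v hv => by simp only [Box, Set.mem_setOf_eq] at *; omega)
      (fun v _ hv => by simp only [Set.mem_setOf_eq] at *; omega)
      (fun v _ hv => by simp only [Set.mem_setOf_eq] at *; omega))
  have m2 : c ≤ μ.real (LR adj (-(30*k)) (30*k) (-(18*k)) (18*k)) :=
    h.trans (hμ.map ok (box_finite _ _ _ _) (Sy.sh (-(7*k)) 0)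
      (fun v hv => by simp only [Box, Set.mem_setOf_eq] at *; omega)
      (fun v _ hv => by simp only [Set.mem_setOf_eq] at *; omega)
      (fun v _ hv => by simp only [Set.mem_setOf_eq] at *; omega))
  have m3 : c ≤ μ.real (LR adj (-(6*k)) (54*k) (-(18*k)) (18*k)) :=
    h.trans (hμ.map ok (box_finite _ _ _ _) (Sy.sh (5*k) 0)
      (fun v hv => by simp only [Box, Set.mem_setOf_eq] at *; omega)
      (fun v _ hv => by simp only [Set.mem_setOf_eq] at *; omega)
      (fun v _ hv => by simp only [Set.mem_setOf_eq] at *; omega))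
  have m4 : c ≤ μ.real (TB adj (-(30*k)) (6*k) (-(30*k)) (30*k)) :=
    h.trans (hμ.map ok (box_finite _ _ _ _) (Sy.sws (-(6*k)) (-(7*k)))
      (fun v hv => by simp only [Box, Set.mem_setOf_eq] at *; omega)
      (fun v _ hv => by simp only [Set.mem_setOf_eq] at *; omega)
      (fun v _ hv => by simp only [Set.mem_setOf_eq] at *; omega))
  have m5 : c ≤ μ.real (TB adj (-(6*k)) (30*k) (-(30*k)) (30*k)) :=
    h.trans (hμ.map ok (box_finite _ _ _ _) (Sy.sws (6*k) (-(7*k)))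
      (fun v hv => by simp only [Box, Set.mem_setOf_eq] at *; omega)
      (fun v _ hv => by simp only [Set.mem_setOf_eq] at *; omega)
      (fun v _ hv => by simp only [Set.mem_setOf_eq] at *; omega))
  have key := hμ.and LR.inc (LR.inc.inter (LR.inc.inter (TB.inc.inter TB.inc))) m1
    (hμ.and LR.inc (LR.inc.inter (TB.inc.inter TB.inc)) m2
    (hμ.and LR.inc (TB.inc.inter TB.inc) m3
    (hμ.and TB.inc TB.inc m4 m5 (by positivity) (by positivity)) (by positivity) (by positivity))
    (by positivity) (by positivity)) (by positivity) (by positivity)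
  refine key.trans (measureReal_mono ?_)
  rintro ξ ⟨⟨a1, ha1, b1, hb1, h1⟩, ⟨a2, ha2, b2, hb2, h2⟩, ⟨a3, ha3, b3, hb3, h3⟩,
    ⟨c1, hc1, d1, hd1, v1⟩, ⟨c2, hc2, d2, hd2, v2⟩⟩
  obtain ⟨c1, d1, hc1, hd1, v1⟩ := tb_trim ok v1 hc1 hd1 (y0' := -(18*k)) (y1' := 18*k) (by omega)
    (by omega) (by omega)
  obtain ⟨c2, d2, hc2, hd2, v2⟩ := tb_trim ok v2 hc2 hd2 (y0' := -(18*k)) (y1' := 18*k) (by omega)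
    (by omega) (by omega)
  simp only [Set.mem_setOf_eq] at ha1 hb1 ha2 hb2 ha3 hb3
  have sub : ∀ {x0 x1 y0 y1 : ℤ}, -(54*k) ≤ x0 → x1 ≤ 54*k → -(18*k) ≤ y0 → y1 ≤ 18*k →
      Box x0 x1 y0 y1 ∩ Gt ξ ⊆ Box (-(54*k)) (54*k) (-(18*k)) (18*k) ∩ Gt ξ := by
    rintro x0 x1 y0 y1 e1 e2 e3 e4 v ⟨hv, hv'⟩
    refine ⟨?_, hv'⟩
    simp only [Box, Set.mem_setOf_eq] at *; omega
  have s1 := @sub (-(54*k)) (6*k) (-(18*k)) (18*k) (by omega) (by omega) (by omega) (by omega)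
  have s2 := @sub (-(30*k)) (30*k) (-(18*k)) (18*k) (by omega) (by omega) (by omega) (by omega)
  have s3 := @sub (-(6*k)) (54*k) (-(18*k)) (18*k) (by omega) (by omega) (by omega) (by omega)
  have t1 := @sub (-(30*k)) (6*k) (-(18*k)) (18*k) (by omega) (by omega) (by omega) (by omega)
  have t2 := @sub (-(6*k)) (30*k) (-(18*k)) (18*k) (by omega) (by omega) (by omega) (by omega)
  have g1 := glue ok h1 v1 s1 t1
    (fun v hv => by have := hv.1; simp only [Box, Set.mem_setOf_eq] at this; omega)
    (fun v hv => by have := hv.1; simp only [Box, Set.mem_setOf_eq] at this; omega)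
  have g2 := glue ok h2 v1 s2 t1
    (fun v hv => by have := hv.1; simp only [Box, Set.mem_setOf_eq] at this; omega)
    (fun v hv => by have := hv.1; simp only [Box, Set.mem_setOf_eq] at this; omega)
  have g3 := glue ok h2 v2 s2 t2
    (fun v hv => by have := hv.1; simp only [Box, Set.mem_setOf_eq] at this; omega)
    (fun v hv => by have := hv.1; simp only [Box, Set.mem_setOf_eq] at this; omega)
  have g4 := glue ok h3 v2 s3 t2
    (fun v hv => by have := hv.1; simp only [Box, Set.mem_setOf_eq] at this; omega)
    (fun v hv => by have := hv.1; simp only [Box, Set.mem_setOf_eq] at this; omega)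
  exact ⟨a1, ha1, b3, hb3, ((((g1.trans (g2.symm ok)).trans g3).trans (g4.symm ok))).trans
    (h3.monoS s3)⟩

/-- circuit event in the annulus `m..3m` -/
def Blk (adj : V → V → Prop) (m : ℤ) : Set (V → Bool) :=
  LR adj (-(3*m)) (3*m) m (3*m) ∩ (LR adj (-(3*m)) (3*m) (-(3*m)) (-m) ∩
    (TB adj m (3*m) (-(3*m)) (3*m) ∩ TB adj (-(3*m)) (-m) (-(3*m)) (3*m)))

lemma Blk.inc {adj m} : Inc (Blk adj m) := LR.inc.inter (LR.inc.inter (TB.inc.inter TB.inc))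

lemma blk_prob {μ : Measure (V → Bool)} (hμ : Rsw μ) {adj : V → V → Prop} (ok : Okay adj)
    {k : ℤ} (hk : 0 ≤ k) {c : ℝ} (hc : 0 ≤ c)
    (h : c ≤ μ.real (LR adj (-(16*k)) (44*k) (-(18*k)) (18*k))) :
    c ^ 20 ≤ μ.real (Blk adj (18*k)) := by
  have h' := jlong hμ ok hk hc h
  set C := c * (c * (c * (c * c))) with hC
  have hC0 : 0 ≤ C := by positivity
  have m1 : C ≤ μ.real (LR adj (-(3*(18*k))) (3*(18*k)) (18*k) (3*(18*k))) :=
    h'.trans (hμ.map ok (box_finite _ _ _ _) (Sy.sh 0 (18*k))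
      (fun v hv => by simp only [Box, Set.mem_setOf_eq] at *; omega)
      (fun v _ hv => by simp only [Set.mem_setOf_eq] at *; omega)
      (fun v _ hv => by simp only [Set.mem_setOf_eq] at *; omega))
  have m2 : C ≤ μ.real (LR adj (-(3*(18*k))) (3*(18*k)) (-(3*(18*k))) (-(18*k))) :=
    h'.trans (hμ.map ok (box_finite _ _ _ _) (Sy.sh 0 (-(18*k)))
      (fun v hv => by simp only [Box, Set.mem_setOf_eq] at *; omega)
      (fun v _ hv => by simp only [Set.mem_setOf_eq] at *; omega)
      (fun v _ hv => by simp only [Set.mem_setOf_eq] at *; omega))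
  have m3 : C ≤ μ.real (TB adj (18*k) (3*(18*k)) (-(3*(18*k))) (3*(18*k))) :=
    h'.trans (hμ.map ok (box_finite _ _ _ _) (Sy.sws (18*k) 0)
      (fun v hv => by simp only [Box, Set.mem_setOf_eq] at *; omega)
      (fun v _ hv => by simp only [Set.mem_setOf_eq] at *; omega)
      (fun v _ hv => by simp only [Set.mem_setOf_eq] at *; omega))
  have m4 : C ≤ μ.real (TB adj (-(3*(18*k))) (-(18*k)) (-(3*(18*k))) (3*(18*k))) :=
    h'.trans (hμ.map ok (box_finite _ _ _ _) (Sy.sws (-(18*k)) 0)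
      (fun v hv => by simp only [Box, Set.mem_setOf_eq] at *; omega)
      (fun v _ hv => by simp only [Set.mem_setOf_eq] at *; omega)
      (fun v _ hv => by simp only [Set.mem_setOf_eq] at *; omega))
  have key := hμ.and LR.inc (LR.inc.inter (TB.inc.inter TB.inc)) m1
    (hμ.and LR.inc (TB.inc.inter TB.inc) m2
    (hμ.and TB.inc TB.inc m3 m4 (by positivity) (by positivity)) (by positivity) (by positivity))
    (by positivity) (by positivity)
  refine le_trans (le_of_eq ?_) key
  rw [hC]; ring

/-- dual adjacency relations -/
def Dual (adj adj' : V → V → Prop) : Prop :=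
  (adj = SqAdj ∧ adj' = StarAdj) ∨ (adj = StarAdj ∧ adj' = SqAdj)

lemma Dual.ok1 {adj adj'} (h : Dual adj adj') : Okay adj := by
  rcases h with ⟨h, _⟩ | ⟨h, _⟩
  · exact Or.inl h
  · exact Or.inr h
lemma Dual.symm {adj adj'} (h : Dual adj adj') : Dual adj' adj := by
  rcases h with ⟨h, h'⟩ | ⟨h, h'⟩
  · exact Or.inr ⟨h', h⟩
  · exact Or.inl ⟨h', h⟩
lemma Dual.ok2 {adj adj'} (h : Dual adj adj') : Okay adj' := h.symm.ok1

lemma Dual.cross {adj adj'} (h : Dual adj adj') {S T : Set V} {a b c d : V} (hS : CI adj S a b)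
    (hT : CI adj' T c d) (h1 : ∀ v ∈ T, a.1 ≤ v.1 ∧ v.1 ≤ b.1)
    (h2 : ∀ v ∈ S, c.2 ≤ v.2 ∧ v.2 ≤ d.2) : (S ∩ T).Nonempty := by
  rcases h with ⟨rfl, rfl⟩ | ⟨rfl, rfl⟩
  · exact DaC.cross hS hT h1 h2
  · have hS' : CI StarAdj (Prod.swap '' S) a.swap b.swap :=
      hS.map _ (Sy.sw.adj (Or.inr rfl)) (fun v hv => ⟨v, hv, rfl⟩)
    have hT' : CI SqAdj (Prod.swap '' T) c.swap d.swap :=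
      hT.map _ (Sy.sw.adj (Or.inl rfl)) (fun v hv => ⟨v, hv, rfl⟩)
    obtain ⟨v, ⟨w, hw, hw'⟩, ⟨u, hu, hu'⟩⟩ := DaC.cross hT' hS'
      (by rintro v ⟨w, hw, rfl⟩; exact h2 w hw)
      (by rintro v ⟨w, hw, rfl⟩; exact h1 w hw)
    have : w = u := Prod.swap_injective (hw'.trans hu'.symm)
    subst this
    exact ⟨w, hu, hw⟩

/-- sup norm -/
def nm (v : V) : ℤ := max |v.1| |v.2|

lemma nm_le {v : V} {n : ℤ} : nm v ≤ n ↔ -n ≤ v.1 ∧ v.1 ≤ n ∧ -n ≤ v.2 ∧ v.2 ≤ n := by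
  unfold nm; rw [max_le_iff, abs_le, abs_le]; tauto

lemma nm_cases (v : V) : v.1 = nm v ∨ v.1 = -nm v ∨ v.2 = nm v ∨ v.2 = -nm v := by
  unfold nm
  rcases max_choice |v.1| |v.2| with h | h <;> rw [h]
  · rcases abs_choice v.1 with h | h <;> rw [h] <;> omega
  · rcases abs_choice v.2 with h | h <;> rw [h] <;> omega

lemma Okay.lipn {adj : V → V → Prop} (ok : Okay adj) (u v : V) (h : adj u v) :
    nm v ≤ nm u + 1 := by
  have := ok.star h; rw [starAdj_iff] at this
  have h2 := (nm_le (v := u)).1 le_rfl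
  rw [nm_le]; omega

lemma blk_blocks {adj adj'} (h : Dual adj adj') {ξ : V → Bool} {m : ℤ} 
    (hb : ξ ∈ Blk adj m) {a b : V} (hc : CI adj' (Gt ξ)ᶜ a b) (ha : nm a ≤ m) (hb' : 3 * m ≤ nm b) :
    False := by
  obtain ⟨b, e1, e2⟩ := hc.firstPart nm h.ok2.lipn (m := 3*m)
    (by have := (nm_le (v := a)).1 le_rfl; omega) hb'
  have ha' := nm_le.1 ha
  obtain ⟨⟨a1, ha1, b1, hb1, h1⟩, ⟨a2, ha2, b2, hb2, h2⟩, ⟨a3, ha3, b3, hb3, h3⟩,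
    ⟨a4, ha4, b4, hb4, h4⟩⟩ := hb
  simp only [Set.mem_setOf_eq] at ha1 hb1 ha2 hb2 ha3 hb3 ha4 hb4
  have neg1 : ∀ u v, adj' u v → -v.1 ≤ -u.1 + 1 := fun u v h' => by
    have := h.ok2.lip1 v u (h.ok2.symm h'); omega
  have neg2 : ∀ u v, adj' u v → -v.2 ≤ -u.2 + 1 := fun u v h' => by
    have := h.ok2.lip2 v u (h.ok2.symm h'); omega
  rcases nm_cases b with q | q | q | q <;> rw [e1] at q
  · obtain ⟨a', f1, -, f2⟩ := e2.lastPart (fun v => v.1) h.ok2.lip1 (m := m) (by omega) (by omega)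
    obtain ⟨v, hv, hv'⟩ := h.symm.cross f2 h3
      (fun v hv => by have := hv.1; simp only [Box, Set.mem_setOf_eq] at this f1; omega)
      (fun v hv => by have := nm_le.1 hv.1.2; omega)
    exact hv.1.1 hv'.2
  · obtain ⟨a', f1, -, f2⟩ := e2.lastPart (fun v => -v.1) neg1 (m := m) (by omega) (by omega)
    obtain ⟨v, hv, hv'⟩ := h.symm.cross (f2.symm h.ok2) h4
      (fun v hv => by have := hv.1; simp only [Box, Set.mem_setOf_eq] at this f1; omega)
      (fun v hv => by have := nm_le.1 hv.1.2; omega)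
    exact hv.1.1 hv'.2
  · obtain ⟨a', f1, -, f2⟩ := e2.lastPart (fun v => v.2) h.ok2.lip2 (m := m) (by omega) (by omega)
    obtain ⟨v, hv, hv'⟩ := h.cross h1 f2
      (fun v hv => by have := nm_le.1 hv.1.2; omega)
      (fun v hv => by have := hv.1; simp only [Box, Set.mem_setOf_eq] at this f1; omega)
    exact hv'.1.1 hv.2
  · obtain ⟨a', f1, -, f2⟩ := e2.lastPart (fun v => -v.2) neg2 (m := m) (by omega) (by omega)
    obtain ⟨v, hv, hv'⟩ := h.cross h2 (f2.symm h.ok2)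
      (fun v hv => by have := nm_le.1 hv.1.2; omega)
      (fun v hv => by have := hv.1; simp only [Box, Set.mem_setOf_eq] at this f1; omega)
    exact hv'.1.1 hv.2

/-- the universal constant for `J` -/
noncomputable def cJ : ℝ := (1/(8*(2*8^10)))^2 * (1/8)^4 * (1/2)
lemma cJ_pos : 0 < cJ := by unfold cJ; positivity

lemma pigeon {μ : Measure (V → Bool)} (hμ : Rsw μ) {adj : V → V → Prop} {n b g : ℤ} (hg : 0 < g)
    {L : ℕ} (hL : 0 < L) (hb : b < L * g) (h : 1/8 ≤ μ.real (HH adj n 0 b)) :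
    ∃ i : ℕ, i * g ≤ n ∧ 1/(8*L) ≤ μ.real (HH adj n (i*g) (i*g+g-1)) := by
  have := hμ.prob
  have hL' : (0:ℝ) < L := by exact_mod_cast hL
  have hs : HH adj n 0 b ⊆ ⋃ i ∈ Finset.range L, HH adj n (i*g) (i*g+g-1) := by
    rintro ξ ⟨a, ha, c, hc, hp⟩
    simp only [Set.mem_setOf_eq] at hc
    have hd := Int.mul_ediv_add_emod c.2 g
    have h1 := Int.emod_nonneg c.2 hg.ne'
    have h2 := Int.emod_lt_of_pos c.2 hg
    have h3 : 0 ≤ c.2 / g := Int.ediv_nonneg hc.2.1 hg.le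
    obtain ⟨i, hi⟩ := Int.eq_ofNat_of_zero_le h3
    rw [hi] at hd
    have e : (i:ℤ) * g = g * i := mul_comm _ _
    simp only [Set.mem_iUnion, Finset.mem_range]
    refine ⟨i, ?_, a, ha, c, ⟨hc.1, ?_, ?_⟩, hp⟩
    · by_contra hcon
      push Not at hcon
      have : (L:ℤ) * g ≤ i * g := mul_le_mul_of_nonneg_right (by exact_mod_cast hcon) hg.le
      omega
    · omega
    · omega
  have h2 : μ.real (HH adj n 0 b) ≤ ∑ i ∈ Finset.range L, μ.real (HH adj n (i*g) (i*g+g-1)) :=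
    (measureReal_mono hs (measure_ne_top _ _)).trans (measureReal_biUnion_finset_le _ _)
  obtain ⟨i, hi, hi'⟩ : ∃ i ∈ Finset.range L, 1/(8*(L:ℝ)) ≤ μ.real (HH adj n (i*g) (i*g+g-1)) := by
    by_contra hcon
    push Not at hcon
    have := Finset.sum_lt_sum_of_nonempty (Finset.nonempty_range_iff.2 hL.ne') hcon
    simp only [Finset.sum_const, Finset.card_range, nsmul_eq_mul] at this
    have e : (L:ℝ) * (1/(8*L)) = 1/8 := by field_simp
    linarith
  refine ⟨i, ?_, hi'⟩
  by_contra hcon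
  push Not at hcon
  have : HH adj n (i*g) (i*g+g-1) = ∅ := by
    ext ξ
    simp only [Set.mem_empty_iff_false, iff_false]
    rintro ⟨a, ha, c, hc, hp⟩
    have := hp.right.1
    simp only [Box, Set.mem_setOf_eq] at this hc
    omega
  rw [this] at hi'
  simp only [measureReal_empty] at hi'
  have : 0 < 1/(8*(L:ℝ)) := by positivity
  linarith

/-- bad scales -/
def BadJ (μ : Measure (V → Bool)) (adj : V → V → Prop) (j : ℕ) : Prop :=
  1/2 ≤ μ.real (LR adj (-(16*8^j)) (16*8^j) (-(16*8^j)) (16*8^j)) ∧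
    μ.real (Blk adj (18*8^j)) < cJ^20

open Classical in
lemma count_abs {Bad : ℕ → Prop} {a : ℕ → ℕ} (h0 : ∀ j, Bad j → 1 ≤ a j ∧ a j ≤ 8 * 8^j)
    (h1 : ∀ i j, i < j → Bad i → Bad j → 8^10 * a i ≤ a j) (k : ℕ) :
    10 * ((Finset.range k).filter Bad).card ≤ 10 + k := by
  have key : ∀ j, Bad j → 8^(10 * ((Finset.range j).filter Bad).card) ≤ a j := by
    intro j
    induction j using Nat.strong_induction_on with
    | _ j ih =>
    intro hj
    rcases ((Finset.range j).filter Bad).eq_empty_or_nonempty with he | hne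
    · rw [he]; simpa using (h0 j hj).1
    · obtain ⟨i, hi, hmax⟩ := Finset.exists_max_image _ id hne
      simp only [Finset.mem_filter, Finset.mem_range, id] at hi hmax
      have hsub : (Finset.range j).filter Bad ⊆ insert i ((Finset.range i).filter Bad) := by
        intro l hl
        simp only [Finset.mem_filter, Finset.mem_range, Finset.mem_insert] at *
        have := hmax l hl
        rcases this.eq_or_lt with h | h
        · exact Or.inl h
        · exact Or.inr ⟨h, hl.2⟩
      have hcard := (Finset.card_le_card hsub).trans (Finset.card_insert_le _ _)
      calc 8^(10 * ((Finset.range j).filter Bad).card)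
          ≤ 8^(10 + 10 * ((Finset.range i).filter Bad).card) :=
            Nat.pow_le_pow_right (by norm_num) (by omega)
        _ = 8^10 * 8^(10 * ((Finset.range i).filter Bad).card) := pow_add _ _ _
        _ ≤ 8^10 * a i := Nat.mul_le_mul_left _ (ih i hi.1 hi.2)
        _ ≤ a j := h1 i j hi.1 hi.2 hj
  rcases ((Finset.range k).filter Bad).eq_empty_or_nonempty with he | hne
  · rw [he]; simp
  · obtain ⟨i, hi, hmax⟩ := Finset.exists_max_image _ id hne
    simp only [Finset.mem_filter, Finset.mem_range, id] at hi hmax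
    have hsub : (Finset.range k).filter Bad ⊆ insert i ((Finset.range i).filter Bad) := by
      intro l hl
      simp only [Finset.mem_filter, Finset.mem_range, Finset.mem_insert] at *
      have := hmax l hl
      rcases this.eq_or_lt with h | h
      · exact Or.inl h
      · exact Or.inr ⟨h, hl.2⟩
    have hcard := (Finset.card_le_card hsub).trans (Finset.card_insert_le _ _)
    have h3 := (key i hi.2).trans (h0 i hi.2).2
    have h4 : 8 * 8^i = 8^(i+1) := by ring
    rw [h4] at h3
    have := (Nat.pow_le_pow_iff_right (by norm_num : 1 < 8)).1 h3
    omega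

open Classical in
theorem rsw_count {μ : Measure (V → Bool)} (hμ : Rsw μ) {adj : V → V → Prop} (ok : Okay adj)
    (k : ℕ) : 10 * ((Finset.range k).filter (BadJ μ adj)).card ≤ 10 + k := by
  have ex : ∀ j : ℕ, ∃ a : ℕ, BadJ μ adj j → (a : ℤ) ≤ 8 * 8^j ∧
      1/8 ≤ μ.real (HH adj (16*8^j) 0 (2*a)) ∧
      (1 ≤ a → 1/8 ≤ μ.real (HH adj (16*8^j) (2*a-2) (16*8^j))) := by
    intro j
    by_cases hb : BadJ μ adj j
    · have e : (2:ℤ) * (8 * 8^j) = 16 * 8^j := by ring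
      obtain ⟨a, h1, h2, h3⟩ := exists_alpha hμ ok (k := 8 * 8^j) (by positivity) (by rw [e]; exact hb.1)
      rw [e] at h2 h3
      exact ⟨a, fun _ => ⟨h1, h2, h3⟩⟩
    · exact ⟨0, fun h => absurd h hb⟩
  choose a ha using ex
  have noJ : ∀ j, BadJ μ adj j →
      μ.real (LR adj (-(16*8^j)) (44*8^j) (-(18*8^j)) (18*8^j)) < cJ := by
    intro j hj
    by_contra hcon
    push Not at hcon
    have := blk_prob hμ ok (k := 8^j) (by positivity) cJ_pos.le hcon
    linarith [hj.2]
  have h2 : ∀ j, BadJ μ adj j → 2 ≤ a j := by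
    intro j hj
    by_contra hcon
    push Not at hcon
    have h1 := (ha j hj).2.1
    have hs : HH adj (16*8^j) 0 (2*a j) ⊆ HH adj (16*8^j) 0 2 := by
      rintro ξ ⟨a, h1, c, hc, hp⟩
      refine ⟨a, h1, c, ?_, hp⟩
      simp only [Set.mem_setOf_eq] at *; omega
    have := hμ.prob
    have h3 := jcase1 hμ ok (k := 8^j) (by positivity) (h1.trans (measureReal_mono hs))
    have h4 : cJ ≤ (1/24)^2 := by unfold cJ; norm_num
    linarith [noJ j hj]
  refine count_abs (a := a) (fun j hj => ⟨by have := h2 j hj; omega, by exact_mod_cast (ha j hj).1⟩) ?_ k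
  intro i j hij hi hj
  by_contra hcon
  push Not at hcon
  have h2i := h2 i hi
  have h2j := h2 j hj
  obtain ⟨l, hl1, hl2⟩ := pigeon hμ (g := 2 * a i - 2) (L := 2 * 8^10) (b := 2 * a j) (n := 16 * 8^j)
    (by omega) (by norm_num) (by push_cast; omega) (ha j hj).2.1
  have e : (l:ℤ) * (2 * a i - 2) = 2 * (l * (a i - 1)) := by ring
  rw [e] at hl1 hl2
  have hp : (8:ℤ) * 8^i ≤ 8^j := by
    calc (8:ℤ) * 8^i = 8^(i+1) := by ring
      _ ≤ 8^j := pow_le_pow_right₀ (by norm_num) hij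
  have := jcase2 hμ ok (k := 8^j) (K := 8^i) (by positivity) hp (y := l * (a i - 1)) (g := 2 * a i - 2)
    (mul_nonneg (by omega) (by omega)) hl1 (by omega) (by positivity) hl2
    ((ha i hi).2.2 (by omega)) hi.1
  have h5 := noJ j hj
  have h6 : (1/(8*((2 * 8^10 : ℕ):ℝ))) * ((1/(8*((2 * 8^10 : ℕ):ℝ))) * (1/8 * (1/8 * (1/8 * (1/8 * (1/2)))))) = cJ := by
    unfold cJ; push_cast; ring
  rw [h6] at this
  linarith
end DaC

namespace DaC

/-! ### The DaC model on a product space -/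

/-- edges: `(v,false)` is `v — v+(1,0)`, `(v,true)` is `v — v+(0,1)` -/
abbrev Ed := V × Bool
/-- index set: edges and colour bits -/
abbrev I := Ed ⊕ V

/-- second endpoint -/
def nx (e : Ed) : V := if e.2 then (e.1.1, e.1.2 + 1) else (e.1.1 + 1, e.1.2)

/-- `e` joins `u` and `v` -/
def Joins (e : Ed) (u v : V) : Prop := (e.1 = u ∧ nx e = v) ∨ (e.1 = v ∧ nx e = u)

lemma Joins.symm {e : Ed} {u v : V} (h : Joins e u v) : Joins e v u := h.elim Or.inr Or.inl
lemma joins_self (e : Ed) : Joins e e.1 (nx e) := Or.inl ⟨rfl, rfl⟩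

/-- edge adjacency in an edge set -/
def EA (η : Set Ed) (u v : V) : Prop := ∃ e ∈ η, Joins e u v
/-- cluster relation -/
def cl (η : Set Ed) (u v : V) : Prop := Relation.ReflTransGen (EA η) u v

lemma EA.symm {η : Set Ed} {u v : V} (h : EA η u v) : EA η v u :=
  h.imp fun _ h => ⟨h.1, h.2.symm⟩
lemma EA.mono {η η' : Set Ed} (hs : η ⊆ η') {u v : V} (h : EA η u v) : EA η' u v :=
  h.imp fun _ h => ⟨hs h.1, h.2⟩
lemma cl.refl {η : Set Ed} {u : V} : cl η u u := Relation.ReflTransGen.refl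
lemma cl.symm {η : Set Ed} {u v : V} (h : cl η u v) : cl η v u := by
  induction h with
  | refl => exact cl.refl
  | tail _ h ih => exact Relation.ReflTransGen.head h.symm ih
lemma cl.trans {η : Set Ed} {u v w : V} (h : cl η u v) (h' : cl η v w) : cl η u w :=
  Relation.ReflTransGen.trans h h'
lemma cl.tail {η : Set Ed} {u v w : V} (h : cl η u v) (h' : EA η v w) : cl η u w :=
  Relation.ReflTransGen.tail h h'
lemma EA.cl {η : Set Ed} {u v : V} (h : EA η u v) : cl η u v := Relation.ReflTransGen.single h
/-- induction: invariant sets -/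
lemma cl.inv {η : Set Ed} {u v : V} (h : cl η u v) {P : V → Prop} (h0 : P u)
    (hs : ∀ a b, cl η u a → P a → EA η a b → P b) : P v := by
  induction h with
  | refl => exact h0
  | tail h1 h2 ih => exact hs _ _ h1 ih h2

lemma cl.mono {η η' : Set Ed} (hs : η ⊆ η') {u v : V} (h : cl η u v) : cl η' u v :=
  h.inv cl.refl (fun _ _ _ h1 h2 => h1.tail (h2.mono hs))

/-- cluster representative: the vertex of least code -/
noncomputable def rep (η : Set Ed) (v : V) : V :=
  Function.argminOn (fun u : V => Encodable.encode u) {w | cl η v w} ⟨v, cl.refl⟩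

lemma rep_cl (η : Set Ed) (v : V) : cl η v (rep η v) :=
  Function.argminOn_mem (fun u : V => Encodable.encode u) {w | cl η v w} ⟨v, cl.refl⟩
lemma rep_le {η : Set Ed} {v w : V} (h : cl η v w) :
    Encodable.encode (rep η v) ≤ Encodable.encode w :=
  Function.argminOn_le (fun u : V => Encodable.encode u) {w | cl η v w} h
lemma rep_eq {η : Set Ed} {v w : V} (h : cl η v w)
    (h' : ∀ u, cl η v u → Encodable.encode w ≤ Encodable.encode u) : rep η v = w :=
  Encodable.encode_injective (le_antisymm (rep_le h) (h' _ (rep_cl η v)))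
lemma rep_congr {η η' : Set Ed} {v v' : V} (h : ∀ w, cl η v w ↔ cl η' v' w) :
    rep η v = rep η' v' :=
  rep_eq ((h _).2 (rep_cl η' v')) (fun u hu => rep_le ((h u).1 hu))
lemma rep_of_cl {η : Set Ed} {u v : V} (h : cl η u v) : rep η u = rep η v :=
  rep_congr fun _ => ⟨fun h' => h.symm.trans h', fun h' => h.trans h'⟩

/-- open edges inside `D` -/
def ed (D : Set V) (x : I → Bool) : Set Ed := {e | x (.inl e) = true ∧ e.1 ∈ D ∧ nx e ∈ D}
/-- the colouring with edges restricted to `D` -/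
noncomputable def sig (D : Set V) (x : I → Bool) : V → Bool := fun v => x (.inr (rep (ed D x) v))

/-! ### FKG in finite volume -/

/-- open edges among `Es` -/
def oe (Es : Finset Ed) (x : I → Bool) : Set Ed := {e | e ∈ Es ∧ x (.inl e) = true}

open Classical in
/-- partially revealed colouring -/
noncomputable def col (Es : Finset Ed) (Vs : Finset V) (τ : V → Bool) (c : Bool) (x : I → Bool) (u : V) : Bool :=
  if u ∉ Vs then τ u else if ∃ k, k ∉ Vs ∧ cl (oe Es x) u k then c else x (.inr (rep (oe Es x) u))

lemma col_out {Es Vs τ c x u} (h : u ∉ Vs) : col Es Vs τ c x u = τ u := by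
  unfold col; rw [if_pos h]
lemma col_conn {Es Vs τ c x u} (h : u ∈ Vs) {k : V} (hk : k ∉ Vs) (hc : cl (oe Es x) u k) :
    col Es Vs τ c x u = c := by
  unfold col; rw [if_neg (by simpa using h), if_pos ⟨k, hk, hc⟩]
lemma col_bit {Es Vs τ c x u} (h : u ∈ Vs) (hc : ∀ k, cl (oe Es x) u k → k ∈ Vs) :
    col Es Vs τ c x u = x (.inr (rep (oe Es x) u)) := by
  unfold col
  rw [if_neg (by simpa using h), if_neg]
  rintro ⟨k, hk, h'⟩; exact hk (hc k h')
/-- trichotomy -/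
lemma col_tri (Es : Finset Ed) (Vs : Finset V) (x : I → Bool) (u : V) : u ∉ Vs ∨ (u ∈ Vs ∧ ∃ k, k ∉ Vs ∧ cl (oe Es x) u k) ∨
    (u ∈ Vs ∧ ∀ k, cl (oe Es x) u k → k ∈ Vs) := by
  by_cases h : u ∈ Vs
  · right
    by_cases h' : ∃ k, k ∉ Vs ∧ cl (oe Es x) u k
    · exact Or.inl ⟨h, h'⟩
    · right; push Not at h'
      exact ⟨h, fun k hk => by by_contra hc; exact h' k hc hk⟩
  · exact Or.inl h

lemma col_loc {β : Type*} (Es : Finset Ed) (Vs : Finset V) (τ : V → Bool) (c : Bool)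
    (f : (V → Bool) → β) : Loc (fun x => f (col Es Vs τ c x)) := by
  classical
  refine Loc.dep (Es.image Sum.inl ∪ Vs.image Sum.inr) (fun x y h => ?_)
  have h1 : oe Es x = oe Es y := by
    ext e
    simp only [oe, Set.mem_setOf_eq]
    refine and_congr_right (fun he => ?_)
    rw [h (.inl e) (by simp [he])]
  congr 1
  ext u
  rcases col_tri Es Vs x u with h2 | ⟨h2, k, hk, hc⟩ | ⟨h2, h3⟩
  · rw [col_out h2, col_out h2]
  · rw [col_conn h2 hk hc, col_conn h2 hk (h1 ▸ hc)]
  · rw [col_bit h2 h3, col_bit h2 (h1 ▸ h3), h1]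
    have h5 : rep (oe Es y) u ∈ Vs := h1 ▸ h3 _ (rep_cl (oe Es x) u)
    exact h _ (by simp [h5])

lemma mix {α A1 A0 B1 B0 C1 C0 : ℝ} (h0 : 0 ≤ α) (h1 : α ≤ 1) (hC1 : A1 * B1 ≤ C1)
    (hC0 : A0 * B0 ≤ C0) (h : 0 ≤ (A1 - A0) * (B1 - B0)) :
    (α * A1 + (1 - α) * A0) * (α * B1 + (1 - α) * B0) ≤ α * C1 + (1 - α) * C0 := by
  have e1 := mul_nonneg (mul_nonneg h0 (sub_nonneg.2 h1)) h
  have e2 := mul_le_mul_of_nonneg_left hC1 h0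
  have e3 := mul_le_mul_of_nonneg_left hC0 (sub_nonneg.2 h1)
  nlinarith

open Classical in
lemma oe_upd_true {Es : Finset Ed} {e : Ed} (he : e ∈ Es) (x : I → Bool) :
    oe Es (Function.update x (.inl e) true) = insert e (oe (Es.erase e) x) := by
  ext e'
  by_cases h : e' = e
  · subst h; simp [oe, he]
  · simp [oe, h]
open Classical in
lemma oe_upd_false {Es : Finset Ed} {e : Ed} (x : I → Bool) :
    oe Es (Function.update x (.inl e) false) = oe (Es.erase e) x := by
  ext e'
  by_cases h : e' = e
  · subst h; simp [oe]
  · simp [oe, h]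
open Classical in
lemma oe_upd_inr {Es : Finset Ed} {v : V} {b : Bool} (x : I → Bool) :
    oe Es (Function.update x (.inr v) b) = oe Es x := by
  ext e'
  simp [oe]

lemma cl_insert {η : Set Ed} {e : Ed} {k u w z : V} (hj : Joins e k u) (h : cl (insert e η) w z) :
    cl η w z ∨ cl η w k ∨ cl η w u := by
  refine cl.inv h (P := fun z => cl η w z ∨ cl η w k ∨ cl η w u) (Or.inl cl.refl) ?_
  rintro a b - (ha | ha | ha) ⟨e', he', hab⟩
  · rcases Set.mem_insert_iff.1 he' with rfl | he'
    · rcases hj with ⟨h1, h2⟩ | ⟨h1, h2⟩ <;> rcases hab with ⟨h3, h4⟩ | ⟨h3, h4⟩ <;> 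
      · subst h1 h2 h3; first | tauto | (subst h4; tauto)
    · exact Or.inl (ha.tail ⟨e', he', hab⟩)
  · exact Or.inr (Or.inl ha)
  · exact Or.inr (Or.inr ha)

lemma cl_insert_eq {η : Set Ed} {e : Ed} {k u w z : V} (hj : Joins e k u) (hk : ¬ cl η w k)
    (hu : ¬ cl η w u) : cl (insert e η) w z ↔ cl η w z := by
  refine ⟨fun h => ?_, cl.mono (Set.subset_insert _ _)⟩
  have := cl_insert hj h
  tauto

open Classical in
lemma col_a {Es : Finset Ed} {Vs : Finset V} {τ : V → Bool} {c : Bool} {e : Ed} (he : e ∈ Es)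
    {k u : V} (hj : Joins e k u) (hk : k ∉ Vs) (x : I → Bool) :
    col Es Vs τ c (Function.update x (.inl e) true) =
      col (Es.erase e) (Vs.erase u) (if u ∈ Vs then Function.update τ u c else τ) c x := by
  have ej : EA (insert e (oe (Es.erase e) x)) u k := ⟨e, Set.mem_insert _ _, hj.symm⟩
  have eo := oe_upd_true he x
  ext w
  rcases col_tri (Es.erase e) (Vs.erase u) x w with h2 | ⟨h2, k', hk', hc⟩ | ⟨h2, h3⟩
  · rw [col_out h2]
    by_cases hw : w ∈ Vs
    · have hwu : w = u := by
        by_contra h; exact h2 (by simp [h, hw])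
      subst hwu
      rw [col_conn hw hk (eo ▸ ej.cl), if_pos hw]; simp
    · rw [col_out hw]
      split_ifs with h
      · have : w ≠ u := by rintro rfl; exact hw h
        simp [this]
      · rfl
  · rw [col_conn h2 hk' hc]
    have hc' := hc.mono (Set.subset_insert e _)
    by_cases hku : k' = u
    · subst hku
      exact col_conn (Finset.mem_of_mem_erase h2) hk (eo ▸ hc'.tail ej)
    · exact col_conn (Finset.mem_of_mem_erase h2) (fun h => hk' (by simp [h, hku])) (eo ▸ hc')
  · rw [col_bit h2 h3]
    have hwk : ¬ cl (oe (Es.erase e) x) w k := fun h => hk (Finset.mem_of_mem_erase (h3 k h))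
    have hwu : ¬ cl (oe (Es.erase e) x) w u := fun h => by simpa using h3 u h
    have hcl := fun z => cl_insert_eq (z := z) hj hwk hwu
    rw [col_bit (Finset.mem_of_mem_erase h2), eo, rep_congr hcl]
    · simp
    · rw [eo]; exact fun z hz => Finset.mem_of_mem_erase (h3 z ((hcl z).1 hz))

open Classical in
lemma col_a' {Es : Finset Ed} {Vs : Finset V} {τ : V → Bool} {c : Bool} {e : Ed} (x : I → Bool) :
    col Es Vs τ c (Function.update x (.inl e) false) = col (Es.erase e) Vs τ c x := by
  ext w
  unfold col
  rw [oe_upd_false]; simp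

open Classical in
lemma col_c {Es : Finset Ed} {Vs : Finset V} {τ : V → Bool} {c : Bool}
    (hE : ∀ e ∈ Es, ∀ k u, Joins e k u → k ∈ Vs) {v : V} (hv : v ∈ Vs)
    (hm : ∀ u ∈ Vs, Encodable.encode v ≤ Encodable.encode u) (b : Bool) (x : I → Bool) :
    col Es Vs τ c (Function.update x (.inr v) b) =
      col Es (Vs.erase v) (Function.update τ v b) b x := by
  have hst : ∀ {u z}, u ∈ Vs → cl (oe Es x) u z → z ∈ Vs := fun hu h =>
    h.inv hu (fun a b _ _ ⟨e, he, hab⟩ => hE e he.1 _ _ hab.symm)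
  have eo : oe Es (Function.update x (.inr v) b) = oe Es x := oe_upd_inr x
  ext w
  by_cases hw : w ∈ Vs
  · rw [col_bit hw (fun z hz => hst hw (eo ▸ hz)), eo]
    by_cases hwv : w = v
    · subst hwv
      rw [col_out (by simp), rep_eq cl.refl (fun u hu => hm u (hst hw hu))]; simp
    · have hw' : w ∈ Vs.erase v := by simp [hw, hwv]
      by_cases h1 : cl (oe Es x) w v
      · rw [col_conn hw' (by simp) h1, rep_eq h1 (fun u hu => hm u (hst hw hu))]; simp
      · have h4 : rep (oe Es x) w ≠ v := fun h => h1 (h ▸ rep_cl _ _)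
        rw [col_bit hw']
        · simp [h4]
        · intro z hz
          have : z ≠ v := by rintro rfl; exact h1 hz
          simp [this, hst hw hz]
  · have : w ≠ v := by rintro rfl; exact hw hv
    rw [col_out hw, col_out (by simp [hw])]; simp [this]

open Classical in
lemma col_le_c {Es : Finset Ed} {Vs : Finset V} {τ : V → Bool} (v : V) (x : I → Bool) :
    col Es (Vs.erase v) (Function.update τ v false) false x ≤
      col Es (Vs.erase v) (Function.update τ v true) true x := by
  intro w
  rcases col_tri Es (Vs.erase v) x w with h2 | ⟨h2, k', hk', hc⟩ | ⟨h2, h3⟩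
  · rw [col_out h2, col_out h2]
    by_cases h : w = v
    · subst h; simp
    · simp [h]
  · rw [col_conn h2 hk' hc]; exact Bool.false_le _
  · rw [col_bit h2 h3, col_bit h2 h3]

open Classical in
lemma col_le_a {Es : Finset Ed} {Vs : Finset V} {τ : V → Bool} (u : V) (hu : u ∈ Vs) (x : I → Bool) :
    col Es Vs τ true x ≤ col Es (Vs.erase u) (Function.update τ u true) true x := by
  intro w
  rcases col_tri Es (Vs.erase u) x w with h2 | ⟨h2, k', hk', hc⟩ | ⟨h2, h3⟩
  · by_cases hwu : w = u
    · subst hwu; rw [col_out h2]; simp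
    · have hw : w ∉ Vs := fun h => h2 (by simp [h, hwu])
      rw [col_out h2, col_out hw]; simp [hwu]
  · rw [col_conn h2 hk' hc]; exact Bool.le_true _
  · rw [col_bit h2 h3, col_bit (Finset.mem_of_mem_erase h2) (fun z hz => Finset.mem_of_mem_erase (h3 z hz))]

open Classical in
lemma col_ge_a {Es : Finset Ed} {Vs : Finset V} {τ : V → Bool} (u : V) (hu : u ∈ Vs) (x : I → Bool) :
    col Es (Vs.erase u) (Function.update τ u false) false x ≤ col Es Vs τ false x := by
  intro w
  rcases col_tri Es (Vs.erase u) x w with h2 | ⟨h2, k', hk', hc⟩ | ⟨h2, h3⟩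
  · by_cases hwu : w = u
    · subst hwu; rw [col_out h2]; simp
    · have hw : w ∉ Vs := fun h => h2 (by simp [h, hwu])
      rw [col_out h2, col_out hw]; simp [hwu]
  · rw [col_conn h2 hk' hc]; exact Bool.false_le _
  · rw [col_bit h2 h3, col_bit (Finset.mem_of_mem_erase h2) (fun z hz => Finset.mem_of_mem_erase (h3 z hz))]

open Classical in
lemma col_b {Es : Finset Ed} {Vs : Finset V} {τ : V → Bool} {c : Bool} {e : Ed} (he : e ∈ Es)
    {k u : V} (hj : Joins e k u) (hk : k ∉ Vs) (hu : u ∉ Vs) (x : I → Bool) :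
    col Es Vs τ c x = col (Es.erase e) Vs τ c x := by
  cases hx : x (.inl e) with
  | true =>
    have := col_a (τ := τ) (c := c) he hj hk x
    rwa [← hx, Function.update_eq_self, if_neg hu, Finset.erase_eq_of_notMem hu] at this
  | false =>
    have := col_a' (Es := Es) (Vs := Vs) (τ := τ) (c := c) (e := e) x
    rwa [← hx, Function.update_eq_self] at this

open Classical in
theorem col_fkg (w : I → ℝ) {f g : (V → Bool) → ℝ} (mf : Monotone f) (mg : Monotone g) :
    ∀ (n : ℕ) (Es : Finset Ed) (Vs : Finset V) (τ : V → Bool) (c : Bool), Es.card + Vs.card = n →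
    EE w (fun x => f (col Es Vs τ c x)) * EE w (fun x => g (col Es Vs τ c x)) ≤
      EE w (fun x => f (col Es Vs τ c x) * g (col Es Vs τ c x)) := by
  intro n
  induction n using Nat.strong_induction_on with
  | _ n ih =>
  intro Es Vs τ c hn
  have lf : ∀ {h : (V → Bool) → ℝ} {Es Vs τ c}, Loc (fun x => h (col Es Vs τ c x)) :=
    fun {h Es Vs τ c} => col_loc Es Vs τ c h
  have lfg : ∀ {Es Vs τ c}, Loc (fun x => f (col Es Vs τ c x) * g (col Es Vs τ c x)) :=
    fun {Es Vs τ c} => col_loc Es Vs τ c (fun ξ => f ξ * g ξ)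
  by_cases h1 : ∃ e ∈ Es, ∃ k u, Joins e k u ∧ k ∉ Vs
  · obtain ⟨e, he, k, u, hj, hk⟩ := h1
    have hc1 : (Es.erase e).card < Es.card := Finset.card_erase_lt_of_mem he
    by_cases hu : u ∈ Vs
    · have hc2 : (Vs.erase u).card < Vs.card := Finset.card_erase_lt_of_mem hu
      rw [EE_resample w (.inl e) (lf (h := f)), EE_resample w (.inl e) (lf (h := g)),
        EE_resample w (.inl e) lfg]
      simp only [col_a he hj hk, col_a', if_pos hu]
      refine mix (clamp_nonneg _) (clamp_le_one _) (ih _ (by omega) _ _ _ _ rfl)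
        (ih _ (by omega) _ _ _ _ rfl) ?_
      cases c with
      | true =>
        exact mul_nonneg (sub_nonneg.2 (EE_mono w lf lf (fun x => mf (col_le_a u hu x))))
          (sub_nonneg.2 (EE_mono w lf lf (fun x => mg (col_le_a u hu x))))
      | false =>
        exact mul_nonneg_of_nonpos_of_nonpos
          (sub_nonpos.2 (EE_mono w lf lf (fun x => mf (col_ge_a u hu x))))
          (sub_nonpos.2 (EE_mono w lf lf (fun x => mg (col_ge_a u hu x))))
    · simp only [col_b (τ := τ) (c := c) he hj hk hu]
      exact ih _ (by omega) _ _ _ _ rfl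
  · rcases Vs.eq_empty_or_nonempty with rfl | hne
    · have h5 : ∀ x, col Es ∅ τ c x = τ := fun x => funext fun u => col_out (by simp)
      simp [h5, EE_const]
    · push Not at h1
      obtain ⟨v, hv, hm⟩ := Finset.exists_min_image Vs (fun u => Encodable.encode u) hne
      have hc2 : (Vs.erase v).card < Vs.card := Finset.card_erase_lt_of_mem hv
      rw [EE_resample w (.inr v) (lf (h := f)), EE_resample w (.inr v) (lf (h := g)),
        EE_resample w (.inr v) lfg]
      simp only [col_c h1 hv hm]
      refine mix (clamp_nonneg _) (clamp_le_one _) (ih _ (by omega) _ _ _ _ rfl)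
        (ih _ (by omega) _ _ _ _ rfl) ?_
      exact mul_nonneg (sub_nonneg.2 (EE_mono w lf lf (fun x => mf (col_le_c v x))))
          (sub_nonneg.2 (EE_mono w lf lf (fun x => mg (col_le_c v x))))

/-- FKG inequality in finite volume -/
theorem sig_fkg (w : I → ℝ) {f g : (V → Bool) → ℝ} (mf : Monotone f) (mg : Monotone g)
    {D : Set V} (hD : D.Finite) (hf : DependsOn f D) (hg : DependsOn g D) :
    EE w (fun x => f (sig D x)) * EE w (fun x => g (sig D x)) ≤
      EE w (fun x => f (sig D x) * g (sig D x)) := by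
  classical
  have hE : ({e : Ed | e.1 ∈ D ∧ nx e ∈ D}).Finite :=
    (hD.prod (Set.finite_univ (α := Bool))).subset (fun e he => ⟨he.1, trivial⟩)
  have h1 : ∀ x, oe hE.toFinset x = ed D x := by
    intro x; ext e; simp [oe, ed]; tauto
  have h2 : ∀ x, ∀ u ∈ D, sig D x u = col hE.toFinset hD.toFinset (fun _ => false) false x u := by
    intro x u hu
    rw [col_bit (by simpa using hu), h1]; · rfl
    intro k hc
    rw [h1] at hc
    simp only [Set.Finite.mem_toFinset]
    refine hc.inv hu ?_
    rintro a b - - ⟨e, he, hab⟩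
    rcases hab with ⟨rfl, rfl⟩ | ⟨rfl, rfl⟩
    · exact he.2.2
    · exact he.2.1
  have hf' : ∀ x, f (sig D x) = f (col hE.toFinset hD.toFinset (fun _ => false) false x) :=
    fun x => hf (fun u hu => h2 x u hu)
  have hg' : ∀ x, g (sig D x) = g (col hE.toFinset hD.toFinset (fun _ => false) false x) :=
    fun x => hg (fun u hu => h2 x u hu)
  simp only [hf', hg']
  exact col_fkg w mf mg _ _ _ _ _ rfl

end DaC

namespace DaC

/-! ### maps of product measures -/

lemma PP_reindex {ι κ : Type*} (w : κ → ℝ) (f : ι → κ) (hf : Function.Injective f) :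
    (PP w).map (fun x i => x (f i)) = PP (fun i => w (f i)) := by
  classical
  have hm : Measurable (fun (x : κ → Bool) (i : ι) => x (f i)) :=
    measurable_pi_iff.2 fun i => measurable_pi_apply _
  refine Measure.eq_infinitePi _ (fun s t ht => ?_)
  rw [Measure.map_apply hm (MeasurableSet.pi s.countable_toSet (fun i _ => ht i))]
  set t' : κ → Set Bool := Function.extend f t (fun _ => Set.univ) with ht'
  have h1 : ∀ i, t' (f i) = t i := fun i => hf.extend_apply t _ i
  have : (fun (x : κ → Bool) (i : ι) => x (f i)) ⁻¹' (Set.pi s t) = Set.pi (s.image f : Finset κ) t' := by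
    ext x
    simp [Set.mem_pi, h1]
  rw [this, PP, Measure.infinitePi_pi _ (fun _ _ => MeasurableSet.of_discrete),
    Finset.prod_image (fun a _ b _ h => hf h)]
  simp only [h1]

lemma EE_reindex {ι κ : Type*} (w : κ → ℝ) (f : ι → κ) (hf : Function.Injective f)
    {F : (ι → Bool) → ℝ} (hF : Measurable F) :
    EE w (fun x => F (fun i => x (f i))) = EE (fun i => w (f i)) F := by
  unfold EE
  rw [← PP_reindex w f hf, integral_map]
  · exact (measurable_pi_iff.2 fun i => measurable_pi_apply _).aemeasurable
  · exact hF.aestronglyMeasurable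

lemma ber_not (q : ℝ) : (ber q).map not = ber (1 - q) := by
  have h : clamp (1 - q) = 1 - clamp q := by
    unfold clamp
    rcases le_total q 1 with h1 | h1 <;> rcases le_total 0 q with h2 | h2
    · rw [min_eq_left h1, max_eq_right h2, min_eq_left (by linarith), max_eq_right (by linarith)]
    · rw [min_eq_left h1, max_eq_left h2, min_eq_right (by linarith)]; norm_num
    · rw [min_eq_right h1, min_eq_left (by linarith), max_eq_left (by linarith)]; norm_num
    · linarith
  unfold ber
  rw [h, Measure.map_add _ _ measurable_from_top, Measure.map_smul, Measure.map_smul,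
    Measure.map_dirac' measurable_from_top, Measure.map_dirac' measurable_from_top]
  simp [add_comm]

/-- flip all colour bits -/
def flp (x : I → Bool) : I → Bool := fun i => match i with
  | .inl e => x (.inl e)
  | .inr v => !x (.inr v)

/-- flipped weights -/
def flw (w : I → ℝ) : I → ℝ := fun i => match i with
  | .inl e => w (.inl e)
  | .inr v => 1 - w (.inr v)

lemma flp_meas : Measurable flp := by
  rw [measurable_pi_iff]
  rintro (e | v)
  · exact measurable_pi_apply _
  · exact (measurable_from_top (f := not)).comp (measurable_pi_apply _)

lemma PP_flp (w : I → ℝ) : (PP w).map flp = PP (flw w) := by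
  have h := Measure.infinitePi_map_pi (μ := fun i : I => ber (w i)) (Y := fun _ => Bool)
    (f := fun i => match i with
      | .inl _ => id
      | .inr _ => not) (fun i => measurable_from_top)
  unfold PP
  have e1 : (fun (x : I → Bool) (i : I) => (match (motive := I → Bool → Bool) i with
      | .inl _ => id
      | .inr _ => not) (x i)) = flp := by
    funext x i; rcases i with i | i <;> rfl
  rw [← e1, h]
  congr 1
  funext i
  rcases i with i | i
  · exact Measure.map_id
  · exact ber_not _

/-! ### infinite volume limit -/

lemma ed_mono {D D' : Set V} (h : D ⊆ D') (x : I → Bool) : ed D x ⊆ ed D' x :=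
  fun _ he => ⟨he.1, h he.2.1, h he.2.2⟩

lemma sig_eventually (x : I → Bool) (v : V) :
    ∃ A : Finset V, ∀ D : Set V, (A : Set V) ⊆ D → sig D x v = sig Set.univ x v := by
  classical
  have h : ∀ w, cl (ed Set.univ x) v w → ∃ A : Finset V, ∀ D : Set V, (A : Set V) ⊆ D → cl (ed D x) v w := by
    intro w hw
    refine hw.inv (P := fun w => ∃ A : Finset V, ∀ D : Set V, (A : Set V) ⊆ D → cl (ed D x) v w)
      ⟨∅, fun D _ => cl.refl⟩ ?_
    rintro a b - ⟨A, hA⟩ ⟨e, he, hab⟩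
    refine ⟨insert e.1 (insert (nx e) A), fun D hD => ?_⟩
    have h1 : (A : Set V) ⊆ D := fun u hu => hD (by simp [Finset.mem_coe.1 hu])
    exact (hA D h1).tail ⟨e, ⟨he.1, hD (by simp), hD (by simp)⟩, hab⟩
  obtain ⟨A, hA⟩ := h _ (rep_cl (ed Set.univ x) v)
  refine ⟨A, fun D hD => ?_⟩
  unfold sig
  rw [rep_eq (hA D hD) (fun u hu => rep_le (hu.mono (ed_mono (Set.subset_univ _) x)))]

/-- boxes -/
def Lam (n : ℕ) : Set V := {v | nm v ≤ n}
lemma Lam_finite (n : ℕ) : (Lam n).Finite := by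
  refine (box_finite (-n) n (-n) n).subset (fun v hv => ?_)
  have := nm_le.1 (show nm v ≤ n from hv)
  simpa only [Box, Set.mem_setOf_eq] using this

lemma Lam_exhaust (A : Finset V) : ∃ n0 : ℕ, ∀ n ≥ n0, (A : Set V) ⊆ Lam n := by
  refine ⟨A.sup (fun v => (nm v).toNat), fun n hn v hv => ?_⟩
  have := Finset.le_sup (f := fun v => (nm v).toNat) (Finset.mem_coe.1 hv)
  show nm v ≤ n
  omega

/-- exhausting sequences -/
def Exh (D : ℕ → Set V) : Prop := ∀ A : Finset V, ∃ n0 : ℕ, ∀ n ≥ n0, (A : Set V) ⊆ D n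

lemma ed_loc {D : Set V} (hD : D.Finite) {β : Type*} (f : Set Ed → β) : Loc (fun x => f (ed D x)) := by
  classical
  have hE : ({e : Ed | e.1 ∈ D ∧ nx e ∈ D}).Finite :=
    (hD.prod (Set.finite_univ (α := Bool))).subset (fun e he => ⟨he.1, trivial⟩)
  refine Loc.dep (hE.toFinset.image Sum.inl) (fun x y h => ?_)
  have : ed D x = ed D y := by
    ext e
    simp only [ed, Set.mem_setOf_eq]
    constructor <;> rintro ⟨h1, h2⟩
    · exact ⟨by rw [← h (.inl e) (by simp [h2])]; exact h1, h2⟩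
    · exact ⟨by rw [h (.inl e) (by simp [h2])]; exact h1, h2⟩
  rw [this]

lemma cl_mem {D : Set V} {x : I → Bool} {u v : V} (h : cl (ed D x) u v) : u = v ∨ (u ∈ D ∧ v ∈ D) := by
  refine h.inv (P := fun v => u = v ∨ (u ∈ D ∧ v ∈ D)) (Or.inl rfl) ?_
  rintro a b - ha ⟨e, he, (⟨rfl, rfl⟩ | ⟨rfl, rfl⟩)⟩
  · rcases ha with rfl | ha
    · exact Or.inr ⟨he.2.1, he.2.2⟩
    · exact Or.inr ⟨ha.1, he.2.2⟩
  · rcases ha with rfl | ha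
    · exact Or.inr ⟨he.2.2, he.2.1⟩
    · exact Or.inr ⟨ha.1, he.2.1⟩

/-- indices inside `D` -/
noncomputable def idx (D : Set V) (hD : D.Finite) : Finset I := by
  classical
  exact (((hD.prod (Set.finite_univ (α := Bool))).toFinset.filter (fun e : Ed => nx e ∈ D)).image Sum.inl) ∪
    hD.toFinset.image Sum.inr

lemma mem_idx_inl {D : Set V} {hD : D.Finite} {e : Ed} : Sum.inl e ∈ idx D hD ↔ e.1 ∈ D ∧ nx e ∈ D := by
  simp [idx, Set.mem_prod]
lemma mem_idx_inr {D : Set V} {hD : D.Finite} {v : V} : Sum.inr v ∈ idx D hD ↔ v ∈ D := by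
  simp [idx]

lemma ed_congr {D : Set V} (hD : D.Finite) {x y : I → Bool} (h : ∀ i ∈ idx D hD, x i = y i) :
    ed D x = ed D y := by
  ext e
  simp only [ed, Set.mem_setOf_eq]
  constructor <;> rintro ⟨h1, h2⟩
  · exact ⟨by rw [← h (.inl e) (mem_idx_inl.2 h2)]; exact h1, h2⟩
  · exact ⟨by rw [h (.inl e) (mem_idx_inl.2 h2)]; exact h1, h2⟩

lemma sig_dep {D : Set V} (hD : D.Finite) {v : V} (hv : v ∈ D) :
    DependsOn (fun x => sig D x v) (idx D hD : Set I) := by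
  intro x y h
  have h1 := ed_congr hD (x := x) (y := y) h
  show x (.inr (rep (ed D x) v)) = y (.inr (rep (ed D y) v))
  rw [h1]
  refine h (.inr _) (mem_idx_inr.2 ?_)
  rcases cl_mem (rep_cl (ed D y) v) with h2 | h2
  · rw [← h2]; exact hv
  · exact h2.2

lemma sig_loc' {D : Set V} (hD : D.Finite) {β : Type*} {f : (V → Bool) → β} {S : Finset V}
    (hf : DependsOn f (S : Set V)) : Loc (fun x => f (sig D x)) := by
  classical
  have hD' : (D ∪ S).Finite := hD.union S.finite_toSet
  refine Loc.dep (idx (D ∪ S) hD') (fun x y h => hf (fun v hv => ?_))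
  have h1 : ed D x = ed D y := ed_congr hD (fun i hi => h i (by
    rcases i with e | u
    · rw [mem_idx_inl] at *; exact ⟨Or.inl hi.1, Or.inl hi.2⟩
    · rw [mem_idx_inr] at *; exact Or.inl hi))
  simp only [sig, h1]
  refine h (.inr _) (mem_idx_inr.2 ?_)
  rcases cl_mem (rep_cl (ed D y) v) with h2 | h2
  · rw [← h2]; exact Or.inr hv
  · exact Or.inl h2.2

lemma sig_loc {D : Set V} (hD : D.Finite) {β : Type*} {f : (V → Bool) → β} (hf : Loc f) :
    Loc (fun x => f (sig D x)) := by
  obtain ⟨S, hS⟩ := hf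
  exact sig_loc' hD hS

lemma sig_ev_loc {D : ℕ → Set V} (hD : Exh D) {β : Type*} {f : (V → Bool) → β} (hf : Loc f)
    (x : I → Bool) : ∀ᶠ n in Filter.atTop, f (sig (D n) x) = f (sig Set.univ x) := by
  classical
  obtain ⟨S, hS⟩ := hf
  choose A hA using sig_eventually x
  obtain ⟨n0, h0⟩ := hD (S.biUnion A)
  filter_upwards [Filter.eventually_ge_atTop n0] with n hn
  refine hS (fun v hv => hA v _ (subset_trans ?_ (h0 n hn)))
  intro u hu
  simp only [Finset.coe_biUnion, Set.mem_iUnion]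
  exact ⟨v, hv, hu⟩

lemma sig_meas : Measurable (sig Set.univ) := by
  rw [measurable_pi_iff]
  intro v
  have lv : Loc (fun ξ : V → Bool => ξ v) := ⟨{v}, fun x y h => h v (by simp)⟩
  refine measurable_of_tendsto_metrizable (f := fun n x => sig (Lam n) x v)
    (fun n => (sig_loc (Lam_finite n) lv).measurable) ?_
  rw [tendsto_pi_nhds]
  intro x
  exact tendsto_const_nhds.congr' ((sig_ev_loc Lam_exhaust lv x).mono fun n h => h.symm)

/-- the law of the colouring -/
noncomputable def mu (w : I → ℝ) : Measure (V → Bool) := (PP w).map (sig Set.univ)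

instance (w : I → ℝ) : IsProbabilityMeasure (mu w) :=
  Measure.isProbabilityMeasure_map sig_meas.aemeasurable

lemma mu_real (w : I → ℝ) {A : Set (V → Bool)} (hA : MeasurableSet A) :
    (mu w).real A = (PP w).real {x | sig Set.univ x ∈ A} := by
  unfold mu
  rw [map_measureReal_apply sig_meas hA]; rfl

lemma EE_sig_tendsto (w : I → ℝ) {D : ℕ → Set V} (hD : Exh D) (hDf : ∀ n, (D n).Finite)
    {f : (V → Bool) → ℝ} (hf : Loc f) :
    Filter.Tendsto (fun n => EE w (fun x => f (sig (D n) x))) Filter.atTop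
      (nhds (EE w (fun x => f (sig Set.univ x)))) := by
  obtain ⟨C, hC⟩ := hf.bdd
  refine tendsto_integral_of_dominated_convergence (fun _ => C)
    (fun n => (sig_loc (hDf n) hf).measurable.aestronglyMeasurable) (integrable_const _)
    (fun n => Filter.Eventually.of_forall fun x => hC _) (Filter.Eventually.of_forall fun x => ?_)
  exact tendsto_const_nhds.congr' ((sig_ev_loc hD hf x).mono fun n h => h.symm)

lemma mu_EE (w : I → ℝ) {A : Set (V → Bool)} (hA : MeasurableSet A) :
    (mu w).real A = EE w (fun x => ind A (sig Set.univ x)) := by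
  rw [mu_real w hA, ← EE_ind w (A := {x | sig Set.univ x ∈ A}) (sig_meas hA)]
  rfl

lemma mu_tendsto (w : I → ℝ) {D : ℕ → Set V} (hD : Exh D) (hDf : ∀ n, (D n).Finite)
    {A : Set (V → Bool)} (hA : Loc (fun ξ => ξ ∈ A)) :
    Filter.Tendsto (fun n => EE w (fun x => ind A (sig (D n) x))) Filter.atTop
      (nhds ((mu w).real A)) := by
  rw [mu_EE w (loc_meas hA)]
  exact EE_sig_tendsto w hD hDf hA.ind

lemma Inc.mono_ind {A : Set (V → Bool)} (hA : Inc A) : Monotone (ind A) := by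
  intro ξ ζ h
  by_cases h1 : ξ ∈ A
  · rw [ind_mem h1, ind_mem (hA.up _ _ h h1)]
  · rw [ind_not h1]; exact ind_nonneg _ _

theorem mu_fkg (w : I → ℝ) {A B : Set (V → Bool)} (hA : Inc A) (hB : Inc B) :
    (mu w).real A * (mu w).real B ≤ (mu w).real (A ∩ B) := by
  have t1 := mu_tendsto w Lam_exhaust Lam_finite hA.loc
  have t2 := mu_tendsto w Lam_exhaust Lam_finite hB.loc
  have t3 := mu_tendsto w Lam_exhaust Lam_finite (hA.inter hB).loc
  refine le_of_tendsto_of_tendsto (t1.mul t2) t3 ?_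
  obtain ⟨S, hS⟩ := hA.loc.ind
  obtain ⟨T, hT⟩ := hB.loc.ind
  obtain ⟨n1, h1⟩ := Lam_exhaust S
  obtain ⟨n2, h2⟩ := Lam_exhaust T
  filter_upwards [Filter.eventually_ge_atTop n1, Filter.eventually_ge_atTop n2] with n hn1 hn2
  have key := sig_fkg w hA.mono_ind hB.mono_ind (Lam_finite n)
    (fun x y h => hS (fun v hv => h v (h1 n hn1 hv))) (fun x y h => hT (fun v hv => h v (h2 n hn2 hv)))
  refine key.trans (le_of_eq ?_)
  congr 1
  funext x
  simp only [ind_apply, Set.mem_inter_iff]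
  split_ifs <;> simp_all

end DaC

namespace DaC

/-! ### Splicing and invariance -/

open Classical in
/-- take the coordinates in `T` from `x`, the others from `y` -/
noncomputable def splice {ι : Type*} (T : Set ι) (x y : ι → Bool) : ι → Bool := fun i => if i ∈ T then x i else y i

lemma splice_meas {ι : Type*} (T : Set ι) :
    Measurable (fun q : (ι → Bool) × (ι → Bool) => splice T q.1 q.2) := by
  rw [measurable_pi_iff]
  intro i
  unfold splice
  split_ifs
  · exact (measurable_pi_apply i).comp measurable_fst
  · exact (measurable_pi_apply i).comp measurable_snd

lemma PP_splice {ι : Type*} (w : ι → ℝ) (T : Set ι) :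
    ((PP w).prod (PP w)).map (fun q : (ι → Bool) × (ι → Bool) => splice T q.1 q.2) = PP w := by
  classical
  refine Measure.eq_infinitePi _ (fun s t ht => ?_)
  have h1 : (fun q : (ι → Bool) × (ι → Bool) => splice T q.1 q.2) ⁻¹' (Set.pi s t) =
      (Set.pi (s.filter (· ∈ T) : Finset ι) t) ×ˢ (Set.pi (s.filter (· ∉ T) : Finset ι) t) := by
    ext ⟨x, y⟩
    simp only [Set.mem_preimage, Set.mem_pi, Set.mem_prod, Finset.coe_filter, Set.mem_setOf_eq, splice,
      Finset.mem_coe]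
    constructor
    · intro h
      refine ⟨fun i hi => ?_, fun i hi => ?_⟩
      · have := h i hi.1; rwa [if_pos hi.2] at this
      · have := h i hi.1; rwa [if_neg hi.2] at this
    · intro h i hi
      by_cases hT : i ∈ T
      · rw [if_pos hT]; exact h.1 i ⟨hi, hT⟩
      · rw [if_neg hT]; exact h.2 i ⟨hi, hT⟩
  rw [Measure.map_apply (splice_meas T) (MeasurableSet.pi s.countable_toSet (fun i _ => ht i)), h1,
    Measure.prod_prod]
  unfold PP
  rw [Measure.infinitePi_pi _ (fun i _ => ht i), Measure.infinitePi_pi _ (fun i _ => ht i)]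
  exact Finset.prod_filter_mul_prod_filter_not s _ _

lemma EE_splice {ι : Type*} (w : ι → ℝ) (T : Set ι) {F : (ι → Bool) → ℝ} (hF : Measurable F) {C : ℝ}
    (hC : ∀ x, ‖F x‖ ≤ C) : EE w F = EE w (fun x => EE w (fun y => F (splice T x y))) := by
  unfold EE
  conv_lhs => rw [← PP_splice w T]
  rw [integral_map (splice_meas T).aemeasurable hF.aestronglyMeasurable, integral_prod]
  exact Integrable.of_bound (hF.comp (splice_meas T)).aestronglyMeasurable C (Filter.Eventually.of_forall fun q => hC _)

/-- changing representatives does not change the law -/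
lemma EE_reps (w : I → ℝ) (R : Setoid V) {ρ ρ' : V → V} (h1 : ∀ u v, R u v ↔ ρ u = ρ v)
    (h2 : ∀ u v, R u v ↔ ρ' u = ρ' v) (hw : ∀ v, w (.inr (ρ v)) = w (.inr (ρ' v)))
    {f : (V → Bool) → ℝ} (hf : Measurable f) :
    EE w (fun y => f (fun v => y (.inr (ρ v)))) = EE w (fun y => f (fun v => y (.inr (ρ' v)))) := by
  let F : (Quotient R → Bool) → ℝ := fun z => f (fun v => z (Quotient.mk R v))
  have hF : Measurable F := hf.comp (measurable_pi_iff.2 fun v => measurable_pi_apply _)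
  let r : Quotient R → I := Quotient.lift (fun v => Sum.inr (ρ v)) (fun a b h => by rw [(h1 a b).1 h])
  let r' : Quotient R → I := Quotient.lift (fun v => Sum.inr (ρ' v)) (fun a b h => by rw [(h2 a b).1 h])
  have hr : Function.Injective r := by
    intro a b
    induction a using Quotient.inductionOn
    induction b using Quotient.inductionOn
    intro h
    exact Quotient.sound ((h1 _ _).2 (Sum.inr.inj h))
  have hr' : Function.Injective r' := by
    intro a b
    induction a using Quotient.inductionOn
    induction b using Quotient.inductionOn
    intro h
    exact Quotient.sound ((h2 _ _).2 (Sum.inr.inj h))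
  have e1 := EE_reindex w r hr hF
  have e2 := EE_reindex w r' hr' hF
  have e3 : (fun i => w (r i)) = (fun i => w (r' i)) := by
    funext i
    induction i using Quotient.inductionOn with
    | h v => exact hw v
  rw [e3] at e1
  exact e1.trans e2.symm

lemma rep_inj {η : Set Ed} {u v : V} : cl η u v ↔ rep η u = rep η v :=
  ⟨rep_of_cl, fun h => (rep_cl η u).trans (by rw [h]; exact (rep_cl η v).symm)⟩

lemma shift_joins (a b : ℤ) (e : Ed) (u v : V) : Joins e u v ↔
    Joins (((Equiv.addRight ((a, b) : V)).prodCongr (Equiv.refl Bool) : Ed ≃ Ed) e)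
      ((Equiv.addRight ((a, b) : V)) u) ((Equiv.addRight ((a, b) : V)) v) := by
  obtain ⟨⟨e1, e2⟩, c⟩ := e
  obtain ⟨u1, u2⟩ := u
  obtain ⟨v1, v2⟩ := v
  cases c <;> simp [Joins, nx, Prod.ext_iff] <;> omega

lemma Sy.lift {g : V → V} (hg : Sy g) : ∃ (G : V ≃ V) (H : Ed ≃ Ed), (∀ v, G v = g v) ∧
    ∀ e u v, Joins e u v ↔ Joins (H e) (G u) (G v) := by
  induction hg with
  | sh a b =>
    exact ⟨_, _, fun v => rfl, shift_joins (2 * a) (2 * b)⟩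
  | rx =>
    refine ⟨⟨fun v => (-v.1, v.2), fun v => (-v.1, v.2), fun v => by simp,
      fun v => by simp⟩, ⟨fun e => ((if e.2 then -e.1.1 else -e.1.1 - 1, e.1.2), e.2),
      fun e => ((if e.2 then -e.1.1 else -e.1.1 - 1, e.1.2), e.2), ?_, ?_⟩, fun v => rfl, ?_⟩
    · rintro ⟨⟨e1, e2⟩, b⟩; cases b <;> simp
    · rintro ⟨⟨e1, e2⟩, b⟩; cases b <;> simp
    rintro ⟨⟨e1, e2⟩, b⟩ ⟨u1, u2⟩ ⟨v1, v2⟩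
    cases b <;> simp [Joins, nx, Prod.ext_iff] <;> omega
  | sw =>
    refine ⟨⟨fun v => (v.2, v.1), fun v => (v.2, v.1), fun v => by simp,
      fun v => by simp⟩, ⟨fun e => ((e.1.2, e.1.1), !e.2), fun e => ((e.1.2, e.1.1), !e.2), ?_, ?_⟩,
      fun v => rfl, ?_⟩
    · rintro ⟨⟨e1, e2⟩, b⟩; cases b <;> simp
    · rintro ⟨⟨e1, e2⟩, b⟩; cases b <;> simp
    rintro ⟨⟨e1, e2⟩, b⟩ ⟨u1, u2⟩ ⟨v1, v2⟩
    cases b <;> simp [Joins, nx, Prod.ext_iff] <;> omega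
  | comp _ _ ih1 ih2 =>
    obtain ⟨G1, H1, a1, b1⟩ := ih1
    obtain ⟨G2, H2, a2, b2⟩ := ih2
    refine ⟨G2.trans G1, H2.trans H1, fun v => ?_, fun e u v => ?_⟩
    · simp [a1, a2]
    · rw [b2, b1]; rfl

/-- compatible reindexing of the indices -/
structure Reidx (w w' : I → ℝ) (G : V ≃ V) (H : Ed ≃ Ed) : Prop where
  joins : ∀ e u v, Joins e u v ↔ Joins (H e) (G u) (G v)
  edges : ∀ e, w (.inl (H e)) = w' (.inl e)
  bits : ∀ v, w (.inr (G v)) = w' (.inr v)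
  clus : ∀ᵐ x ∂(PP w), ∀ u v, cl (ed Set.univ x) u v → w (.inr u) = w (.inr v)

lemma cl_reidx {G : V ≃ V} {H : Ed ≃ Ed} (h : ∀ e u v, Joins e u v ↔ Joins (H e) (G u) (G v))
    (x : I → Bool) (u v : V) :
    cl (ed Set.univ (fun i => x (Sum.map H G i))) u v ↔ cl (ed Set.univ x) (G u) (G v) := by
  constructor
  · intro hc
    refine hc.inv (P := fun v => cl (ed Set.univ x) (G u) (G v)) cl.refl ?_
    rintro a b - h1 ⟨e, he, hj⟩
    exact h1.tail ⟨H e, ⟨he.1, trivial, trivial⟩, (h _ _ _).1 hj⟩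
  · intro hc
    have := hc.inv (P := fun v => cl (ed Set.univ (fun i => x (Sum.map H G i))) u (G.symm v)) (by simpa using cl.refl) ?_
    · simpa using this
    rintro a b - h1 ⟨e, he, hj⟩
    refine h1.tail ⟨H.symm e, ⟨?_, trivial, trivial⟩, (h _ _ _).2 ?_⟩
    · simpa using he.1
    · simpa using hj

theorem Reidx.inv {w w' : I → ℝ} {G : V ≃ V} {H : Ed ≃ Ed} (h : Reidx w w' G H) {f : (V → Bool) → ℝ}
    (hf : Measurable f) {C : ℝ} (hC : ∀ ξ, ‖f ξ‖ ≤ C) :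
    EE w (fun x => f (fun v => sig Set.univ x (G v))) = EE w' (fun x => f (sig Set.univ x)) := by
  have m1 : Measurable (fun x => f (fun v => sig Set.univ x (G v))) :=
    hf.comp (measurable_pi_iff.2 fun v => (measurable_pi_apply _).comp sig_meas)
  have m2 : Measurable (fun x => f (sig Set.univ x)) := hf.comp sig_meas
  have hinj : Function.Injective (Sum.map H G : I → I) := H.injective.sumMap G.injective
  have mG : Measurable (fun (x : I → Bool) (i : I) => x (Sum.map H G i)) :=
    measurable_pi_iff.2 fun i => measurable_pi_apply _
  have hww : (fun i => w (Sum.map H G i)) = w' := by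
    funext i; rcases i with e | v
    · exact h.edges e
    · exact h.bits v
  have e0 := EE_reindex w (Sum.map H G : I → I) hinj m2
  rw [hww] at e0
  rw [← e0, EE_splice w (Set.range Sum.inl) m1 (fun x => hC _),
    EE_splice w (Set.range Sum.inl) (F := fun x => f (sig Set.univ fun i => x (Sum.map H G i)))
      (m2.comp mG) (fun x => hC _)]
  refine integral_congr_ae ?_
  filter_upwards [h.clus] with x hx
  set η := ed Set.univ x
  set η' := ed Set.univ (fun i => x (Sum.map H G i))
  have s1 : ∀ y, ed Set.univ (splice (Set.range Sum.inl) x y) = η := by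
    intro y; ext e; simp [ed, η, splice]
  have s2 : ∀ y, ed Set.univ (fun i => splice (Set.range Sum.inl) x y (Sum.map H G i)) = η' := by
    intro y; ext e; simp [ed, η', splice]
  have c1 := cl_reidx h.joins x
  have key := EE_reps w (R := ⟨fun u v => cl η' u v, ⟨fun _ => cl.refl, cl.symm, cl.trans⟩⟩)
    (ρ := fun v => rep η (G v)) (ρ' := fun v => G (rep η' v))
    (fun u v => (c1 u v).trans rep_inj) (fun u v => by
      rw [G.injective.eq_iff]; exact rep_inj)
    (fun v => hx _ _ ((rep_cl η (G v)).symm.trans ((c1 _ _).1 (rep_cl η' v)))) hf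
  convert key using 2
  · funext y
    congr 1; funext v
    simp only [sig, s1]
    simp [splice]
  · funext y
    congr 1; funext v
    simp only [sig, s2]
    simp [splice]

end DaC

namespace DaC

/-! ### The models -/

/-- weights: edges open with probability `pe`, bits true with probability `t` unless frozen -/
noncomputable def Wt (pe : ℝ) (fz : V → Option Bool) (t : ℝ) : I → ℝ := fun i => match i with
  | .inl _ => pe
  | .inr v => match fz v with
    | none => t
    | some b => if b then 1 else 0

/-- admissible models -/
def Mok (pe : ℝ) (fz : V → Option Bool) : Prop :=
  (pe = 0 ∧ ∀ g, Sy g → ∀ v, fz (g v) = fz v) ∨ fz = fun _ => none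

lemma PP_coord {ι : Type*} (w : ι → ℝ) (i : ι) (b : Bool) :
    (PP w).real {x | x i = b} = wt (w i) b := by
  have h := Measure.infinitePi_map_eval (fun i : ι => ber (w i)) i
  have h2 : (PP w).real {x | x i = b} = ((PP w).map (fun x => x i)).real {b} := by
    rw [map_measureReal_apply (measurable_pi_apply i) (MeasurableSet.of_discrete)]; rfl
  rw [h2]
  unfold PP
  erw [h]
  have h1 := integral_ber (w i) (fun c => if c = b then 1 else 0)
  have h3 : ∫ c, (if c = b then (1 : ℝ) else 0) ∂(ber (w i)) = (ber (w i)).real {b} := by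
    rw [← integral_indicator_one (MeasurableSet.of_discrete)]
    congr 1; funext c
    by_cases hc : c = b <;> simp [hc]
  rw [← h3, h1]
  cases b <;> simp [wt]

lemma ae_closed (w : I → ℝ) (h : ∀ e, w (.inl e) = 0) : ∀ᵐ x ∂(PP w), ed Set.univ x = ∅ := by
  have : ∀ e : Ed, ∀ᵐ x ∂(PP w), x (.inl e) = false := by
    intro e
    have h1 := PP_coord w (.inl e) true
    rw [h e] at h1
    have h2 : wt 0 true = 0 := by simp [wt, clamp_eq]
    rw [h2] at h1
    have h3 := (measureReal_eq_zero_iff).1 h1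
    rw [ae_iff]
    simpa using h3
  filter_upwards [ae_all_iff.2 this] with x hx
  ext e
  simp [ed, hx e]

lemma cl_empty {u v : V} (h : cl ∅ u v) : u = v := by
  refine h.inv (P := fun v => u = v) rfl ?_
  rintro a b - - ⟨e, he, -⟩
  exact absurd he (Set.notMem_empty _)

lemma Mok.clus {pe : ℝ} {fz : V → Option Bool} (h : Mok pe fz) (t : ℝ) :
    ∀ᵐ x ∂(PP (Wt pe fz t)), ∀ u v, cl (ed Set.univ x) u v → Wt pe fz t (.inr u) = Wt pe fz t (.inr v) := by
  rcases h with ⟨rfl, -⟩ | rfl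
  · filter_upwards [ae_closed (Wt 0 fz t) (fun _ => rfl)] with x hx u v huv
    rw [hx] at huv
    rw [cl_empty huv]
  · exact Filter.Eventually.of_forall fun x u v _ => rfl

lemma ind_comp_meas {A : Set (V → Bool)} (hA : MeasurableSet A) : Measurable (ind A) := by
  unfold ind
  exact measurable_const.indicator hA

lemma ind_bound {α : Type*} (A : Set α) (x : α) : ‖ind A x‖ ≤ 1 := by
  rw [Real.norm_of_nonneg (ind_nonneg _ _)]; exact ind_le_one _ _

lemma Reidx.mu {w w' : I → ℝ} {G : V ≃ V} {H : Ed ≃ Ed} (h : Reidx w w' G H) {A : Set (V → Bool)}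
    (hA : MeasurableSet A) : (DaC.mu w).real {ξ | (fun v => ξ (G v)) ∈ A} = (DaC.mu w').real A := by
  have m : MeasurableSet {ξ : V → Bool | (fun v => ξ (G v)) ∈ A} :=
    (measurable_pi_iff.2 fun v => measurable_pi_apply _ : Measurable fun (ξ : V → Bool) v => ξ (G v)) hA
  rw [mu_EE _ m, mu_EE _ hA, ← h.inv (ind_comp_meas hA) (fun ξ => ind_bound A ξ)]
  rfl

theorem Mok.rsw {pe : ℝ} {fz : V → Option Bool} (h : Mok pe fz) (t : ℝ) : Rsw (mu (Wt pe fz t)) where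
  prob := inferInstance
  inv := by
    intro g hg A hA
    obtain ⟨G, H, h1, h2⟩ := hg.lift
    have hb : ∀ v, fz (G v) = fz v := by
      rcases h with ⟨-, h⟩ | rfl
      · intro v; rw [h1]; exact h g hg v
      · intro v; rfl
    have hr : Reidx (Wt pe fz t) (Wt pe fz t) G H :=
      ⟨h2, fun e => rfl, fun v => by simp only [Wt, hb], h.clus t⟩
    rw [← hr.mu hA.meas]
    congr 1
    ext ξ
    have : ξ ∘ g = fun v => ξ (G v) := by funext v; simp [h1]
    simp only [Set.mem_setOf_eq, this]
  fkg := fun A B => mu_fkg _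

/-- translation invariance without frozen sites -/
lemma shift_mu (pe t : ℝ) (a b : ℤ) {A : Set (V → Bool)} (hA : MeasurableSet A) :
    (mu (Wt pe (fun _ => none) t)).real {ξ | (fun v => ξ (v + (a, b))) ∈ A} = (mu (Wt pe (fun _ => none) t)).real A :=
  Reidx.mu (G := Equiv.addRight ((a, b) : V)) ⟨shift_joins a b, fun _ => rfl, fun _ => rfl, Mok.clus (Or.inr rfl) t⟩ hA

lemma sig_flp (D : Set V) (x : I → Bool) : sig D (flp x) = fun v => !sig D x v := by
  have : ed D (flp x) = ed D x := by ext e; simp [ed, flp]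
  funext v
  simp [sig, this, flp]

lemma flw_Wt (pe : ℝ) (fz : V → Option Bool) (t : ℝ) :
    flw (Wt pe fz t) = Wt pe (fun v => (fz v).map not) (1 - t) := by
  funext i
  rcases i with e | v
  · rfl
  · simp only [flw, Wt]
    rcases fz v with _ | b
    · rfl
    · cases b <;> simp

lemma Mok.flip {pe : ℝ} {fz : V → Option Bool} (h : Mok pe fz) : Mok pe (fun v => (fz v).map not) := by
  rcases h with ⟨h1, h2⟩ | rfl
  · exact Or.inl ⟨h1, fun g hg v => by simp only [h2 g hg v]⟩
  · exact Or.inr rfl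

lemma mu_flip (w : I → ℝ) {A : Set (V → Bool)} (hA : MeasurableSet A) :
    (mu (flw w)).real A = (mu w).real {ξ | (fun v => !ξ v) ∈ A} := by
  have m : MeasurableSet {ξ : V → Bool | (fun v => !ξ v) ∈ A} :=
    (measurable_pi_iff.2 fun v => (measurable_from_top (f := not)).comp (measurable_pi_apply _) :
      Measurable fun (ξ : V → Bool) v => !ξ v) hA
  have hA' : MeasurableSet {x | sig Set.univ x ∈ A} := sig_meas hA
  rw [mu_real _ hA, mu_real _ m, ← PP_flp, map_measureReal_apply flp_meas hA']
  have : flp ⁻¹' {x | sig Set.univ x ∈ A} = {x | sig Set.univ x ∈ {ξ | (fun v => !ξ v) ∈ A}} := by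
    ext x
    simp only [Set.mem_preimage, Set.mem_setOf_eq, sig_flp]
  rw [this]

/-! ### Quasi-locality -/

/-- box around `v` -/
def bl (v : V) (R : ℕ) : Set V := {u | nm (u - v) ≤ R}

lemma bl_finite (v : V) (R : ℕ) : (bl v R).Finite := by
  have := (Lam_finite R).image (fun u => u + v)
  refine this.subset (fun u hu => ⟨u - v, hu, by simp⟩)

/-- the cluster of `v` reaches distance `R` -/
def rad (x : I → Bool) (v : V) (R : ℕ) : Prop := ∃ u, (R : ℤ) ≤ nm (u - v) ∧ cl (ed (bl v R) x) v u

lemma nm_tri (a b c : V) : nm (a - c) ≤ nm (a - b) + nm (b - c) := by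
  simp only [nm, Prod.fst_sub, Prod.snd_sub, abs_eq_max_neg]
  omega
lemma nm_comm (a b : V) : nm (a - b) = nm (b - a) := by
  simp only [nm, Prod.fst_sub, Prod.snd_sub, abs_eq_max_neg]
  omega
lemma nm_nonneg (a : V) : 0 ≤ nm a := by
  simp only [nm, abs_eq_max_neg]
  omega
lemma nm_self (a : V) : nm (a - a) = 0 := by
  simp [nm]
lemma Joins.nm {e : Ed} {u v : V} (h : Joins e u v) : DaC.nm (v - u) = 1 := by
  obtain ⟨⟨e1, e2⟩, c⟩ := e
  rcases h with ⟨rfl, rfl⟩ | ⟨rfl, rfl⟩ <;> cases c <;> simp [DaC.nm, nx]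

lemma not_rad {x : I → Bool} {v u : V} {R : ℕ} (h : ¬ rad x v R) (hu : cl (ed Set.univ x) v u) :
    cl (ed (bl v R) x) v u ∧ nm (u - v) < R := by
  have h0 : ∀ u, cl (ed (bl v R) x) v u → nm (u - v) < R := fun u hu => by
    by_contra h'
    exact h ⟨u, not_lt.1 h', hu⟩
  suffices cl (ed (bl v R) x) v u from ⟨this, h0 u this⟩
  refine hu.inv (P := fun u => cl (ed (bl v R) x) v u) cl.refl ?_
  rintro a b - ha ⟨e, he, hj⟩
  have h1 := h0 a ha
  have h2 := hj.nm
  have h3 := nm_tri b a v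
  have hbl : a ∈ bl v R ∧ b ∈ bl v R := ⟨h1.le, by show nm (b - v) ≤ R; omega⟩
  refine ha.tail ⟨e, ⟨he.1, ?_⟩, hj⟩
  rcases hj with ⟨rfl, rfl⟩ | ⟨rfl, rfl⟩
  · exact hbl
  · exact hbl.symm

lemma not_rad_rep {x : I → Bool} {v : V} {R : ℕ} (h : ¬ rad x v R) {D : Set V} (hD : bl v R ⊆ D) :
    rep (ed D x) v = rep (ed Set.univ x) v :=
  rep_congr fun _ => ⟨cl.mono (ed_mono (Set.subset_univ _) x), fun hw => ((not_rad h hw).1).mono (ed_mono hD x)⟩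

lemma not_rad_sig {x : I → Bool} {v : V} {R : ℕ} (h : ¬ rad x v R) {D : Set V} (hD : bl v R ⊆ D) :
    sig D x v = sig Set.univ x v := by
  unfold sig; rw [not_rad_rep h hD]

/-- locally computed colouring -/
noncomputable def sg (R : ℕ) (x : I → Bool) : V → Bool := fun v => sig (bl v R) x v

lemma rad_dep (v : V) (R : ℕ) : DependsOn (fun x => rad x v R) (idx (bl v R) (bl_finite v R) : Set I) := by
  intro x y h
  simp only [rad, ed_congr (bl_finite v R) h]

lemma rad_loc (v : V) (R : ℕ) : Loc (fun x => rad x v R) := ⟨_, rad_dep v R⟩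

lemma sg_dep (v : V) (R : ℕ) : DependsOn (fun x => sg R x v) (idx (bl v R) (bl_finite v R) : Set I) :=
  sig_dep _ (by show nm (v - v) ≤ R; rw [nm_self]; positivity)

/-- decay of edge clusters -/
def Dec (pe : ℝ) : Prop := ∀ C : ℕ, ∃ K : ℝ, 0 < K ∧ ∀ w : I → ℝ, (∀ e, w (.inl e) = pe) → ∀ v, ∀ R : ℕ, 1 ≤ R →
  (PP w).real {x | rad x v R} ≤ K / (R : ℝ) ^ C

lemma dec_zero : Dec 0 := by
  intro C
  refine ⟨1, one_pos, fun w hw v R hR => ?_⟩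
  have : (PP w).real {x | rad x v R} = 0 := by
    rw [measureReal_eq_zero_iff]
    have := ae_closed w hw
    refine measure_mono_null ?_ (ae_iff.1 this)
    rintro x ⟨u, h1, h2⟩ h3
    have h4 := cl_empty (h3 ▸ h2.mono (ed_mono (Set.subset_univ _) x))
    rw [h4, nm_self] at h1
    omega
  rw [this]; positivity

end DaC

namespace DaC

/-! ### Arms and blocking circuits -/

lemma Con_dep {adj : V → V → Prop} {D A B : Set V} : DependsOn (fun ξ => ξ ∈ Con adj D A B) D := by
  intro x y h
  have : D ∩ Gt x = D ∩ Gt y := by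
    ext v
    simp only [Set.mem_inter_iff, Gt, Set.mem_setOf_eq]
    constructor <;> rintro ⟨h1, h2⟩
    · exact ⟨h1, by rw [← h v h1]; exact h2⟩
    · exact ⟨h1, by rw [h v h1]; exact h2⟩
  simp only [Con, Set.mem_setOf_eq, this]

/-- arm from the box of radius `a` to distance `b` -/
def Arm (adj : V → V → Prop) (a b : ℕ) : Set (V → Bool) :=
  Con adj (Lam b) (Lam a) {v | nm v = b}

lemma Arm.inc {adj a b} : Inc (Arm adj a b) := Con.inc (Lam_finite b)

lemma Arm.of {adj : V → V → Prop} (ok : Okay adj) {a b : ℕ} (hab : a ≤ b) {ξ : V → Bool} {u v : V}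
    (hu : nm u ≤ a) (hv : b ≤ nm v) (h : CI adj (Gt ξ) u v) : ξ ∈ Arm adj a b := by
  obtain ⟨b', h1, h2⟩ := h.firstPart nm ok.lipn (m := b) (by omega) hv
  exact ⟨u, hu, b', h1, h2.monoS (fun z hz => ⟨hz.2, hz.1⟩)⟩

lemma Arm.mono {adj : V → V → Prop} (ok : Okay adj) {a b a' b' : ℕ} (ha : a ≤ a') (hb : b' ≤ b) (hab : a' ≤ b') :
    Arm adj a b ⊆ Arm adj a' b' := by
  rintro ξ ⟨u, hu, v, hv, h⟩
  have hu' : nm u ≤ a := hu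
  have hv' : nm v = b := hv
  exact Arm.of ok hab (by omega) (by omega) (h.monoS Set.inter_subset_right)

/-- annulus -/
def Ann (a b : ℕ) : Set V := {v | a ≤ nm v ∧ nm v ≤ b}
lemma Ann_finite (a b : ℕ) : (Ann a b).Finite := (Lam_finite b).subset fun _ h => h.2

lemma Blk_dep {adj : V → V → Prop} (m : ℕ) : DependsOn (fun ξ => ξ ∈ Blk adj m) (Ann m (3 * m)) := by
  have hs : ∀ x0 x1 y0 y1 : ℤ, (∀ v ∈ Box x0 x1 y0 y1, v ∈ Ann m (3*m)) → ∀ A B : Set V,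
      ∀ x y : V → Bool, (∀ v ∈ Ann m (3*m), x v = y v) →
      (x ∈ Con adj (Box x0 x1 y0 y1) A B ↔ y ∈ Con adj (Box x0 x1 y0 y1) A B) :=
    fun x0 x1 y0 y1 h A B x y hxy => iff_of_eq (Con_dep (fun v hv => hxy v (h v hv)))
  intro x y hxy
  have hbox : ∀ v : V, (m : ℤ) ≤ v.1 ∨ (m : ℤ) ≤ -v.1 ∨ (m : ℤ) ≤ v.2 ∨ (m : ℤ) ≤ -v.2 →
      -(3*m : ℤ) ≤ v.1 → v.1 ≤ 3*m → -(3*m : ℤ) ≤ v.2 → v.2 ≤ 3*m → v ∈ Ann m (3*m) := by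
    intro v h1 h2 h3 h4 h5
    refine ⟨?_, nm_le.2 (by push_cast; exact ⟨h2, h3, h4, h5⟩)⟩
    have := nm_le.1 (le_refl (nm v))
    omega
  refine propext ?_
  simp only [Blk, Set.mem_inter_iff, LR, TB]
  refine and_congr (hs _ _ _ _ ?_ _ _ x y hxy) (and_congr (hs _ _ _ _ ?_ _ _ x y hxy) (and_congr (hs _ _ _ _ ?_ _ _ x y hxy) (hs _ _ _ _ ?_ _ _ x y hxy)))
  all_goals
    intro v hv
    simp only [Box, Set.mem_setOf_eq] at hv
    refine hbox v ?_ ?_ ?_ ?_ ?_ <;> omega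

/-- union bound for the event that some radius is large -/
lemma rad_union (w : I → ℝ) (S : Finset V) (R : ℕ) {c : ℝ} (h : ∀ v ∈ S, (PP w).real {x | rad x v R} ≤ c) :
    (PP w).real {x | ∃ v ∈ S, rad x v R} ≤ S.card * c := by
  have : {x | ∃ v ∈ S, rad x v R} = ⋃ v ∈ S, {x | rad x v R} := by ext x; simp
  rw [this]
  refine (measureReal_biUnion_finset_le S _).trans ?_
  calc ∑ v ∈ S, (PP w).real {x | rad x v R} ≤ ∑ v ∈ S, c := Finset.sum_le_sum h
    _ = S.card * c := by simp

lemma sg_iff {A : Set (V → Bool)} {S : Finset V} (hd : DependsOn (fun ξ => ξ ∈ A) (S : Set V)) {R : ℕ} {x : I → Bool}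
    (h : ¬ ∃ v ∈ S, rad x v R) : sg R x ∈ A ↔ sig Set.univ x ∈ A := by
  refine iff_of_eq (hd (fun v hv => ?_))
  exact not_rad_sig (fun h' => h ⟨v, hv, h'⟩) subset_rfl

lemma ind_congr {α β : Type*} {A : Set α} {B : Set β} {x : α} {y : β} (h : x ∈ A ↔ y ∈ B) : ind A x = ind B y := by
  by_cases hx : x ∈ A
  · rw [ind_mem hx, ind_mem (h.1 hx)]
  · rw [ind_not hx, ind_not (fun hy => hx (h.2 hy))]

lemma ind_dep {ι : Type*} {A : Set (ι → Bool)} {S : Set ι} (h : DependsOn (fun x => x ∈ A) S) :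
    DependsOn (ind A) S := fun _ _ hxy => ind_congr (iff_of_eq (h hxy))

lemma indep_inter {ι : Type*} [DecidableEq ι] (w : ι → ℝ) (J : Finset ℕ) (E : ℕ → Set (ι → Bool)) (S : ℕ → Finset ι)
    (hE : ∀ j, DependsOn (fun x => x ∈ E j) (S j : Set ι))
    (hd : ∀ i ∈ J, ∀ j ∈ J, i ≠ j → Disjoint (S i) (S j)) :
    (PP w).real {x | ∀ j ∈ J, x ∈ E j} = ∏ j ∈ J, (PP w).real (E j) := by
  induction J using Finset.induction_on with
  | empty => simp
  | insert a J ha ih =>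
    rw [Finset.prod_insert ha, ← ih (fun i hi j hj => hd i (Finset.mem_insert_of_mem hi) j (Finset.mem_insert_of_mem hj))]
    have d1 : DependsOn (ind (E a)) (S a : Set ι) := ind_dep (hE a)
    have d2' : DependsOn (fun x => x ∈ {x | ∀ j ∈ J, x ∈ E j}) (J.biUnion S : Set ι) := fun x y h => by
      refine propext (forall₂_congr fun j hj => iff_of_eq (hE j fun i hi => h i ?_))
      exact Finset.mem_coe.2 (Finset.mem_biUnion.2 ⟨j, hj, hi⟩)
    have d2 : DependsOn (ind {x | ∀ j ∈ J, x ∈ E j}) (J.biUnion S : Set ι) := ind_dep d2'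
    have hdis : Disjoint (S a) (J.biUnion S) := by
      rw [Finset.disjoint_biUnion_right]
      intro j hj
      exact hd a (Finset.mem_insert_self _ _) j (Finset.mem_insert_of_mem hj) (fun e => ha (e ▸ hj))
    have l1 : MeasurableSet (E a) := loc_meas (⟨_, hE a⟩)
    have l2 : MeasurableSet {x | ∀ j ∈ J, x ∈ E j} := loc_meas (⟨_, d2'⟩)
    have key := EE_indep' w d1 d2 hdis
    rw [EE_ind w l1, EE_ind w l2] at key
    rw [← key]
    have l3 : MeasurableSet {x | ∀ j ∈ insert a J, x ∈ E j} := by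
      have : {x | ∀ j ∈ insert a J, x ∈ E j} = E a ∩ {x | ∀ j ∈ J, x ∈ E j} := by ext x; simp
      rw [this]; exact l1.inter l2
    rw [← EE_ind w l3]
    congr 1; funext x
    by_cases h1 : x ∈ E a
    · by_cases h2 : x ∈ {x | ∀ j ∈ J, x ∈ E j}
      · rw [ind_mem h1, ind_mem h2, ind_mem (show x ∈ {x | ∀ j ∈ insert a J, x ∈ E j} from
          (Finset.forall_mem_insert _ _ _).2 ⟨h1, h2⟩), one_mul]
      · rw [ind_not h2, mul_zero]
        exact ind_not (fun h => h2 ((Finset.forall_mem_insert _ _ _).1 h).2)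
    · rw [ind_not h1, zero_mul]
      exact ind_not (fun h => h1 ((Finset.forall_mem_insert _ _ _).1 h).1)

lemma Lam_card (n : ℕ) : ((Lam_finite n).toFinset.card : ℝ) ≤ (2 * n + 1) ^ 2 := by
  have : (Lam_finite n).toFinset ⊆ (Finset.Icc (-(n:ℤ)) n) ×ˢ (Finset.Icc (-(n:ℤ)) n) := by
    intro v hv
    have := nm_le.1 (show nm v ≤ n from (Set.Finite.mem_toFinset (Lam_finite n)).1 hv)
    simp only [Finset.mem_product, Finset.mem_Icc]; omega
  have h2 := Finset.card_le_card this
  rw [Finset.card_product, Int.card_Icc] at h2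
  have h3 : ((n:ℤ) + 1 - -(n:ℤ)).toNat = 2 * n + 1 := by omega
  rw [h3] at h2
  calc ((Lam_finite n).toFinset.card : ℝ) ≤ (((2 * n + 1) * (2 * n + 1) : ℕ) : ℝ) := by exact_mod_cast h2
    _ = _ := by push_cast; ring

end DaC

namespace DaC

/-! ### One of the two colours has small arms -/

lemma flw_flw (w : I → ℝ) : flw (flw w) = w := by
  funext i; rcases i with e | v <;> simp [flw]

lemma cJ_q : 0 < cJ ^ 20 ∧ cJ ^ 20 ≤ 1 := by
  refine ⟨pow_pos cJ_pos _, pow_le_one₀ cJ_pos.le ?_⟩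
  unfold cJ; norm_num

/-- indices seen by the annulus at scale `j` -/
noncomputable def annIdx (j : ℕ) : Finset I := by
  classical
  exact (Ann_finite (18 * 8 ^ j) (3 * (18 * 8 ^ j))).toFinset.biUnion (fun v => idx (bl v (8 ^ j)) (bl_finite v (8 ^ j)))

lemma mem_annIdx {j : ℕ} {i : I} (h : i ∈ annIdx j) : ∃ u : V, (i = .inr u ∨ ∃ e : Ed, i = .inl e ∧ e.1 = u) ∧
    17 * 8 ^ j ≤ nm u ∧ nm u ≤ 55 * 8 ^ j := by
  classical
  simp only [annIdx, Finset.mem_biUnion, Set.Finite.mem_toFinset] at h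
  obtain ⟨v, hv, hi⟩ := h
  have h1 : (18 * 8 ^ j : ℤ) ≤ nm v ∧ nm v ≤ 3 * (18 * 8 ^ j) := by
    have := hv.1; have := hv.2; push_cast at *; constructor <;> assumption
  have h2 : ∀ u ∈ bl v (8 ^ j), (17 * 8 ^ j : ℤ) ≤ nm u ∧ nm u ≤ 55 * 8 ^ j := by
    intro u hu
    have hu' : nm (u - v) ≤ ((8 ^ j : ℕ) : ℤ) := hu
    push_cast at hu'
    have e1 := nm_tri u v 0
    have e2 := nm_tri v u 0
    rw [nm_comm v u] at e2
    simp only [sub_zero] at e1 e2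
    omega
  rcases i with e | u
  · exact ⟨e.1, Or.inr ⟨e, rfl, rfl⟩, h2 _ (mem_idx_inl.1 hi).1⟩
  · exact ⟨u, Or.inl rfl, h2 _ (mem_idx_inr.1 hi)⟩

lemma annIdx_disj {i j : ℕ} (h : i ≠ j) : Disjoint (annIdx i) (annIdx j) := by
  have key : ∀ i j, i < j → Disjoint (annIdx i) (annIdx j) := by
    intro i j hij
    rw [Finset.disjoint_left]
    intro a ha hb
    obtain ⟨u, hu, h1, h2⟩ := mem_annIdx ha
    obtain ⟨v, hv, h3, h4⟩ := mem_annIdx hb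
    have huv : u = v := by
      rcases hu with rfl | ⟨e, rfl, rfl⟩
      · rcases hv with h | ⟨e', h, -⟩
        · exact Sum.inr.inj h
        · exact absurd h (by simp)
      · rcases hv with h | ⟨e', h, rfl⟩
        · exact absurd h (by simp)
        · rw [Sum.inl.inj h]
    subst huv
    have : (8:ℤ) ^ (i + 1) ≤ 8 ^ j := pow_le_pow_right₀ (by norm_num) hij
    have h8 : (0:ℤ) < 8 ^ i := by positivity
    rw [pow_succ] at this
    omega
  rcases lt_or_gt_of_ne h with h | h
  · exact key _ _ h
  · exact (key _ _ h).symm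

theorem blk_arm {pe : ℝ} (hdec : Dec pe) : ∃ C : ℝ, 0 < C ∧ ∃ ρ : ℝ, 0 < ρ ∧ ρ < 1 ∧
    ∀ w : I → ℝ, (∀ e, w (.inl e) = pe) → ∀ adj adj', Dual adj adj' → ∀ (k : ℕ) (J : Finset ℕ),
    (∀ j ∈ J, k ≤ 2 * j + 1 ∧ j < k) → (∀ j ∈ J, cJ ^ 20 ≤ (mu w).real (Blk adj (18 * 8 ^ j))) →
    k ≤ 8 * J.card + 8 → (mu (flw w)).real (Arm adj' 18 (54 * 8 ^ k)) ≤ C * ρ ^ k := by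
  obtain ⟨K, hK, hrad⟩ := hdec 3
  obtain ⟨q0, q1⟩ := cJ_q
  set q := cJ ^ 20 with hq
  set M := 12100 * K with hM
  have hM0 : 0 < M := by positivity
  set ρ := 1 - q / 16 with hρ
  have hρ0 : 15 / 16 ≤ ρ := by rw [hρ]; linarith
  have hρ1 : ρ < 1 := by rw [hρ]; linarith
  have hρ8 : 1 - q / 2 ≤ ρ ^ 8 := by
    have := one_add_mul_le_pow (a := -(q/16)) (by linarith) 8
    have e : (1 + -(q/16)) = ρ := by rw [hρ]; ring
    rw [e] at this
    push_cast at this; linarith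
  refine ⟨4 * M + 1 / ρ ^ 8 + 4 * M / q, by positivity, ρ, by linarith, hρ1, ?_⟩
  intro w hw adj adj' hdual k J hJ hB hcard
  have hρk : (1/2 : ℝ) ^ k ≤ ρ ^ k := pow_le_pow_left₀ (by norm_num) (by linarith) k
  have hρk0 : 0 < ρ ^ k := by have : 0 < ρ := by linarith
                              positivity
  have h1ρ8 : 0 ≤ 1 / ρ ^ 8 := by positivity
  by_cases hsmall : q / 2 < 2 * M * (1/2) ^ k
  · refine measureReal_le_one.trans ?_
    have : 1 ≤ 4 * M / q * (1/2) ^ k := by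
      rw [div_mul_eq_mul_div, le_div_iff₀ q0]; linarith
    have h2 : 4 * M / q * (1/2) ^ k ≤ 4 * M / q * ρ ^ k := by gcongr
    have h3 : 0 ≤ (4 * M + 1 / ρ ^ 8) * ρ ^ k := by positivity
    nlinarith
  push Not at hsmall
  -- error events
  set Sj : ℕ → Finset V := fun j => (Ann_finite (18 * 8 ^ j) (3 * (18 * 8 ^ j))).toFinset with hSj
  have hSc : ∀ j, ((Sj j).card : ℝ) ≤ 12100 * (8 ^ j) ^ 2 := by
    intro j
    have h1 : Sj j ⊆ (Lam_finite (54 * 8 ^ j)).toFinset := by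
      intro v hv
      simp only [hSj, Set.Finite.mem_toFinset] at hv ⊢
      have := hv.2
      show nm v ≤ _
      push_cast at *; linarith
    have h2 : ((Sj j).card : ℝ) ≤ (Lam_finite (54 * 8 ^ j)).toFinset.card := by exact_mod_cast Finset.card_le_card h1
    refine h2.trans ((Lam_card _).trans ?_)
    push_cast
    have : (1:ℝ) ≤ 8 ^ j := one_le_pow₀ (by norm_num)
    nlinarith
  set Er : ℕ → Set (I → Bool) := fun j => {x | ∃ v ∈ Sj j, rad x v (8 ^ j)} with hEr
  have hErr : ∀ j, k ≤ 2 * j + 1 → (PP w).real (Er j) ≤ 2 * M * (1/2) ^ k := by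
    intro j hj
    have h1 := rad_union w (Sj j) (8 ^ j) (fun v _ => hrad w hw v (8 ^ j) (Nat.one_le_pow _ _ (by norm_num)))
    refine h1.trans ?_
    push_cast
    have h8 : (0:ℝ) < 8 ^ j := by positivity
    have h2 : ((Sj j).card : ℝ) * (K / (8 ^ j) ^ 3) ≤ 12100 * (8 ^ j) ^ 2 * (K / (8 ^ j) ^ 3) := by
      gcongr; exact hSc j
    refine h2.trans ?_
    have h3 : 12100 * (8 ^ j : ℝ) ^ 2 * (K / (8 ^ j) ^ 3) = M * (1 / 8 ^ j) := by
      rw [hM]; field_simp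
    have h4 : (1 / 8 ^ j : ℝ) = (1/2) ^ (3 * j) := by
      rw [pow_mul, one_div, ← inv_pow]; norm_num
    have h5 : (1/2 : ℝ) ^ (3 * j + 1) ≤ (1/2) ^ k := pow_le_pow_of_le_one (by norm_num) (by norm_num) (by omega)
    rw [h3, h4]
    rw [pow_succ] at h5
    nlinarith
  set E : ℕ → Set (I → Bool) := fun j => {x | sg (8 ^ j) x ∉ Blk adj (18 * 8 ^ j)} with hE
  have hdepB : ∀ j, DependsOn (fun ξ => ξ ∈ Blk adj (18 * 8 ^ j)) (Ann (18 * 8 ^ j) (3 * (18 * 8 ^ j))) := by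
    intro j
    have := Blk_dep (adj := adj) (18 * 8 ^ j)
    push_cast at this
    exact this
  have hEdep : ∀ j, DependsOn (fun x => x ∈ E j) (annIdx j : Set I) := by
    classical
    intro j x y hxy
    refine propext (not_congr (iff_of_eq (hdepB j (fun v hv => ?_))))
    refine sg_dep v (8 ^ j) (fun i hi => hxy i ?_)
    simp only [annIdx, Finset.mem_coe, Finset.mem_biUnion, Set.Finite.mem_toFinset]
    exact ⟨v, hv, hi⟩
  have hEmeas : ∀ j, MeasurableSet (E j) := fun j => loc_meas ⟨_, hEdep j⟩
  have hsg : ∀ j x, x ∉ Er j → (sg (8 ^ j) x ∈ Blk adj (18 * 8 ^ j) ↔ sig Set.univ x ∈ Blk adj (18 * 8 ^ j)) := by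
    intro j x hx
    refine sg_iff (S := Sj j) ?_ hx
    simpa [hSj] using hdepB j
  have hEp : ∀ j ∈ J, (PP w).real (E j) ≤ 1 - q / 2 := by
    intro j hj
    have h1 := hB j hj
    rw [mu_real w Blk.inc.meas] at h1
    have h2 : {x | sig Set.univ x ∈ Blk adj (18 * 8 ^ j)} ⊆ (E j)ᶜ ∪ Er j := by
      intro x hx
      by_cases hx' : x ∈ Er j
      · exact Or.inr hx'
      · exact Or.inl (fun h => h ((hsg j x hx').2 hx))
    have h3 := (measureReal_mono h2 (μ := PP w)).trans (measureReal_union_le _ _)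
    rw [measureReal_compl (hEmeas j)] at h3
    have h4 := hErr j (hJ j hj).1
    simp only [probReal_univ] at h3
    linarith
  have hprod : (PP w).real {x | ∀ j ∈ J, x ∈ E j} ≤ 1 / ρ ^ 8 * ρ ^ k := by
    rw [indep_inter w J E annIdx hEdep (fun i _ j _ h => annIdx_disj h)]
    have h1 : ∏ j ∈ J, (PP w).real (E j) ≤ ∏ j ∈ J, ρ ^ 8 :=
      Finset.prod_le_prod (fun _ _ => measureReal_nonneg) (fun j hj => (hEp j hj).trans hρ8)
    refine h1.trans ?_
    rw [Finset.prod_const, ← pow_mul, div_mul_eq_mul_div, one_mul, le_div_iff₀ (by positivity), ← pow_add]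
    exact pow_le_pow_of_le_one (by linarith) hρ1.le hcard
  -- conclusion
  rw [mu_flip w Arm.inc.meas]
  have hm : MeasurableSet {ξ : V → Bool | (fun v => !ξ v) ∈ Arm adj' 18 (54 * 8 ^ k)} :=
    (measurable_pi_iff.2 fun v => (measurable_from_top (f := not)).comp (measurable_pi_apply _) :
      Measurable fun (ξ : V → Bool) v => !ξ v) Arm.inc.meas
  rw [mu_real w hm]
  have hsub : {x | sig Set.univ x ∈ {ξ : V → Bool | (fun v => !ξ v) ∈ Arm adj' 18 (54 * 8 ^ k)}} ⊆
      {x | ∀ j ∈ J, x ∈ E j} ∪ ⋃ j ∈ J, Er j := by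
    rintro x ⟨u, hu, v, hv, hc⟩
    by_cases hx : ∃ j ∈ J, x ∈ Er j
    · right; simpa using hx
    · left
      intro j hj hblk
      have hx' : x ∉ Er j := fun h => hx ⟨j, hj, h⟩
      have hu' : nm u ≤ (18 : ℕ) := hu
      have hv' : nm v = (54 * 8 ^ k : ℕ) := hv
      push_cast at hu' hv'
      have h8 : (1:ℤ) ≤ 8 ^ j := one_le_pow₀ (by norm_num)
      have h8' : (8:ℤ) ^ j ≤ 8 ^ k := pow_le_pow_right₀ (by norm_num) (hJ j hj).2.le
      refine blk_blocks hdual ((hsg j x hx').1 hblk) (a := u) (b := v) (hc.monoS ?_) (by omega) (by omega)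
      intro z hz hz'
      have e1 : (!sig Set.univ x z) = true := hz.2
      have e2 : sig Set.univ x z = true := hz'
      rw [e2] at e1
      simp at e1
  have h1 := (measureReal_mono hsub (μ := PP w)).trans (measureReal_union_le _ _)
  have h2 : (PP w).real (⋃ j ∈ J, Er j) ≤ k * (2 * M * (1/2) ^ k) := by
    refine (measureReal_biUnion_finset_le J _).trans ?_
    refine (Finset.sum_le_sum (fun j hj => hErr j (hJ j hj).1)).trans ?_
    rw [Finset.sum_const, nsmul_eq_mul]
    have : J.card ≤ k := by
      have : J ⊆ Finset.range k := fun j hj => Finset.mem_range.2 (hJ j hj).2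
      simpa using Finset.card_le_card this
    have : (J.card : ℝ) ≤ k := by exact_mod_cast this
    gcongr
  have h3 : (k:ℝ) * (2 * M * (1/2) ^ k) ≤ 4 * M * ρ ^ k := by
    have e1 : (k:ℝ) ≤ 2 * (3/2) ^ k := by
      have := one_add_mul_le_pow (a := (1/2:ℝ)) (by norm_num) k
      have e : (1 + 1/2 : ℝ) = 3/2 := by norm_num
      rw [e] at this; linarith
    have e2 : (3/2 : ℝ) ^ k * (1/2) ^ k ≤ ρ ^ k := by
      rw [← mul_pow]
      exact pow_le_pow_left₀ (by norm_num) (by linarith) k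
    have e3 : (k:ℝ) * (1/2)^k ≤ 2 * (3/2)^k * (1/2)^k := by gcongr
    nlinarith
  have h4 : 0 ≤ 4 * M / q * ρ ^ k := by positivity
  calc _ ≤ _ := h1
    _ ≤ 1 / ρ ^ 8 * ρ ^ k + 4 * M * ρ ^ k := add_le_add hprod (h2.trans h3)
    _ ≤ _ := by nlinarith

end DaC

namespace DaC

lemma tb_le_lr {μ : Measure (V → Bool)} (h : Rsw μ) {adj : V → V → Prop} (ok : Okay adj) (a b : ℤ) :
    μ.real (TB adj a b a b) ≤ μ.real (LR adj a b a b) := by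
  refine h.map ok (box_finite _ _ _ _) Sy.sw ?_ ?_ ?_
  · intro v hv; simp only [Box, Set.mem_setOf_eq] at hv ⊢; omega
  · intro v _ hv; exact hv
  · intro v _ hv; exact hv

lemma half_aux {w : I → ℝ} (h2 : Rsw (mu (flw w))) (n : ℤ) (hn : 0 ≤ n) :
    1 ≤ (mu w).real (LR SqAdj (-n) n (-n) n) + (mu (flw w)).real (LR StarAdj (-n) n (-n) n) := by
  have h3 := tb_le_lr h2 (Or.inr rfl : Okay StarAdj) (-n) n
  rw [mu_flip w TB.inc.meas] at h3
  have hu : (Set.univ : Set (V → Bool)) ⊆ LR SqAdj (-n) n (-n) n ∪ {ξ | (fun v => !ξ v) ∈ TB StarAdj (-n) n (-n) n} := by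
    intro ξ _
    rcases dual_exists (-n) n (-n) n (by omega) (by omega) (Gt ξ) with ⟨a, b, ha, hb, hc⟩ | ⟨a, b, ha, hb, hc⟩
    · exact Or.inl ⟨a, ha, b, hb, hc⟩
    · refine Or.inr ⟨a, ha, b, hb, hc.monoS (fun v hv => ⟨hv.1, ?_⟩)⟩
      have : ¬ ξ v = true := hv.2
      simpa [Gt] using this
  have := (measureReal_mono hu (μ := mu w)).trans (measureReal_union_le _ _)
  simp only [probReal_univ] at this
  linarith

lemma half_lr {w : I → ℝ} (h1 : Rsw (mu w)) (h2 : Rsw (mu (flw w))) {adj adj' : V → V → Prop}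
    (hd : Dual adj adj') (n : ℤ) (hn : 0 ≤ n) :
    1/2 ≤ (mu w).real (LR adj (-n) n (-n) n) ∨ 1/2 ≤ (mu (flw w)).real (LR adj' (-n) n (-n) n) := by
  have : 1 ≤ (mu w).real (LR adj (-n) n (-n) n) + (mu (flw w)).real (LR adj' (-n) n (-n) n) := by
    rcases hd with ⟨rfl, rfl⟩ | ⟨rfl, rfl⟩
    · exact half_aux h2 n hn
    · have := half_aux (w := flw w) (by rwa [flw_flw]) n hn
      rw [flw_flw] at this
      linarith
  by_contra! h
  linarith [h.1, h.2]

open Classical in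
theorem one_small {pe : ℝ} (hdec : Dec pe) : ∃ C : ℝ, 0 < C ∧ ∃ ρ : ℝ, 0 < ρ ∧ ρ < 1 ∧
    ∀ fz, Mok pe fz → ∀ t, ∀ adj adj', Dual adj adj' → ∀ k : ℕ,
    (mu (Wt pe fz t)).real (Arm adj 18 (54 * 8 ^ k)) ≤ C * ρ ^ k ∨
    (mu (flw (Wt pe fz t))).real (Arm adj' 18 (54 * 8 ^ k)) ≤ C * ρ ^ k := by
  obtain ⟨C, hC, ρ, hρ0, hρ1, H⟩ := blk_arm hdec
  refine ⟨C, hC, ρ, hρ0, hρ1, fun fz hfz t adj adj' hd k => ?_⟩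
  set w := Wt pe fz t with hw
  have r1 : Rsw (mu w) := hfz.rsw t
  have r2 : Rsw (mu (flw w)) := by rw [hw, flw_Wt]; exact hfz.flip.rsw _
  have c1 := rsw_count r1 hd.ok1 k
  have c2 := rsw_count r2 hd.ok2 k
  set Bb := (Finset.range k).filter (BadJ (mu w) adj)
  set Bw := (Finset.range k).filter (BadJ (mu (flw w)) adj')
  set T := Finset.Ico (k/2) k with hT
  set Jb := T.filter (fun j => cJ ^ 20 ≤ (mu w).real (Blk adj (18 * 8 ^ j)))
  set Jw := T.filter (fun j => cJ ^ 20 ≤ (mu (flw w)).real (Blk adj' (18 * 8 ^ j)))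
  have hsub : T ⊆ (Jb ∪ Jw) ∪ (Bb ∪ Bw) := by
    intro j hj
    have hj' : j ∈ Finset.range k := by rw [hT, Finset.mem_Ico] at hj; exact Finset.mem_range.2 hj.2
    by_contra hcon
    simp only [Finset.mem_union, not_or] at hcon
    obtain ⟨⟨n1, n2⟩, n3, n4⟩ := hcon
    have n1' : (mu w).real (Blk adj (18 * 8 ^ j)) < cJ ^ 20 := by
      by_contra! h; exact n1 (Finset.mem_filter.2 ⟨hj, h⟩)
    have n2' : (mu (flw w)).real (Blk adj' (18 * 8 ^ j)) < cJ ^ 20 := by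
      by_contra! h; exact n2 (Finset.mem_filter.2 ⟨hj, h⟩)
    rcases half_lr r1 r2 hd (16 * 8 ^ j) (by positivity) with h | h
    · exact n3 (Finset.mem_filter.2 ⟨hj', h, n1'⟩)
    · exact n4 (Finset.mem_filter.2 ⟨hj', h, n2'⟩)
  have hc := Finset.card_le_card hsub
  have u1 := Finset.card_union_le (Jb ∪ Jw) (Bb ∪ Bw)
  have u2 := Finset.card_union_le Jb Jw
  have u3 := Finset.card_union_le Bb Bw
  have hTc : T.card = k - k / 2 := by rw [hT, Nat.card_Ico]
  have hor : k ≤ 8 * Jb.card + 8 ∨ k ≤ 8 * Jw.card + 8 := by omega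
  rcases hor with h | h
  · right
    refine H w (fun e => rfl) adj adj' hd k Jb (fun j hj => ?_) (fun j hj => (Finset.mem_filter.1 hj).2) h
    have := Finset.mem_Ico.1 (Finset.mem_filter.1 hj).1
    omega
  · left
    have := H (flw w) (fun e => rfl) adj' adj hd.symm k Jw (fun j hj => ?_) (fun j hj => (Finset.mem_filter.1 hj).2) h
    · rwa [flw_flw] at this
    have := Finset.mem_Ico.1 (Finset.mem_filter.1 hj).1
    omega

end DaC

namespace DaC

/-! ### The exploration for the OSSS inequality -/

/-- vertices reached by the exploration started at distance `m`, with revealed set `K` -/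
inductive Rk (adj : V → V → Prop) (D : Set V) (N m : ℕ) (K : Set I) (z : I → Bool) : V → Prop
  | base (v : V) (h : nm v = m) : Rk adj D N m K z v
  | edge (u v : V) (h : Rk adj D N m K z u) (h' : EA (ed D z) u v) : Rk adj D N m K z v
  | step (u v : V) (h : Rk adj D N m K z u) (hu : u ∈ Lam N) (hv : v ∈ Lam N) (ha : adj u v)
      (hK : ∀ e : Ed, e.1 ∈ D → nx e ∈ D → (cl (ed D z) u e.1 ∨ cl (ed D z) u (nx e)) → Sum.inl e ∈ K)
      (hb : z (.inr (rep (ed D z) u)) = true) : Rk adj D N m K z v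

/-- an index touches a vertex -/
def touch (i : I) (u : V) : Prop := match i with
  | .inl e => e.1 = u ∨ nx e = u
  | .inr v => v = u

/-- the full revealed set -/
def Full (adj : V → V → Prop) (D : Set V) (N m : ℕ) (x : I → Bool) : Set I :=
  {i | ∃ u, Rk adj D N m Set.univ x u ∧ touch i u}

lemma cl_same {D : Set V} {x z : I → Bool} {K : Set I} (hx : ∀ i ∈ K, x i = z i) {u : V}
    (hK : ∀ e : Ed, e.1 ∈ D → nx e ∈ D → (cl (ed D z) u e.1 ∨ cl (ed D z) u (nx e)) → Sum.inl e ∈ K)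
    (w : V) : cl (ed D z) u w ↔ cl (ed D x) u w := by
  constructor
  · intro h
    refine h.inv (P := fun w => cl (ed D x) u w) cl.refl ?_
    rintro a b h1 h2 ⟨e, he, hj⟩
    refine h2.tail ⟨e, ⟨?_, he.2⟩, hj⟩
    rw [hx _ (hK e he.2.1 he.2.2 ?_)]
    · exact he.1
    · rcases hj with ⟨rfl, rfl⟩ | ⟨rfl, rfl⟩
      · exact Or.inl h1
      · exact Or.inr h1
  · intro h
    refine h.inv (P := fun w => cl (ed D z) u w) cl.refl ?_
    rintro a b h1 h2 ⟨e, he, hj⟩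
    refine h2.tail ⟨e, ⟨?_, he.2⟩, hj⟩
    rw [← hx _ (hK e he.2.1 he.2.2 ?_)]
    · exact he.1
    · rcases hj with ⟨rfl, rfl⟩ | ⟨rfl, rfl⟩
      · exact Or.inl h2
      · exact Or.inr h2

lemma Rk.to_univ {adj : V → V → Prop} {D : Set V} {N m : ℕ} {K : Set I} {x z : I → Bool}
    (hz : ∀ i ∉ K, z i = false) (hx : ∀ i ∈ K, x i = z i) {v : V} (h : Rk adj D N m K z v) :
    Rk adj D N m Set.univ x v := by
  have hin : ∀ i, z i = true → x i = true := by
    intro i hi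
    by_cases hk : i ∈ K
    · rw [hx i hk, hi]
    · rw [hz i hk] at hi; exact absurd hi (by simp)
  induction h with
  | base v h => exact .base v h
  | edge u v _ h' ih =>
    obtain ⟨e, he, hj⟩ := h'
    exact .edge u v ih ⟨e, ⟨hin _ he.1, he.2⟩, hj⟩
  | step u v _ hu hv ha hK hb ih =>
    refine .step u v ih hu hv ha (fun _ _ _ _ => trivial) ?_
    rw [← rep_congr (fun w => cl_same hx hK w)]
    exact hin _ hb

lemma Rk.cl {adj : V → V → Prop} {D : Set V} {N m : ℕ} {K : Set I} {z : I → Bool} {u v : V}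
    (h : Rk adj D N m K z u) (h' : cl (ed D z) u v) : Rk adj D N m K z v :=
  h'.inv (P := fun v => Rk adj D N m K z v) h fun a b _ h1 h2 => .edge a b h1 h2

lemma Rk.done {adj : V → V → Prop} {D : Set V} {hD : D.Finite} {N m : ℕ} {K : Set I} {z x : I → Bool}
    (hN : Lam N ⊆ D)
    (hn : ∀ i ∈ idx D hD, ∀ u, Rk adj D N m K z u → touch i u → i ∈ K)
    (hx : ∀ i ∈ K, x i = z i) {u : V} (hu : Rk adj D N m K z u) :
    (∀ e : Ed, e.1 ∈ D → nx e ∈ D → (DaC.cl (ed D z) u e.1 ∨ DaC.cl (ed D z) u (nx e)) → Sum.inl e ∈ K) ∧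
    (u ∈ D → sig D x u = sig D z u) := by
  have h1 : ∀ e : Ed, e.1 ∈ D → nx e ∈ D → (DaC.cl (ed D z) u e.1 ∨ DaC.cl (ed D z) u (nx e)) → Sum.inl e ∈ K := by
    intro e h1 h2 h3
    rcases h3 with h3 | h3
    · exact hn _ (mem_idx_inl.2 ⟨h1, h2⟩) _ (hu.cl h3) (Or.inl rfl)
    · exact hn _ (mem_idx_inl.2 ⟨h1, h2⟩) _ (hu.cl h3) (Or.inr rfl)
  refine ⟨h1, fun hD' => ?_⟩
  have h2 := rep_congr (fun w => cl_same hx h1 w)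
  unfold sig
  rw [← h2]
  refine hx _ (hn _ (mem_idx_inr.2 ?_) _ (hu.cl (rep_cl _ u)) rfl)
  rcases cl_mem (rep_cl (ed D z) u) with h2 | h2
  · rw [← h2]; exact hD'
  · exact h2.2

lemma Rk.path {adj : V → V → Prop} {D : Set V} {hD : D.Finite} {N m : ℕ} {K : Set I} {z y : I → Bool}
    (hN : Lam N ⊆ D)
    (hn : ∀ i ∈ idx D hD, ∀ u, Rk adj D N m K z u → touch i u → i ∈ K)
    (hy : ∀ i ∈ K, y i = z i) {c b : V} (hc : Rk adj D N m K z c)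
    (h : CI adj (Lam N ∩ Gt (sig D y)) c b) :
    CI adj (Lam N ∩ Gt (sig D y) ∩ {v | Rk adj D N m K z v}) c b := by
  induction h using CI.induct with
  | h0 h => exact CI.refl ⟨h, hc⟩
  | hs b d hab ih h1 h2 h3 =>
    have hb : Rk adj D N m K z b := ih.right.2
    have := Rk.done hN hn hy hb
    refine ih.tail h1 ⟨h3, Rk.step b d hb h2.1 h3.1 h1 this.1 ?_⟩
    have h4 := this.2 (hN h2.1)
    have h5 : sig D y b = true := h2.2
    rw [h4] at h5; exact h5

lemma Rk.transfer {adj : V → V → Prop} (ok : Okay adj) {D : Set V} {hD : D.Finite} {N m : ℕ} {K : Set I} {z x y : I → Bool}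
    (hm : 1 ≤ m) (hmN : m ≤ N) (hN : Lam N ⊆ D)
    (hn : ∀ i ∈ idx D hD, ∀ u, Rk adj D N m K z u → touch i u → i ∈ K)
    (hy : ∀ i ∈ K, y i = z i) (hx : ∀ i ∈ K, x i = z i)
    (h : sig D y ∈ Arm adj 1 N) : sig D x ∈ Arm adj 1 N := by
  obtain ⟨a, ha, b, hb, hp⟩ := h
  have ha' : nm a ≤ 1 := by exact_mod_cast ha
  have hb' : nm b = N := hb
  obtain ⟨c, hc, h1, h2⟩ := hp.lastPart nm ok.lipn (m := m) (by omega) (by omega)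
  have hcR : Rk adj D N m K z c := .base c hc
  have h1' := Rk.path hN hn hy hcR (h1.symm ok)
  have h2' := Rk.path hN hn hy hcR (h2.monoS Set.inter_subset_left)
  refine ⟨a, ha, b, hb, ((h1'.symm ok).trans h2').monoS ?_⟩
  rintro v ⟨⟨hv1, hv2⟩, hv3⟩
  refine ⟨hv1, ?_⟩
  have hv2' : sig D y v = true := hv2
  show sig D x v = true
  rw [(Rk.done hN hn hx hv3).2 (hN hv1), ← (Rk.done hN hn hy hv3).2 (hN hv1), hv2']

lemma Rk_congr {adj : V → V → Prop} {D : Set V} (hD : D.Finite) {N m : ℕ} (hN : Lam N ⊆ D) {x y : I → Bool}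
    (h : ∀ i ∈ idx D hD, x i = y i) {v : V} (hv : Rk adj D N m Set.univ x v) :
    Rk adj D N m Set.univ y v := by
  have h1 := ed_congr hD h
  induction hv with
  | base v h => exact .base v h
  | edge u v _ h' ih => rw [h1] at h'; exact .edge u v ih h'
  | step u v _ hu hv ha hK hb ih =>
    refine .step u v ih hu hv ha (fun _ _ _ _ => trivial) ?_
    have := sig_dep hD (hN hu) h
    exact this.symm.trans hb

lemma Rk_dep {adj : V → V → Prop} {D : Set V} (hD : D.Finite) {N m : ℕ} (hN : Lam N ⊆ D) (v : V) :
    Loc (fun x => Rk adj D N m Set.univ x v) :=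
  Loc.dep (idx D hD) fun x y h => propext
    ⟨fun h' => Rk_congr hD hN h h', fun h' => Rk_congr hD hN (fun i hi => (h i hi).symm) h'⟩

lemma Full_loc {adj : V → V → Prop} {D : Set V} (hD : D.Finite) {N m : ℕ} (hN : Lam N ⊆ D) (j : I) :
    Loc (fun x => j ∈ Full adj D N m x) :=
  Loc.dep (idx D hD) fun x y h => propext
    ⟨fun ⟨u, h1, h2⟩ => ⟨u, Rk_congr hD hN h h1, h2⟩,
     fun ⟨u, h1, h2⟩ => ⟨u, Rk_congr hD hN (fun i hi => (h i hi).symm) h1, h2⟩⟩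

/-- the arm indicator in finite volume -/
noncomputable def FA (adj : V → V → Prop) (D : Set V) (N : ℕ) (x : I → Bool) : ℝ :=
  ind {x | sig D x ∈ Arm adj 1 N} x

lemma FA_loc {adj : V → V → Prop} {D : Set V} (hD : D.Finite) {N : ℕ} : Loc (FA adj D N) := by
  have : FA adj D N = fun x => (fun ξ => ind (Arm adj 1 N) ξ) (sig D x) := by
    funext x; simp [FA, ind_apply]
  rw [this]
  exact sig_loc hD (Arm.inc.loc.ind)

open Classical in
theorem osss_arm {adj : V → V → Prop} (ok : Okay adj) (w : I → ℝ) {D : Set V} (hD : D.Finite) {N m : ℕ}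
    (hm : 1 ≤ m) (hmN : m ≤ N) (hN : Lam N ⊆ D) :
    EE w (FA adj D N) * (1 - EE w (FA adj D N)) ≤
      ∑ j ∈ idx D hD, EE w (ind {x | j ∈ Full adj D N m x}) *
        (2 * (clamp (w j) * (1 - clamp (w j))) * EE w (fun x => |DD j (FA adj D N) x|)) := by
  let next : Finset I → (I → Bool) → Option I := fun K z =>
    if h : ∃ i, i ∈ idx D hD ∧ i ∉ K ∧ ∃ u, Rk adj D N m (K : Set I) z u ∧ touch i u
    then some h.choose else none
  have hsome : ∀ K z i, next K z = some i →
      i ∈ idx D hD ∧ i ∉ K ∧ ∃ u, Rk adj D N m (K : Set I) z u ∧ touch i u := by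
    intro K z i h
    simp only [next] at h
    split_ifs at h with h1
    · simp only [Option.some.injEq] at h
      rw [← h]; exact h1.choose_spec
  have hF1 : ∀ x, |FA adj D N x| ≤ 1 := by
    intro x; unfold FA; rw [abs_of_nonneg (ind_nonneg _ _)]; exact ind_le_one _ _
  have := osss_explore w (F := FA adj D N) (g := FA adj D N) (FA_loc hD) hF1 (idx D hD) next
    (fun K z i h => ⟨(hsome K z i h).1, (hsome K z i h).2.1⟩) ?_ (Full adj D N m) (Full_loc hD hN) ?_
  · have h2 : (fun x => FA adj D N x * FA adj D N x) = FA adj D N := by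
      funext x; simp only [FA, ind_apply]; split_ifs <;> simp
    rw [h2] at this
    have := (le_abs_self _).trans this
    linarith
  · intro K z hz hnone x hx
    have hn : ∀ i ∈ idx D hD, ∀ u, Rk adj D N m (K : Set I) z u → touch i u → i ∈ (K : Set I) := by
      intro i hi u hu ht
      by_contra hK
      have : ∃ i, i ∈ idx D hD ∧ i ∉ K ∧ ∃ u, Rk adj D N m (K : Set I) z u ∧ touch i u :=
        ⟨i, hi, hK, u, hu, ht⟩
      simp only [next, dif_pos this] at hnone
      exact absurd hnone (by simp)
    have : sig D x ∈ Arm adj 1 N ↔ sig D z ∈ Arm adj 1 N :=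
      ⟨Rk.transfer ok hm hmN hN hn hx (fun _ _ => rfl), Rk.transfer ok hm hmN hN hn (fun _ _ => rfl) hx⟩
    simp only [FA, ind_apply, Set.mem_setOf_eq, this]
  · intro K z x i hz hx h
    obtain ⟨u, h1, h2⟩ := (hsome K z i h).2.2
    exact ⟨u, h1.to_univ (K := (K : Set I)) hz hx, h2⟩

end DaC

namespace DaC

lemma EE_sum {ι κ : Type*} [DecidableEq ι] (w : ι → ℝ) (s : Finset κ) {F : κ → (ι → Bool) → ℝ} (hF : ∀ k, Loc (F k)) :
    EE w (fun x => ∑ k ∈ s, F k x) = ∑ k ∈ s, EE w (F k) :=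
  integral_finset_sum s fun k _ => (hF k).integrable _

lemma ed_upd_inr (D : Set V) (x : I → Bool) (v : V) (b : Bool) :
    ed D (Function.update x (.inr v) b) = ed D x := by
  ext e; simp [ed]

lemma sig_upd_inr (D : Set V) (x : I → Bool) (v u : V) (b : Bool) :
    sig D (Function.update x (.inr v) b) u = if rep (ed D x) u = v then b else sig D x u := by
  unfold sig
  rw [ed_upd_inr, Function.update_apply]
  simp

lemma cl_CI {adj : V → V → Prop} (ok : Okay adj) {D : Set V} {x : I → Bool} {a b : V} (h : cl (ed D x) a b)
    (ha : a ∈ D) (hb : sig D x a = true) : CI adj (D ∩ Gt (sig D x)) a b := by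
  refine h.inv (P := fun b => CI adj (D ∩ Gt (sig D x)) a b) (CI.refl ⟨ha, hb⟩) ?_
  rintro c d h1 h2 ⟨e, he, hj⟩
  have hcd : cl (ed D x) a d := h1.tail ⟨e, he, hj⟩
  refine h2.tail (ok.ofSq ?_) ⟨?_, ?_⟩
  · obtain ⟨⟨e1, e2⟩, q⟩ := e
    rw [sqAdj_iff]
    rcases hj with ⟨rfl, rfl⟩ | ⟨rfl, rfl⟩ <;> cases q <;> simp [nx]
  · rcases cl_mem hcd with h | h
    · rw [← h]; exact ha
    · exact h.2
  · show sig D x d = true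
    unfold sig at hb ⊢; rw [← rep_of_cl hcd]; exact hb

lemma Rk.T {adj : V → V → Prop} (ok : Okay adj) {D : Set V} {N m : ℕ} (hmN : m ≤ N) (hN : Lam N ⊆ D)
    {x : I → Bool} {v : V} (h : Rk adj D N m Set.univ x v) :
    ∃ v' ∈ Lam N, DaC.cl (ed D x) v' v ∧ (nm v' = m ∨ ∃ u a, nm a = m ∧ CI adj (D ∩ Gt (sig D x)) a u ∧ adj u v') := by
  induction h with
  | base v h => exact ⟨v, by show nm v ≤ N; omega, cl.refl, Or.inl h⟩
  | edge u v _ h' ih =>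
    obtain ⟨v', h1, h2, h3⟩ := ih
    exact ⟨v', h1, h2.tail h', h3⟩
  | step u v _ hu hv ha hK hb ih =>
    obtain ⟨v', h1, h2, h3⟩ := ih
    refine ⟨v, hv, cl.refl, Or.inr ⟨u, ?_⟩⟩
    have hv' : sig D x v' = true := by
      unfold sig; rw [rep_of_cl h2]; exact hb
    have hc := cl_CI ok h2 (hN h1) hv'
    rcases h3 with h3 | ⟨u0, a, h3, h4, h5⟩
    · exact ⟨v', h3, hc, ha⟩
    · exact ⟨a, h3, (h4.tail h5 hc.left).trans hc, ha⟩

/-- connection in finite volume from distance `m` to `v` -/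
def Bv (adj : V → V → Prop) (D : Set V) (m : ℕ) (v : V) : Set (I → Bool) :=
  {x | sig D x ∈ Con adj D {a | nm a = m} {v}}

lemma Rk.toB {adj : V → V → Prop} (ok : Okay adj) {D : Set V} {N m : ℕ} (hmN : m ≤ N) (hN : Lam N ⊆ D)
    {x : I → Bool} {v : V} (h : Rk adj D N m Set.univ x v) :
    Function.update x (.inr (rep (ed D x) v)) true ∈ Bv adj D m v := by
  obtain ⟨v', h1, h2, h3⟩ := Rk.T ok hmN hN h
  set y := Function.update x (.inr (rep (ed D x) v)) true with hy
  have hsub : Gt (sig D x) ⊆ Gt (sig D y) := by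
    intro u (hu : sig D x u = true)
    show sig D y u = true
    rw [hy, sig_upd_inr]; split_ifs <;> simp [hu]
  have hv' : sig D y v' = true := by
    rw [hy, sig_upd_inr, if_pos (rep_of_cl h2)]
  have h2' : DaC.cl (ed D y) v' v := by rw [hy, ed_upd_inr]; exact h2
  have hc := cl_CI ok h2' (hN h1) hv'
  rcases h3 with h3 | ⟨u0, a, h3, h4, h5⟩
  · exact ⟨v', h3, v, rfl, hc⟩
  · exact ⟨a, h3, v, rfl, ((h4.monoS (Set.inter_subset_inter_right _ hsub)).tail h5 hc.left).trans hc⟩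

lemma rep_mem {D : Set V} (x : I → Bool) {v : V} (hv : v ∈ D) : rep (ed D x) v ∈ D := by
  rcases cl_mem (rep_cl (ed D x) v) with h2 | h2
  · rw [← h2]; exact hv
  · exact h2.2

/-- finite energy -/
lemma fin_energy {pe t : ℝ} {fz : V → Option Bool} (hM : Mok pe fz) {D : Set V} (hD : D.Finite) {v : V} (hv : v ∈ D)
    {A B : Set (I → Bool)} (hA : Loc (fun x => x ∈ A)) (hB : Loc (fun x => x ∈ B))
    (h : ∀ x ∈ A, Function.update x (.inr (rep (ed D x) v)) true ∈ B) :
    clamp (Wt pe fz t (.inr v)) * EE (Wt pe fz t) (ind A) ≤ EE (Wt pe fz t) (ind B) := by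
  set w := Wt pe fz t with hw
  let Aρ : V → Set (I → Bool) := fun ρ => {x | x ∈ A ∧ rep (ed D x) v = ρ}
  let Bρ : V → Set (I → Bool) := fun ρ => {x | x ∈ B ∧ rep (ed D x) v = ρ}
  have hr : Loc (fun x => rep (ed D x) v) := ed_loc hD (fun η => rep η v)
  have hAl : ∀ ρ, Loc (ind (Aρ ρ)) := fun ρ => Loc.ind (hA.map₂ hr (fun a b => a ∧ b = ρ))
  have hBl : ∀ ρ, Loc (ind (Bρ ρ)) := fun ρ => Loc.ind (hB.map₂ hr (fun a b => a ∧ b = ρ))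
  have sum : ∀ C : Set (I → Bool), ind C = fun x => ∑ ρ ∈ hD.toFinset, ind {x | x ∈ C ∧ rep (ed D x) v = ρ} x := by
    intro C; funext x
    have hm : rep (ed D x) v ∈ hD.toFinset := hD.mem_toFinset.2 (rep_mem x hv)
    rw [Finset.sum_eq_single_of_mem _ hm]
    · exact ind_congr (by simp)
    · intro ρ _ hρ
      exact ind_not (fun hh => hρ hh.2.symm)
  rw [sum A, sum B, EE_sum w _ hAl, EE_sum w _ hBl, Finset.mul_sum]
  refine Finset.sum_le_sum fun ρ _ => ?_
  show clamp (w (.inr v)) * EE w (ind (Aρ ρ)) ≤ EE w (ind (Bρ ρ))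
  have key : clamp (w (.inr ρ)) * EE w (ind (Aρ ρ)) ≤ EE w (ind (Bρ ρ)) := by
    rw [EE_resample w (.inr ρ) (hBl ρ)]
    have h1 : EE w (ind (Aρ ρ)) ≤ EE w (fun x => ind (Bρ ρ) (Function.update x (.inr ρ) true)) := by
      refine EE_mono w (hAl ρ) ((hBl ρ).upd _ _) fun x => ?_
      by_cases hx : x ∈ Aρ ρ
      · rw [ind_mem hx, ind_mem]
        refine ⟨?_, by rw [ed_upd_inr]; exact hx.2⟩
        have := h x hx.1
        rw [hx.2] at this; exact this
      · rw [ind_not hx]; exact ind_nonneg _ _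
    have h2 : 0 ≤ EE w (fun x => ind (Bρ ρ) (Function.update x (.inr ρ) false)) :=
      EE_nonneg w fun x => ind_nonneg _ _
    have := mul_le_mul_of_nonneg_left h1 (clamp_nonneg (w (.inr ρ)))
    have := mul_nonneg (sub_nonneg.2 (clamp_le_one (w (.inr ρ)))) h2
    linarith
  rcases hM with ⟨rfl, -⟩ | rfl
  · by_cases hρ : ρ = v
    · rw [← hρ]; exact key
    · have : EE w (ind (Aρ ρ)) = 0 := by
        refine integral_eq_zero_of_ae ?_
        filter_upwards [ae_closed w (fun _ => rfl)] with x hx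
        refine ind_not (fun hh => hρ ?_)
        have h1 := rep_cl (ed D x) v
        have h2 := h1.mono (ed_mono (Set.subset_univ D) x)
        rw [hx] at h2
        rw [← hh.2]; exact (cl_empty h2).symm
      rw [this, mul_zero]; exact EE_nonneg w fun x => ind_nonneg _ _
  · exact key

end DaC

namespace DaC

lemma nm_sub_ge (a v : V) : nm v - nm a ≤ nm (a - v) ∧ nm a - nm v ≤ nm (a - v) := by
  simp only [nm, Prod.fst_sub, Prod.snd_sub, abs_eq_max_neg]
  omega

lemma even_near (v : V) : ∃ a b : ℤ, nm (v - (2 * a, 2 * b)) ≤ 1 := by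
  refine ⟨v.1 / 2, v.2 / 2, ?_⟩
  rw [nm_le]; simp only [Prod.fst_sub, Prod.snd_sub]; omega

lemma Bv_loc {adj : V → V → Prop} {D : Set V} (hD : D.Finite) {m : ℕ} {v : V} :
    Loc (fun x => x ∈ Bv adj D m v) :=
  sig_loc hD (f := fun ξ => ξ ∈ Con adj D {a | nm a = m} {v}) (Con.inc hD).loc

lemma Loc.meas {ι : Type*} [DecidableEq ι] {A : Set (ι → Bool)} (h : Loc (fun x => x ∈ A)) : MeasurableSet A := by
  have := h.measurable
  exact measurableSet_setOf.2 this

lemma bound_B {pe t : ℝ} {fz : V → Option Bool} (hM : Mok pe fz) {adj : V → V → Prop} (ok : Okay adj)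
    {D : Set V} (hD : D.Finite) {N n m : ℕ} (hn : 2 ≤ n) (hnN : n ≤ N) (hN : Lam (4 * N) ⊆ D)
    {c : ℝ} (hc : ∀ v, (PP (Wt pe fz t)).real {x | rad x v N} ≤ c) {v : V} (hv : v ∈ Lam (2 * N))
    (hd : (n:ℤ) ≤ nm v - m ∨ (n:ℤ) ≤ m - nm v) :
    EE (Wt pe fz t) (ind (Bv adj D m v)) ≤
      (mu (Wt pe fz t)).real (Arm adj 1 (n - 1)) + (6 * N + 1) ^ 2 * c := by
  set w := Wt pe fz t with hw
  have hRsw := hM.rsw t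
  rw [← hw] at hRsw
  have := hRsw.prob
  have hPP : IsProbabilityMeasure (PP w) := by unfold PP; infer_instance
  obtain ⟨a, b, hab⟩ := even_near v
  rw [EE_ind w (Bv_loc hD).meas, ← hRsw.inv _ (Sy.sh a b) _ Arm.inc]
  have hmA : MeasurableSet {ξ : V → Bool | ξ ∘ (fun v => (v.1 + 2 * a, v.2 + 2 * b)) ∈ Arm adj 1 (n - 1)} :=
    (Arm.inc (adj := adj)).meas.preimage (by fun_prop)
  rw [mu_real w hmA]
  have hU := rad_union w (Lam_finite (3 * N)).toFinset N (c := c) (fun v _ => hc v)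
  have hc0 : 0 ≤ c := measureReal_nonneg.trans (hc v)
  have hU2 : ((Lam_finite (3 * N)).toFinset.card : ℝ) * c ≤ (6 * N + 1) ^ 2 * c := by
    refine mul_le_mul_of_nonneg_right ((Lam_card _).trans (le_of_eq ?_)) hc0
    push_cast; ring
  refine le_trans ?_ (add_le_add le_rfl (hU.trans hU2))
  refine le_trans (measureReal_mono ?_) (measureReal_union_le _ _)
  rintro x ⟨q, hq, v', rfl, hp⟩
  by_cases hr : ∃ v ∈ (Lam_finite (3 * N)).toFinset, rad x v N
  · exact Or.inr hr
  refine Or.inl ?_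
  have hq' : nm q = m := hq
  have hv2 : nm v' ≤ 2 * N := by exact_mod_cast hv
  have hnq := nm_sub_ge q v'
  obtain ⟨u, hu, hpu⟩ := (hp.symm ok).firstPart (fun z => nm (z - v')) (m := n) (fun y z hyz => by
      have h1 := nm_tri z y v'
      have h2 := (starAdj_iff _ _).1 (ok.star hyz)
      have h3 : nm (z - y) ≤ 1 := by
        rw [nm_le]; simp only [Prod.fst_sub, Prod.snd_sub]; omega
      show nm (z - v') ≤ nm (y - v') + 1
      omega) (by rw [nm_self]; omega) (by omega)
  have hpu2 : CI adj (Gt (sig Set.univ x)) v' u := by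
    refine hpu.monoS ?_
    rintro z ⟨⟨hz1, hz2⟩, hz3⟩
    have hz2' : sig D x z = true := hz2
    have hz3' : nm (z - v') ≤ n := hz3
    have h5 := nm_sub_ge z v'
    have hnr : ¬ rad x z N := fun h => hr ⟨z, (Lam_finite _).mem_toFinset.2 (by
      show nm z ≤ (3 * N : ℕ); push_cast; omega), h⟩
    show sig Set.univ x z = true
    rw [← not_rad_sig hnr (D := D), hz2']
    intro y hy
    refine hN ?_
    have hy' : nm (y - z) ≤ N := hy
    have := nm_sub_ge y z
    show nm y ≤ (4 * N : ℕ); push_cast; omega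
  have h6 := hpu2.map (fun z => z - (2 * a, 2 * b))
    (T := Gt (sig Set.univ x ∘ fun v => (v.1 + 2 * a, v.2 + 2 * b))) ?_ ?_
  · refine Arm.of ok (by omega) (u := v' - (2 * a, 2 * b)) (v := u - (2 * a, 2 * b)) (by exact_mod_cast hab) ?_ h6
    have h7 := nm_tri u (2 * a, 2 * b) v'
    rw [nm_comm (2*a, 2*b) v'] at h7
    have hu' : nm (u - v') = n := hu
    push_cast [Nat.cast_sub (show 1 ≤ n by omega)]
    omega
  · intro y z h
    rcases ok with rfl | rfl
    · rw [sqAdj_iff] at *; simp only [Prod.fst_sub, Prod.snd_sub]; omega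
    · rw [starAdj_iff] at *; simp only [Prod.fst_sub, Prod.snd_sub]; omega
  · intro z hz
    have hz' : sig Set.univ x z = true := hz
    show sig Set.univ x _ = true
    simpa using hz'

/-- revealment bound for one starting distance -/
lemma bound_R {pe t : ℝ} {fz : V → Option Bool} (hM : Mok pe fz) {adj : V → V → Prop} (ok : Okay adj)
    {D : Set V} (hD : D.Finite) {N n m : ℕ} (hn : 2 ≤ n) (hnN : n ≤ N) (hN : Lam (4 * N) ⊆ D) (hmN : m ≤ N)
    {c : ℝ} (hc : ∀ v, (PP (Wt pe fz t)).real {x | rad x v N} ≤ c) {v : V} (hv : v ∈ D) :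
    clamp (Wt pe fz t (.inr v)) * EE (Wt pe fz t) (ind {x | Rk adj D N m Set.univ x v}) ≤
      (if (nm v - m < n ∧ m - nm v < n) then 1 else 0) +
      ((mu (Wt pe fz t)).real (Arm adj 1 (n - 1)) + (6 * N + 1) ^ 2 * c) := by
  have hN' : Lam N ⊆ D := fun z hz => hN (by
    have : nm z ≤ N := hz
    show nm z ≤ (4 * N : ℕ); push_cast; omega)
  have hPP : IsProbabilityMeasure (PP (Wt pe fz t)) := by unfold PP; infer_instance
  have hc0 : 0 ≤ c := measureReal_nonneg.trans (hc v)
  have hΘ : 0 ≤ (mu (Wt pe fz t)).real (Arm adj 1 (n - 1)) := measureReal_nonneg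
  have hRl : Loc (fun x => x ∈ {x | Rk adj D N m Set.univ x v}) := Rk_dep hD hN' v
  have h6 : c ≤ (6 * N + 1) ^ 2 * c := by
    have : (1:ℝ) ≤ (6 * N + 1) ^ 2 := by
      have : (0:ℝ) ≤ N := by positivity
      nlinarith
    nlinarith
  by_cases h2 : v ∈ Lam (2 * N)
  · have h1 := fin_energy (t := t) hM hD hv hRl (Bv_loc (adj := adj) (m := m) hD) (fun x hx => Rk.toB ok hmN hN' hx)
    refine h1.trans ?_
    split_ifs with h3
    · have : EE (Wt pe fz t) (ind (Bv adj D m v)) ≤ 1 := by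
        rw [EE_ind _ (Bv_loc hD).meas]; exact measureReal_le_one
      nlinarith
    · rw [zero_add]
      exact bound_B hM ok hD hn hnN hN hc h2 (by omega)
  · have h1 : EE (Wt pe fz t) (ind {x | Rk adj D N m Set.univ x v}) ≤ c := by
      rw [EE_ind _ hRl.meas]
      refine (measureReal_mono ?_).trans (hc v)
      intro x hx
      obtain ⟨v', g1, g2, -⟩ := Rk.T ok hmN hN' hx
      by_contra hr
      have := (not_rad hr (g2.mono (ed_mono (Set.subset_univ _) x)).symm).2
      have := nm_sub_ge v' v
      have g1' : nm v' ≤ N := g1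
      have h2' : ¬ nm v ≤ (2 * N : ℕ) := h2
      push_cast at h2'
      omega
    have h3 := clamp_le_one (Wt pe fz t (.inr v))
    have h4 := clamp_nonneg (Wt pe fz t (.inr v))
    have h5 : 0 ≤ EE (Wt pe fz t) (ind {x | Rk adj D N m Set.univ x v}) := EE_nonneg _ fun x => ind_nonneg _ _
    have : (0:ℝ) ≤ (if (nm v - m < n ∧ m - nm v < n) then 1 else 0) := by split_ifs <;> simp
    nlinarith

lemma bound_sum {pe t : ℝ} {fz : V → Option Bool} (hM : Mok pe fz) {adj : V → V → Prop} (ok : Okay adj)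
    {D : Set V} (hD : D.Finite) {N n : ℕ} (hn : 2 ≤ n) (hnN : n ≤ N) (hN : Lam (4 * N) ⊆ D)
    {c : ℝ} (hc : ∀ v, (PP (Wt pe fz t)).real {x | rad x v N} ≤ c) {v : V} (hv : v ∈ D) :
    clamp (Wt pe fz t (.inr v)) * ∑ m ∈ Finset.Icc 1 N, EE (Wt pe fz t) (ind {x | Rk adj D N m Set.univ x v}) ≤
      2 * n + N * ((mu (Wt pe fz t)).real (Arm adj 1 (n - 1)) + (6 * N + 1) ^ 2 * c) := by
  rw [Finset.mul_sum]
  refine (Finset.sum_le_sum fun m hm => bound_R hM ok hD hn hnN hN (Finset.mem_Icc.1 hm).2 hc hv).trans ?_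
  rw [Finset.sum_add_distrib, Finset.sum_const, nsmul_eq_mul, Nat.card_Icc, Nat.add_sub_cancel]
  refine add_le_add ?_ le_rfl
  rw [← Finset.sum_filter, Finset.sum_const, nsmul_eq_mul, mul_one]
  have : (Finset.filter (fun m : ℕ => nm v - m < n ∧ m - nm v < n) (Finset.Icc 1 N)) ⊆
      Finset.Ico ((nm v).toNat + 1 - n) ((nm v).toNat + n) := by
    intro m hm
    have h0 := nm_nonneg v
    simp only [Finset.mem_filter, Finset.mem_Icc, Finset.mem_Ico] at *
    omega
  have := Finset.card_le_card this
  rw [Nat.card_Ico] at this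
  have h2 : (Finset.filter (fun m : ℕ => nm v - m < n ∧ m - nm v < n) (Finset.Icc 1 N)).card ≤ 2 * n := by omega
  exact_mod_cast h2

end DaC

namespace DaC

open Classical in
lemma merge1 {η : Set Ed} {e : Ed} {u u' : V} (hj : Joins e u u') (y : I → Bool)
    (h : cl η (rep (insert e η) u) u) (w : V) :
    y (.inr (rep (insert e η) w)) = if rep η w = rep η u' then y (.inr (rep (insert e η) u)) else y (.inr (rep η w)) := by
  have hsub : η ⊆ insert e η := Set.subset_insert _ _
  have huu : cl (insert e η) u u' := EA.cl ⟨e, Set.mem_insert _ _, hj⟩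
  have h1 : rep η u = rep (insert e η) u := rep_eq h.symm (fun w hw => rep_le (hw.mono hsub))
  split_ifs with h2
  · have h3 : cl (insert e η) w u := ((rep_inj.2 h2).mono hsub).trans huu.symm
    rw [rep_of_cl h3]
  · by_cases h3 : cl η w u
    · rw [rep_of_cl h3, h1, rep_of_cl (h3.mono hsub)]
    · have h4 : ¬ cl η w u' := fun h' => h2 (rep_of_cl h')
      rw [rep_congr (fun z => cl_insert_eq hj h3 h4)]

lemma ed_upd_true {D : Set V} {e : Ed} (h1 : e.1 ∈ D) (h2 : nx e ∈ D) (x : I → Bool) :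
    ed D (Function.update x (.inl e) true) = insert e (ed D (Function.update x (.inl e) false)) := by
  ext e'
  simp only [ed, Set.mem_setOf_eq, Set.mem_insert_iff, Function.update_apply, Sum.inl.injEq]
  by_cases h : e' = e
  · subst h; simp [h1, h2]
  · simp [h]

/-- influence of a cluster's colour -/
noncomputable def gu (D : Set V) (F : (I → Bool) → ℝ) (u : V) (x : I → Bool) : ℝ :=
  |DD (.inr (rep (ed D x) u)) F x|

lemma flip_le {ι : Type*} [DecidableEq ι] (F : (ι → Bool) → ℝ) (y : ι → Bool) (i : ι) (c : Bool) :
    |F (Function.update y i c) - F y| ≤ |DD i F y| := by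
  unfold DD
  have h : y = Function.update y i (y i) := (Function.update_eq_self i y).symm
  conv_lhs => rw [h]
  rw [Function.update_idem]
  cases c <;> cases y i
  · simp
  · rw [abs_sub_comm]
  · exact le_rfl
  · simp

lemma edge_infl {adj : V → V → Prop} {D : Set V} {N : ℕ} {e : Ed} (h1 : e.1 ∈ D) (h2 : nx e ∈ D) (x : I → Bool) :
    |DD (.inl e) (FA adj D N) x| ≤ gu D (FA adj D N) e.1 (Function.update x (.inl e) false) +
      gu D (FA adj D N) (nx e) (Function.update x (.inl e) false) := by
  classical
  set y := Function.update x (.inl e) false with hy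
  set y1 := Function.update x (.inl e) true with hy1
  have hbit : ∀ v, y1 (.inr v) = y (.inr v) := by intro v; simp [hy, hy1]
  have hη : ed D y1 = insert e (ed D y) := ed_upd_true h1 h2 x
  have main : ∃ v, (v = e.1 ∨ v = nx e) ∧ ∃ c, sig D y1 = sig D (Function.update y (.inr (rep (ed D y) v)) c) := by
    have hj := joins_self e
    have hc : cl (insert e (ed D y)) (rep (insert e (ed D y)) e.1) e.1 := (rep_cl _ _).symm
    have huu : cl (insert e (ed D y)) e.1 (nx e) := EA.cl ⟨e, Set.mem_insert _ _, hj⟩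
    have : cl (ed D y) (rep (insert e (ed D y)) e.1) e.1 ∨ cl (ed D y) (rep (insert e (ed D y)) e.1) (nx e) := by
      have := cl_insert hj hc; tauto
    rcases this with h | h
    · refine ⟨nx e, Or.inr rfl, y (.inr (rep (insert e (ed D y)) e.1)), ?_⟩
      · funext w
        rw [sig_upd_inr]
        unfold sig
        rw [hbit, hη]
        exact merge1 hj y h w
    · rw [rep_of_cl huu] at h
      refine ⟨e.1, Or.inl rfl, y (.inr (rep (insert e (ed D y)) (nx e))), ?_⟩
      · funext w
        rw [sig_upd_inr]
        unfold sig
        rw [hbit, hη]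
        exact merge1 hj.symm y h w
  obtain ⟨v, hv, c, hs⟩ := main
  have hF : FA adj D N y1 = FA adj D N (Function.update y (.inr (rep (ed D y) v)) c) := by
    simp only [FA, ind_apply, Set.mem_setOf_eq, hs]
  have h3 : |DD (.inl e) (FA adj D N) x| ≤ gu D (FA adj D N) v y := by
    show |FA adj D N y1 - FA adj D N y| ≤ _
    rw [hF]; exact flip_le _ _ _ _
  have h4 : ∀ u, 0 ≤ gu D (FA adj D N) u y := fun u => abs_nonneg _
  rcases hv with rfl | rfl
  · linarith [h4 (nx e)]
  · linarith [h4 e.1]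

lemma gu_loc {F : (I → Bool) → ℝ} (hF : Loc F) {D : Set V} (hD : D.Finite) {u : V} (hu : u ∈ D) :
    Loc (gu D F u) := by
  have h : gu D F u = fun x => ∑ ρ ∈ hD.toFinset, (ind {x | rep (ed D x) u = ρ} x) * |DD (.inr ρ) F x| := by
    funext x
    have hm : rep (ed D x) u ∈ hD.toFinset := hD.mem_toFinset.2 (rep_mem x hu)
    rw [Finset.sum_eq_single_of_mem _ hm]
    · rw [ind_mem (by simp)]; simp [gu]
    · intro ρ _ hρ
      rw [ind_not (fun hh => hρ hh.symm), zero_mul]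
  rw [h]
  have : ∀ s : Finset V, Loc (fun x => ∑ ρ ∈ s, (ind {x | rep (ed D x) u = ρ} x) * |DD (.inr ρ) F x|) := by
    intro s
    induction s using Finset.induction_on with
    | empty => simpa using Loc.const 0
    | insert a s ha ih =>
      simp only [Finset.sum_insert ha]
      refine Loc.map₂ ?_ ih (· + ·)
      refine Loc.map₂ (Loc.ind ?_) ((hF.DD _).map fun z => |z|) (· * ·)
      exact ed_loc hD (fun η => rep η u = a)
  exact this _

lemma edge_infl_EE {adj : V → V → Prop} {D : Set V} (hD : D.Finite) {N : ℕ} {e : Ed} (h1 : e.1 ∈ D) (h2 : nx e ∈ D)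
    (w : I → ℝ) :
    (1 - clamp (w (.inl e))) * EE w (fun x => |DD (.inl e) (FA adj D N) x|) ≤
      EE w (gu D (FA adj D N) e.1) + EE w (gu D (FA adj D N) (nx e)) := by
  have l1 := gu_loc (FA_loc hD (adj := adj) (N := N)) hD h1
  have l2 := gu_loc (FA_loc hD (adj := adj) (N := N)) hD h2
  have l3 : Loc (fun x => gu D (FA adj D N) e.1 x + gu D (FA adj D N) (nx e) x) := l1.map₂ l2 (· + ·)
  rw [← EE_add w l1 l2, EE_resample w (.inl e) l3]
  have h3 : EE w (fun x => |DD (.inl e) (FA adj D N) x|) ≤ _ :=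
    EE_mono w (((FA_loc hD).DD _).map fun z => |z|) (l3.upd (.inl e) false) (fun x => edge_infl h1 h2 x)
  have h4 : 0 ≤ EE w (fun x => gu D (FA adj D N) e.1 (Function.update x (.inl e) true) + gu D (FA adj D N) (nx e) (Function.update x (.inl e) true)) :=
    EE_nonneg w fun x => add_nonneg (abs_nonneg _) (abs_nonneg _)
  have h5 := mul_le_mul_of_nonneg_left h3 (sub_nonneg.2 (clamp_le_one (w (.inl e))))
  have h6 := mul_nonneg (clamp_nonneg (w (.inl e))) h4
  linarith

lemma DD_le_one {adj : V → V → Prop} {D : Set V} {N : ℕ} (i : I) (x : I → Bool) : |DD i (FA adj D N) x| ≤ 1 := by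
  unfold DD FA
  have a1 := ind_nonneg {x | sig D x ∈ Arm adj 1 N} (Function.update x i true)
  have a2 := ind_nonneg {x | sig D x ∈ Arm adj 1 N} (Function.update x i false)
  have a3 := ind_le_one {x | sig D x ∈ Arm adj 1 N} (Function.update x i true)
  have a4 := ind_le_one {x | sig D x ∈ Arm adj 1 N} (Function.update x i false)
  rw [abs_le]; constructor <;> linarith

lemma DD_bit_nonneg {adj : V → V → Prop} {D : Set V} {N : ℕ} (v : V) (x : I → Bool) :
    0 ≤ DD (.inr v) (FA adj D N) x := by
  unfold DD FA
  by_cases h : sig D (Function.update x (.inr v) false) ∈ Arm adj 1 N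
  · rw [ind_mem (x := Function.update x (.inr v) true)]
    · linarith [ind_le_one {x | sig D x ∈ Arm adj 1 N} (Function.update x (.inr v) false)]
    · refine Arm.inc.up _ _ (fun u => ?_) h
      rw [sig_upd_inr, sig_upd_inr]; split_ifs <;> simp
  · rw [ind_not (x := Function.update x (.inr v) false) h]
    linarith [ind_nonneg {x | sig D x ∈ Arm adj 1 N} (Function.update x (.inr v) true)]

lemma bl_card (v : V) (R : ℕ) : ((bl_finite v R).toFinset.card : ℝ) ≤ (2 * R + 1) ^ 2 := by
  refine le_trans ?_ (Lam_card R)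
  have : (bl_finite v R).toFinset.card ≤ (Lam_finite R).toFinset.card := by
    refine Finset.card_le_card_of_injOn (fun u => u - v) (fun u hu => ?_) (fun a _ b _ h => by simpa using h)
    have h1 : nm (u - v) ≤ R := (bl_finite v R).mem_toFinset.1 hu
    exact (Lam_finite R).mem_toFinset.2 h1
  exact_mod_cast this

lemma gu_sum {adj : V → V → Prop} {D : Set V} (hD : D.Finite) {N R : ℕ} (w : I → ℝ) {c : ℝ}
    (hc : ∀ v, (PP w).real {x | rad x v R} ≤ c) :
    ∑ u ∈ hD.toFinset, EE w (gu D (FA adj D N) u) ≤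
      (2 * R + 1) ^ 2 * ∑ v ∈ hD.toFinset, EE w (fun x => |DD (.inr v) (FA adj D N) x|) + hD.toFinset.card * c := by
  classical
  have l1 : ∀ v : V, Loc (fun x => |DD (.inr v) (FA adj D N) x|) := fun v => ((FA_loc hD).DD _).map fun z => |z|
  have step : ∀ u ∈ hD.toFinset, EE w (gu D (FA adj D N) u) ≤
      (∑ v ∈ hD.toFinset, if v ∈ bl u R then EE w (fun x => |DD (.inr v) (FA adj D N) x|) else 0) + c := by
    intro u hu
    have hu' := hD.mem_toFinset.1 hu
    rw [← Finset.sum_filter, ← EE_sum w _ l1]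
    have l2 : Loc (fun x => ∑ v ∈ hD.toFinset.filter (fun v => v ∈ bl u R), |DD (.inr v) (FA adj D N) x|) := by
      have : ∀ s : Finset V, Loc (fun x => ∑ v ∈ s, |DD (.inr v) (FA adj D N) x|) := by
        intro s
        induction s using Finset.induction_on with
        | empty => simpa using Loc.const 0
        | insert a s ha ih =>
          simp only [Finset.sum_insert ha]
          exact (l1 a).map₂ ih (· + ·)
      exact this _
    have l3 : Loc (ind {x | rad x u R}) := Loc.ind (rad_loc u R)
    refine le_trans ?_ (add_le_add le_rfl (hc u))
    rw [← EE_ind w (A := {x | rad x u R}) (Loc.meas (A := {x | rad x u R}) (rad_loc u R)), ← EE_add w l2 l3]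
    refine EE_mono w (gu_loc (FA_loc hD) hD hu') (l2.map₂ l3 (· + ·)) fun x => ?_
    have n0 : 0 ≤ ∑ v ∈ hD.toFinset.filter (fun v => v ∈ bl u R), |DD (.inr v) (FA adj D N) x| :=
      Finset.sum_nonneg fun _ _ => abs_nonneg _
    by_cases hr : rad x u R
    · rw [ind_mem (A := {x | rad x u R}) hr]
      have : gu D (FA adj D N) u x ≤ 1 := DD_le_one _ _
      linarith
    · rw [ind_not (A := {x | rad x u R}) hr, add_zero]
      have hmem : rep (ed D x) u ∈ hD.toFinset.filter (fun v => v ∈ bl u R) := by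
        rw [Finset.mem_filter]
        refine ⟨hD.mem_toFinset.2 (rep_mem x hu'), ?_⟩
        have := (not_rad hr ((rep_cl (ed D x) u).mono (ed_mono (Set.subset_univ _) x))).2
        exact this.le
      unfold gu
      generalize hρ : rep (ed D x) u = ρ at hmem ⊢
      generalize hD.toFinset.filter (fun v => v ∈ bl u R) = s at hmem ⊢
      have key : ∀ f : V → ℝ, (∀ v, 0 ≤ f v) → f ρ ≤ ∑ v ∈ s, f v := fun f hf =>
        Finset.single_le_sum (fun v _ => hf v) hmem
      have := key (fun v => |DD (.inr v) (FA adj D N) x|) (fun v => abs_nonneg _)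
      exact this
  refine (Finset.sum_le_sum step).trans ?_
  rw [Finset.sum_add_distrib, Finset.sum_const, nsmul_eq_mul]
  refine add_le_add ?_ le_rfl
  rw [Finset.sum_comm, Finset.mul_sum]
  refine Finset.sum_le_sum fun v _ => ?_
  rw [← Finset.sum_filter, Finset.sum_const, nsmul_eq_mul]
  refine mul_le_mul_of_nonneg_right (le_trans ?_ (bl_card v R)) (EE_nonneg w fun _ => abs_nonneg _)
  have : (hD.toFinset.filter (fun u => v ∈ bl u R)) ⊆ (bl_finite v R).toFinset := by
    intro u hu
    have h1 : nm (v - u) ≤ R := (Finset.mem_filter.1 hu).2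
    rw [nm_comm] at h1
    exact (bl_finite v R).mem_toFinset.2 h1
  exact_mod_cast Finset.card_le_card this

lemma idx_sum {D : Set V} (hD : D.Finite) (f : I → ℝ) (hf : ∀ i, 0 ≤ f i) {G : V → ℝ} (hG : ∀ v, 0 ≤ G v)
    (h : ∀ e : Ed, e.1 ∈ D → nx e ∈ D → f (.inl e) ≤ G e.1 + G (nx e)) :
    ∑ i ∈ idx D hD, f i ≤ 4 * ∑ v ∈ hD.toFinset, G v + ∑ v ∈ hD.toFinset, f (.inr v) := by
  classical
  unfold idx
  rw [Finset.sum_union (by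
    rw [Finset.disjoint_left]; intro i hi hi'
    simp only [Finset.mem_image] at hi hi'
    obtain ⟨a, -, rfl⟩ := hi; obtain ⟨b, -, hb⟩ := hi'; simp at hb),
    Finset.sum_image (fun a _ b _ h => Sum.inl_injective h), Finset.sum_image (fun a _ b _ h => Sum.inr_injective h)]
  refine add_le_add ?_ le_rfl
  set E0 := ((hD.prod (Set.finite_univ (α := Bool))).toFinset) with hE0
  have hmem : ∀ e : Ed, e ∈ E0 ↔ e.1 ∈ D := by intro e; simp [hE0, Set.mem_prod]
  have hE1 : E0 = hD.toFinset ×ˢ (Finset.univ : Finset Bool) := by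
    ext e; rw [hmem]; simp
  have s0 : ∑ e ∈ E0, G e.1 = 2 * ∑ v ∈ hD.toFinset, G v := by
    rw [hE1, Finset.sum_product]
    simp [Finset.mul_sum]
  have s1 : ∑ e ∈ E0.filter (fun e : Ed => nx e ∈ D), G e.1 ≤ 2 * ∑ v ∈ hD.toFinset, G v := by
    rw [← s0]
    exact Finset.sum_le_sum_of_subset_of_nonneg (Finset.filter_subset _ _) (fun _ _ _ => hG _)
  have s2 : ∑ e ∈ E0.filter (fun e : Ed => nx e ∈ D), G (nx e) ≤ 2 * ∑ v ∈ hD.toFinset, G v := by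
    rw [← s0]
    have inj : Set.InjOn (fun e : Ed => ((nx e, e.2) : Ed)) (E0.filter (fun e : Ed => nx e ∈ D)) := by
      rintro ⟨⟨a, b⟩, c⟩ - ⟨⟨a', b'⟩, c'⟩ - h
      simp only [nx, Prod.mk.injEq] at h
      obtain ⟨h1, rfl⟩ := h
      cases c <;> simp at h1 <;> simp [h1]
    have := Finset.sum_image (f := fun e : Ed => G e.1) inj
    simp only at this
    rw [← this]
    refine Finset.sum_le_sum_of_subset_of_nonneg ?_ (fun _ _ _ => hG _)
    intro e he
    obtain ⟨e', h1, rfl⟩ := Finset.mem_image.1 he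
    rw [hmem]; exact (Finset.mem_filter.1 h1).2
  calc _ ≤ ∑ e ∈ E0.filter (fun e : Ed => nx e ∈ D), (G e.1 + G (nx e)) :=
        Finset.sum_le_sum fun e he => h e ((hmem e).1 (Finset.mem_filter.1 he).1) (Finset.mem_filter.1 he).2
    _ ≤ _ := by rw [Finset.sum_add_distrib]; linarith

end DaC

namespace DaC

open Classical in
/-- derivative of the finite-volume arm probability -/
noncomputable def dth (pe : ℝ) (fz : V → Option Bool) (adj : V → V → Prop) (D : Set V) (hD : D.Finite) (N : ℕ) (t : ℝ) : ℝ :=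
  ∑ v ∈ hD.toFinset, (if fz v = none then 1 else 0) * EE (Wt pe fz t) (fun x => |DD (.inr v) (FA adj D N) x|)

lemma dth_nonneg {pe fz adj D hD N t} : 0 ≤ dth pe fz adj D hD N t :=
  Finset.sum_nonneg fun v _ => mul_nonneg (by split_ifs <;> simp) (EE_nonneg _ fun _ => abs_nonneg _)

lemma FA_dep {adj : V → V → Prop} {D : Set V} (hD : D.Finite) {N : ℕ} (hN : Lam N ⊆ D) :
    DependsOn (FA adj D N) (idx D hD : Set I) := by
  intro x y h
  refine ind_congr ?_
  have := Con_dep (adj := adj) (D := Lam N) (A := Lam 1) (B := {v | nm v = N})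
  have h2 := this (x := sig D x) (y := sig D y) (fun v hv => sig_dep hD (hN hv) h)
  exact iff_of_eq h2

open Classical in
lemma FA_deriv {pe : ℝ} {fz : V → Option Bool} {adj : V → V → Prop} {D : Set V} (hD : D.Finite) {N : ℕ} (hN : Lam N ⊆ D)
    {t : ℝ} (h0 : 0 < t) (h1 : t < 1) :
    HasDerivAt (fun s => EE (Wt pe fz s) (FA adj D N)) (dth pe fz adj D hD N t) t := by
  have hw : ∀ i, HasDerivAt (fun s => clamp (Wt pe fz s i)) (match i with
      | .inl _ => 0
      | .inr v => if fz v = none then 1 else 0 : ℝ) t := by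
    rintro (e | v)
    · exact (hasDerivAt_const t (clamp pe) : HasDerivAt (fun _ : ℝ => clamp pe) 0 t)
    · rcases hv : fz v with _ | b
      · simp only [hv, if_true]
        refine (hasDerivAt_id t).congr_of_eventuallyEq ?_
        filter_upwards [Ioo_mem_nhds h0 h1] with s hs
        simp only [Wt, hv, id]
        exact clamp_eq hs.1.le hs.2.le
      · simp only [hv, Wt]
        simpa using hasDerivAt_const t (clamp (if b = true then (1:ℝ) else 0))
  convert russo hw (FA_dep hD hN (adj := adj)) using 1
  have hab : ∀ v : V, (fun x => |DD (.inr v) (FA adj D N) x|) = DD (.inr v) (FA adj D N) := fun v =>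
    funext fun x => abs_of_nonneg (DD_bit_nonneg v x)
  unfold dth idx
  rw [Finset.sum_union (by
    rw [Finset.disjoint_left]; intro i hi hi'
    simp only [Finset.mem_image] at hi hi'
    obtain ⟨a, -, rfl⟩ := hi; obtain ⟨b, -, hb⟩ := hi'; simp at hb),
    Finset.sum_image (fun a _ b _ h => Sum.inl_injective h), Finset.sum_image (fun a _ b _ h => Sum.inr_injective h)]
  simp only [zero_mul, Finset.sum_const_zero, zero_add, hab]

lemma FA_mono {pe : ℝ} {fz : V → Option Bool} {adj : V → V → Prop} {D : Set V} (hD : D.Finite) {N : ℕ} (hN : Lam N ⊆ D)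
    {a b : ℝ} (h0 : 0 < a) (hab : a ≤ b) (h1 : b < 1) :
    EE (Wt pe fz a) (FA adj D N) ≤ EE (Wt pe fz b) (FA adj D N) := by
  have hd : ∀ t ∈ Set.Icc a b, HasDerivAt (fun s => EE (Wt pe fz s) (FA adj D N)) (dth pe fz adj D hD N t) t :=
    fun t ht => FA_deriv hD hN (h0.trans_le ht.1) (ht.2.trans_lt h1)
  have := monotoneOn_of_deriv_nonneg (convex_Icc a b)
    (f := fun s => EE (Wt pe fz s) (FA adj D N)) (fun t ht => (hd t ht).continuousAt.continuousWithinAt)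
    (fun t ht => (hd t (interior_subset ht)).differentiableAt.differentiableWithinAt)
    (fun t ht => by rw [(hd t (interior_subset ht)).deriv]; exact dth_nonneg)
  exact this ⟨le_rfl, hab⟩ ⟨hab, le_rfl⟩ hab

lemma Lam_Exh : Exh Lam := Lam_exhaust

lemma Lam_mono {a b : ℕ} (h : a ≤ b) : Lam a ⊆ Lam b := fun v hv => by
  have : nm v ≤ a := hv
  show nm v ≤ b; omega

lemma arm_mono {pe : ℝ} {fz : V → Option Bool} {adj : V → V → Prop} {N : ℕ}
    {a b : ℝ} (h0 : 0 < a) (hab : a ≤ b) (h1 : b < 1) :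
    (mu (Wt pe fz a)).real (Arm adj 1 N) ≤ (mu (Wt pe fz b)).real (Arm adj 1 N) := by
  have e : ∀ n, (fun x => ind (Arm adj 1 N) (sig (Lam n) x)) = FA adj (Lam n) N := fun n =>
    funext fun x => ind_congr Iff.rfl
  refine le_of_tendsto_of_tendsto (mu_tendsto (Wt pe fz a) Lam_Exh Lam_finite (Arm.inc (adj := adj) (a := 1) (b := N)).loc)
    (mu_tendsto (Wt pe fz b) Lam_Exh Lam_finite (Arm.inc (adj := adj) (a := 1) (b := N)).loc) ?_
  filter_upwards [Filter.eventually_ge_atTop N] with n hn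
  rw [e]
  exact FA_mono (Lam_finite n) (Lam_mono hn) h0 hab h1

open Classical in
theorem diffineq {pe t : ℝ} {fz : V → Option Bool} (hM : Mok pe fz) {adj : V → V → Prop} (ok : Okay adj)
    (h0 : 0 < t) (h1 : t < 1) {D : Set V} (hD : D.Finite) {N n R : ℕ} (hn : 2 ≤ n) (hnN : n ≤ N) (hN : Lam (4 * N) ⊆ D)
    {c c' : ℝ} (hc : ∀ v, (PP (Wt pe fz t)).real {x | rad x v N} ≤ c)
    (hc' : ∀ v, (PP (Wt pe fz t)).real {x | rad x v R} ≤ c') {Δ : ℝ}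
    (hΔ : 2 * n + N * ((mu (Wt pe fz t)).real (Arm adj 1 (n - 1)) + (6 * N + 1) ^ 2 * c) ≤ t * Δ) :
    N * (EE (Wt pe fz t) (FA adj D N) * (1 - EE (Wt pe fz t) (FA adj D N))) ≤
      18 * Δ * (2 * R + 1) ^ 2 * dth pe fz adj D hD N t + 16 * Δ * (hD.toFinset.card * c') := by
  set w := Wt pe fz t with hw
  set F := FA adj D N with hF
  have hN' : Lam N ⊆ D := (Lam_mono (by omega)).trans hN
  have hc0 : 0 ≤ c := measureReal_nonneg.trans (hc (0, 0))
  have hc0' : 0 ≤ c' := measureReal_nonneg.trans (hc' (0, 0))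
  have hΔ0 : 0 ≤ Δ := by
    have : 0 ≤ t * Δ := le_trans (by positivity) hΔ
    exact nonneg_of_mul_nonneg_right this h0
  let P : V → ℝ := fun v => ∑ m ∈ Finset.Icc 1 N, EE w (ind {x | Rk adj D N m Set.univ x v})
  have hP0 : ∀ v, 0 ≤ P v := fun v => Finset.sum_nonneg fun m _ => EE_nonneg w fun x => ind_nonneg _ _
  have hPb : ∀ v ∈ D, fz v = none → P v ≤ Δ := by
    intro v hv hfz
    have := (bound_sum (t := t) hM ok hD hn hnN hN hc hv).trans hΔ
    have hwv : clamp (Wt pe fz t (.inr v)) = t := by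
      simp only [Wt, hfz]; exact clamp_eq h0.le h1.le
    rw [hwv] at this
    exact le_of_mul_le_mul_left this h0
  let J : I → ℝ := fun j => ∑ m ∈ Finset.Icc 1 N, EE w (ind {x | j ∈ Full adj D N m x})
  have hJ0 : ∀ j, 0 ≤ J j := fun j => Finset.sum_nonneg fun m _ => EE_nonneg w fun x => ind_nonneg _ _
  have hJv : ∀ v, J (.inr v) = P v := by
    intro v
    refine Finset.sum_congr rfl fun m _ => ?_
    congr 1; funext x
    refine ind_congr ⟨?_, ?_⟩
    · rintro ⟨u, hu, rfl⟩; exact hu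
    · intro h; exact ⟨v, h, rfl⟩
  have hJe : ∀ e : Ed, J (.inl e) ≤ P e.1 + P (nx e) := by
    intro e
    rw [← Finset.sum_add_distrib]
    refine Finset.sum_le_sum fun m _ => ?_
    have l1 : ∀ v, Loc (ind {x | Rk adj D N m Set.univ x v}) := fun v => Loc.ind (Rk_dep hD hN' v)
    have l2 : Loc (ind {x | Sum.inl e ∈ Full adj D N m x}) := Loc.ind (Full_loc hD hN' _)
    rw [← EE_add w (l1 e.1) (l1 (nx e))]
    refine EE_mono w l2 ((l1 e.1).map₂ (l1 (nx e)) (· + ·)) fun x => ?_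
    by_cases h : Sum.inl e ∈ Full adj D N m x
    · rw [ind_mem (A := {x | Sum.inl e ∈ Full adj D N m x}) h]
      obtain ⟨u, hu, rfl | rfl⟩ := h
      · rw [ind_mem (A := {x | Rk adj D N m Set.univ x e.1}) hu]
        linarith [ind_nonneg {x | Rk adj D N m Set.univ x (nx e)} x]
      · rw [ind_mem (A := {x | Rk adj D N m Set.univ x (nx e)}) hu]
        linarith [ind_nonneg {x | Rk adj D N m Set.univ x e.1} x]
    · rw [ind_not (A := {x | Sum.inl e ∈ Full adj D N m x}) h]
      exact add_nonneg (ind_nonneg _ _) (ind_nonneg _ _)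
  let f : I → ℝ := fun j => J j * (2 * (clamp (w j) * (1 - clamp (w j))) * EE w (fun x => |DD j F x|))
  have hDD0 : ∀ j, 0 ≤ EE w (fun x => |DD j F x|) := fun j => EE_nonneg w fun _ => abs_nonneg _
  have hcl : ∀ j, 0 ≤ clamp (w j) * (1 - clamp (w j)) := fun j =>
    mul_nonneg (clamp_nonneg _) (sub_nonneg.2 (clamp_le_one _))
  have hf0 : ∀ j, 0 ≤ f j := fun j => mul_nonneg (hJ0 j) (mul_nonneg (mul_nonneg (by norm_num) (hcl j)) (hDD0 j))
  have tot : N * (EE w F * (1 - EE w F)) ≤ ∑ j ∈ idx D hD, f j := by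
    have h : ∀ m ∈ Finset.Icc 1 N, EE w F * (1 - EE w F) ≤ _ := fun m hm =>
      osss_arm ok w hD (Finset.mem_Icc.1 hm).1 (Finset.mem_Icc.1 hm).2 hN'
    have := Finset.sum_le_sum h
    rw [Finset.sum_const, nsmul_eq_mul, Nat.card_Icc, Nat.add_sub_cancel, Finset.sum_comm] at this
    refine this.trans (le_of_eq (Finset.sum_congr rfl fun j _ => ?_))
    simp only [f, J, Finset.sum_mul]; rfl
  have hbit : ∑ v ∈ hD.toFinset, f (.inr v) ≤ 2 * Δ * dth pe fz adj D hD N t := by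
    unfold dth
    rw [Finset.mul_sum]
    refine Finset.sum_le_sum fun v hv => ?_
    have hv' := hD.mem_toFinset.1 hv
    simp only [f]
    rw [hJv]
    rcases hfz : fz v with _ | b
    · simp only [if_true, one_mul]
      have g1 := hPb v hv' hfz
      have g2 : 2 * (clamp (w (.inr v)) * (1 - clamp (w (.inr v)))) ≤ 2 := by
        nlinarith [clamp_nonneg (w (.inr v)), clamp_le_one (w (.inr v))]
      calc _ ≤ Δ * (2 * EE w (fun x => |DD (.inr v) F x|)) :=
            mul_le_mul g1 (mul_le_mul_of_nonneg_right g2 (hDD0 _)) (mul_nonneg (mul_nonneg (by norm_num) (hcl _)) (hDD0 _)) hΔ0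
        _ = _ := by ring
    · have : clamp (w (.inr v)) * (1 - clamp (w (.inr v))) = 0 := by
        simp only [hw, Wt, hfz]
        cases b <;> simp [clamp]
      rw [this]; simp
  rcases hM with ⟨rfl, -⟩ | hfz
  · have := tot.trans (idx_sum hD f hf0 (G := fun _ => 0) (fun _ => le_rfl) (fun e _ _ => by
      have : clamp (w (.inl e)) = 0 := by simp [hw, Wt, clamp]
      simp only [f, this]; simp))
    have hd0 := dth_nonneg (pe := 0) (fz := fz) (adj := adj) (D := D) (hD := hD) (N := N) (t := t)
    have h9 : 2 * Δ * dth 0 fz adj D hD N t ≤ 18 * Δ * (2 * R + 1) ^ 2 * dth 0 fz adj D hD N t := by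
      refine mul_le_mul_of_nonneg_right ?_ hd0
      have : (1:ℝ) ≤ (2 * R + 1) ^ 2 := by
        have : (0:ℝ) ≤ R := by positivity
        nlinarith
      nlinarith
    have h10 : 0 ≤ 16 * Δ * (hD.toFinset.card * c') := by positivity
    simp only [Finset.sum_const_zero, mul_zero, zero_add] at this
    linarith
  · have hg := gu_sum (adj := adj) (N := N) hD w hc'
    have hgd : ∑ v ∈ hD.toFinset, EE w (fun x => |DD (.inr v) (FA adj D N) x|) = dth pe fz adj D hD N t := by
      unfold dth; simp [hfz, hw]
    rw [hgd] at hg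
    have := tot.trans (idx_sum hD f hf0 (G := fun v => 4 * Δ * EE w (gu D F v))
      (fun v => mul_nonneg (by positivity) (EE_nonneg w fun _ => abs_nonneg _)) (fun e g1 g2 => by
        have g3 : J (.inl e) ≤ 2 * Δ := by
          have := hJe e
          have := hPb e.1 g1 (by rw [hfz])
          have := hPb (nx e) g2 (by rw [hfz])
          linarith
        have g4 := edge_infl_EE (adj := adj) (N := N) hD g1 g2 w
        have g5 : 2 * (clamp (w (.inl e)) * (1 - clamp (w (.inl e)))) * EE w (fun x => |DD (.inl e) F x|) ≤
            2 * (EE w (gu D F e.1) + EE w (gu D F (nx e))) := by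
          have a1 := clamp_le_one (w (.inl e))
          have a2 := clamp_nonneg (w (.inl e))
          have a3 : 0 ≤ (1 - clamp (w (.inl e))) * EE w (fun x => |DD (.inl e) F x|) :=
            mul_nonneg (sub_nonneg.2 a1) (hDD0 _)
          have a4 := mul_le_mul_of_nonneg_right a1 a3
          simp only [← hF] at g4
          linarith
        calc f (.inl e) ≤ 2 * Δ * (2 * (EE w (gu D F e.1) + EE w (gu D F (nx e)))) :=
              mul_le_mul g3 g5 (mul_nonneg (mul_nonneg (by norm_num) (hcl _)) (hDD0 _)) (by positivity)
          _ = _ := by ring))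
    rw [← Finset.mul_sum] at this
    have hd0 := dth_nonneg (pe := pe) (fz := fz) (adj := adj) (D := D) (hD := hD) (N := N) (t := t)
    have h8 := mul_le_mul_of_nonneg_left hg (show 0 ≤ 16 * Δ by positivity)
    have h9 : 2 * Δ * dth pe fz adj D hD N t ≤ 2 * Δ * (2 * R + 1) ^ 2 * dth pe fz adj D hD N t := by
      refine mul_le_mul_of_nonneg_right ?_ hd0
      have : (1:ℝ) ≤ (2 * R + 1) ^ 2 := by
        have : (0:ℝ) ≤ R := by positivity
        nlinarith
      nlinarith
    linarith

/-- integrating the differential inequality -/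
lemma ode {θ θ' : ℝ → ℝ} {a b Q ε : ℝ} (hab : a ≤ b) (hQ : 0 < Q) (hε : 0 ≤ ε)
    (hd : ∀ t ∈ Set.Icc a b, HasDerivAt θ (θ' t) t) (h0 : ∀ t ∈ Set.Icc a b, 0 ≤ θ t) (hθ' : ∀ t ∈ Set.Icc a b, 0 ≤ θ' t)
    (hb : θ b ≤ 1 / 2) (h : ∀ t ∈ Set.Icc a b, θ t * (1 - θ t) ≤ Q * θ' t + ε) :
    θ a ≤ 2 * ε + Real.exp (-((b - a) / (2 * Q))) := by
  have mono := monotoneOn_of_deriv_nonneg (convex_Icc a b)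
    (f := θ) (fun t ht => (hd t ht).continuousAt.continuousWithinAt)
    (fun t ht => (hd t (interior_subset ht)).differentiableAt.differentiableWithinAt)
    (fun t ht => by rw [(hd t (interior_subset ht)).deriv]; exact hθ' t (interior_subset ht))
  have half : ∀ t ∈ Set.Icc a b, θ t ≤ 1 / 2 := fun t ht => (mono ht ⟨hab, le_rfl⟩ ht.2).trans hb
  let g : ℝ → ℝ := fun t => (θ t - 2 * ε) * Real.exp (-(t / (2 * Q)))
  have hg : ∀ t ∈ Set.Icc a b, HasDerivAt g (θ' t * Real.exp (-(t / (2 * Q))) +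
      (θ t - 2 * ε) * (Real.exp (-(t / (2 * Q))) * (-(1 / (2 * Q))))) t := by
    intro t ht
    have e1 : HasDerivAt (fun t => -(t / (2 * Q))) (-(1 / (2 * Q))) t := ((hasDerivAt_id t).div_const (2 * Q)).neg
    exact ((hd t ht).sub_const _).mul e1.exp
  have gm := monotoneOn_of_deriv_nonneg (convex_Icc a b)
    (f := g) (fun t ht => (hg t ht).continuousAt.continuousWithinAt)
    (fun t ht => (hg t (interior_subset ht)).differentiableAt.differentiableWithinAt)
    (fun t ht => by
      have ht' := interior_subset ht
      rw [(hg t ht').deriv]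
      have k1 := h t ht'
      have k2 := half t ht'
      have k3 := h0 t ht'
      have k4 : θ t - 2 * ε ≤ θ' t * (2 * Q) := by nlinarith
      have k5 : (θ t - 2 * ε) * (1 / (2 * Q)) ≤ θ' t := by
        rw [mul_one_div, div_le_iff₀ (by positivity)]; exact k4
      have k6 := Real.exp_pos (-(t / (2 * Q)))
      nlinarith)
  have k := gm ⟨le_rfl, hab⟩ ⟨hab, le_rfl⟩ hab
  simp only [g] at k
  have e0 : Real.exp (-((b - a) / (2 * Q))) = Real.exp (-(b / (2 * Q))) / Real.exp (-(a / (2 * Q))) := by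
    rw [← Real.exp_sub]; congr 1; ring
  rw [e0]
  have p1 := Real.exp_pos (-(b / (2 * Q)))
  have p2 := Real.exp_pos (-(a / (2 * Q)))
  have : θ a - 2 * ε ≤ Real.exp (-(b / (2 * Q))) / Real.exp (-(a / (2 * Q))) := by
    rw [le_div_iff₀ p2]
    refine k.trans ?_
    nlinarith
  linarith

end DaC

namespace DaC

/-- finite versus infinite volume -/
lemma fv (w : I → ℝ) {adj : V → V → Prop} {D : Set V} (hD : D.Finite) {N : ℕ} (hN : Lam (4 * N) ⊆ D) {c : ℝ}
    (hc : ∀ v, (PP w).real {x | rad x v N} ≤ c) :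
    |EE w (FA adj D N) - (mu w).real (Arm adj 1 N)| ≤ (2 * N + 1) ^ 2 * c := by
  have hm : MeasurableSet (Arm adj 1 N) := Arm.inc.meas
  have hb : MeasurableSet {x | ∃ v ∈ (Lam_finite N).toFinset, rad x v N} := by
    have : {x | ∃ v ∈ (Lam_finite N).toFinset, rad x v N} = ⋃ v ∈ (Lam_finite N).toFinset, {x | rad x v N} := by ext x; simp
    rw [this]
    exact Finset.measurableSet_biUnion _ fun v _ => (rad_loc v N).meas
  have hA : MeasurableSet {x | sig D x ∈ Arm adj 1 N} := (sig_loc hD Arm.inc.loc).meas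
  have e1 : EE w (FA adj D N) = (PP w).real {x | sig D x ∈ Arm adj 1 N} := EE_ind w hA
  rw [e1, mu_real w hm]
  have hc0 : 0 ≤ c := measureReal_nonneg.trans (hc (0, 0))
  have hbad := (rad_union w (Lam_finite N).toFinset N (fun v _ => hc v)).trans
    (mul_le_mul_of_nonneg_right (Lam_card N) hc0)
  have key : ∀ x, (¬ ∃ v ∈ (Lam_finite N).toFinset, rad x v N) → (sig D x ∈ Arm adj 1 N ↔ sig Set.univ x ∈ Arm adj 1 N) := by
    intro x hx
    push Not at hx
    refine iff_of_eq (Con_dep (adj := adj) (D := Lam N) (A := Lam 1) (B := {v | nm v = N}) (fun v hv => ?_))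
    refine not_rad_sig (hx v (by simpa using hv)) fun u hu => hN ?_
    have h1 : nm (u - v) ≤ N := hu
    have h2 : nm v ≤ N := hv
    have := (nm_sub_ge u v).2
    show nm u ≤ ((4 * N : ℕ) : ℤ)
    push_cast; omega
  haveI : IsProbabilityMeasure (PP w) := by unfold PP; infer_instance
  have i1 : (PP w).real {x | sig D x ∈ Arm adj 1 N} ≤ (PP w).real {x | sig Set.univ x ∈ Arm adj 1 N} + (PP w).real {x | ∃ v ∈ (Lam_finite N).toFinset, rad x v N} := by
    refine (measureReal_mono (fun x hx => ?_)).trans (measureReal_union_le _ _)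
    by_cases h : ∃ v ∈ (Lam_finite N).toFinset, rad x v N
    · exact Or.inr h
    · exact Or.inl ((key x h).1 hx)
  have i2 : (PP w).real {x | sig Set.univ x ∈ Arm adj 1 N} ≤ (PP w).real {x | sig D x ∈ Arm adj 1 N} + (PP w).real {x | ∃ v ∈ (Lam_finite N).toFinset, rad x v N} := by
    refine (measureReal_mono (fun x hx => ?_)).trans (measureReal_union_le _ _)
    by_cases h : ∃ v ∈ (Lam_finite N).toFinset, rad x v N
    · exact Or.inr h
    · exact Or.inl ((key x h).2 hx)
  rw [abs_le]; constructor <;> linarith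

/-- numerical part -/
lemma sharp_num {ρ : ℝ} (h0 : 0 < ρ) (h1 : ρ < 1) : ∃ M : ℕ, ∃ σ : ℝ, 0 < M ∧ 0 < σ ∧ σ < 1 ∧
    ∀ k : ℕ, ρ ^ k * 64 ^ (k / M) ≤ σ ^ k := by
  refine ?_
  set σ := Real.sqrt ρ with hσ
  have s0 : 0 < σ := Real.sqrt_pos.2 h0
  have s1 : σ < 1 := by rw [hσ, Real.sqrt_lt' one_pos]; simpa using h1
  have s2 : σ * σ = ρ := Real.mul_self_sqrt h0.le
  obtain ⟨M, hM⟩ := exists_pow_lt_of_lt_one (show (0:ℝ) < 1 / 64 by norm_num) s1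
  have hM0 : 0 < M := by
    rcases Nat.eq_zero_or_pos M with rfl | h
    · norm_num at hM
    · exact h
  refine ⟨M, σ, hM0, s0, s1, fun k => ?_⟩
  have a1 : σ ^ k ≤ (1 / 64) ^ (k / M) := by
    calc σ ^ k ≤ σ ^ (M * (k / M)) := pow_le_pow_of_le_one s0.le s1.le (Nat.mul_div_le k M)
      _ = (σ ^ M) ^ (k / M) := pow_mul _ _ _
      _ ≤ _ := pow_le_pow_left₀ (by positivity) hM.le _
  rw [← s2, mul_pow, mul_assoc]
  refine mul_le_of_le_one_right (by positivity) ?_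
  calc σ ^ k * 64 ^ (k / M) ≤ (1 / 64) ^ (k / M) * 64 ^ (k / M) := mul_le_mul_of_nonneg_right a1 (by positivity)
    _ = 1 := by rw [← mul_pow]; norm_num

lemma exp_num {σ B : ℝ} (h0 : 0 < σ) (h1 : σ < 1) (hB : 0 < B) : ∃ C > 0, ∀ k : ℕ,
    64 ^ k * Real.exp (-(B / σ ^ k)) ≤ C * (1 / 2) ^ k := by
  obtain ⟨m, hm⟩ := exists_pow_lt_of_lt_one (show (0:ℝ) < 1 / 128 by norm_num) h1
  refine ⟨m.factorial / B ^ m, by positivity, fun k => ?_⟩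
  have e1 := Real.pow_div_factorial_le_exp (B / σ ^ k) (by positivity) m
  have p : 0 < (B / σ ^ k) ^ m / m.factorial := by positivity
  rw [Real.exp_neg]
  have e2 := inv_anti₀ p e1
  have e3 : ((B / σ ^ k) ^ m / m.factorial)⁻¹ = m.factorial / B ^ m * (σ ^ m) ^ k := by
    rw [← pow_mul, mul_comm m k, pow_mul, div_pow]; field_simp
  rw [e3] at e2
  have e4 : (σ ^ m) ^ k ≤ (1 / 128) ^ k := pow_le_pow_left₀ (by positivity) hm.le _
  calc 64 ^ k * (Real.exp (B / σ ^ k))⁻¹ ≤ 64 ^ k * (m.factorial / B ^ m * (1 / 128) ^ k) := by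
        gcongr; exact e2.trans (by gcongr)
    _ = m.factorial / B ^ m * (64 * (1 / 128)) ^ k := by rw [mul_pow]; ring
    _ = _ := by norm_num

set_option maxHeartbeats 1600000 in
theorem sharp {pe : ℝ} {fz : V → Option Bool} (hdec : Dec pe) (hM : Mok pe fz) {adj : V → V → Prop} (ok : Okay adj)
    {a b : ℝ} (ha : 0 < a) (hab : a < b) (hb : b < 1) {C ρ : ℝ} (hC : 0 < C) (hρ0 : 0 < ρ) (hρ1 : ρ < 1)
    (hk : ∀ k0 : ℕ, ∃ k ≥ k0, (mu (Wt pe fz b)).real (Arm adj 1 (54 * 8 ^ k)) ≤ C * ρ ^ k) {κ : ℝ} (hκ : 0 < κ) (N0 : ℕ) :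
    ∃ N ≥ N0, N * (mu (Wt pe fz a)).real (Arm adj 1 N) ≤ κ := by
  wlog hρ8 : 1 / 8 ≤ ρ generalizing ρ
  · refine this (ρ := 1 / 8) (by norm_num) (by norm_num) (fun k0 => ?_) le_rfl
    obtain ⟨k, h1, h2⟩ := hk k0
    exact ⟨k, h1, h2.trans (by gcongr; linarith)⟩
  obtain ⟨M, σ, hM0, hσ0, hσ1, hMσ⟩ := sharp_num hρ0 hρ1
  obtain ⟨K, hK, hKb⟩ := hdec 4
  obtain ⟨K', hK', hKb'⟩ := hdec (7 * M)
  set C1 := (4 + C + 49 * K) / a with hC1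
  have C10 : 0 < C1 := by positivity
  obtain ⟨C4, hC4, hexp⟩ := exp_num hσ0 hσ1 (B := (b - a) / (2 * (162 * C1))) (by have := sub_pos.2 hab; positivity)
  -- the scale
  set C3 := 16 * C1 * (81 * 2916 ^ 3) * (K' * 8 ^ (7 * M)) with hC3
  have hC30 : 0 < C3 := by positivity
  set C5 := 2 * C3 + 2916 * C4 + 9 * K with hC5
  have hC50 : 0 < C5 := by positivity
  have ev1 : ∀ᶠ k : ℕ in Filter.atTop, C5 * (1 / 2) ^ k ≤ κ := by
    have := (tendsto_pow_atTop_nhds_zero_of_lt_one (r := (1/2 : ℝ)) (by norm_num) (by norm_num)).const_mul C5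
    rw [mul_zero] at this
    exact this.eventually_le_const hκ
  have ev2 : ∀ᶠ k : ℕ in Filter.atTop, (C + 9 * K) * ρ ^ k ≤ 1 / 2 := by
    have := (tendsto_pow_atTop_nhds_zero_of_lt_one hρ0.le hρ1).const_mul (C + 9 * K)
    rw [mul_zero] at this
    exact this.eventually_le_const (by norm_num)
  obtain ⟨k1, hk1⟩ := Filter.eventually_atTop.1 (ev1.and ev2)
  obtain ⟨k, hk2, hkb⟩ := hk (max k1 N0)
  obtain ⟨e1, e2⟩ := hk1 k ((le_max_left _ _).trans hk2)
  have hkN : N0 ≤ k := (le_max_right _ _).trans hk2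
  clear hk1 ev1 ev2 hk
  clear_value C1 C3 C5
  set n0 := 54 * 8 ^ k with hn0
  set N := n0 * n0 with hN
  have hn1 : 1 ≤ 8 ^ k := Nat.one_le_pow _ _ (by norm_num)
  have hNn : n0 + 1 ≤ N := by rw [hN]; nlinarith
  have hNR : (N : ℝ) = 2916 * 64 ^ k := by
    rw [hN, hn0]; push_cast
    rw [show (64:ℝ) = 8 * 8 by norm_num, mul_pow]; ring
  have hn0R : (n0 : ℝ) = 54 * 8 ^ k := by rw [hn0]; push_cast; rfl
  have h8 : (1:ℝ) ≤ 8 ^ k := one_le_pow₀ (by norm_num)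
  have h64 : (1:ℝ) ≤ 64 ^ k := one_le_pow₀ (by norm_num)
  have hN1 : (1:ℝ) ≤ N := by rw [hNR]; linarith
  have hN0R : (0:ℝ) < N := by linarith
  have hNN : 1 ≤ N := by omega
  have q8 : (1 / 8 : ℝ) ^ k ≤ ρ ^ k := pow_le_pow_left₀ (by norm_num) hρ8 _
  have in0 : (1:ℝ) / n0 ≤ ρ ^ k := by
    refine le_trans ?_ q8
    rw [hn0R, div_pow, one_pow]
    exact one_div_le_one_div_of_le (by positivity) (by linarith)
  have iN : (1:ℝ) / N ≤ (1 / 8) ^ k := by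
    rw [hNR, div_pow, one_pow]
    refine one_div_le_one_div_of_le (by positivity) ?_
    have : (8:ℝ) ^ k ≤ 64 ^ k := pow_le_pow_left₀ (by norm_num) (by norm_num) _
    linarith
  have iN2 : (1:ℝ) / N ≤ (1 / 2) ^ k := iN.trans (pow_le_pow_left₀ (by norm_num) (by norm_num) _)
  clear_value N n0
  set c := K / (N:ℝ) ^ 4 with hc
  clear_value c
  have hcb : ∀ t v, (PP (Wt pe fz t)).real {x | rad x v N} ≤ c := fun t v => hc ▸ hKb _ (fun _ => rfl) v N hNN
  have c0 : 0 ≤ c := measureReal_nonneg.trans (hcb a (0, 0))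
  have c1 : ∀ s : ℝ, 0 ≤ s → s ≤ 7 * N → s ^ 2 * c ≤ 49 * (K * (1 / N)) * (1 / N) := by
    intro s h1 h2
    have : s ^ 2 ≤ 49 * (N:ℝ) ^ 2 := (pow_le_pow_left₀ h1 h2 2).trans_eq (by ring)
    calc s ^ 2 * c ≤ 49 * (N:ℝ) ^ 2 * c := mul_le_mul_of_nonneg_right this (by positivity)
      _ = _ := by rw [hc]; field_simp
  have c2 : (2 * (N:ℝ) + 1) ^ 2 * c ≤ 9 * (K * (1 / N)) * (1 / N) := by
    have : (2 * (N:ℝ) + 1) ^ 2 ≤ 9 * (N:ℝ) ^ 2 :=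
      (pow_le_pow_left₀ (by positivity) (show 2 * (N:ℝ) + 1 ≤ 3 * N by linarith) 2).trans_eq (by ring)
    calc _ ≤ 9 * (N:ℝ) ^ 2 * c := mul_le_mul_of_nonneg_right this (by positivity)
      _ = _ := by rw [hc]; field_simp
  have iN1 : (1:ℝ) / N ≤ 1 := by rw [div_le_one hN0R]; exact hN1
  have iN0 : (0:ℝ) < 1 / N := by positivity
  have armb : ∀ t, a ≤ t → t ≤ b → (mu (Wt pe fz t)).real (Arm adj 1 n0) ≤ C * ρ ^ k := by
    intro t h1 h2
    refine (arm_mono (ha.trans_le h1) h2 hb).trans hkb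
  set Δ := C1 * ρ ^ k * N with hΔ
  set R := 8 ^ (k / M) with hR
  clear_value Δ R
  have hR1 : 1 ≤ R := by rw [hR]; exact Nat.one_le_pow _ _ (by norm_num)
  have hRp : 0 < R := hR1
  have hΔ0 : 0 ≤ Δ := by rw [hΔ]; positivity
  set c' := K' / (R:ℝ) ^ (7 * M) with hc'
  have hcb' : ∀ t v, (PP (Wt pe fz t)).real {x | rad x v R} ≤ c' := fun t v => hKb' _ (fun _ => rfl) v R hR1
  have c'b : c' ≤ K' * 8 ^ (7 * M) / 8 ^ (7 * k) := by
    rw [hc', div_le_div_iff₀ (by positivity) (by positivity), mul_assoc]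
    refine mul_le_mul_of_nonneg_left ?_ hK'.le
    rw [hR]; push_cast
    rw [← pow_mul, ← pow_add]
    refine pow_le_pow_right₀ (by norm_num) ?_
    have := Nat.div_add_mod k M
    have := Nat.mod_lt k hM0
    nlinarith
  have RQ : (2 * (R:ℝ) + 1) ^ 2 ≤ 9 * 64 ^ (k / M) := by
    have : (R:ℝ) ^ 2 = 64 ^ (k / M) := by
      rw [hR]; push_cast; rw [← pow_mul, mul_comm, pow_mul]; norm_num
    have hR1' : (1:ℝ) ≤ R := by exact_mod_cast hR1
    rw [← this]
    exact (pow_le_pow_left₀ (by positivity) (show 2 * (R:ℝ) + 1 ≤ 3 * R by linarith) 2).trans_eq (by ring)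
  have hD := Lam_finite (4 * N)
  clear_value c'
  have Dc : (hD.toFinset.card : ℝ) ≤ 81 * (N:ℝ) ^ 2 := by
    refine (Lam_card _).trans ?_
    push_cast
    exact (pow_le_pow_left₀ (by positivity) (show 2 * (4 * (N:ℝ)) + 1 ≤ 9 * N by linarith) 2).trans_eq (by ring)
  set ε := 16 * C1 * (81 * (N:ℝ) ^ 2 * c') with hε
  have c'0 : 0 ≤ c' := measureReal_nonneg.trans (hcb' a (0, 0))
  have hε0 : 0 ≤ ε := by positivity
  clear_value ε
  have hQ0 : 0 < 162 * C1 * σ ^ k := by positivity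
  have hΔb : ∀ t, a ≤ t → t ≤ b → 2 * ((n0 + 1 : ℕ) : ℝ) + N * ((mu (Wt pe fz t)).real (Arm adj 1 (n0 + 1 - 1)) + (6 * N + 1) ^ 2 * c) ≤ t * Δ := by
    intro t h1 h2
    rw [Nat.add_sub_cancel]
    have h3 := armb t h1 h2
    have h4 := c1 (6 * N + 1) (by positivity) (by linarith)
    have h5 : 2 * ((n0 + 1 : ℕ) : ℝ) ≤ 4 * N * (1 / n0) := by
      have : (N:ℝ) * (1 / n0) = n0 := by
        rw [hN]; push_cast
        have : (n0:ℝ) ≠ 0 := by rw [hn0R]; positivity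
        field_simp
      rw [mul_assoc, this]; push_cast; rw [hn0R]; linarith
    have h6 : 4 * N * (1 / n0 : ℝ) ≤ 4 * N * ρ ^ k := by gcongr
    have h7 : 49 * (K * (1 / N)) * (1 / N) ≤ 49 * K * ρ ^ k := by
      have : K * (1 / N) * (1 / N) ≤ K * 1 * ρ ^ k := by gcongr; exact iN.trans q8
      linarith
    have h8 : (N:ℝ) * ((mu (Wt pe fz t)).real (Arm adj 1 n0) + (6 * N + 1) ^ 2 * c) ≤ N * (C * ρ ^ k + 49 * K * ρ ^ k) :=
      mul_le_mul_of_nonneg_left (add_le_add h3 (h4.trans h7)) hN0R.le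
    calc _ ≤ 4 * N * ρ ^ k + N * (C * ρ ^ k + 49 * K * ρ ^ k) := add_le_add (h5.trans h6) h8
      _ = N * ((4 + C + 49 * K) * ρ ^ k) := by ring
      _ = a * Δ := by rw [hΔ, hC1]; field_simp
      _ ≤ t * Δ := by gcongr
  have hρ1k : ρ ^ k ≤ 1 := pow_le_one₀ hρ0.le hρ1.le
  have main := ode (θ := fun t => EE (Wt pe fz t) (FA adj (Lam (4 * N)) N)) (θ' := fun t => dth pe fz adj (Lam (4 * N)) hD N t)
    hab.le hQ0 hε0 (fun t ht => FA_deriv hD (Lam_mono (by omega)) (ha.trans_le ht.1) (ht.2.trans_lt hb))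
    (fun t _ => EE_nonneg _ fun _ => ind_nonneg _ _) (fun t _ => dth_nonneg)
    (by
      have g1 := (abs_le.1 (fv (Wt pe fz b) (adj := adj) hD subset_rfl (hcb b))).2
      have g2 : (mu (Wt pe fz b)).real (Arm adj 1 N) ≤ (mu (Wt pe fz b)).real (Arm adj 1 n0) := by
        haveI : IsProbabilityMeasure (mu (Wt pe fz b)) := (hM.rsw b).prob
        exact measureReal_mono (Arm.mono ok le_rfl (by omega) (by omega))
      have g3 := armb b hab.le le_rfl
      have g4 : K * (1 / N) * (1 / N) ≤ K * 1 * ρ ^ k := by gcongr; exact iN.trans q8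
      show EE _ _ ≤ _
      linarith)
    (by
      intro t ht
      have g := diffineq hM ok (ha.trans_le ht.1) (ht.2.trans_lt hb) hD (N := N) (n := n0 + 1) (R := R) (by omega) hNn subset_rfl
        (hcb t) (hcb' t) (hΔb t ht.1 ht.2)
      have hd0 := dth_nonneg (pe := pe) (fz := fz) (adj := adj) (D := Lam (4 * N)) (hD := hD) (N := N) (t := t)
      refine le_of_mul_le_mul_left (g.trans ?_) hN0R
      have g1 : 18 * Δ * (2 * R + 1) ^ 2 * dth pe fz adj (Lam (4 * N)) hD N t ≤
          N * (162 * C1 * σ ^ k * dth pe fz adj (Lam (4 * N)) hD N t) := by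
        rw [← mul_assoc (N:ℝ)]
        refine mul_le_mul_of_nonneg_right ?_ hd0
        calc 18 * Δ * (2 * R + 1) ^ 2 ≤ 18 * Δ * (9 * 64 ^ (k / M)) := by gcongr
          _ = N * (162 * C1 * (ρ ^ k * 64 ^ (k / M))) := by rw [hΔ]; ring
          _ ≤ _ := by gcongr; exact hMσ k
      have g2 : 16 * Δ * (hD.toFinset.card * c') ≤ N * ε := by
        calc 16 * Δ * (hD.toFinset.card * c') ≤ 16 * (C1 * 1 * N) * (81 * (N:ℝ) ^ 2 * c') := by rw [hΔ]; gcongr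
          _ = _ := by rw [hε]; ring
      linarith)
  refine ⟨N, ?_, ?_⟩
  · have : k < 8 ^ k := Nat.lt_pow_self (by norm_num)
    omega
  have g1 := (abs_le.1 (fv (Wt pe fz a) (adj := adj) hD subset_rfl (hcb a))).1
  have main' : EE (Wt pe fz a) (FA adj (Lam (4 * N)) N) ≤ 2 * ε + Real.exp (-((b - a) / (2 * (162 * C1)) / σ ^ k)) := by
    refine main.trans (le_of_eq ?_)
    congr 3; field_simp
  have f1 : N * ε ≤ C3 * (1 / 2) ^ k := by
    have : (8:ℝ) ^ (7 * k) = 64 ^ k * 64 ^ k * 64 ^ k * 8 ^ k := by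
      rw [show (64:ℝ) = 8 ^ 2 by norm_num]; simp only [← pow_mul, ← pow_add]; congr 1; ring
    calc N * ε ≤ N * (16 * C1 * (81 * (N:ℝ) ^ 2 * (K' * 8 ^ (7 * M) / 8 ^ (7 * k)))) := by rw [hε]; gcongr
      _ = C3 * (1 / 8) ^ k := by rw [hNR, this, hC3, div_pow, one_pow]; field_simp
      _ ≤ _ := by gcongr; norm_num
  have f2 : N * Real.exp (-((b - a) / (2 * (162 * C1)) / σ ^ k)) ≤ 2916 * C4 * (1 / 2) ^ k := by
    have := hexp k
    rw [hNR]; linarith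
  have f3 : N * ((2 * (N:ℝ) + 1) ^ 2 * c) ≤ 9 * K * (1 / 2) ^ k := by
    calc N * ((2 * (N:ℝ) + 1) ^ 2 * c) ≤ N * (9 * (K * (1 / N)) * (1 / N)) := by gcongr
      _ = 9 * K * (1 / N) := by field_simp
      _ ≤ _ := by gcongr
  calc N * (mu (Wt pe fz a)).real (Arm adj 1 N)
      ≤ N * (2 * ε + Real.exp (-((b - a) / (2 * (162 * C1)) / σ ^ k)) + (2 * (N:ℝ) + 1) ^ 2 * c) := by gcongr; linarith
    _ = 2 * (N * ε) + N * Real.exp (-((b - a) / (2 * (162 * C1)) / σ ^ k)) + N * ((2 * (N:ℝ) + 1) ^ 2 * c) := by ring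
    _ ≤ C5 * (1 / 2) ^ k := by rw [hC5]; linarith
    _ ≤ κ := e1

end DaC

namespace DaC

lemma idx_disj {u v : V} {R : ℕ} (h : 2 * (R:ℤ) < nm (u - v)) :
    Disjoint (idx (bl u R) (bl_finite u R)) (idx (bl v R) (bl_finite v R)) := by
  have : ∀ z, z ∈ bl u R → z ∈ bl v R → False := by
    intro z h1 h2
    have h1' : nm (z - u) ≤ R := h1
    have h2' : nm (z - v) ≤ R := h2
    have := nm_tri u z v
    rw [nm_comm u z] at this
    omega
  rw [Finset.disjoint_left]
  rintro (e | z) h1 h2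
  · rw [mem_idx_inl] at h1 h2; exact this _ h1.1 h2.1
  · rw [mem_idx_inr] at h1 h2; exact this _ h1 h2

/-- approximate independence of far away events -/
lemma decor (w : I → ℝ) {A B : Set (V → Bool)} {S T : Finset V} (hA : DependsOn (fun ξ => ξ ∈ A) (S : Set V))
    (hB : DependsOn (fun ξ => ξ ∈ B) (T : Set V)) {R : ℕ} {c : ℝ} (hc : ∀ v, (PP w).real {x | rad x v R} ≤ c)
    (hST : ∀ u ∈ S, ∀ v ∈ T, 2 * (R:ℤ) < nm (u - v)) :
    (mu w).real (A ∩ B) ≤ (mu w).real A * (mu w).real B + 2 * (S.card + T.card) * c := by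
  classical
  have mA : MeasurableSet A := loc_meas ⟨_, hA⟩
  have mB : MeasurableSet B := loc_meas ⟨_, hB⟩
  have dep : ∀ {A : Set (V → Bool)} {S : Finset V}, DependsOn (fun ξ => ξ ∈ A) (S : Set V) →
      DependsOn (fun x => x ∈ {x | sg R x ∈ A}) (S.biUnion fun v => idx (bl v R) (bl_finite v R) : Finset I) := by
    intro A S h x y hxy
    refine h fun v hv => sg_dep v R fun i hi => hxy i ?_
    exact Finset.mem_coe.2 (Finset.mem_biUnion.2 ⟨v, hv, hi⟩)
  have hdis : Disjoint (S.biUnion fun v => idx (bl v R) (bl_finite v R)) (T.biUnion fun v => idx (bl v R) (bl_finite v R)) := by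
    rw [Finset.disjoint_biUnion_left]; intro u hu
    rw [Finset.disjoint_biUnion_right]; intro v hv
    exact idx_disj (hST u hu v hv)
  have key := indep_inter w {0, 1} (fun j => if j = 0 then {x | sg R x ∈ A} else {x | sg R x ∈ B})
    (fun j => if j = 0 then (S.biUnion fun v => idx (bl v R) (bl_finite v R)) else (T.biUnion fun v => idx (bl v R) (bl_finite v R)))
    (fun j => by by_cases h : j = 0 <;> simp only [h, if_true, if_false]; exacts [dep hA, dep hB])
    (fun i hi j hj hij => by
      simp only [Finset.mem_insert, Finset.mem_singleton] at hi hj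
      rcases hi with rfl | rfl <;> rcases hj with rfl | rfl <;> first | exact absurd rfl hij | simpa using hdis | simpa using hdis.symm)
  simp only [Finset.mem_insert, Finset.mem_singleton, forall_eq_or_imp, forall_eq, if_true, one_ne_zero, if_false,
    Finset.prod_pair (zero_ne_one (α := ℕ)), Set.mem_setOf_eq] at key
  have bS := rad_union w S R (fun v _ => hc v)
  have bT := rad_union w T R (fun v _ => hc v)
  have cmp : ∀ {A : Set (V → Bool)} {S : Finset V}, DependsOn (fun ξ => ξ ∈ A) (S : Set V) →
      (PP w).real {x | sg R x ∈ A} ≤ (PP w).real {x | sig Set.univ x ∈ A} + (PP w).real {x | ∃ v ∈ S, rad x v R} := by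
    intro A S h
    refine (measureReal_mono fun x hx => ?_).trans (measureReal_union_le _ _)
    by_cases hb : ∃ v ∈ S, rad x v R
    · exact Or.inr hb
    · exact Or.inl ((sg_iff h hb).1 hx)
  have h3 : (PP w).real {x | sig Set.univ x ∈ A ∩ B} ≤ (PP w).real {x | sg R x ∈ A ∧ sg R x ∈ B} +
      ((PP w).real {x | ∃ v ∈ S, rad x v R} + (PP w).real {x | ∃ v ∈ T, rad x v R}) := by
    refine le_trans (measureReal_mono fun x hx => ?_) ((measureReal_union_le _ _).trans (add_le_add_right (measureReal_union_le _ _) _))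
    by_cases hb : ∃ v ∈ S, rad x v R
    · exact Or.inr (Or.inl hb)
    by_cases hb' : ∃ v ∈ T, rad x v R
    · exact Or.inr (Or.inr hb')
    · exact Or.inl ⟨(sg_iff hA hb).2 hx.1, (sg_iff hB hb').2 hx.2⟩
  have h1 := cmp hA
  have h2 := cmp hB
  rw [mu_real w mA, mu_real w mB, mu_real w (mA.inter mB)]
  rw [key] at h3
  have p1 : (PP w).real {x | sg R x ∈ A} ≤ 1 := measureReal_le_one
  have p2 : (PP w).real {x | sig Set.univ x ∈ B} ≤ 1 := measureReal_le_one
  have q0 : 0 ≤ (PP w).real {x | sg R x ∈ A} := measureReal_nonneg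
  have q2 : 0 ≤ (PP w).real {x | sig Set.univ x ∈ B} := measureReal_nonneg
  have q3 : 0 ≤ (PP w).real {x | ∃ v ∈ S, rad x v R} := measureReal_nonneg
  have q4 : 0 ≤ (PP w).real {x | ∃ v ∈ T, rad x v R} := measureReal_nonneg
  have k1 := mul_le_mul_of_nonneg_left h2 q0
  have k2 := mul_le_mul_of_nonneg_right h1 q2
  have k3 := mul_le_mul_of_nonneg_right p1 q4
  have k4 := mul_le_mul_of_nonneg_left p2 q3
  nlinarith

/-- even translates of arms -/
def ArmAt (adj : V → V → Prop) (a b : ℕ) (c : V) : Set (V → Bool) := {ξ | (fun v => ξ (v + c)) ∈ Arm adj a b}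

lemma ArmAt.of {adj : V → V → Prop} (ok : Okay adj) {a b : ℕ} (hab : a ≤ b) {ξ : V → Bool} {u v c : V}
    (hu : nm (u - c) ≤ a) (hv : b ≤ nm (v - c)) (h : CI adj (Gt ξ) u v) : ξ ∈ ArmAt adj a b c := by
  refine Arm.of ok hab hu hv (h.map (fun z => z - c) ?_ fun z hz => ?_)
  · intro u v
    rcases ok with rfl | rfl <;> simp only [sqAdj_iff, starAdj_iff, Prod.fst_sub, Prod.snd_sub] <;> omega
  · show ξ (z - c + c) = true
    rw [sub_add_cancel]; exact hz

lemma ArmAt.dep {adj : V → V → Prop} {a b : ℕ} {c : V} :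
    DependsOn (fun ξ => ξ ∈ ArmAt adj a b c) ((bl_finite c b).toFinset : Set V) := by
  intro x y h
  refine Con_dep (adj := adj) (D := Lam b) (A := Lam a) (B := {v | nm v = b}) fun v hv => h _ ?_
  have hv' : nm v ≤ b := hv
  simp only [Set.Finite.coe_toFinset]
  show nm (v + c - c) ≤ b
  rwa [add_sub_cancel_right]

lemma ArmAt.prob {μ : Measure (V → Bool)} (h : Rsw μ) {adj : V → V → Prop} {a b : ℕ} (i j : ℤ) :
    μ.real (ArmAt adj a b (2 * i, 2 * j)) = μ.real (Arm adj a b) := h.inv _ (Sy.sh i j) _ Arm.inc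

end DaC

namespace DaC

lemma ctr {M : ℕ} (hM : 0 < M) {v : V} {L : ℕ} (hv : nm v ≤ L * M) :
    ∃ i ∈ Finset.Icc (-(L:ℤ) - 1) L, ∃ j ∈ Finset.Icc (-(L:ℤ) - 1) L, nm (v - (M * i, M * j)) ≤ M := by
  have hM' : (0:ℤ) < M := by exact_mod_cast hM
  rw [nm_le] at hv
  have key : ∀ a : ℤ, -(L * M : ℤ) ≤ a → a ≤ L * M → a / M ∈ Finset.Icc (-(L:ℤ) - 1) L ∧ 0 ≤ a - M * (a / M) ∧ a - M * (a / M) ≤ M := by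
    intro a h1 h2
    have e1 := Int.emod_nonneg a hM'.ne'
    have e2 := Int.emod_lt_of_pos a hM'
    have e3 := Int.emod_add_mul_ediv a M
    refine ⟨Finset.mem_Icc.2 ⟨?_, ?_⟩, by omega, by omega⟩
    · refine Int.le_ediv_of_mul_le hM' ?_
      nlinarith
    · exact Int.ediv_le_of_le_mul hM' (by linarith)
  obtain ⟨a1, a2, a3⟩ := key v.1 (by omega) (by omega)
  obtain ⟨b1, b2, b3⟩ := key v.2 (by omega) (by omega)
  refine ⟨_, a1, _, b1, nm_le.2 ?_⟩
  simp only [Prod.fst_sub, Prod.snd_sub]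
  omega

/-- one renormalization step -/
lemma renorm {pe : ℝ} {fz : V → Option Bool} (hM : Mok pe fz) (t : ℝ) {adj : V → V → Prop} (ok : Okay adj) {M : ℕ} (hM0 : 0 < M)
    (hev : 2 ∣ M) {c : ℝ} (hc : ∀ v, (PP (Wt pe fz t)).real {x | rad x v M} ≤ c) :
    (mu (Wt pe fz t)).real (Arm adj (16 * M) (32 * M)) ≤
      66 ^ 4 * ((mu (Wt pe fz t)).real (Arm adj M (2 * M)) ^ 2 + 4 * (4 * M + 1) ^ 2 * c) := by
  set μ := mu (Wt pe fz t) with hμ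
  have hr : Rsw μ := hM.rsw t
  haveI := hr.prob
  obtain ⟨h, rfl⟩ := hev
  set M := 2 * h with hMh
  set J := Finset.Icc (-(32:ℤ) - 1) 32 with hJ
  let T : Finset ((ℤ × ℤ) × (ℤ × ℤ)) := (J ×ˢ J) ×ˢ (J ×ˢ J)
  let ct : ℤ × ℤ → V := fun q => (2 * ((h:ℤ) * q.1), 2 * ((h:ℤ) * q.2))
  have hct : ∀ q, ct q = ((M:ℤ) * q.1, (M:ℤ) * q.2) := by
    intro q; simp only [ct, hMh]; push_cast; ext <;> simp <;> ring
  let E : (ℤ × ℤ) × (ℤ × ℤ) → Set (V → Bool) := fun q =>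
    if 6 * (M:ℤ) < nm (ct q.1 - ct q.2) then ArmAt adj M (2 * M) (ct q.1) ∩ ArmAt adj M (2 * M) (ct q.2) else ∅
  have hc0 : 0 ≤ c := measureReal_nonneg.trans (hc (0, 0))
  have hsub : Arm adj (16 * M) (32 * M) ⊆ ⋃ q ∈ T, E q := by
    rintro ξ ⟨a, ha, b, hb, hp⟩
    have ha' : nm a ≤ (16 * M : ℕ) := ha
    have hb' : nm b = (32 * M : ℕ) := hb
    push_cast at ha' hb'
    obtain ⟨a', e1, -, e2⟩ := hp.lastPart nm ok.lipn (m := 16 * M) ha' (by omega)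
    have e3 : CI adj (Gt ξ) a' b := e2.monoS fun z hz => hz.1.2
    obtain ⟨i, hi, j, hj, d1⟩ := ctr (L := 32) hM0 (v := a') (by push_cast; omega)
    obtain ⟨i', hi', j', hj', d2⟩ := ctr (L := 32) hM0 (v := b) (by push_cast; omega)
    rw [← hct (i, j)] at d1
    rw [← hct (i', j')] at d2
    simp only [Set.mem_iUnion]
    refine ⟨((i, j), (i', j')), ?_, ?_⟩
    · simp only [T, Finset.mem_product]; exact ⟨⟨hi, hj⟩, ⟨hi', hj'⟩⟩
    have hMp : (0:ℤ) < M := by exact_mod_cast hM0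
    have s1 := (nm_sub_ge b a').2
    have s2 := nm_tri b (ct (i', j')) a'
    have s3 := nm_tri (ct (i', j')) (ct (i, j)) a'
    have s4 := nm_tri b (ct (i, j)) a'
    have s5 := nm_comm (ct (i, j)) a'
    have s6 := nm_comm (ct (i, j)) (ct (i', j'))
    have s7 := nm_comm (ct (i', j')) a'
    simp only [E]
    rw [if_pos (by omega)]
    exact ⟨ArmAt.of ok (by omega) d1 (by push_cast; omega) e3, ArmAt.of ok (by omega) d2 (by push_cast; omega) (e3.symm ok)⟩
  have hE : ∀ q ∈ T, μ.real (E q) ≤ μ.real (Arm adj M (2 * M)) ^ 2 + 4 * (4 * M + 1) ^ 2 * c := by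
    intro q _
    simp only [E]
    split_ifs with hq
    · have := decor (Wt pe fz t) (ArmAt.dep (adj := adj) (a := M) (b := 2 * M) (c := ct q.1))
        (ArmAt.dep (adj := adj) (a := M) (b := 2 * M) (c := ct q.2)) hc (fun u hu v hv => by
          have hu' : nm (u - ct q.1) ≤ (2 * M : ℕ) := (bl_finite _ _).mem_toFinset.1 hu
          have hv' : nm (v - ct q.2) ≤ (2 * M : ℕ) := (bl_finite _ _).mem_toFinset.1 hv
          have t1 := nm_tri (ct q.1) u (ct q.2)
          have t2 := nm_tri u v (ct q.2)
          rw [nm_comm (ct q.1) u] at t1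
          push_cast at hu' hv'
          omega)
      rw [← hμ, ArmAt.prob hr, ArmAt.prob hr, ← sq] at this
      refine this.trans (add_le_add_right (mul_le_mul_of_nonneg_right ?_ hc0) _)
      have b1 := bl_card (ct q.1) (2 * M)
      have b2 := bl_card (ct q.2) (2 * M)
      push_cast at b1 b2
      linarith
    · simp only [measureReal_empty]; positivity
  refine (measureReal_mono hsub (measure_ne_top _ _)).trans ((measureReal_biUnion_finset_le T E).trans ((Finset.sum_le_sum hE).trans ?_))
  rw [Finset.sum_const, nsmul_eq_mul]
  refine le_of_eq ?_
  have : J.card = 66 := by rw [hJ, Int.card_Icc]; rfl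
  simp only [T, Finset.card_product, this]; push_cast; ring

lemma arm_start {μ : Measure (V → Bool)} (hr : Rsw μ) {adj : V → V → Prop} (ok : Okay adj) {M : ℕ} (hM : 2 ≤ M) :
    μ.real (Arm adj M (2 * M)) ≤ 4 * (2 * M + 1) * μ.real (Arm adj 1 (M - 1)) := by
  haveI := hr.prob
  let S : Finset V := (({(M:ℤ), -(M:ℤ)} : Finset ℤ) ×ˢ Finset.Icc (-(M:ℤ)) M) ∪ (Finset.Icc (-(M:ℤ)) M ×ˢ {(M:ℤ), -(M:ℤ)})
  choose f g hfg using even_near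
  have hsub : Arm adj M (2 * M) ⊆ ⋃ v ∈ S, ArmAt adj 1 (M - 1) (2 * f v, 2 * g v) := by
    rintro ξ ⟨a, ha, b, hb, hp⟩
    have ha' : nm a ≤ M := ha
    have hb' : nm b = (2 * M : ℕ) := hb
    push_cast at hb'
    obtain ⟨a', e1, -, e2⟩ := hp.lastPart nm ok.lipn (m := M) ha' (by omega)
    have e3 : CI adj (Gt ξ) a' b := e2.monoS fun z hz => hz.1.2
    simp only [Set.mem_iUnion]
    refine ⟨a', ?_, ArmAt.of ok (by omega) (by exact_mod_cast hfg a') ?_ e3⟩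
    · have h1 := nm_le.1 e1.le
      have h2 := nm_cases a'
      rw [e1] at h2
      simp only [S, Finset.mem_union, Finset.mem_product, Finset.mem_insert, Finset.mem_singleton, Finset.mem_Icc]
      omega
    · have s1 := (nm_sub_ge b a').2
      have s4 := nm_tri b (2 * f a', 2 * g a') a'
      have s5 := nm_comm (2 * f a', 2 * g a') a'
      have := hfg a'
      omega
  refine (measureReal_mono hsub (measure_ne_top _ _)).trans ((measureReal_biUnion_finset_le S _).trans ?_)
  simp only [ArmAt.prob hr, Finset.sum_const, nsmul_eq_mul]
  refine mul_le_mul_of_nonneg_right ?_ measureReal_nonneg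
  have h1 : S.card ≤ 2 * (2 * M + 1) + (2 * M + 1) * 2 := by
    refine (Finset.card_union_le _ _).trans ?_
    rw [Finset.card_product, Finset.card_product, Int.card_Icc]
    have h3 : ((M:ℤ) + 1 - -(M:ℤ)).toNat = 2 * M + 1 := by omega
    rw [h3]
    have := Finset.card_le_two (a := (M:ℤ)) (b := -(M:ℤ))
    gcongr
  calc (S.card : ℝ) ≤ ((2 * (2 * M + 1) + (2 * M + 1) * 2 : ℕ) : ℝ) := by exact_mod_cast h1
    _ = _ := by push_cast; ring

/-- polynomial decay of every order -/
theorem decay {pe : ℝ} {fz : V → Option Bool} (hdec : Dec pe) (hM : Mok pe fz) {t : ℝ} {adj : V → V → Prop} (ok : Okay adj)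
    (hs : ∀ κ > (0:ℝ), ∀ N0 : ℕ, ∃ N ≥ N0, N * (mu (Wt pe fz t)).real (Arm adj 1 N) ≤ κ) (C : ℕ) :
    ∃ K : ℝ, 0 < K ∧ ∀ R : ℕ, 1 ≤ R → (mu (Wt pe fz t)).real (Arm adj 1 R) ≤ K / (R:ℝ) ^ C := by
  have hr := hM.rsw t
  haveI := hr.prob
  obtain ⟨K, hK, hKb⟩ := hdec (C + 3)
  set β : ℝ := (1 / 16) ^ C with hβ
  have hβ0 : 0 < β := by positivity
  have hβ1 : β ≤ 1 := pow_le_one₀ (by norm_num) (by norm_num)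
  set κ : ℝ := β / (2 * 66 ^ 4) with hκ
  have hκ0 : 0 < κ := by positivity
  obtain ⟨N1, hN1⟩ := exists_nat_gt (2 * 66 ^ 4 * (100 * K) / (κ * β))
  obtain ⟨N, hN, hNs⟩ := hs (κ / 36) (by positivity) (max N1 1)
  have hN1' : N1 ≤ N := (le_max_left _ _).trans hN
  have hNp : 1 ≤ N := (le_max_right _ _).trans hN
  obtain ⟨M, hMe, hM1, hM2⟩ : ∃ M, 2 ∣ M ∧ N + 1 ≤ M ∧ M ≤ N + 2 := by
    rcases Nat.even_or_odd' N with ⟨k, h | h⟩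
    · exact ⟨2 * k + 2, by omega, by omega, by omega⟩
    · exact ⟨2 * k + 2, by omega, by omega, by omega⟩
  have hNR : (1:ℝ) ≤ N := by exact_mod_cast hNp
  have hMR : (M:ℝ) ≤ N + 2 := by exact_mod_cast hM2
  have hMR1 : (N:ℝ) + 1 ≤ M := by exact_mod_cast hM1
  have start : (mu (Wt pe fz t)).real (Arm adj M (2 * M)) ≤ κ := by
    refine (arm_start hr ok (by omega)).trans ?_
    have h1 : (mu (Wt pe fz t)).real (Arm adj 1 (M - 1)) ≤ (mu (Wt pe fz t)).real (Arm adj 1 N) :=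
      measureReal_mono (Arm.mono ok le_rfl (by omega) hNp) (measure_ne_top _ _)
    calc _ ≤ 4 * (9 * (N:ℝ)) * (mu (Wt pe fz t)).real (Arm adj 1 N) := by gcongr; linarith
      _ = 36 * (N * (mu (Wt pe fz t)).real (Arm adj 1 N)) := by ring
      _ ≤ κ := by linarith
  have errN : 66 ^ 4 * (4 * (25 * K)) / N ≤ κ * β / 2 := by
    have hN1R : (N1:ℝ) ≤ N := by exact_mod_cast hN1'
    rw [div_lt_iff₀ (by positivity)] at hN1
    rw [div_le_iff₀ (by positivity)]
    have : (N1:ℝ) * (κ * β) ≤ N * (κ * β) := by gcongr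
    linarith
  have step : ∀ i : ℕ, (mu (Wt pe fz t)).real (Arm adj (16 ^ i * M) (2 * (16 ^ i * M))) ≤ κ * β ^ i := by
    intro i
    induction i with
    | zero => simpa using start
    | succ i ih =>
      set M' := 16 ^ i * M with hM'
      have h16 : 1 ≤ 16 ^ i := Nat.one_le_pow _ _ (by norm_num)
      have hM'1 : 1 ≤ M' := by rw [hM']; exact Nat.mul_pos h16 (by omega)
      have hM'R : (M':ℝ) = 16 ^ i * M := by rw [hM']; push_cast; rfl
      have h16R : (1:ℝ) ≤ 16 ^ i := one_le_pow₀ (by norm_num)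
      have hM'1R : (1:ℝ) ≤ M' := by exact_mod_cast hM'1
      have g := renorm hM t ok (M := M') hM'1 (Dvd.dvd.mul_left hMe _) (c := K / (M':ℝ) ^ (C + 3)) (fun v => hKb _ (fun _ => rfl) v M' hM'1)
      have e1 : 16 ^ (i + 1) * M = 16 * M' := by rw [hM']; ring
      have e2 : 2 * (16 * M') = 32 * M' := by ring
      rw [e1, e2]
      refine g.trans ?_
      have q1 : 66 ^ 4 * (mu (Wt pe fz t)).real (Arm adj M' (2 * M')) ^ 2 ≤ κ * β ^ (i + 1) / 2 := by
        calc 66 ^ 4 * (mu (Wt pe fz t)).real (Arm adj M' (2 * M')) ^ 2 ≤ 66 ^ 4 * (κ * β ^ i) ^ 2 := by gcongr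
          _ = (66 ^ 4 * κ) * (κ * β ^ i) * β ^ i := by ring
          _ = β / 2 * (κ * β ^ i) * β ^ i := by rw [hκ]; ring
          _ ≤ β / 2 * (κ * β ^ i) * 1 := by gcongr; exact pow_le_one₀ hβ0.le hβ1
          _ = _ := by ring
      have q2 : (4 * (M':ℝ) + 1) ^ 2 * (K / (M':ℝ) ^ (C + 3)) ≤ 25 * K / N * β ^ i := by
        have : (4 * (M':ℝ) + 1) ^ 2 ≤ 25 * (M':ℝ) ^ 2 :=
          (pow_le_pow_left₀ (by positivity) (show 4 * (M':ℝ) + 1 ≤ 5 * M' by linarith) 2).trans_eq (by ring)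
        have h3 : β ^ i * (16 ^ i : ℝ) ^ C = 1 := by
          rw [hβ, ← pow_mul, ← pow_mul, mul_comm i C, ← mul_pow]; norm_num
        have hM'0 : (0:ℝ) < M' := by linarith
        have hNM : (N:ℝ) ≤ M' := by rw [hM'R]; nlinarith
        have h4 : 1 ≤ β ^ i * (M':ℝ) ^ C := by
          rw [← h3]; gcongr; rw [hM'R]; nlinarith
        calc _ ≤ 25 * (M':ℝ) ^ 2 * (K / (M':ℝ) ^ (C + 3)) := by gcongr
          _ = 25 * K / M' * (1 / (M':ℝ) ^ C) := by rw [pow_add]; field_simp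
          _ ≤ 25 * K / N * β ^ i := by
            gcongr
            rw [div_le_iff₀ (by positivity)]; exact h4
      calc _ = 66 ^ 4 * (mu (Wt pe fz t)).real (Arm adj M' (2 * M')) ^ 2 + 66 ^ 4 * 4 * ((4 * (M':ℝ) + 1) ^ 2 * (K / (M':ℝ) ^ (C + 3))) := by ring
        _ ≤ κ * β ^ (i + 1) / 2 + 66 ^ 4 * 4 * (25 * K / N * β ^ i) := by gcongr
        _ = κ * β ^ (i + 1) / 2 + 66 ^ 4 * (4 * (25 * K)) / N * β ^ i := by ring
        _ ≤ κ * β ^ (i + 1) / 2 + κ * β / 2 * β ^ i := by gcongr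
        _ = _ := by ring
  refine ⟨1 + κ * (32 * M) ^ C + (2 * M) ^ C, by positivity, fun R hR => ?_⟩
  have hRp : (0:ℝ) < R := by exact_mod_cast hR
  rw [le_div_iff₀ (by positivity)]
  by_cases hRM : R < 2 * M
  · have h1 : (mu (Wt pe fz t)).real (Arm adj 1 R) ≤ 1 := measureReal_le_one
    have h2 : (R:ℝ) ^ C ≤ (2 * M) ^ C := by gcongr; exact_mod_cast hRM.le
    have h3 : 0 ≤ κ * (32 * (M:ℝ)) ^ C := by positivity
    calc _ ≤ 1 * (R:ℝ) ^ C := by gcongr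
      _ ≤ _ := by linarith
  · push Not at hRM
    obtain ⟨i, hi1, hi2⟩ : ∃ i, 2 * (16 ^ i * M) ≤ R ∧ R < 2 * (16 ^ (i + 1) * M) := by
      have hex : ∃ i, R < 2 * (16 ^ (i + 1) * M) := by
        refine ⟨R, ?_⟩
        have : R < 16 ^ R := Nat.lt_pow_self (by norm_num)
        have h2 : 16 ^ R ≤ 16 ^ (R + 1) := Nat.pow_le_pow_right (by norm_num) (by omega)
        nlinarith
      classical
      refine ⟨Nat.find hex, ?_, Nat.find_spec hex⟩
      rcases h : Nat.find hex with _ | j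
      · simpa using hRM
      · have := Nat.find_min hex (m := j) (by omega)
        omega
    have h16 : 1 ≤ 16 ^ i := Nat.one_le_pow _ _ (by norm_num)
    have h1 : (mu (Wt pe fz t)).real (Arm adj 1 R) ≤ κ * β ^ i :=
      (measureReal_mono (Arm.mono ok (by nlinarith) hi1 (by omega)) (measure_ne_top _ _)).trans (step i)
    have h2 : (R:ℝ) ^ C ≤ ((32 * M) * 16 ^ i) ^ C := by
      gcongr
      have : (R:ℝ) ≤ ((2 * (16 ^ (i + 1) * M) : ℕ) : ℝ) := by exact_mod_cast hi2.le
      refine this.trans (le_of_eq ?_)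
      push_cast; ring
    have h3 : β ^ i * (16 ^ i : ℝ) ^ C = 1 := by
      rw [hβ, ← pow_mul, ← pow_mul, mul_comm i C, ← mul_pow]; norm_num
    calc _ ≤ κ * β ^ i * ((32 * M) * 16 ^ i) ^ C := by gcongr
      _ = κ * (32 * M) ^ C * (β ^ i * (16 ^ i : ℝ) ^ C) := by rw [mul_pow]; ring
      _ = κ * (32 * M) ^ C := by rw [h3, mul_one]
      _ ≤ _ := by
        have : (0:ℝ) ≤ (2 * M) ^ C := by positivity
        linarith

end DaC

namespace DaC

/-! ### Percolation of the dual colour -/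

lemma dual_gen {adj adj' : V → V → Prop} (h : Dual adj adj') {x0 x1 y0 y1 : ℤ} (hx : x0 ≤ x1) (hy : y0 ≤ y1) (G : Set V) :
    (∃ a b, a.1 = x0 ∧ b.1 = x1 ∧ CI adj (Box x0 x1 y0 y1 ∩ G) a b) ∨
    (∃ c d, c.2 = y0 ∧ d.2 = y1 ∧ CI adj' (Box x0 x1 y0 y1 ∩ Gᶜ) c d) := by
  rcases h with ⟨rfl, rfl⟩ | ⟨rfl, rfl⟩
  · exact dual_exists _ _ _ _ hx hy G
  · rcases dual_exists y0 y1 x0 x1 hy hx {v | v.swap ∉ G} with ⟨a, b, h1, h2, h3⟩ | ⟨a, b, h1, h2, h3⟩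
    · refine Or.inr ⟨a.swap, b.swap, h1, h2, h3.map _ (Sy.sw.adj (Or.inl rfl)) fun v hv => ?_⟩
      obtain ⟨⟨q1, q2, q3, q4⟩, q5⟩ := hv
      exact ⟨⟨q3, q4, q1, q2⟩, q5⟩
    · refine Or.inl ⟨a.swap, b.swap, h1, h2, h3.map _ (Sy.sw.adj (Or.inr rfl)) fun v hv => ?_⟩
      obtain ⟨⟨q1, q2, q3, q4⟩, q5⟩ := hv
      exact ⟨⟨q3, q4, q1, q2⟩, not_not.1 q5⟩

/-- deterministic part -/
lemma perc_det {adj adj' : V → V → Prop} (h : Dual adj adj') {m L : ℕ} (hmL : m ≤ L) (ξ : V → Bool) :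
    (∃ u v, nm u ≤ (m + 1 : ℕ) ∧ L ≤ nm v ∧ CI adj (Gt fun v => !ξ v) u v) ∨
    ∃ x ∈ Finset.range (L + 1), ∃ v, ((max x m : ℕ) : ℤ) ≤ nm (v - ((x:ℤ), 0)) ∧ CI adj' (Gt ξ) ((x:ℤ), 0) v := by
  rcases dual_gen h (x0 := -1) (x1 := L) (y0 := 0) (y1 := L) (by omega) (by omega)
    {v | (0 ≤ v.1 ∧ ξ v = false) ∨ (v.1 = -1 ∧ v.2 ≤ m)} with ⟨a, b, h1, h2, h3⟩ | ⟨c, d, h1, h2, h3⟩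
  · left
    have key : ∀ b, CI adj (Box (-1) L 0 L ∩ {v | (0 ≤ v.1 ∧ ξ v = false) ∨ (v.1 = -1 ∧ v.2 ≤ m)}) a b →
        b.1 = -1 ∨ ∃ u, nm u ≤ (m + 1 : ℕ) ∧ CI adj (Gt fun v => !ξ v) u b := by
      intro b hb
      induction hb using CI.induct with
      | h0 h => exact Or.inl h1
      | hs b c hab ih q1 q2 q3 =>
        rcases q3.2 with q3' | q3'
        · have hc : c ∈ Gt fun v => !ξ v := by simp [Gt, q3'.2]
          right
          rcases ih with ih | ⟨u, hu, hu'⟩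
          · refine ⟨c, ?_, CI.refl hc⟩
            have := (starAdj_iff _ _).1 (h.ok1.star q1)
            have hb := hab.right
            obtain ⟨⟨_, _, b3, b4⟩, b5⟩ := hb
            obtain ⟨⟨_, _, b6, b7⟩, b8⟩ := q3
            simp only [Set.mem_setOf_eq] at b5
            rw [nm_le]; omega
          · exact ⟨u, hu, hu'.tail q1 hc⟩
        · exact Or.inl q3'.1
    rcases key b h3 with h | ⟨u, hu, hu'⟩
    · omega
    · refine ⟨u, b, hu, ?_, hu'⟩
      have := (nm_le.1 (le_refl (nm b))); omega
  · right
    set S := Box (-1) L 0 L ∩ {v | (0 ≤ v.1 ∧ ξ v = false) ∨ (v.1 = -1 ∧ v.2 ≤ m)}ᶜ with hS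
    have hSe : ∀ v ∈ S, (0 ≤ v.1 ∧ v ∈ Gt ξ) ∨ (v.1 = -1 ∧ m < v.2) := by
      rintro v ⟨⟨b1, b2, b3, b4⟩, b5⟩
      simp only [Set.mem_compl_iff, Set.mem_setOf_eq, not_or, not_and, not_le] at b5
      by_cases hv : v.1 = -1
      · exact Or.inr ⟨hv, b5.2 hv⟩
      · refine Or.inl ⟨by omega, ?_⟩
        have := b5.1 (by omega)
        simpa [Gt] using this
    have hc0 : 0 ≤ c.1 ∧ c ∈ Gt ξ := by
      rcases hSe c h3.left with h | h
      · exact h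
      · omega
    have key : ∀ b, CI adj' S c b →
        (∃ v : V, v.1 = 0 ∧ m ≤ v.2 ∧ CI adj' (Gt ξ) c v) ∨ (0 ≤ b.1 ∧ CI adj' (Gt ξ) c b) := by
      intro b hb
      induction hb using CI.induct with
      | h0 h => exact Or.inr ⟨hc0.1, CI.refl hc0.2⟩
      | hs b c' hab ih q1 q2 q3 =>
        rcases ih with ih | ⟨ih1, ih2⟩
        · exact Or.inl ih
        · rcases hSe c' q3 with q | q
          · exact Or.inr ⟨q.1, ih2.tail q1 q.2⟩
          · have := (starAdj_iff _ _).1 (h.ok2.star q1)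
            exact Or.inl ⟨b, by omega, by omega, ih2⟩
    have hcB := h3.left.1
    obtain ⟨b1, b2, b3, b4⟩ := hcB
    have hce : c = (((c.1.toNat : ℕ) : ℤ), 0) := by
      ext
      · simp only; omega
      · simpa using h1
    refine ⟨c.1.toNat, Finset.mem_range.2 (by omega), ?_⟩
    rw [← hce]
    rcases key d h3 with ⟨v, v1, v2, v3⟩ | ⟨v1, v3⟩
    · refine ⟨v, ?_, v3⟩
      have := (nm_le.1 (le_refl (nm (v - c)))); simp only [Prod.fst_sub, Prod.snd_sub] at this; omega
    · refine ⟨d, ?_, v3⟩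
      have := (nm_le.1 (le_refl (nm (d - c)))); simp only [Prod.fst_sub, Prod.snd_sub] at this; omega

theorem perc {pe t : ℝ} {adj adj' : V → V → Prop} (h : Dual adj adj') {K : ℝ} (hK0 : 0 < K)
    (hK : ∀ R : ℕ, 1 ≤ R → (mu (Wt pe (fun _ => none) t)).real (Arm adj' 1 R) ≤ K / (R:ℝ) ^ 3) :
    0 < (mu (Wt pe (fun _ => none) (1 - t))).real (⋂ L : ℕ, Arm adj 0 L) := by
  have hM : Mok pe (fun _ => none) := Or.inr rfl
  have hr := hM.rsw t
  haveI := hr.prob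
  haveI := (hM.rsw (1 - t)).prob
  have hfl : flw (Wt pe (fun _ => none) t) = Wt pe (fun _ => none) (1 - t) := by rw [flw_Wt]; rfl
  have hsum : Summable fun x : ℕ => 1 / ((x:ℝ) + 1) ^ 2 := by
    have := (summable_nat_add_iff 1).2 (Real.summable_one_div_nat_pow.2 (show 1 < 2 by norm_num))
    simpa using this
  set Sg := ∑' x : ℕ, 1 / ((x:ℝ) + 1) ^ 2 with hSg
  have hSg0 : 0 ≤ Sg := tsum_nonneg fun x => by positivity
  obtain ⟨m0, hm0⟩ := exists_nat_gt (8 * K * Sg)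
  set m := m0 + 3 with hm
  have bound : ∀ L : ℕ, m + 1 ≤ L → 1 / 2 ≤ (mu (Wt pe (fun _ => none) (1 - t))).real (Arm adj (m + 1) L) := by
    intro L hL
    choose f g hfg using even_near
    rw [← hfl, mu_flip _ Arm.inc.meas]
    have hsub : {ξ : V → Bool | (fun v => !ξ v) ∈ Arm adj (m + 1) L}ᶜ ⊆
        ⋃ x ∈ Finset.range (L + 1), ArmAt adj' 1 (max x m - 1) (2 * f ((x:ℤ), 0), 2 * g ((x:ℤ), 0)) := by
      intro ξ hξ
      rcases perc_det h (m := m) (L := L) (by omega) ξ with ⟨u, v, h1, h2, h3⟩ | ⟨x, hx, v, h1, h2⟩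
      · exact absurd (Arm.of h.ok1 hL h1 h2 h3) hξ
      · simp only [Set.mem_iUnion]
        have q := hfg ((x:ℤ), 0)
        have s4 := nm_tri v (2 * f ((x:ℤ), 0), 2 * g ((x:ℤ), 0)) ((x:ℤ), 0)
        have s5 := nm_comm (2 * f ((x:ℤ), 0), 2 * g ((x:ℤ), 0)) ((x:ℤ), 0)
        exact ⟨x, hx, ArmAt.of h.ok2 (by omega) (by exact_mod_cast q) (by omega) h2⟩
    have hmeas : MeasurableSet {ξ : V → Bool | (fun v => !ξ v) ∈ Arm adj (m + 1) L} :=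
      Arm.inc.meas.preimage (measurable_pi_lambda _ fun v => (measurable_of_finite (fun b : Bool => !b)).comp (measurable_pi_apply v))
    have h1 := probReal_compl_eq_one_sub (μ := mu (Wt pe (fun _ => none) t)) hmeas
    have h2 : (mu (Wt pe (fun _ => none) t)).real {ξ : V → Bool | (fun v => !ξ v) ∈ Arm adj (m + 1) L}ᶜ ≤ 1 / 2 := by
      refine (measureReal_mono hsub (measure_ne_top _ _)).trans ((measureReal_biUnion_finset_le _ _).trans ?_)
      have h3 : ∀ x ∈ Finset.range (L + 1), (mu (Wt pe (fun _ => none) t)).real (ArmAt adj' 1 (max x m - 1) (2 * f ((x:ℤ), 0), 2 * g ((x:ℤ), 0)))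
          ≤ 4 * K / (m0 + 1) * (1 / ((x:ℝ) + 1) ^ 2) := by
        intro x _
        rw [ArmAt.prob hr]
        refine (hK _ (by omega)).trans ?_
        have n1 : (x:ℝ) + 1 ≤ 2 * ((max x m - 1 : ℕ) : ℝ) := by
          have : x + 1 ≤ 2 * (max x m - 1) := by omega
          exact_mod_cast this
        have n2 : (m0:ℝ) + 1 ≤ ((max x m - 1 : ℕ) : ℝ) := by
          have : m0 + 1 ≤ max x m - 1 := by omega
          exact_mod_cast this
        set y := ((max x m - 1 : ℕ) : ℝ)
        have e : 4 * K / (m0 + 1) * (1 / ((x:ℝ) + 1) ^ 2) = K / (((m0:ℝ) + 1) * (((x:ℝ) + 1) / 2) ^ 2) := by field_simp; ring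
        rw [e, pow_succ' y]
        gcongr
        linarith
      refine (Finset.sum_le_sum h3).trans ?_
      rw [← Finset.mul_sum]
      have h4 := hsum.sum_le_tsum (Finset.range (L + 1)) fun x _ => by positivity
      calc _ ≤ 4 * K / (m0 + 1) * Sg := by gcongr
        _ = 4 * K * Sg / (m0 + 1) := by ring
        _ ≤ 1 / 2 := by rw [div_le_iff₀ (by positivity)]; linarith
    linarith
  -- limit
  set ν := mu (Wt pe (fun _ => none) (1 - t)) with hν
  have hT : Filter.Tendsto (fun n : ℕ => ν.real (Arm adj (m + 1) (m + 1 + n))) Filter.atTop (nhds (ν.real (⋂ n : ℕ, Arm adj (m + 1) (m + 1 + n)))) := by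
    have := tendsto_measure_iInter_atTop (μ := ν) (s := fun n : ℕ => Arm adj (m + 1) (m + 1 + n)) (fun n => Arm.inc.meas.nullMeasurableSet)
      (fun i j hij => Arm.mono h.ok1 le_rfl (by omega) (by omega)) ⟨0, measure_ne_top _ _⟩
    exact (ENNReal.tendsto_toReal (measure_ne_top _ _)).comp this
  have hlim : 1 / 2 ≤ ν.real (⋂ n : ℕ, Arm adj (m + 1) (m + 1 + n)) :=
    ge_of_tendsto' hT fun n => bound _ (by omega)
  -- some vertex is on an infinite path
  have hsub : (⋂ n : ℕ, Arm adj (m + 1) (m + 1 + n)) ⊆ ⋃ u ∈ (Lam_finite (m + 1)).toFinset, {ξ | (fun v => ξ (v + u)) ∈ ⋂ L : ℕ, Arm adj 0 L} := by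
    intro ξ hξ
    rw [Set.mem_iInter] at hξ
    choose u hu v hv hp using hξ
    have hfin := Lam_finite (m + 1)
    haveI : Finite (Lam (m + 1 : ℕ)) := hfin
    obtain ⟨z, hz⟩ := Finite.exists_infinite_fiber (fun n : ℕ => (⟨u n, hu n⟩ : Lam (m + 1 : ℕ)))
    rw [Set.infinite_coe_iff] at hz
    simp only [Set.mem_iUnion]
    refine ⟨z.1, hfin.mem_toFinset.2 z.2, Set.mem_iInter.2 fun L => ?_⟩
    obtain ⟨n, hn, hLn⟩ := hz.exists_gt (L + (m + 1))
    have hn' : u n = z.1 := congrArg Subtype.val hn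
    have hvn : nm (v n) = (m + 1 + n : ℕ) := hv n
    have hzn : nm z.1 ≤ (m + 1 : ℕ) := z.2
    have := (nm_sub_ge (v n) z.1).2
    refine ArmAt.of h.ok1 (u := z.1) (v := v n) (Nat.zero_le _) (by rw [nm_self]; simp) (by omega) ?_
    rw [← hn']
    exact (hp n).monoS Set.inter_subset_right
  have hpos : 0 < ν.real (⋂ n : ℕ, Arm adj (m + 1) (m + 1 + n)) := by linarith
  by_contra hcon
  have hz : ν.real (⋂ L : ℕ, Arm adj 0 L) = 0 := le_antisymm (not_lt.1 hcon) measureReal_nonneg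
  have := (measureReal_mono hsub (measure_ne_top ν _)).trans (measureReal_biUnion_finset_le _ _)
  rw [Finset.sum_eq_zero] at this
  · linarith
  · intro u _
    have e := shift_mu pe (1 - t) u.1 u.2 (A := ⋂ L : ℕ, Arm adj 0 L) (MeasurableSet.iInter fun L => Arm.inc.meas)
    rw [← hν, hz] at e
    exact e

end DaC

namespace DaC

/-! ### Subcritical bond percolation, as a site model -/

/-- even-even sites are vertices, odd-odd sites are dual vertices, the other sites are edges -/
def fz0 (v : V) : Option Bool :=
  if v.1 % 2 = 0 ∧ v.2 % 2 = 0 then some true else if v.1 % 2 = 1 ∧ v.2 % 2 = 1 then some false else none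

lemma fz0_mok : Mok 0 fz0 := by
  refine Or.inl ⟨rfl, fun g hg => ?_⟩
  induction hg with
  | sh a b => intro v; simp only [fz0, Int.add_mul_emod_self_left]
  | rx => intro v; simp only [fz0, Int.neg_emod_two]
  | sw => intro v; simp only [fz0, and_comm]
  | comp _ _ h1 h2 => intro v; exact (h1 _).trans (h2 v)

lemma fz0_shift (v : V) : fz0 (v + (1, 1)) = (fz0 v).map not := by
  simp only [fz0, Prod.fst_add, Prod.snd_add]
  rcases Int.emod_two_eq_zero_or_one v.1 with h | h <;> rcases Int.emod_two_eq_zero_or_one v.2 with h' | h' <;>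
    simp [Int.add_emod, h, h']

/-- the site of an edge -/
def es (e : Ed) : V := e.1 + nx e

lemma es_inj : Function.Injective es := by
  rintro ⟨⟨a, b⟩, c⟩ ⟨⟨a', b'⟩, c'⟩ h
  cases c <;> cases c' <;> simp [es, nx, Prod.ext_iff] at h ⊢ <;> omega

lemma es_fz (e : Ed) : fz0 (es e) = none := by
  obtain ⟨⟨a, b⟩, c⟩ := e
  cases c <;> simp only [es, nx, fz0, Prod.fst_add, Prod.snd_add, if_true, Bool.false_eq_true, if_false] <;>
    rw [if_neg (by omega), if_neg (by omega)]

/-- self-duality at 1/2 -/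
lemma half_small : ∃ C : ℝ, 0 < C ∧ ∃ ρ : ℝ, 0 < ρ ∧ ρ < 1 ∧ ∀ k : ℕ,
    (mu (Wt 0 fz0 (1/2))).real (Arm SqAdj 1 (54 * 8 ^ (k + 1))) ≤ C * ρ ^ (k + 1) := by
  obtain ⟨C, hC, ρ, h0, h1, H⟩ := one_small dec_zero
  have hr := fz0_mok.rsw (1/2)
  haveI := hr.prob
  refine ⟨C / ρ, by positivity, ρ, h0, h1, fun k => ?_⟩
  have e : C / ρ * ρ ^ (k + 1) = C * ρ ^ k := by rw [pow_succ]; field_simp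
  rw [e]
  have h8 : 1 ≤ 8 ^ k := Nat.one_le_pow _ _ (by norm_num)
  have h9 : 54 * 8 ^ k + 1 ≤ 54 * 8 ^ (k + 1) := by rw [pow_succ]; omega
  rcases H fz0 fz0_mok (1/2) SqAdj StarAdj (Or.inl ⟨rfl, rfl⟩) k with h | h
  · exact (measureReal_mono (Arm.mono (Or.inl rfl) (by norm_num) (by omega) (by omega)) (measure_ne_top _ _)).trans h
  · refine le_trans ?_ h
    have hrel : Reidx (Wt 0 fz0 (1/2)) (flw (Wt 0 fz0 (1/2))) (Equiv.addRight ((1, 1) : V)) _ :=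
      ⟨shift_joins 1 1, fun _ => rfl, fun v => by
        rw [flw_Wt]
        simp only [Wt, Equiv.coe_addRight, fz0_shift]
        norm_num, fz0_mok.clus _⟩
    rw [← hrel.mu Arm.inc.meas]
    refine measureReal_mono ?_ (measure_ne_top _ _)
    rintro ξ ⟨a, ha, b, hb, hp⟩
    have ha' : nm a ≤ (1:ℕ) := ha
    have hb' : nm b = (54 * 8 ^ (k + 1) : ℕ) := hb
    have t1 := nm_tri b (1, 1) (0, 0)
    have t2 := nm_tri a (0, 0) (1, 1)
    have n1 : nm ((1, 1) - ((0, 0) : V)) = 1 := by decide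
    have n2 : nm ((0, 0) - ((1, 1) : V)) = 1 := by decide
    have z1 : ∀ z : V, z - (0, 0) = z := fun z => sub_zero z
    rw [z1] at t1 t2
    refine ArmAt.of (Or.inr rfl) (c := (1, 1)) (u := a) (v := b) (by omega) (by omega) (by omega) ?_
    exact (hp.monoS Set.inter_subset_right).mono (fun u v h => h.star) subset_rfl

lemma two_joins {e : Ed} {u v : V} (h : Joins e u v) : SqAdj (2 • u) (es e) ∧ SqAdj (es e) (2 • v) := by
  obtain ⟨⟨a, b⟩, c⟩ := e
  rw [sqAdj_iff, sqAdj_iff]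
  rcases h with ⟨rfl, rfl⟩ | ⟨rfl, rfl⟩ <;> cases c <;> simp [es, nx] <;> omega

theorem dec_lt {p : ℝ} (hp0 : 0 ≤ p) (hp : p < 1/2) : Dec p := by
  rcases hp0.eq_or_lt with rfl | hp0
  · exact dec_zero
  obtain ⟨C0, hC0, ρ, h0, h1, H⟩ := half_small
  intro C
  obtain ⟨K, hK, hb⟩ := decay dec_zero fz0_mok (Or.inl rfl) (fun κ hκ N0 => sharp dec_zero fz0_mok (Or.inl rfl) hp0 hp (by norm_num) hC0 h0 h1
    (fun k0 => ⟨k0 + 1, by omega, H k0⟩) hκ N0) C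
  set w0 := Wt 0 fz0 p with hw0
  have hr := fz0_mok.rsw p
  rw [← hw0] at hr
  refine ⟨K, hK, fun w hw v R hR => ?_⟩
  have mE : MeasurableSet {y : Ed → Bool | rad (Sum.elim y fun _ => false) v R} := by
    have : Measurable fun (y : Ed → Bool) => (Sum.elim y fun _ => false : I → Bool) :=
      measurable_pi_iff.2 fun i => by
        rcases i with e | u
        · exact measurable_pi_apply e
        · exact measurable_const
    exact this (loc_meas (A := {x | rad x v R}) (rad_loc v R))
  have q1 : (PP w).real {x | rad x v R} = (PP fun _ : Ed => p).real {y : Ed → Bool | rad (Sum.elim y fun _ => false) v R} := by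
    have := PP_reindex w Sum.inl Sum.inl_injective
    simp only [hw] at this
    rw [← this, map_measureReal_apply (measurable_pi_iff.2 fun i => measurable_pi_apply _) mE]
    rfl
  have q2 : (PP fun _ : Ed => p).real {y : Ed → Bool | rad (Sum.elim y fun _ => false) v R} =
      (PP w0).real {x | rad (Sum.elim (fun e => x (.inr (es e))) fun _ => false) v R} := by
    have := PP_reindex w0 (fun e : Ed => Sum.inr (es e)) (Sum.inr_injective.comp es_inj)
    have e : (fun e : Ed => w0 (Sum.inr (es e))) = fun _ => p := by
      funext e; simp only [hw0, Wt, es_fz]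
    rw [e] at this
    rw [← this, map_measureReal_apply (measurable_pi_iff.2 fun i => measurable_pi_apply _) mE]
    rfl
  have q3 : (PP w0).real {x | rad (Sum.elim (fun e => x (.inr (es e))) fun _ => false) v R} ≤
      (PP w0).real {x | sig Set.univ x ∈ ArmAt SqAdj 1 (2 * R) (2 * v.1, 2 * v.2)} := by
    have ae1 := ae_closed w0 (fun _ => rfl)
    have ae2 : ∀ᵐ x ∂(PP w0), ∀ u : V, x (.inr (2 • u)) = true := by
      rw [ae_all_iff]
      intro u
      have h1 := PP_coord w0 (.inr (2 • u)) false
      have h2 : w0 (.inr (2 • u)) = 1 := by simp [hw0, Wt, fz0]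
      rw [h2] at h1
      have h3 : wt 1 false = 0 := by simp [wt, clamp_eq]
      rw [h3, measureReal_eq_zero_iff] at h1
      rw [ae_iff]
      simpa using h1
    refine ENNReal.toReal_mono (measure_ne_top _ _) (measure_mono_ae ?_)
    filter_upwards [ae1, ae2] with x a1 a2 hx
    obtain ⟨u, hu, hc⟩ := hx
    have hsig : sig Set.univ x = fun v => x (.inr v) := by
      funext v
      simp only [sig, a1]
      rw [← cl_empty (rep_cl ∅ v)]
    have hp : CI SqAdj (Gt fun v => x (.inr v)) (2 • v) (2 • u) := by
      refine hc.inv (P := fun u => CI SqAdj (Gt fun v => x (.inr v)) (2 • v) (2 • u)) (CI.refl (a2 v)) ?_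
      rintro a b - hab ⟨e, he, hj⟩
      exact (hab.tail (two_joins hj).1 he.1).tail (two_joins hj).2 (a2 b)
    show sig Set.univ x ∈ ArmAt SqAdj 1 (2 * R) (2 * v.1, 2 * v.2)
    rw [hsig]
    have hv2 : ((2 * v.1, 2 * v.2) : V) = 2 • v := by ext <;> simp
    rw [hv2]
    have hn : nm (2 • u - 2 • v) = 2 * nm (u - v) := by
      rw [← hv2, show 2 • u = ((2 * u.1, 2 * u.2) : V) by ext <;> simp]
      simp only [nm, Prod.fst_sub, Prod.snd_sub, abs_eq_max_neg]
      omega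
    exact ArmAt.of (Or.inl rfl) (by omega) (by rw [nm_self]; simp) (by rw [hn]; push_cast; omega) hp
  rw [q1, q2]
  refine q3.trans ?_
  rw [← mu_real w0 (loc_meas ⟨_, ArmAt.dep⟩), ArmAt.prob hr]
  refine (hb (2 * R) (by omega)).trans ?_
  have : (0:ℝ) < R := by exact_mod_cast hR
  gcongr
  omega

end DaC

namespace DaC

/-- between two densities, one of the colours percolates -/
theorem dich {p : ℝ} (hp0 : 0 ≤ p) (hp : p < 1/2) {rb ra : ℝ} (hb : 0 ≤ rb) (hba : rb < ra) (ha : ra ≤ 1) :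
    (∃ t, rb < t ∧ t < ra ∧ 0 < (mu (Wt p (fun _ => none) (1 - t))).real (⋂ L : ℕ, Arm StarAdj 0 L)) ∨
    (∃ t, rb < t ∧ t < ra ∧ 0 < (mu (Wt p (fun _ => none) t)).real (⋂ L : ℕ, Arm SqAdj 0 L)) := by
  have hdec := dec_lt hp0 hp
  have hM : Mok p (fun _ => none) := Or.inr rfl
  obtain ⟨C, hC, ρ, h0, h1, H⟩ := one_small hdec
  set r := (ra + rb) / 2 with hr
  have hfl : flw (Wt p (fun _ => none) r) = Wt p (fun _ => none) (1 - r) := by rw [flw_Wt]; rfl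
  have H' := H _ hM r SqAdj StarAdj (Or.inl ⟨rfl, rfl⟩)
  rw [hfl] at H'
  have weak : ∀ (t : ℝ) (adj : V → V → Prop), Okay adj → ∀ k, (mu (Wt p (fun _ => none) t)).real (Arm adj 18 (54 * 8 ^ k)) ≤ C * ρ ^ k →
      (mu (Wt p (fun _ => none) t)).real (Arm adj 1 (54 * 8 ^ k)) ≤ C * ρ ^ k := by
    intro t adj ok k h
    have h8 : 1 ≤ 8 ^ k := Nat.one_le_pow _ _ (by norm_num)
    exact (measureReal_mono (Arm.mono ok (by norm_num) le_rfl (by omega)) (measure_ne_top _ _)).trans h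
  by_cases hI : ∀ k0 : ℕ, ∃ k ≥ k0, (mu (Wt p (fun _ => none) r)).real (Arm SqAdj 18 (54 * 8 ^ k)) ≤ C * ρ ^ k
  · left
    obtain ⟨K, hK, hKb⟩ := decay hdec hM (t := (r + rb) / 2) (Or.inl rfl) (fun κ hκ N0 => sharp hdec hM (Or.inl rfl) (a := (r + rb) / 2) (b := r)
      (by linarith) (by linarith) (by linarith) hC h0 h1 (fun k0 => by
        obtain ⟨k, hk, h⟩ := hI k0
        exact ⟨k, hk, weak _ _ (Or.inl rfl) k h⟩) hκ N0) 3
    exact ⟨_, by linarith, by linarith, perc (Or.inr ⟨rfl, rfl⟩) hK hKb⟩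
  · right
    push Not at hI
    obtain ⟨k1, hk1⟩ := hI
    obtain ⟨K, hK, hKb⟩ := decay hdec hM (t := 1 - (r + ra) / 2) (Or.inr rfl) (fun κ hκ N0 => sharp hdec hM (Or.inr rfl) (a := 1 - (r + ra) / 2) (b := 1 - r)
      (by linarith) (by linarith) (by linarith) hC h0 h1 (fun k0 => ⟨max k0 k1, le_max_left _ _, weak _ _ (Or.inr rfl) _ <|
        (H' _).resolve_left (not_le.2 (hk1 _ (le_max_right _ _)))⟩) hκ N0) 3
    have := perc (Or.inl ⟨rfl, rfl⟩) hK hKb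
    exact ⟨(r + ra) / 2, by linarith, by linarith, by
      have e : (1:ℝ) - (1 - (r + ra) / 2) = (r + ra) / 2 := by ring
      rwa [e] at this⟩

end DaC

namespace DaC

/-! ### Binary digits -/

lemma boolOf_iff {P : Prop} : boolOf P = true ↔ P := by simp [boolOf]

lemma bit_iff {n : ℕ} {x : ℝ} : bit n x = true ↔ ⌊x * 2 ^ (n + 1)⌋ % 2 = 1 := boolOf_iff

lemma bit_meas (n : ℕ) : Measurable (bit n) := by
  refine measurable_to_bool ?_
  have : bit n ⁻¹' {true} = (fun x : ℝ => ⌊x * 2 ^ (n + 1)⌋) ⁻¹' {z | z % 2 = 1} := by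
    ext x; exact bit_iff
  rw [this]
  exact (Int.measurable_floor.comp (measurable_id.mul_const _)) (MeasurableSet.of_discrete)

lemma bit_step (n : ℕ) (x : ℝ) (m : ℤ) : bit (n + 1) x = bit n (2 * x - m) := by
  rw [Bool.eq_iff_iff, bit_iff, bit_iff]
  have : (2 * x - m) * 2 ^ (n + 1) = x * 2 ^ (n + 1 + 1) - ((m * 2 ^ (n + 1) : ℤ) : ℝ) := by push_cast; ring
  rw [this, Int.floor_sub_intCast]
  have : (m * 2 ^ (n + 1)) % 2 = 0 := by rw [pow_succ, ← mul_assoc]; exact Int.mul_emod_left _ _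
  omega

lemma bit_zero {x : ℝ} (b : Bool) : (x ∈ Set.Ico (0:ℝ) 1 ∧ bit 0 x = b) ↔ 2 * x - ((if b then 1 else 0 : ℤ) : ℝ) ∈ Set.Ico (0:ℝ) 1 := by
  have key : x ∈ Set.Ico (0:ℝ) 1 → (⌊x * 2⌋ = 0 ∨ ⌊x * 2⌋ = 1) := by
    rintro ⟨h1, h2⟩
    have a1 : 0 ≤ ⌊x * 2⌋ := Int.floor_nonneg.2 (by linarith)
    have a2 : ⌊x * 2⌋ < 2 := Int.floor_lt.2 (by push_cast; linarith)
    omega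
  have e : ∀ m : ℤ, 2 * x - m ∈ Set.Ico (0:ℝ) 1 ↔ ⌊x * 2⌋ = m := by
    intro m
    rw [Int.floor_eq_iff, Set.mem_Ico]
    constructor <;> rintro ⟨h1, h2⟩ <;> constructor <;> linarith
  rw [e]
  constructor
  · rintro ⟨hx, rfl⟩
    by_cases h : bit 0 x = true
    · rw [h]; rw [bit_iff] at h; simp only [zero_add, pow_one] at h
      rcases key hx with k | k <;> simp_all
    · have h' := h
      rw [bit_iff] at h; simp only [zero_add, pow_one] at h
      rw [Bool.not_eq_true] at h'
      rw [h']
      rcases key hx with k | k <;> simp_all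
  · intro h
    have hx : x ∈ Set.Ico (0:ℝ) 1 := by
      rw [Int.floor_eq_iff] at h
      cases b <;> simp at h <;> constructor <;> linarith
    refine ⟨hx, ?_⟩
    rw [Bool.eq_iff_iff, bit_iff]
    simp only [zero_add, pow_one, h]
    cases b <;> simp

lemma bits_cyl (n : ℕ) : ∀ t : ℕ → Set Bool, volume {x : ℝ | x ∈ Set.Ico (0:ℝ) 1 ∧ ∀ k < n, bit k x ∈ t k} =
    ∏ k ∈ Finset.range n, ber (1/2) (t k) := by
  classical
  induction n with
  | zero =>
    intro t
    have e : {x : ℝ | x ∈ Set.Ico (0:ℝ) 1 ∧ ∀ k < 0, bit k x ∈ t k} = Set.Ico 0 1 := by ext x; simp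
    rw [e]; simp
  | succ n ih =>
    intro t
    set A := {x : ℝ | x ∈ Set.Ico (0:ℝ) 1 ∧ ∀ k < n, bit k x ∈ t (k + 1)} with hA
    have mA : ∀ b, MeasurableSet {x : ℝ | x ∈ Set.Ico (0:ℝ) 1 ∧ bit 0 x = b} := fun b =>
      measurableSet_Ico.inter (bit_meas 0 (measurableSet_singleton b))
    have half : ∀ b : Bool, volume {x : ℝ | (x ∈ Set.Ico (0:ℝ) 1 ∧ ∀ k < n, bit (k + 1) x ∈ t (k + 1)) ∧ bit 0 x = b} = ENNReal.ofReal (1/2) * volume A := by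
      intro b
      have e : {x : ℝ | (x ∈ Set.Ico (0:ℝ) 1 ∧ ∀ k < n, bit (k + 1) x ∈ t (k + 1)) ∧ bit 0 x = b} =
          (fun x => 2 * x) ⁻¹' ((fun x => x + -((if b then 1 else 0 : ℤ) : ℝ)) ⁻¹' A) := by
        ext x
        simp only [Set.mem_setOf_eq, Set.mem_preimage, hA, ← sub_eq_add_neg, ← bit_step]
        rw [← bit_zero b]
        tauto
      rw [e, Real.volume_preimage_mul_left (by norm_num), measure_preimage_add_right]
      norm_num
    have split : ∀ b : Bool, volume {x : ℝ | (x ∈ Set.Ico (0:ℝ) 1 ∧ ∀ k < n + 1, bit k x ∈ t k) ∧ bit 0 x = b} =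
        (if b ∈ t 0 then 1 else 0) * (ENNReal.ofReal (1/2) * volume A) := by
      intro b
      rw [← half b]
      have hx : ∀ x, (∀ k < n + 1, bit k x ∈ t k) ↔ bit 0 x ∈ t 0 ∧ ∀ k < n, bit (k + 1) x ∈ t (k + 1) := by
        intro x
        constructor
        · exact fun h => ⟨h 0 (by omega), fun k hk => h _ (by omega)⟩
        · rintro ⟨h1, h2⟩ (_ | k) hk
          · exact h1
          · exact h2 k (by omega)
      split_ifs with hb
      · rw [one_mul]; congr 1; ext x; simp only [Set.mem_setOf_eq, hx]
        constructor
        · tauto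
        · rintro ⟨⟨q1, q2⟩, rfl⟩; tauto
      · rw [zero_mul]
        convert measure_empty (μ := (volume : Measure ℝ))
        ext x; simp only [Set.mem_setOf_eq, hx, Set.mem_empty_iff_false, iff_false]
        rintro ⟨⟨q1, q2⟩, rfl⟩; tauto
    have e1 := measure_inter_add_diff (μ := (volume : Measure ℝ)) {x : ℝ | x ∈ Set.Ico (0:ℝ) 1 ∧ ∀ k < n + 1, bit k x ∈ t k} (bit_meas 0 (measurableSet_singleton true))
    have e2 : {x : ℝ | x ∈ Set.Ico (0:ℝ) 1 ∧ ∀ k < n + 1, bit k x ∈ t k} \ (bit 0 ⁻¹' {true}) = {x : ℝ | (x ∈ Set.Ico (0:ℝ) 1 ∧ ∀ k < n + 1, bit k x ∈ t k) ∧ bit 0 x = false} := by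
      ext x; simp
    rw [e2, split false] at e1
    rw [← e1]
    change volume {x : ℝ | (x ∈ Set.Ico (0:ℝ) 1 ∧ ∀ k < n + 1, bit k x ∈ t k) ∧ bit 0 x = true} + _ = _
    rw [split true, Finset.prod_range_succ', hA, ih (fun k => t (k + 1)), ← add_mul]
    have ht : ber (1/2) (t 0) = ((if true ∈ t 0 then 1 else 0) + (if false ∈ t 0 then 1 else 0)) * ENNReal.ofReal (1/2) := by
      have hc : clamp (1/2) = 1/2 := clamp_eq (by norm_num) (by norm_num)
      have hh : (1:ℝ) - 1/2 = 1/2 := by norm_num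
      simp only [ber, hc, hh, Measure.coe_add, Measure.coe_smul, Pi.add_apply, Pi.smul_apply, smul_eq_mul,
        Measure.dirac_apply' _ (MeasurableSet.of_discrete (s := t 0)), Set.indicator_apply, Pi.one_apply]
      ring
    rw [ht]; ring

lemma base_Ico : base = volume.restrict (Set.Ico (0:ℝ) 1) := (restrict_Ico_eq_restrict_Ioc).symm

instance : IsProbabilityMeasure base := ⟨by simp [base]⟩

lemma bits_meas : Measurable fun (x : ℝ) n => bit n x := measurable_pi_iff.2 bit_meas

/-- the binary digits are fair coin tosses -/
lemma bits_law : base.map (fun x n => bit n x) = PP (fun _ : ℕ => 1/2) := by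
  classical
  refine Measure.eq_infinitePi _ fun s t ht => ?_
  rw [Measure.map_apply bits_meas (MeasurableSet.pi s.countable_toSet (fun i _ => ht i)), base_Ico,
    Measure.restrict_apply (bits_meas (MeasurableSet.pi s.countable_toSet (fun i _ => ht i)))]
  obtain ⟨n, hn⟩ := s.exists_nat_subset_range
  have := bits_cyl n (fun k => if k ∈ s then t k else Set.univ)
  rw [← Finset.prod_subset hn (by intro k _ hk; simp only [hk, if_false]; exact measure_univ)] at this
  rw [Finset.prod_congr rfl (fun k hk => by rw [if_pos hk])] at this
  rw [← this]
  congr 1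
  ext x
  simp only [Set.mem_inter_iff, Set.mem_preimage, Set.mem_pi, SetLike.mem_coe, Set.mem_setOf_eq]
  constructor
  · rintro ⟨h1, h2⟩
    refine ⟨h2, fun k _ => ?_⟩
    split_ifs with hk
    · exact h1 k hk
    · trivial
  · rintro ⟨h1, h2⟩
    refine ⟨fun k hk => ?_, h1⟩
    simpa [hk] using h2 k (Finset.mem_range.1 (hn hk))

/-- the number with given digits -/
noncomputable def UU (b : ℕ → Bool) : ℝ := ∑' k : ℕ, if b k then ((2 : ℝ)⁻¹) ^ (k + 1) else 0

lemma UU_summable (b : ℕ → Bool) : Summable fun k => if b k then ((2 : ℝ)⁻¹) ^ (k + 1) else 0 := by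
  refine Summable.of_nonneg_of_le (fun k => by split_ifs <;> positivity) (fun k => ?_)
    ((summable_nat_add_iff 1).2 (summable_geometric_of_lt_one (by norm_num) (show (2:ℝ)⁻¹ < 1 by norm_num)))
  split_ifs
  · exact le_rfl
  · positivity

lemma UU_meas : Measurable UU :=
  Measurable.tsum fun k => Measurable.ite (show MeasurableSet {b : ℕ → Bool | b k = true} from (measurable_pi_apply (X := fun _ : ℕ => Bool) k) (measurableSet_singleton true)) measurable_const measurable_const

lemma UU_bits {x : ℝ} (hx : x ∈ Set.Ico (0:ℝ) 1) : UU (fun n => bit n x) = x := by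
  have part : ∀ n, ∑ k ∈ Finset.range n, (if bit k x then ((2 : ℝ)⁻¹) ^ (k + 1) else 0) = ⌊x * 2 ^ n⌋ * (2⁻¹) ^ n := by
    intro n
    induction n with
    | zero =>
      have : ⌊x⌋ = 0 := Int.floor_eq_zero_iff.2 hx
      simp [this]
    | succ n ih =>
      rw [Finset.sum_range_succ, ih]
      have e : (⌊x * 2 ^ (n + 1)⌋ : ℤ) = 2 * ⌊x * 2 ^ n⌋ + (if bit n x then 1 else 0) := by
        have h1 := Int.floor_le (x * 2 ^ n)
        have h2 := Int.lt_floor_add_one (x * 2 ^ n)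
        have h3 : 2 * ⌊x * 2 ^ n⌋ ≤ ⌊x * 2 ^ (n + 1)⌋ := Int.le_floor.2 (by push_cast; rw [pow_succ]; linarith)
        have h4 : ⌊x * 2 ^ (n + 1)⌋ < 2 * ⌊x * 2 ^ n⌋ + 2 := Int.floor_lt.2 (by push_cast; rw [pow_succ]; linarith)
        by_cases hb : bit n x = true
        · rw [if_pos hb]; rw [bit_iff] at hb; omega
        · rw [if_neg hb]; rw [bit_iff] at hb; omega
      rw [e]
      push_cast
      rw [pow_succ (2⁻¹ : ℝ)]
      split_ifs <;> ring
  have h := (UU_summable fun n => bit n x).hasSum.tendsto_sum_nat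
  simp only [part] at h
  refine tendsto_nhds_unique h ?_
  have hz : Filter.Tendsto (fun n : ℕ => ((2:ℝ)⁻¹) ^ n) Filter.atTop (nhds 0) := tendsto_pow_atTop_nhds_zero_of_lt_one (by norm_num) (by norm_num)
  have hl : Filter.Tendsto (fun n : ℕ => x - ((2:ℝ)⁻¹) ^ n) Filter.atTop (nhds x) := by simpa using hz.const_sub x
  have id : ∀ n : ℕ, x * 2 ^ n * (2⁻¹) ^ n = x := fun n => by rw [mul_assoc, ← mul_pow]; norm_num
  refine tendsto_of_tendsto_of_tendsto_of_le_of_le hl tendsto_const_nhds (fun n => ?_) (fun n => ?_)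
  · have h2 := Int.lt_floor_add_one (x * 2 ^ n)
    have p : (0:ℝ) < (2⁻¹) ^ n := by positivity
    have := mul_le_mul_of_nonneg_right h2.le p.le
    rw [id, add_mul, one_mul] at this
    simp only; linarith
  · have h1 := Int.floor_le (x * 2 ^ n)
    have p : (0:ℝ) < (2⁻¹) ^ n := by positivity
    have := mul_le_mul_of_nonneg_right h1 p.le
    rwa [id] at this

/-- thresholding a uniform variable -/
lemma UU_law {q : ℝ} (h0 : 0 ≤ q) (h1 : q ≤ 1) :
    (PP (fun _ : ℕ => 1/2)).map (fun b => boolOf (UU b < q)) = ber q := by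
  have m : Measurable fun b : ℕ → Bool => boolOf (UU b < q) := by
    refine measurable_to_bool ?_
    have : (fun b : ℕ → Bool => boolOf (UU b < q)) ⁻¹' {true} = UU ⁻¹' Set.Iio q := by ext x; exact boolOf_iff
    rw [this]; exact UU_meas measurableSet_Iio
  have t1 : ((PP (fun _ : ℕ => 1/2)).map (fun b => boolOf (UU b < q))) {true} = ENNReal.ofReal q := by
    rw [← bits_law, Measure.map_map m bits_meas, Measure.map_apply (m.comp bits_meas) (measurableSet_singleton _), base_Ico,
      Measure.restrict_apply ((m.comp bits_meas) (measurableSet_singleton _))]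
    have : ((fun b : ℕ → Bool => boolOf (UU b < q)) ∘ fun x n => bit n x) ⁻¹' {true} ∩ Set.Ico (0:ℝ) 1 = Set.Ico 0 q := by
      ext x
      simp only [Set.mem_inter_iff, Set.mem_preimage, Function.comp, Set.mem_singleton_iff, boolOf_iff]
      constructor
      · rintro ⟨a, b⟩; rw [UU_bits b] at a; exact ⟨b.1, a⟩
      · intro a
        have b : x ∈ Set.Ico (0:ℝ) 1 := ⟨a.1, a.2.trans_le h1⟩
        rw [UU_bits b]; exact ⟨a.2, b⟩
    rw [this]; simp
  haveI : IsProbabilityMeasure ((PP (fun _ : ℕ => 1/2)).map (fun b => boolOf (UU b < q))) := Measure.isProbabilityMeasure_map m.aemeasurable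
  have hc : clamp q = q := clamp_eq h0 h1
  have t2 : (ber q) {true} = ENNReal.ofReal q := by simp [ber, hc]
  refine Measure.ext_of_singleton fun b => ?_
  cases b
  · have c : ({false} : Set Bool) = {true}ᶜ := by ext b; cases b <;> simp
    rw [c, prob_compl_eq_one_sub (measurableSet_singleton _), prob_compl_eq_one_sub (measurableSet_singleton _), t1, t2]
  · rw [t1, t2]

end DaC

namespace DaC

/-! ### Transfer to the model defined from binary digits -/

lemma eIdx_symm (u v : V) : eIdx u v = eIdx v u := min_comm _ _

lemma eIdx_inj {u v u' v' : V} (h : eIdx u v = eIdx u' v') : (u = u' ∧ v = v') ∨ (u = v' ∧ v = u') := by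
  have key : ∀ a b c d : V, Encodable.encode (a, b) = Encodable.encode (c, d) → a = c ∧ b = d := by
    intro a b c d h
    exact Prod.ext_iff.1 (Encodable.encode_injective h)
  unfold eIdx at h
  rcases min_choice (Encodable.encode (u, v)) (Encodable.encode (v, u)) with e | e <;>
    rcases min_choice (Encodable.encode (u', v')) (Encodable.encode (v', u')) with e' | e' <;>
    rw [e, e'] at h <;> have := key _ _ _ _ h <;> tauto

/-- the index of the label of a coordinate -/
noncomputable def ix : I → ℕ
  | .inl e => 2 * eIdx e.1 (nx e)
  | .inr v => 2 * Encodable.encode v + 1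

lemma ix_inj : Function.Injective ix := by
  rintro (e | v) (e' | v') h
  · have h : 2 * eIdx e.1 (nx e) = 2 * eIdx e'.1 (nx e') := h
    congr 1
    obtain ⟨⟨a, b⟩, c⟩ := e
    obtain ⟨⟨a', b'⟩, c'⟩ := e'
    have := eIdx_inj (Nat.eq_of_mul_eq_mul_left (by norm_num) h)
    cases c <;> cases c' <;> simp only [nx, Prod.mk.injEq, if_true, if_false, Bool.false_eq_true, Bool.true_eq_false, and_true, and_false, reduceCtorEq] at this ⊢ <;> omega
  · have h : 2 * eIdx e.1 (nx e) = 2 * Encodable.encode v' + 1 := h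
    omega
  · have h : 2 * Encodable.encode v + 1 = 2 * eIdx e'.1 (nx e') := h
    omega
  · have h : 2 * Encodable.encode v + 1 = 2 * Encodable.encode v' + 1 := h
    congr 1
    exact Encodable.encode_injective (by omega)

/-- thresholded labels -/
noncomputable def Psi (p t : ℝ) (x : ℝ) (j : I) : Bool := boolOf (unif (ix j) x < Wt p (fun _ => none) t j)

lemma Psi_law {p t : ℝ} (hp0 : 0 ≤ p) (hp1 : p ≤ 1) (ht0 : 0 ≤ t) (ht1 : t ≤ 1) :
    base.map (Psi p t) = PP (Wt p (fun _ => none) t) ∧ Measurable (Psi p t) := by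
  have hw : ∀ j, 0 ≤ Wt p (fun _ => none) t j ∧ Wt p (fun _ => none) t j ≤ 1 := by
    rintro (e | v)
    · exact ⟨hp0, hp1⟩
    · exact ⟨ht0, ht1⟩
  have mU : ∀ j : I, Measurable fun b : ℕ → Bool => boolOf (UU b < Wt p (fun _ => none) t j) := by
    intro j
    refine measurable_to_bool ?_
    have : (fun b : ℕ → Bool => boolOf (UU b < Wt p (fun _ => none) t j)) ⁻¹' {true} = UU ⁻¹' Set.Iio (Wt p (fun _ => none) t j) := by
      ext x; exact boolOf_iff
    rw [this]; exact UU_meas measurableSet_Iio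
  have finj : Function.Injective fun q : I × ℕ => Nat.pair (ix q.1) q.2 := by
    rintro ⟨a, k⟩ ⟨b, l⟩ h
    have := Nat.pair_eq_pair.1 h
    exact Prod.ext (ix_inj this.1) this.2
  have m1 : Measurable fun (x : ℕ → Bool) (q : I × ℕ) => x (Nat.pair (ix q.1) q.2) :=
    measurable_pi_iff.2 fun q => measurable_pi_apply _
  have m2 : Measurable fun (x : I → ℕ → Bool) (j : I) => boolOf (UU (x j) < Wt p (fun _ => none) t j) :=
    measurable_pi_iff.2 fun j => (mU j).comp (measurable_pi_apply j)
  have e : Psi p t = (fun (x : I → ℕ → Bool) (j : I) => boolOf (UU (x j) < Wt p (fun _ => none) t j)) ∘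
      (MeasurableEquiv.curry I ℕ Bool) ∘ (fun (x : ℕ → Bool) (q : I × ℕ) => x (Nat.pair (ix q.1) q.2)) ∘ (fun x n => bit n x) := rfl
  have mc := (MeasurableEquiv.curry I ℕ Bool).measurable
  refine ⟨?_, by rw [e]; exact m2.comp (mc.comp (m1.comp bits_meas))⟩
  rw [e, ← Measure.map_map m2 (mc.comp (m1.comp bits_meas)), ← Measure.map_map mc (m1.comp bits_meas),
    ← Measure.map_map m1 bits_meas, bits_law, PP_reindex (fun _ : ℕ => 1/2) _ finj]
  have c := Measure.infinitePi_map_curry (ι := I) (κ := ℕ) (X := Bool) (fun _ _ => ber (1/2))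
  have hPP : PP (fun _ : I × ℕ => 1/2) = Measure.infinitePi fun _ : I × ℕ => ber (1/2) := rfl
  rw [hPP, c, Measure.infinitePi_map_pi (fun _ : I => Measure.infinitePi fun _ : ℕ => ber (1/2)) mU]
  unfold PP
  congr 1
  ext1 j
  exact UU_law (hw j).1 (hw j).2

lemma sqAdj_joins (u v : V) : SqAdj u v ↔ ∃ e, Joins e u v := by
  rw [sqAdj_iff]
  constructor
  · rintro (⟨h, h' | h'⟩ | ⟨h, h' | h'⟩)
    · exact ⟨(v, true), Or.inr ⟨rfl, Prod.ext h.symm h'.symm⟩⟩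
    · exact ⟨(u, true), Or.inl ⟨rfl, Prod.ext h h'.symm⟩⟩
    · exact ⟨(v, false), Or.inr ⟨rfl, Prod.ext h'.symm h.symm⟩⟩
    · exact ⟨(u, false), Or.inl ⟨rfl, Prod.ext h'.symm h⟩⟩
  · rintro ⟨⟨w, c⟩, ⟨rfl, rfl⟩ | ⟨rfl, rfl⟩⟩ <;> cases c <;> simp [nx]

lemma edge_iff (p t x : ℝ) (u v : V) : edgeCfg SqAdj p x u v = true ↔ EA (ed Set.univ (Psi p t x)) u v := by
  have key : ∀ e : Ed, e ∈ ed Set.univ (Psi p t x) ↔ edgeU e.1 (nx e) x < p := by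
    intro e
    simp only [ed, Set.mem_setOf_eq, Set.mem_univ, and_true]
    exact boolOf_iff
  have hs : ∀ a b, edgeU a b x = edgeU b a x := fun a b => by unfold edgeU; rw [eIdx_symm]
  unfold edgeCfg
  rw [Bool.and_eq_true, boolOf_iff, boolOf_iff, sqAdj_joins]
  constructor
  · rintro ⟨⟨e, he⟩, h⟩
    refine ⟨e, (key e).2 ?_, he⟩
    rcases he with ⟨rfl, rfl⟩ | ⟨rfl, rfl⟩
    · exact h
    · rwa [hs]
  · rintro ⟨e, h, he⟩
    refine ⟨⟨e, he⟩, ?_⟩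
    rw [key] at h
    rcases he with ⟨rfl, rfl⟩ | ⟨rfl, rfl⟩
    · exact h
    · rwa [hs]

lemma rep_clusterRep (p t x : ℝ) (v : V) : clusterRep (edgeCfg SqAdj p x) v = rep (ed Set.univ (Psi p t x)) v := by
  have hc : ∀ w, Conn (edgeCfg SqAdj p x) v w ↔ cl (ed Set.univ (Psi p t x)) v w := by
    intro w
    have : (fun a b => edgeCfg SqAdj p x a b = true) = EA (ed Set.univ (Psi p t x)) := by
      ext a b; exact edge_iff p t x a b
    unfold Conn cl
    rw [this]
  have hs : sInf (Encodable.encode '' pCluster (edgeCfg SqAdj p x) v) = Encodable.encode (rep (ed Set.univ (Psi p t x)) v) := by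
    refine IsLeast.csInf_eq ⟨⟨_, (hc _).2 (rep_cl _ v), rfl⟩, ?_⟩
    rintro _ ⟨w, hw, rfl⟩
    exact rep_le ((hc w).1 hw)
  unfold clusterRep
  rw [hs, Encodable.encodek]
  rfl

lemma colour_sig (p t x : ℝ) : colourCfg SqAdj p t x = sig Set.univ (Psi p t x) := by
  funext v
  unfold colourCfg sig
  rw [rep_clusterRep p t x]
  rfl

lemma cfg_meas {p t : ℝ} (hp0 : 0 ≤ p) (hp1 : p ≤ 1) (ht0 : 0 ≤ t) (ht1 : t ≤ 1) :
    Measurable fun x => (edgeCfg SqAdj p x, colourCfg SqAdj p t x) := by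
  have mP := (Psi_law hp0 hp1 ht0 ht1).2
  refine Measurable.prodMk ?_ ?_
  · refine measurable_pi_iff.2 fun u => measurable_pi_iff.2 fun v => ?_
    have mu' : Measurable (edgeU u v) := by
      have : edgeU u v = UU ∘ (fun (b : ℕ → Bool) k => b (Nat.pair (2 * eIdx u v) k)) ∘ fun x n => bit n x := rfl
      rw [this]
      exact UU_meas.comp ((measurable_pi_iff.2 fun k => measurable_pi_apply _).comp bits_meas)
    refine measurable_to_bool ?_
    have : (fun x => edgeCfg SqAdj p x u v) ⁻¹' {true} = {x | SqAdj u v} ∩ edgeU u v ⁻¹' Set.Iio p := by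
      ext x
      simp [edgeCfg, boolOf]
    rw [this]
    exact (MeasurableSet.const _).inter (mu' measurableSet_Iio)
  · have : colourCfg SqAdj p t = sig Set.univ ∘ Psi p t := funext fun x => colour_sig p t x
    rw [this]; exact sig_meas.comp mP

/-- arms from the origin give an infinite cluster -/
lemma arm_infinite {adj : V → V → Prop} {ξ ξ' : V → Bool} {c : Bool} (h : ξ ∈ ⋂ L : ℕ, Arm adj 0 L)
    (hc : ∀ v, ξ v = true → ξ' v = c) : (monoCluster adj ξ' c origin).Infinite := by
  have H : ∀ L : ℕ, ∃ w ∈ monoCluster adj ξ' c origin, nm w = L := by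
    intro L
    obtain ⟨a, ha, b, hb, hab⟩ := Set.mem_iInter.1 h L
    have ha0 : a = origin := by
      have := nm_le.1 (show nm a ≤ (0:ℕ) from ha)
      exact Prod.ext (by simp [origin]; omega) (by simp [origin]; omega)
    subst ha0
    refine ⟨b, ⟨hc _ hab.left.2, ?_⟩, hb⟩
    unfold MonoConn
    clear hb
    induction hab using CI.induct with
    | h0 h => exact Relation.ReflTransGen.refl
    | hs b d _ ih h1 h2 h3 => exact ih.tail ⟨h1, hc _ h2.2, hc _ h3.2⟩
  intro hf
  have : (Set.range (fun L : ℕ => (L : ℤ))).Finite := by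
    refine (hf.image nm).subset ?_
    rintro _ ⟨L, rfl⟩
    obtain ⟨w, hw, e⟩ := H L
    exact ⟨w, hw, e⟩
  exact Set.infinite_range_of_injective Nat.cast_injective this

lemma perc_null {p r : ℝ} (hp0 : 0 ≤ p) (hp1 : p ≤ 1) (ht0 : 0 ≤ r) (ht1 : r ≤ 1) {adj : V → V → Prop} {c : Bool}
    (h : percProb SqAdj adj c p r = 0) : base {x | (monoCluster adj (colourCfg SqAdj p r x) c origin).Infinite} = 0 := by
  refine le_antisymm ?_ bot_le
  rw [← h]
  exact Measure.le_map_apply (cfg_meas hp0 hp1 ht0 ht1).aemeasurable _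

lemma mu_base {p t : ℝ} (hp0 : 0 ≤ p) (hp1 : p ≤ 1) (ht0 : 0 ≤ t) (ht1 : t ≤ 1) {A : Set (V → Bool)} (hA : MeasurableSet A) :
    (mu (Wt p (fun _ => none) t)).real A = base.real {x | colourCfg SqAdj p t x ∈ A} := by
  obtain ⟨e, m⟩ := Psi_law hp0 hp1 ht0 ht1
  rw [mu_real _ hA, ← e, map_measureReal_apply m (show MeasurableSet {y | sig Set.univ y ∈ A} from sig_meas hA)]
  congr 1
  ext x
  rw [Set.mem_setOf_eq, colour_sig]
  rfl

theorem main_aux (p : ℝ) (hp0 : 0 ≤ p) (hp : p < 1 / 2) {ra s : ℝ} (ha : ra ∈ Set.Icc (0:ℝ) 1) (hs : s ∈ Set.Icc (0:ℝ) 1)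
    (hra : thetaSq p ra = 0) (hst : thetaStarSq p s = 0) (hlt : 1 < ra + s) : False := by
  have hp1 : p ≤ 1 := by linarith
  have n1 := perc_null hp0 hp1 ha.1 ha.2 hra
  have n2 := perc_null hp0 hp1 (r := 1 - s) (by linarith [hs.2]) (by linarith [hs.1]) hst
  have mI : ∀ adj, Okay adj → MeasurableSet (⋂ L : ℕ, Arm adj 0 L) := fun adj ok =>
    MeasurableSet.iInter fun L => (Arm.inc).meas
  rcases dich hp0 hp (rb := 1 - s) (ra := ra) (by linarith [hs.2]) (by linarith) ha.2 with ⟨t, t1, t2, h⟩ | ⟨t, t1, t2, h⟩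
  · have ht0 : 0 ≤ t := by linarith [hs.2]
    have ht1 : t ≤ 1 := by linarith [ha.2]
    have hfl : flw (Wt p (fun _ => none) t) = Wt p (fun _ => none) (1 - t) := by rw [flw_Wt]; rfl
    have m := mI _ (Or.inr rfl)
    have mf : Measurable fun (ξ : V → Bool) v => !ξ v := measurable_pi_iff.2 fun v => (Measurable.of_discrete (f := not)).comp (measurable_pi_apply v)
    rw [← hfl, mu_flip _ m, mu_base hp0 hp1 ht0 ht1 (show MeasurableSet {ξ : V → Bool | (fun v => !ξ v) ∈ ⋂ L : ℕ, Arm StarAdj 0 L} from mf m)] at h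
    have : base.real {x | colourCfg SqAdj p t x ∈ {ξ : V → Bool | (fun v => !ξ v) ∈ ⋂ L : ℕ, Arm StarAdj 0 L}} = 0 := by
      rw [measureReal_def, measure_mono_null _ n2, ENNReal.toReal_zero]
      intro x hx
      refine arm_infinite hx fun v hv => ?_
      have hv : (!colourCfg SqAdj p t x v) = true := hv
      rw [Bool.not_eq_true'] at hv
      by_contra hne
      rw [Bool.not_eq_false] at hne
      have := boolOf_iff.1 hne
      have h2 : colourCfg SqAdj p t x v = true := boolOf_iff.2 (this.trans t1)
      rw [hv] at h2; cases h2
    exact absurd h (by rw [show base.real _ = 0 from this]; exact lt_irrefl _)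
  · have ht0 : 0 ≤ t := by linarith [hs.2]
    have ht1 : t ≤ 1 := by linarith [ha.2]
    rw [mu_base hp0 hp1 ht0 ht1 (mI _ (Or.inl rfl))] at h
    refine h.ne' ?_
    rw [measureReal_def, measure_mono_null _ n1, ENNReal.toReal_zero]
    intro x hx
    exact arm_infinite hx fun v hv => boolOf_iff.2 ((boolOf_iff.1 hv).trans t2)

/-- For every `p < 1/2`, `r_c(p) + r_c*(p) ≤ 1`. -/
theorem rc_add_rcStar_le_one (p : ℝ) (hp0 : 0 ≤ p) (hp : p < 1 / 2) :
    rcSq p + rcStarSq p ≤ 1 := by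
  by_contra hcon
  push Not at hcon
  have b1 : rcSq p ≤ 1 := Real.sSup_le (fun r hr => hr.1.2) zero_le_one
  have b2 : rcStarSq p ≤ 1 := Real.sSup_le (fun r hr => hr.1.2) zero_le_one
  have ne1 : {r : ℝ | r ∈ Set.Icc (0 : ℝ) 1 ∧ thetaSq p r = 0}.Nonempty := by
    by_contra h
    rw [Set.not_nonempty_iff_eq_empty] at h
    have : rcSq p = 0 := by unfold rcSq; rw [h, Real.sSup_empty]
    linarith
  have ne2 : {r : ℝ | r ∈ Set.Icc (0 : ℝ) 1 ∧ thetaStarSq p r = 0}.Nonempty := by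
    by_contra h
    rw [Set.not_nonempty_iff_eq_empty] at h
    have : rcStarSq p = 0 := by unfold rcStarSq; rw [h, Real.sSup_empty]
    linarith
  obtain ⟨ra, h1, h2⟩ := exists_lt_of_lt_csSup ne1 (show 1 - rcStarSq p < _ from show _ < rcSq p by linarith)
  obtain ⟨s, h3, h4⟩ := exists_lt_of_lt_csSup ne2 (show 1 - ra < _ from show _ < rcStarSq p by linarith)
  exact main_aux p hp0 hp h1.1 h3.1 h1.2 h3.2 (by linarith)

end DaC
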